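/- Let X be a compact metric space with finite Hausdorff n-measure, let Σ be a finite simplicial complex equipped with the ℓ²-metric, let φ : X → Σ be a C-Lipschitz map, and let P ⊆ X be purely n-unrectifiable. Then for every ε > 0 there exists a 3C-Lipschitz map ψ : X → Σ such that: (1) d(φ(x), ψ(x)) ≤ ε for every x ∈ X; (2) ψ(φ⁻¹(Δ)) ⊆ Δ for every simplex Δ of Σ; (3) the Hausdorff n-measure of ψ(P) is at most ε. -/

import Mathlib

open Set MeasureTheory Metric Filter
open scoped NNReal ENNReal Pointwise

noncomputable section

/-- The space ℓ^∞ of bounded real sequences with the supremum norm. -/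
abbrev Linf : Type := lp (fun _ : ℕ => ℝ) ⊤

/-- Nagata dimension of `X` is at most `n` with constant `c`: for every `s > 0` there is
a covering of `X` by sets of diameter at most `c·s` such that every set of diameter
less than `s` meets at most `n+1` members of the covering. -/
def NagataDimLE (X : Type*) [MetricSpace X] (n : ℕ) (c : ℝ) : Prop :=
  ∀ s : ℝ, 0 < s → ∃ 𝒰 : Set (Set X),
    (⋃₀ 𝒰 = Set.univ) ∧
    (∀ U ∈ 𝒰, EMetric.diam U ≤ ENNReal.ofReal (c * s)) ∧
    (∀ A : Set X, EMetric.diam A < ENNReal.ofReal s →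
      ({U ∈ 𝒰 | (A ∩ U).Nonempty}).Finite ∧
      ({U ∈ 𝒰 | (A ∩ U).Nonempty}).ncard ≤ n + 1)

/-- An abstract finite simplicial complex on vertex set `I`:
a nonempty family of nonempty finite subsets of `I`, closed under nonempty subsets. -/
structure SimplicialCplx (I : Type*) where
  F : Finset (Finset I)
  F_nonempty : F.Nonempty
  mem_nonempty : ∀ S ∈ F, S.Nonempty
  down_closed : ∀ S ∈ F, ∀ T : Finset I, T ⊆ S → T.Nonempty → T ∈ F

/-- The vertex `e_i` of the standard simplex in the Euclidean space `ℝ^I`. -/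
def vertex {I : Type*} [Fintype I] [DecidableEq I] (i : I) : EuclideanSpace ℝ I :=
  EuclideanSpace.single i (1 : ℝ)

/-- The closed simplex `Δ_S = (ε/√2) · convexHull {e_i : i ∈ S}`,
a Euclidean simplex of side length `ε`. -/
def simplexOf {I : Type*} [Fintype I] [DecidableEq I] (ε : ℝ) (S : Finset I) :
    Set (EuclideanSpace ℝ I) :=
  (ε / Real.sqrt 2) • convexHull ℝ (vertex '' (S : Set I))

/-- The geometric realization of a simplicial complex with side length `ε`,
as a subset of the Euclidean space `ℝ^I` (carrying the `ℓ²`-metric). -/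
def realization {I : Type*} [Fintype I] [DecidableEq I] (ε : ℝ) (K : SimplicialCplx I) :
    Set (EuclideanSpace ℝ I) :=
  ⋃ S ∈ K.F, simplexOf ε S

/-- The `k`-skeleton of the realization: the union of the simplices on at most
`k+1` vertices. -/
def skeleton {I : Type*} [Fintype I] [DecidableEq I] (ε : ℝ) (K : SimplicialCplx I) (k : ℕ) :
    Set (EuclideanSpace ℝ I) :=
  ⋃ S ∈ K.F, ⋃ (_ : S.card ≤ k + 1), simplexOf ε S

/-- The relative interior of the simplex with vertex set `S` (side length `ε`). -/
def openSimplexOf {I : Type*} [Fintype I] [DecidableEq I] (ε : ℝ) (S : Finset I) :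
    Set (EuclideanSpace ℝ I) :=
  {x | ∃ t : I → ℝ, (∀ i ∈ S, 0 < t i) ∧ (∑ i ∈ S, t i) = 1 ∧
    x = (ε / Real.sqrt 2) • ∑ i ∈ S, t i • vertex i}

/-- The open star of the simplex with vertex set `S`: the union of the relative
interiors of the simplices of `K` having `S` as a face. -/
def openStar {I : Type*} [Fintype I] [DecidableEq I] (ε : ℝ) (K : SimplicialCplx I)
    (S : Finset I) : Set (EuclideanSpace ℝ I) :=
  ⋃ T ∈ K.F, ⋃ (_ : S ⊆ T), openSimplexOf ε T

/-- `P` is purely `n`-unrectifiable: every Lipschitz image of a subset of `ℝⁿ`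
meets `P` in a set of Hausdorff `n`-measure zero. -/
def PurelyUnrectifiable (n : ℕ) {X : Type*} [MetricSpace X] [MeasurableSpace X] [BorelSpace X]
    (P : Set X) : Prop :=
  ∀ (A : Set (EuclideanSpace ℝ (Fin n))) (φ : EuclideanSpace ℝ (Fin n) → X) (L : ℝ≥0),
    LipschitzOnWith L φ A → μH[(n : ℝ)] (P ∩ φ '' A) = 0

lemma mem_simplexOf_iff {m : ℕ} {s : ℝ} (hs : 0 < s) {S : Finset (Fin m)}
    (y : EuclideanSpace ℝ (Fin m)) :
    y ∈ simplexOf s S ↔ (∀ i, 0 ≤ y i) ∧ ∑ i, y i = s / Real.sqrt 2 ∧ ∀ i, i ∉ S → y i = 0 := by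
  have hc : 0 < s / Real.sqrt 2 := by positivity
  set c := s / Real.sqrt 2 with hcdef
  have hT : Convex ℝ {y : EuclideanSpace ℝ (Fin m) |
      (∀ i, 0 ≤ y i) ∧ ∑ i, y i = 1 ∧ ∀ i, i ∉ S → y i = 0} := by
    rintro x ⟨hx1, hx2, hx3⟩ z ⟨hz1, hz2, hz3⟩ a b ha hb hab
    refine ⟨fun i => ?_, ?_, fun i hi => ?_⟩
    · have := hx1 i; have := hz1 i
      simp only [PiLp.add_apply, PiLp.smul_apply, smul_eq_mul]; positivity
    · simp only [PiLp.add_apply, PiLp.smul_apply, smul_eq_mul, Finset.sum_add_distrib,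
        ← Finset.mul_sum, hx2, hz2]; linarith
    · simp [hx3 i hi, hz3 i hi]
  have key : ∀ z : EuclideanSpace ℝ (Fin m), z ∈ convexHull ℝ (vertex '' (S : Set (Fin m))) ↔
      (∀ i, 0 ≤ z i) ∧ ∑ i, z i = 1 ∧ ∀ i, i ∉ S → z i = 0 := by
    intro z
    constructor
    · intro hz
      refine convexHull_min ?_ hT hz
      rintro _ ⟨i, hi, rfl⟩
      refine ⟨fun j => ?_, ?_, fun j hj => ?_⟩
      · simp only [vertex, PiLp.single_apply]; split_ifs <;> norm_num
      · simp [vertex, PiLp.single_apply]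
      · have : j ≠ i := fun h => hj (h ▸ hi)
        simp [vertex, this]
    · rintro ⟨h1, h2, h3⟩
      have hz : z = ∑ i ∈ S, z i • vertex i := by
        ext j
        simp only [WithLp.ofLp_sum, WithLp.ofLp_smul, Finset.sum_apply, Pi.smul_apply, smul_eq_mul,
          vertex, PiLp.single_apply]
        by_cases hj : j ∈ S
        · simp [hj]
        · simp [hj, h3 j hj]
      rw [hz]
      refine (convex_convexHull ℝ _).sum_mem (fun i _ => h1 i) ?_ ?_
      · rw [← h2]
        exact Finset.sum_subset (Finset.subset_univ _) (fun i _ hi => h3 i hi)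
      · intro i hi
        exact subset_convexHull _ _ ⟨i, hi, rfl⟩
  unfold simplexOf
  rw [← hcdef, Set.mem_smul_set_iff_inv_smul_mem₀ hc.ne', key]
  simp only [PiLp.smul_apply, smul_eq_mul, ← Finset.mul_sum]
  refine and_congr (forall_congr' fun i => ?_) (and_congr ?_ (forall_congr' fun i =>
    imp_congr_right fun _ => ?_))
  · rw [mul_nonneg_iff_of_pos_left (inv_pos.2 hc)]
  · rw [inv_mul_eq_iff_eq_mul₀ hc.ne', mul_one]
  · simp [hc.ne']

/-- A `(1+κ)`-Lipschitz self-map of Euclidean space that sends a neighbourhood of the standard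
simplex into the simplex, preserving faces. -/
lemma exists_simplex_retraction (m : ℕ) {c κ : ℝ} (hc : 0 < c) (hκ : 0 < κ) {ε : ℝ}
    (hε : 0 < ε) (hκε : κ * (c + 1) < ε / 2) :
    ∃ η > 0, ∃ T : EuclideanSpace ℝ (Fin m) → EuclideanSpace ℝ (Fin m),
      LipschitzWith (1 + κ).toNNReal T ∧
      ∀ y z : EuclideanSpace ℝ (Fin m), (∀ i, 0 ≤ y i) → ∑ i, y i = c → dist y z ≤ η →
        dist y (T z) ≤ ε ∧ (∀ i, 0 ≤ T z i) ∧ ∑ i, T z i = c ∧ ∀ i, y i = 0 → T z i = 0 := by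
  set Δ : Set (EuclideanSpace ℝ (Fin m)) := {y | (∀ i, 0 ≤ y i) ∧ ∑ i, y i = c} with hΔ
  have hconv : Convex ℝ Δ := by
    rintro x ⟨hx1, hx2⟩ z ⟨hz1, hz2⟩ a b ha hb hab
    refine ⟨fun i => ?_, ?_⟩
    · have := hx1 i; have := hz1 i
      simp only [PiLp.add_apply, PiLp.smul_apply, smul_eq_mul]; positivity
    · simp only [PiLp.add_apply, PiLp.smul_apply, smul_eq_mul, Finset.sum_add_distrib,
        ← Finset.mul_sum, hx2, hz2]; rw [← add_mul, hab, one_mul]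
  have hclosed : IsClosed Δ := by
    have : Δ = (⋂ i, {y : EuclideanSpace ℝ (Fin m) | 0 ≤ y i}) ∩
        {y : EuclideanSpace ℝ (Fin m) | ∑ i, y i = c} := by ext; simp [hΔ]
    rw [this]
    exact (isClosed_iInter fun i => isClosed_le continuous_const (by fun_prop)).inter
      (isClosed_eq (by fun_prop) continuous_const)
  rcases Δ.eq_empty_or_nonempty with hemp | hne
  · refine ⟨1, one_pos, fun _ => 0, LipschitzWith.const' 0, fun y z h1 h2 _ => ?_⟩
    exact absurd (show y ∈ Δ from ⟨h1, h2⟩) (by simp [hemp])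
  have hP : ∀ u : EuclideanSpace ℝ (Fin m), ∃ v ∈ Δ, ∀ w ∈ Δ, inner ℝ (u - v) (w - v) ≤ 0 := by
    intro u
    obtain ⟨v, hv, h⟩ := exists_norm_eq_iInf_of_complete_convex hne hclosed.isComplete hconv u
    exact ⟨v, hv, (norm_eq_iInf_iff_real_inner_le_zero hconv hv).1 h⟩
  choose P hPmem hPin using hP
  have hPlip : ∀ u v, ‖P u - P v‖ ≤ ‖u - v‖ := by
    intro u v
    have h1 := hPin u (P v) (hPmem v)
    have h2 := hPin v (P u) (hPmem u)
    have h3 : ‖P u - P v‖ * ‖P u - P v‖ ≤ inner ℝ (u - v) (P u - P v) := by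
      rw [← real_inner_self_eq_norm_mul_norm]
      have e1 : inner ℝ (u - P u) (P v - P u) = - inner ℝ (u - P u) (P u - P v) := by
        rw [← inner_neg_right]; congr 1; abel
      have e2 : inner ℝ (u - v) (P u - P v) = inner ℝ (u - P u) (P u - P v)
          + inner ℝ (P u - P v) (P u - P v) - inner ℝ (v - P v) (P u - P v) := by
        rw [← inner_add_left, ← inner_sub_left]; congr 1; abel
      linarith
    have h4 := real_inner_le_norm (u - v) (P u - P v)
    by_contra! hlt
    have : 0 < ‖P u - P v‖ := lt_of_le_of_lt (norm_nonneg _) hlt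
    nlinarith
  have hPid : ∀ y ∈ Δ, P y = y := by
    intro y hy
    have := hPin y y hy
    rw [real_inner_self_eq_norm_sq] at this
    have h0 : ‖y - P y‖ = 0 := by
      have := norm_nonneg (y - P y); nlinarith
    rw [norm_sub_eq_zero_iff] at h0; exact h0.symm
  have hnorm : ∀ y ∈ Δ, ‖y‖ ≤ c := by
    rintro y ⟨h1, h2⟩
    have : ‖y‖ ^ 2 ≤ c ^ 2 := by
      rw [EuclideanSpace.norm_sq_eq, ← h2, sq (∑ i, y i), Finset.sum_mul_sum]
      refine Finset.sum_le_sum fun i _ => ?_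
      rw [Real.norm_eq_abs, sq_abs, sq]
      exact Finset.single_le_sum (f := fun j => y i * y j)
        (fun j _ => mul_nonneg (h1 i) (h1 j)) (Finset.mem_univ i)
    exact abs_le_of_sq_le_sq' this hc.le |>.2
  set η : ℝ := min (ε / 2) (min 1 (κ * c / (2 * (m + 1) * (1 + κ)))) with hη
  have hη0 : 0 < η := by positivity
  have hη1 : η ≤ 1 := (min_le_right _ _).trans (min_le_left _ _)
  have hη2 : η ≤ ε / 2 := min_le_left _ _
  have hη3 : 2 * m * η * (1 + κ) < κ * c := by
    have : η ≤ κ * c / (2 * (m + 1) * (1 + κ)) := (min_le_right _ _).trans (min_le_right _ _)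
    rw [le_div_iff₀ (by positivity)] at this
    have : 0 < η * (1 + κ) := by positivity
    nlinarith
  refine ⟨η, hη0, fun z => P ((1 + κ) • z), ?_, ?_⟩
  · refine LipschitzWith.of_dist_le_mul fun x y => ?_
    rw [dist_eq_norm, dist_eq_norm, Real.coe_toNNReal _ (by positivity)]
    refine (hPlip _ _).trans ?_
    rw [← smul_sub, norm_smul, Real.norm_eq_abs, abs_of_pos (by positivity)]
  · intro y z h1 h2 hd
    have hy : y ∈ Δ := ⟨h1, h2⟩
    have hw := hPmem ((1 + κ) • z)
    refine ⟨?_, hw.1, hw.2, fun i hi => ?_⟩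
    · rw [dist_eq_norm]
      nth_rewrite 1 [← hPid y hy]
      refine (hPlip _ _).trans ?_
      have : y - (1 + κ) • z = (y - z) - κ • (z - y) - κ • y := by module
      rw [this]
      rw [dist_eq_norm] at hd
      have a1 : ‖κ • (z - y)‖ ≤ κ * η := by
        rw [norm_smul, Real.norm_eq_abs, abs_of_pos hκ, norm_sub_rev]; gcongr
      have a2 : ‖κ • y‖ ≤ κ * c := by
        rw [norm_smul, Real.norm_eq_abs, abs_of_pos hκ]; gcongr; exact hnorm y hy
      have a3 : κ * η ≤ κ * 1 := by gcongr
      have := norm_sub_le ((y - z) - κ • (z - y)) (κ • y)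
      have := norm_sub_le (y - z) (κ • (z - y))
      linarith
    · have hcoord : ∀ j, |y j - z j| ≤ η := by
        intro j
        refine le_trans ?_ hd
        rw [dist_eq_norm]
        have := PiLp.norm_apply_le (y - z) j
        simpa using this
      by_contra hne0
      have hpos : 0 < P ((1 + κ) • z) i := lt_of_le_of_ne (hw.1 i) (Ne.symm hne0)
      set w := P ((1 + κ) • z) with hwdef
      have hj : ∀ j, (1 + κ) * z j - w j ≤ (1 + κ) * z i - w i := by
        intro j
        have hmem : w + (w i) • (EuclideanSpace.single j (1 : ℝ) - EuclideanSpace.single i 1) ∈ Δ := by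
          refine ⟨fun k => ?_, ?_⟩
          · have := hw.1 k
            simp only [PiLp.add_apply, PiLp.smul_apply, PiLp.sub_apply, PiLp.single_apply,
              smul_eq_mul]
            by_cases hki : k = i
            · subst hki
              split_ifs <;> simp <;> linarith
            · simp only [hki, if_false]
              split_ifs <;> simp <;> linarith
          · simp [Finset.sum_add_distrib, ← Finset.mul_sum, hw.2]
        have := hPin ((1 + κ) • z) _ hmem
        rw [← hwdef, add_sub_cancel_left, inner_smul_right, inner_sub_right,
          EuclideanSpace.inner_single_right, EuclideanSpace.inner_single_right] at this
        simp only [PiLp.sub_apply, PiLp.smul_apply, smul_eq_mul, one_mul, conj_trivial] at this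
        have := nonpos_of_mul_nonpos_right this hpos
        linarith
      have hzi : z i ≤ η := by have := (abs_le.1 (hcoord i)).1; rw [hi] at this; linarith
      have hsum : ∑ j, ((1 + κ) * z j - w j) ≤ ∑ _j : Fin m, (1 + κ) * η := by
        refine Finset.sum_le_sum fun j _ => (hj j).trans ?_
        have : (1 + κ) * z i ≤ (1 + κ) * η := by gcongr
        linarith
      have hsz : c - m * η ≤ ∑ j, z j := by
        have : ∑ j, (y j - z j) ≤ ∑ _j : Fin m, η :=
          Finset.sum_le_sum fun j _ => (abs_le.1 (hcoord j)).2
        simp only [Finset.sum_sub_distrib, Finset.sum_const, Finset.card_univ, Fintype.card_fin,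
          nsmul_eq_mul, h2] at this
        linarith
      simp only [Finset.sum_sub_distrib, ← Finset.mul_sum, Finset.sum_const, Finset.card_univ,
        Fintype.card_fin, nsmul_eq_mul, hw.2] at hsum
      have : (1 + κ) * (c - m * η) ≤ (1 + κ) * ∑ j, z j := by gcongr
      nlinarith

/-- A countable subfamily that exhausts a family of measurable sets up to null sets. -/
lemma exists_seq_exhausting {X : Type*} [MeasurableSpace X] (μ : Measure X) [IsFiniteMeasure μ]
    (𝒮 : Set (Set X)) (hmeas : ∀ S ∈ 𝒮, MeasurableSet S) (hne : 𝒮.Nonempty) :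
    ∃ f : ℕ → Set X, (∀ k, f k ∈ 𝒮) ∧ ∀ S ∈ 𝒮, μ (S \ ⋃ k, f k) = 0 := by
  classical
  have hfne : Nonempty (ℕ → 𝒮) := ⟨fun _ => ⟨_, hne.some_mem⟩⟩
  set M : ℝ≥0∞ := ⨆ g : ℕ → 𝒮, μ (⋃ k, (g k : Set X)) with hM
  have hMtop : M ≠ ⊤ := ne_top_of_le_ne_top (measure_ne_top μ univ)
    (iSup_le fun g => measure_mono (subset_univ _))
  obtain ⟨u, -, hu, hulim⟩ := exists_seq_tendsto_sSup (S := range fun g : ℕ → 𝒮 =>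
    μ (⋃ k, (g k : Set X))) (range_nonempty _) (OrderTop.bddAbove _) |>.imp fun u h =>
      (⟨trivial, h.2.2, h.2.1⟩ : True ∧ _ ∧ _)
  choose g hg using hu
  have hsup : sSup (range fun g : ℕ → 𝒮 => μ (⋃ k, (g k : Set X))) = M := by rw [sSup_range]
  rw [hsup] at hulim
  let f : ℕ → 𝒮 := fun k => g k.unpair.1 k.unpair.2
  have hfU : (⋃ k, (f k : Set X)) = ⋃ i, ⋃ j, (g i j : Set X) := by
    ext x; simp only [mem_iUnion]
    constructor
    · rintro ⟨k, hk⟩; exact ⟨_, _, hk⟩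
    · rintro ⟨i, j, h⟩; exact ⟨Nat.pair i j, by simpa [f] using h⟩
  have hfM : M ≤ μ (⋃ k, (f k : Set X)) := by
    refine le_of_tendsto' hulim fun i => ?_
    rw [← hg i, hfU]
    exact measure_mono (subset_iUnion (fun i => ⋃ j, (g i j : Set X)) i)
  refine ⟨fun k => f k, fun k => (f k).2, fun S hS => ?_⟩
  set R := ⋃ k, (f k : Set X) with hR
  have hRm : MeasurableSet R := MeasurableSet.iUnion fun k => hmeas _ (f k).2
  have h1 : μ (S ∪ R) ≤ M := by
    let g' : ℕ → 𝒮 := fun k => Nat.rec ⟨S, hS⟩ (fun k _ => f k) k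
    have : S ∪ R ⊆ ⋃ k : ℕ, (g' k).1 := by
      rintro x (hx | hx)
      · exact mem_iUnion.2 ⟨0, hx⟩
      · obtain ⟨k, hk⟩ := mem_iUnion.1 hx; exact mem_iUnion.2 ⟨k + 1, hk⟩
    exact (measure_mono this).trans (le_iSup (fun g : ℕ → 𝒮 => μ (⋃ k, (g k : Set X))) g')
  have h2 : μ (S ∪ R) = μ R + μ (S \ R) := by
    rw [union_comm, ← union_sdiff_self, measure_union disjoint_sdiff_right ((hmeas S hS).diff hRm)]
  have h3 : μ R + μ (S \ R) ≤ μ R + 0 := by rw [add_zero, ← h2]; exact h1.trans hfM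
  exact le_antisymm ((ENNReal.add_le_add_iff_left (measure_ne_top μ R)).1 h3) (zero_le)

/-- No compact Lipschitz piece of positive measure lies in `U`. -/
def Unrect (n : ℕ) {X : Type*} [MetricSpace X] [MeasurableSpace X] [BorelSpace X]
    (U : Set X) : Prop :=
  ∀ (Z : Set (EuclideanSpace ℝ (Fin n))) (g : EuclideanSpace ℝ (Fin n) → X) (L : ℝ≥0),
    IsCompact Z → LipschitzOnWith L g Z → g '' Z ⊆ U → μH[(n : ℝ)] (g '' Z) = 0

lemma exists_rectifiable_part (n : ℕ) {X : Type*} [MetricSpace X] [CompactSpace X]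
    [MeasurableSpace X] [BorelSpace X] (hX : μH[(n : ℝ)] (Set.univ : Set X) < ⊤) :
    ∃ R : Set X, MeasurableSet R ∧
      (∀ P : Set X, PurelyUnrectifiable n P → μH[(n : ℝ)] (P ∩ R) = 0) ∧
      ∀ U : Set X, Disjoint U R → Unrect n U := by
  have : IsFiniteMeasure (μH[(n : ℝ)] : Measure X) := ⟨hX⟩
  obtain ⟨f, hf, hmax⟩ := exists_seq_exhausting (μH[(n : ℝ)] : Measure X)
    {S | S = ∅ ∨ ∃ (Z : Set (EuclideanSpace ℝ (Fin n))) (g : EuclideanSpace ℝ (Fin n) → X)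
      (L : ℝ≥0), IsCompact Z ∧ LipschitzOnWith L g Z ∧ S = g '' Z}
    (by
      rintro S (rfl | ⟨Z, g, L, hZ, hg, rfl⟩)
      · exact MeasurableSet.empty
      · exact (hZ.image_of_continuousOn hg.continuousOn).measurableSet) ⟨∅, Or.inl rfl⟩
  refine ⟨⋃ k, f k, MeasurableSet.iUnion fun k => ?_, fun P hP => ?_, fun U hU => ?_⟩
  · rcases hf k with h | ⟨Z, g, L, hZ, hg, h⟩
    · rw [h]; exact MeasurableSet.empty
    · rw [h]; exact (hZ.image_of_continuousOn hg.continuousOn).measurableSet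
  · rw [inter_iUnion, measure_iUnion_null_iff]
    intro k
    rcases hf k with h | ⟨Z, g, L, hZ, hg, h⟩
    · simp [h]
    · rw [h]; exact hP Z g L hg
  · intro Z g L hZ hg hsub
    have := hmax _ (Or.inr ⟨Z, g, L, hZ, hg, rfl⟩)
    rwa [(hU.mono_left hsub).sdiff_eq_left] at this

/-- The perturbation theorem for maps into Euclidean space. -/
def PerturbStatement (n : ℕ) (X : Type*) [MetricSpace X] [MeasurableSpace X] [BorelSpace X]
    (m : ℕ) : Prop :=
  ∀ (U : Set X), IsCompact U → Unrect n U → ∀ (C C' : ℝ≥0), 0 < C → C < C' →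
    ∀ (φ : X → EuclideanSpace ℝ (Fin m)), LipschitzWith C φ → ∀ ε : ℝ, 0 < ε →
    ∃ ψ : X → EuclideanSpace ℝ (Fin m), LipschitzWith C' ψ ∧ (∀ x, dist (φ x) (ψ x) ≤ ε) ∧
      μH[(n : ℝ)] (ψ '' U) = 0

theorem simplicial_perturbation_of_euclidean (n : ℕ) (X : Type*) [MetricSpace X] [CompactSpace X]
    [MeasurableSpace X] [BorelSpace X]
    (hX : μH[(n : ℝ)] (Set.univ : Set X) < ⊤)
    (m : ℕ) (hcore : 0 < n → PerturbStatement n X m) (K : SimplicialCplx (Fin m)) (s : ℝ) (hs : 0 < s)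
    (C : ℝ≥0) (φ : X → EuclideanSpace ℝ (Fin m))
    (hφmem : ∀ x, φ x ∈ realization s K) (hφ : LipschitzWith C φ)
    (P : Set X) (hP : PurelyUnrectifiable n P)
    (ε : ℝ) (hε : 0 < ε) :
    ∃ ψ : X → EuclideanSpace ℝ (Fin m),
      (∀ x, ψ x ∈ realization s K) ∧
      LipschitzWith (3 * C) ψ ∧
      (∀ x, dist (φ x) (ψ x) ≤ ε) ∧
      (∀ S ∈ K.F, ∀ x : X, φ x ∈ simplexOf s S → ψ x ∈ simplexOf s S) ∧
      μH[(n : ℝ)] (ψ '' P) ≤ ENNReal.ofReal ε := by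
  have hfin : IsFiniteMeasure (μH[(n : ℝ)] : Measure X) := ⟨hX⟩
  have htriv : μH[(n : ℝ)] (φ '' P) = 0 → _ := fun h => (⟨φ, hφmem, hφ.weaken (by
      calc C = 1 * C := (one_mul _).symm
        _ ≤ 3 * C := by gcongr; norm_num), fun x => by simp [hε.le], fun S _ x h => h,
    by rw [h]; exact zero_le⟩ : ∃ ψ : X → EuclideanSpace ℝ (Fin m),
      (∀ x, ψ x ∈ realization s K) ∧ LipschitzWith (3 * C) ψ ∧ (∀ x, dist (φ x) (ψ x) ≤ ε) ∧
      (∀ S ∈ K.F, ∀ x : X, φ x ∈ simplexOf s S → ψ x ∈ simplexOf s S) ∧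
      μH[(n : ℝ)] (ψ '' P) ≤ ENNReal.ofReal ε)
  rcases Nat.eq_zero_or_pos n with rfl | hn
  · apply htriv
    rcases P.eq_empty_or_nonempty with rfl | ⟨x, hx⟩
    · simp
    · have := hP univ (fun _ => x) 0 (LipschitzWith.const x).lipschitzOnWith
      have h2 : P ∩ (fun _ : EuclideanSpace ℝ (Fin 0) => x) '' univ = {x} := by
        ext y; constructor
        · rintro ⟨_, z, _, rfl⟩; rfl
        · rintro rfl; exact ⟨hx, 0, trivial, rfl⟩
      rw [h2] at this
      simp [Measure.hausdorffMeasure_zero_singleton] at this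
  rcases eq_or_lt_of_le (show (0:ℝ≥0) ≤ C by positivity) with hC | hC
  · apply htriv
    have := Measure.nullSingletonClass_hausdorff (EuclideanSpace ℝ (Fin m)) (d := (n : ℝ)) (by exact_mod_cast hn)
    refine Set.Subsingleton.measure_zero ?_ _
    rintro _ ⟨x, _, rfl⟩ _ ⟨y, _, rfl⟩
    have := hφ.dist_le_mul x y
    rw [← hC] at this
    simpa using this
  obtain ⟨R, hRm, hRP, hRU⟩ := exists_rectifiable_part n hX
  set M : ℝ≥0∞ := ((3 * C : ℝ≥0) : ℝ≥0∞) ^ (n : ℝ) with hM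
  have hM0 : M ≠ 0 := by simp [hM, hC.ne']
  have hMtop : M ≠ ⊤ := ENNReal.rpow_ne_top_of_nonneg (by positivity) ENNReal.coe_ne_top
  have hεM : ENNReal.ofReal ε / M ≠ 0 := by
    simp [ENNReal.div_eq_zero_iff, hε, hMtop]
  obtain ⟨U, hUR, hUc, hUlt⟩ := hRm.compl.exists_isCompact_sdiff_lt (μ := (μH[(n : ℝ)] : Measure X))
    (measure_ne_top _ _) hεM
  have hc : 0 < s / Real.sqrt 2 := by positivity
  set c := s / Real.sqrt 2 with hcdef
  set κ : ℝ := min (1 / 2) (ε / (4 * (c + 1))) with hκ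
  have hκ0 : 0 < κ := by positivity
  have hκ1 : κ ≤ 1 / 2 := min_le_left _ _
  have hκ2 : κ * (c + 1) < ε / 2 := by
    have : κ ≤ ε / (4 * (c + 1)) := min_le_right _ _
    rw [le_div_iff₀ (by positivity)] at this
    nlinarith
  obtain ⟨η, hη, T, hT, hTprop⟩ := exists_simplex_retraction m hc hκ0 hε hκ2
  obtain ⟨ψ, hψ, hclose, hzero⟩ := hcore hn U hUc (hRU U (disjoint_left.2 fun x hx => hUR hx))
    C (2 * C) hC (by
      calc C = 1 * C := (one_mul _).symm
        _ < 2 * C := by gcongr; norm_num) φ hφ η hη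
  have hlip : LipschitzWith (3 * C) (T ∘ ψ) := by
    refine (hT.comp hψ).weaken ?_
    rw [← mul_assoc]
    gcongr
    rw [← NNReal.coe_le_coe, NNReal.coe_mul, Real.coe_toNNReal _ (by positivity)]
    push_cast; linarith
  have hSmem : ∀ S ∈ K.F, ∀ x : X, φ x ∈ simplexOf s S → T (ψ x) ∈ simplexOf s S := by
    intro S hS x hx
    rw [mem_simplexOf_iff hs] at hx ⊢
    obtain ⟨-, h1, h2, h3⟩ := hTprop (φ x) (ψ x) hx.1 hx.2.1 (hclose x)
    exact ⟨h1, h2, fun i hi => h3 i (hx.2.2 i hi)⟩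
  refine ⟨T ∘ ψ, fun x => ?_, hlip, fun x => ?_, hSmem, ?_⟩
  · obtain ⟨S, hS, hx⟩ := mem_iUnion₂.1 (hφmem x)
    exact mem_iUnion₂.2 ⟨S, hS, hSmem S hS x hx⟩
  · obtain ⟨S, hS, hx⟩ := mem_iUnion₂.1 (hφmem x)
    rw [mem_simplexOf_iff hs] at hx
    exact (hTprop (φ x) (ψ x) hx.1 hx.2.1 (hclose x)).1
  · have hsub : (T ∘ ψ) '' P ⊆ (T ∘ ψ) '' (P ∩ R) ∪ (T '' (ψ '' U) ∪ (T ∘ ψ) '' (Rᶜ \ U)) := by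
      rintro _ ⟨x, hx, rfl⟩
      by_cases h1 : x ∈ R
      · exact Or.inl ⟨x, ⟨hx, h1⟩, rfl⟩
      by_cases h2 : x ∈ U
      · exact Or.inr (Or.inl ⟨_, ⟨x, h2, rfl⟩, rfl⟩)
      · exact Or.inr (Or.inr ⟨x, ⟨h1, h2⟩, rfl⟩)
    have hn0 : (0 : ℝ) ≤ n := by positivity
    have e1 : μH[(n : ℝ)] ((T ∘ ψ) '' (P ∩ R)) = 0 := by
      have := hlip.hausdorffMeasure_image_le hn0 (P ∩ R)
      rw [hRP P hP, mul_zero] at this; exact le_antisymm this (zero_le)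
    have e2 : μH[(n : ℝ)] (T '' (ψ '' U)) = 0 := by
      have := hT.hausdorffMeasure_image_le hn0 (ψ '' U)
      rw [hzero, mul_zero] at this; exact le_antisymm this (zero_le)
    have e3 : μH[(n : ℝ)] ((T ∘ ψ) '' (Rᶜ \ U)) ≤ ENNReal.ofReal ε := by
      refine (hlip.hausdorffMeasure_image_le hn0 _).trans ?_
      calc _ ≤ M * (ENNReal.ofReal ε / M) := by gcongr
        _ = _ := ENNReal.mul_div_cancel hM0 hMtop
    refine (measure_mono hsub).trans ((measure_union_le _ _).trans ?_)
    rw [e1, zero_add]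
    refine (measure_union_le _ _).trans ?_
    rw [e2, zero_add]; exact e3

/-- A set function dominated by Hausdorff measure for which small perturbations of Lipschitz maps
can be controlled. -/
structure IsContent (n : ℕ) {E : Type*} [NormedAddCommGroup E] [NormedSpace ℝ E]
    [MeasurableSpace E] [BorelSpace E] (Φ : Set E → ℝ≥0∞) : Prop where
  mono : ∀ {S T : Set E}, S ⊆ T → Φ S ≤ Φ T
  union_le : ∀ S T : Set E, Φ (S ∪ T) ≤ Φ S + Φ T
  exists_open : ∀ (S : Set E) (q : ℝ≥0∞), Φ S < q → ∃ O, IsOpen O ∧ S ⊆ O ∧ Φ O < q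
  bound : ∃ K : ℝ≥0, ∀ S, Φ S ≤ K * μH[(n : ℝ)] S
  scale : ∀ t : ℝ, 0 < t → t ≤ 1 → ∀ S, Φ (t • S) ≤ Φ S

lemma exists_countable_compact_family (X : Type*) [MetricSpace X] [CompactSpace X]
    [MeasurableSpace X] [BorelSpace X] (μ : Measure X) [IsFiniteMeasure μ] :
    ∃ (κ : Type) (_ : Countable κ) (K : κ → Set X), (∀ l, IsCompact (K l)) ∧
      ∀ B, IsCompact B → ∀ η : ℝ≥0∞, η ≠ 0 → ∃ l, B ⊆ K l ∧ μ (K l \ B) < η := by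
  obtain ⟨b, hbc, -, hb⟩ := TopologicalSpace.exists_countable_basis X
  have : Countable b := hbc.to_subtype
  have hemb : Countable (Finset b) := inferInstance
  obtain ⟨f, hf⟩ := exists_injective_nat (Finset b)
  refine ⟨range f, inferInstance, fun l => closure (⋃ s ∈ l.2.choose, (s : Set X)),
    fun l => isClosed_closure.isCompact, fun B hB η hη => ?_⟩
  obtain ⟨O, hBO, hO, hOlt⟩ := B.exists_isOpen_lt_add (μ := μ) (measure_ne_top μ B) hη
  obtain ⟨δ, hδ, hδO⟩ := hB.exists_cthickening_subset_open hO hBO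
  have hcov : B ⊆ ⋃ s : {s : b // (s : Set X) ⊆ thickening δ B}, ((s.1 : Set X)) := by
    intro x hx
    obtain ⟨s, hs, hxs, hst⟩ := hb.exists_subset_of_mem_open
      (self_subset_thickening hδ B hx) isOpen_thickening
    exact mem_iUnion.2 ⟨⟨⟨s, hs⟩, hst⟩, hxs⟩
  obtain ⟨t, ht⟩ := hB.elim_finite_subcover _ (fun s => hb.isOpen s.1.2) hcov
  classical
  let F : Finset b := t.image Subtype.val
  have hFc : (⟨f F, F, rfl⟩ : range f).2.choose = F :=
    hf (⟨f F, F, rfl⟩ : range f).2.choose_spec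
  refine ⟨⟨f F, F, rfl⟩, ?_, ?_⟩
  · simp only [hFc]
    refine Subset.trans ?_ subset_closure
    intro x hx
    obtain ⟨s, hs, hxs⟩ := mem_iUnion₂.1 (ht hx)
    exact mem_iUnion₂.2 ⟨s.1, Finset.mem_image_of_mem _ hs, hxs⟩
  · simp only [hFc]
    have hsub : closure (⋃ s ∈ F, (s : Set X)) ⊆ O := by
      refine Subset.trans (closure_minimal ?_ isClosed_cthickening) hδO
      refine iUnion₂_subset fun s hs => ?_
      obtain ⟨s', -, rfl⟩ := Finset.mem_image.1 hs
      exact s'.2.trans (thickening_subset_cthickening _ _)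
    refine (measure_mono (sdiff_subset_sdiff_left hsub)).trans_lt ?_
    rw [measure_sdiff hBO hB.measurableSet.nullMeasurableSet (measure_ne_top _ _)]
    exact ENNReal.sub_lt_of_lt_add (measure_mono hBO) (by rwa [add_comm] at hOlt)

theorem exists_generic_lipschitz (n : ℕ) {X : Type*} [MetricSpace X] [CompactSpace X]
    [MeasurableSpace X] [BorelSpace X] (hX : μH[(n : ℝ)] (Set.univ : Set X) < ⊤)
    {E : Type*} [NormedAddCommGroup E] [NormedSpace ℝ E] [CompleteSpace E]
    [MeasurableSpace E] [BorelSpace E] {ι : Type*} [Countable ι] (Φ : ι → Set E → ℝ≥0∞)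
    (hΦ : ∀ i, IsContent n (Φ i)) (C' : ℝ≥0) (φ : X → E) (hφ : LipschitzWith C' φ)
    (ε : ℝ) (hε : 0 < ε) (hC' : 0 < C') :
    ∃ ψ : X → E, LipschitzWith C' ψ ∧ (∀ x, dist (φ x) (ψ x) ≤ ε) ∧
      ∀ i B, IsCompact B → ∀ r < Φ i (ψ '' B), ∃ δ : ℝ≥0, 0 < δ ∧ ∀ ψ' : X → E,
        LipschitzWith (C' + δ) ψ' → (∀ x, dist (ψ x) (ψ' x) ≤ δ) → r < Φ i (ψ' '' B) := by
  have hfin : IsFiniteMeasure (μH[(n : ℝ)] : Measure X) := ⟨hX⟩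
  obtain ⟨κ, hκ, K, hK, hKapx⟩ := exists_countable_compact_family X (μH[(n : ℝ)] : Measure X)
  let L : Set C(X, E) := {ψ | LipschitzWith C' ψ}
  have hLclosed : IsClosed L := by
    have : L = ⋂ (x : X) (y : X), {ψ : C(X, E) | dist (ψ x) (ψ y) ≤ C' * dist x y} := by
      ext ψ; simp [L, lipschitzWith_iff_dist_le_mul]
    rw [this]
    exact isClosed_iInter fun x => isClosed_iInter fun y => isClosed_le
      ((continuous_eval_const x).dist (continuous_eval_const y)) continuous_const
  have hLc : CompleteSpace L := hLclosed.completeSpace_coe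
  let O : ι × κ × ℚ → Set L := fun p => {ψ | Φ p.1 ((ψ : C(X, E)) '' K p.2.1) < ((Real.toNNReal p.2.2 : ℝ≥0) : ℝ≥0∞)}
  have hOopen : ∀ p, IsOpen (O p) := by
    intro p
    rw [Metric.isOpen_iff]
    intro ψ hψ
    obtain ⟨V, hV, hsub, hlt⟩ := (hΦ p.1).exists_open _ _ hψ
    obtain ⟨δ, hδ, hδV⟩ := ((hK p.2.1).image ψ.1.continuous).exists_thickening_subset_open hV hsub
    refine ⟨δ, hδ, fun ψ' hψ' => lt_of_le_of_lt ((hΦ p.1).mono ?_) hlt⟩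
    rintro _ ⟨x, hx, rfl⟩
    refine hδV (mem_thickening_iff.2 ⟨_, ⟨x, hx, rfl⟩, ?_⟩)
    exact lt_of_le_of_lt (ContinuousMap.dist_apply_le_dist x) hψ'
  have hdense : Dense (⋂ p, (O p ∪ interior (O p)ᶜ)) := by
    refine dense_iInter_of_isOpen (fun p => (hOopen p).union isOpen_interior) fun p => ?_
    have := (hOopen p).isClosed_compl.frontier_eq
    rw [dense_iff_closure_eq, closure_union, ← univ_subset_iff]
    intro ψ _
    by_cases h : ψ ∈ closure (O p)
    · exact Or.inl h
    · right
      rw [← mem_compl_iff, ← interior_compl] at h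
      exact subset_closure h
  let φ' : L := ⟨⟨φ, hφ.continuous⟩, hφ⟩
  obtain ⟨ψ, hψb, hψ⟩ := hdense.inter_open_nonempty (ball φ' ε) isOpen_ball ⟨φ', mem_ball_self hε⟩
  rw [mem_iInter] at hψ
  refine ⟨ψ.1, ψ.2, fun x => ?_, fun i B hB r hr => ?_⟩
  · have : dist (ψ : C(X, E)) φ' < ε := hψb
    rw [dist_comm]
    exact (ContinuousMap.dist_apply_le_dist (f := ψ.1) (g := φ'.1) x).trans this.le
  obtain ⟨q, hrq, hqΦ⟩ : ∃ q : ℚ, r < ((Real.toNNReal q : ℝ≥0) : ℝ≥0∞) ∧ ((Real.toNNReal q : ℝ≥0) : ℝ≥0∞) < Φ i (ψ.1 '' B) := by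
    obtain ⟨q, -, h1, h2⟩ := ENNReal.lt_iff_exists_rat_btwn.1 hr
    exact ⟨q, h1, h2⟩
  obtain ⟨k, hk⟩ := (hΦ i).bound
  set M : ℝ≥0∞ := k * ((C' + 1 : ℝ≥0) : ℝ≥0∞) ^ (n : ℝ) with hM
  have hMtop : M ≠ ⊤ := ENNReal.mul_ne_top ENNReal.coe_ne_top
    (ENNReal.rpow_ne_top_of_nonneg (by positivity) ENNReal.coe_ne_top)
  have hgap : (((Real.toNNReal q : ℝ≥0) : ℝ≥0∞) - r) / M ≠ 0 := by
    rw [Ne, ENNReal.div_eq_zero_iff, not_or]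
    exact ⟨(tsub_pos_of_lt hrq).ne', hMtop⟩
  obtain ⟨l, hBl, hlt⟩ := hKapx B hB _ hgap
  have hn0 : (0 : ℝ) ≤ n := by positivity
  have hrest : ∀ ψ' : X → E, LipschitzWith (C' + 1) ψ' →
      Φ i (ψ' '' (K l \ B)) ≤ M * μH[(n : ℝ)] (K l \ B) := by
    intro ψ' h
    refine (hk _).trans ?_
    rw [hM, mul_assoc]
    gcongr
    exact h.hausdorffMeasure_image_le hn0 _
  have hrest2 : M * μH[(n : ℝ)] (K l \ B) < ((Real.toNNReal q : ℝ≥0) : ℝ≥0∞) - r := by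
    rcases eq_or_ne M 0 with h0 | h0
    · rw [h0, zero_mul]; exact tsub_pos_of_lt hrq
    · calc _ < M * ((((Real.toNNReal q : ℝ≥0) : ℝ≥0∞) - r) / M) := by
            exact ENNReal.mul_lt_mul_right h0 hMtop hlt
        _ = _ := ENNReal.mul_div_cancel h0 hMtop
  have hint : ψ ∈ interior (O (i, l, q))ᶜ := by
    refine (hψ (i, l, q)).resolve_left fun h => ?_
    have h' : Φ i (ψ.1 '' K l) < ((Real.toNNReal q : ℝ≥0) : ℝ≥0∞) := h
    exact absurd (hqΦ.trans_le ((hΦ i).mono (image_mono hBl))) (not_lt.2 h'.le)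
  obtain ⟨δ₀, hδ₀, hball⟩ := Metric.isOpen_iff.1 isOpen_interior _ hint
  set N : ℝ := ‖(ψ : C(X, E))‖ with hN
  have hC0 : (0 : ℝ) < C' := by exact_mod_cast hC'
  have hN0 : 0 ≤ N := norm_nonneg _
  set d : ℝ := min 1 (δ₀ / 2 / (1 + (N + 1) / C')) with hd
  have hd0 : 0 < d := by positivity
  have hd1 : d ≤ 1 := min_le_left _ _
  have hd2 : d * (1 + (N + 1) / C') ≤ δ₀ / 2 := by
    have : d ≤ _ := min_le_right _ _
    rwa [le_div_iff₀ (by positivity)] at this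
  refine ⟨⟨d, hd0.le⟩, hd0, fun ψ' hψ' hdist => ?_⟩
  set δ : ℝ≥0 := ⟨d, hd0.le⟩ with hδ
  have hδd : (δ : ℝ) = d := rfl
  set t : ℝ≥0 := C' / (C' + δ) with ht
  have hδ0 : 0 < δ := hd0
  have ht0 : 0 < t := by positivity
  have ht1 : t ≤ 1 := div_le_one_of_le₀ (by simp) (by positivity)
  have htlip : LipschitzWith C' fun x => (t : ℝ) • ψ' x := by
    have := (lipschitzWith_smul (t : ℝ) (β := E)).comp hψ'
    refine this.weaken (le_of_eq ?_)
    rw [NNReal.nnnorm_eq]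
    exact div_mul_cancel₀ _ (by positivity)
  let ψ₁ : L := ⟨⟨_, htlip.continuous⟩, htlip⟩
  have hψ₁ : ψ₁ ∈ ball ψ δ₀ := by
    rw [mem_ball]
    refine lt_of_le_of_lt ((ContinuousMap.dist_le (by positivity)).2 fun x => ?_)
      (half_lt_self hδ₀)
    change dist ((t : ℝ) • ψ' x) (ψ.1 x) ≤ δ₀ / 2
    rw [dist_eq_norm]
    have e : (t : ℝ) • ψ' x - ψ.1 x = (t : ℝ) • (ψ' x - ψ.1 x) - (1 - (t : ℝ)) • ψ.1 x := by module
    have h1 : ‖ψ' x - ψ.1 x‖ ≤ d := by rw [← dist_eq_norm, dist_comm]; exact hdist x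
    have h2 : ‖ψ.1 x‖ ≤ N := ψ.1.norm_coe_le_norm x
    have h3 : 1 - (t : ℝ) ≤ d / C' := by
      have : (t : ℝ) = C' / (C' + d) := by rw [ht]; push_cast; rfl
      rw [this, one_sub_div (by positivity), add_sub_cancel_left]
      gcongr; linarith
    have h4 : 0 ≤ 1 - (t : ℝ) := sub_nonneg.2 (by exact_mod_cast ht1)
    rw [e]
    refine (norm_sub_le _ _).trans ?_
    rw [norm_smul, norm_smul, Real.norm_of_nonneg t.coe_nonneg, Real.norm_of_nonneg h4]
    calc (t : ℝ) * ‖ψ' x - ψ.1 x‖ + (1 - (t : ℝ)) * ‖ψ.1 x‖ ≤ 1 * d + d / C' * (N + 1) := by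
          gcongr
          · exact_mod_cast ht1
          · linarith
      _ = d * (1 + (N + 1) / C') := by ring
      _ ≤ _ := hd2
  have hq1 : ((Real.toNNReal q : ℝ≥0) : ℝ≥0∞) ≤ Φ i (ψ₁.1 '' K l) := not_lt.1 (interior_subset (hball hψ₁))
  have hq2 : Φ i (ψ₁.1 '' K l) ≤ Φ i (ψ' '' K l) := by
    refine le_trans (le_of_eq ?_) ((hΦ i).scale t ht0 (by exact_mod_cast ht1) _)
    rw [← image_smul, image_image]; rfl
  have hq3 : Φ i (ψ' '' K l) ≤ Φ i (ψ' '' B) + Φ i (ψ' '' (K l \ B)) := by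
    refine le_trans ((hΦ i).mono ?_) ((hΦ i).union_le _ _)
    rw [← image_union, union_sdiff_self]
    exact image_mono subset_union_right
  have hq4 := hrest ψ' (hψ'.weaken (by gcongr; exact_mod_cast hd1))
  by_contra! hle
  have hrtop : r ≠ ⊤ := ne_top_of_lt hrq
  have : ((Real.toNNReal q : ℝ≥0) : ℝ≥0∞) < r + (((Real.toNNReal q : ℝ≥0) : ℝ≥0∞) - r) :=
    calc ((Real.toNNReal q : ℝ≥0) : ℝ≥0∞) ≤ Φ i (ψ' '' B) + Φ i (ψ' '' (K l \ B)) := hq1.trans (hq2.trans hq3)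
      _ ≤ r + M * μH[(n : ℝ)] (K l \ B) := add_le_add hle hq4
      _ < _ := ENNReal.add_lt_add_left hrtop hrest2
  rw [add_tsub_cancel_of_le hrq.le] at this
  exact lt_irrefl _ this

section HausdorffContent
variable {E : Type*} [NormedAddCommGroup E] [NormedSpace ℝ E] [MeasurableSpace E] [BorelSpace E]

/-- The unnormalised Hausdorff content of dimension `n`, computed with open covers. -/
def hContent (n : ℕ) (S : Set E) : ℝ≥0∞ :=
  ⨅ (t : ℕ → Set E) (_ : S ⊆ ⋃ k, t k) (_ : ∀ k, IsOpen (t k)), ∑' k, Metric.ediam (t k) ^ n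

lemma hContent_le {n : ℕ} {S : Set E} (t : ℕ → Set E) (h : S ⊆ ⋃ k, t k)
    (ho : ∀ k, IsOpen (t k)) : hContent n S ≤ ∑' k, Metric.ediam (t k) ^ n :=
  iInf₂_le_of_le t h (iInf_le _ ho)

lemma exists_cover_of_hContent_lt {n : ℕ} {S : Set E} {q : ℝ≥0∞} (h : hContent n S < q) :
    ∃ t : ℕ → Set E, S ⊆ ⋃ k, t k ∧ (∀ k, IsOpen (t k)) ∧ ∑' k, Metric.ediam (t k) ^ n < q := by
  simp only [hContent, iInf_lt_iff] at h
  obtain ⟨t, h1, h2, h3⟩ := h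
  exact ⟨t, h1, h2, h3⟩

lemma hContent_union_le (n : ℕ) (S T : Set E) : hContent n (S ∪ T) ≤ hContent n S + hContent n T := by
  refine ENNReal.le_of_forall_pos_le_add fun ε hε hfin => ?_
  obtain ⟨h1, h2⟩ := ENNReal.add_lt_top.1 hfin
  have hε2 : ((ε / 2 : ℝ≥0) : ℝ≥0∞) ≠ 0 := by simpa using hε.ne'
  obtain ⟨t, ht, hto, htl⟩ := exists_cover_of_hContent_lt (ENNReal.lt_add_right h1.ne hε2)
  obtain ⟨u, hu, huo, hul⟩ := exists_cover_of_hContent_lt (ENNReal.lt_add_right h2.ne hε2)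
  let v : ℕ ⊕ ℕ → Set E := Sum.elim t u
  let e := (Equiv.natSumNatEquivNat).symm
  have := hContent_le (n := n) (S := S ∪ T) (fun k => v (e k)) (by
    rintro x (hx | hx)
    · obtain ⟨k, hk⟩ := mem_iUnion.1 (ht hx)
      exact mem_iUnion.2 ⟨e.symm (Sum.inl k), by simpa [v] using hk⟩
    · obtain ⟨k, hk⟩ := mem_iUnion.1 (hu hx)
      exact mem_iUnion.2 ⟨e.symm (Sum.inr k), by simpa [v] using hk⟩) (by
    intro k; rcases e k with j | j
    · exact hto j
    · exact huo j)
  refine this.trans ?_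
  rw [e.tsum_eq (fun k => Metric.ediam (v k) ^ n), ENNReal.summable.tsum_sum ENNReal.summable]
  calc _ ≤ (hContent n S + ((ε / 2 : ℝ≥0) : ℝ≥0∞)) + (hContent n T + ((ε / 2 : ℝ≥0) : ℝ≥0∞)) :=
        add_le_add htl.le hul.le
    _ = hContent n S + hContent n T + (((ε / 2 : ℝ≥0) : ℝ≥0∞) + ((ε / 2 : ℝ≥0) : ℝ≥0∞)) := by ring
    _ = _ := by rw [← ENNReal.coe_add, add_halves]

lemma exists_isOpen_ediam_pow_le {n : ℕ} (S : Set E) {η : ℝ≥0∞} (hη : η ≠ 0) :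
    ∃ O, IsOpen O ∧ S ⊆ O ∧ Metric.ediam O ^ n ≤ Metric.ediam S ^ n + η := by
  rcases eq_or_ne (Metric.ediam S) ⊤ with h | h
  · rcases Nat.eq_zero_or_pos n with rfl | hn
    · exact ⟨univ, isOpen_univ, subset_univ _, by simp⟩
    · exact ⟨univ, isOpen_univ, subset_univ _, by rw [h, ENNReal.top_pow hn.ne']; simp⟩
  have hcont : Tendsto (fun r : ℝ => (Metric.ediam S + 2 * ENNReal.ofReal r) ^ n) (nhdsWithin 0 (Ioi 0))
      (nhds ((Metric.ediam S + 2 * ENNReal.ofReal 0) ^ n)) := by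
    refine ((ENNReal.continuous_pow n).tendsto _).comp ?_
    refine Tendsto.mono_left ?_ nhdsWithin_le_nhds
    refine Tendsto.const_add _ (ENNReal.Tendsto.const_mul ?_ (Or.inr (by simp)))
    exact (ENNReal.continuous_ofReal.tendsto 0)
  have hlt : (Metric.ediam S + 2 * ENNReal.ofReal 0) ^ n < Metric.ediam S ^ n + η := by
    simp only [ENNReal.ofReal_zero, mul_zero, add_zero]
    exact ENNReal.lt_add_right (ENNReal.pow_ne_top h) hη
  obtain ⟨r, hr, hr0⟩ := ((hcont.eventually_lt_const hlt).and self_mem_nhdsWithin).exists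
  refine ⟨thickening r S, isOpen_thickening, self_subset_thickening hr0 S, le_trans ?_ hr.le⟩
  refine pow_le_pow_left' ?_ n
  have := Metric.ediam_thickening_le (s := S) ⟨r, (show (0:ℝ) < r from hr0).le⟩
  refine this.trans (le_of_eq ?_)
  rw [ENNReal.ofReal, Real.toNNReal_of_nonneg (show (0:ℝ) < r from hr0).le]
  rfl

lemma hContent_le_hausdorffMeasure {n : ℕ} (hn : 0 < n) (S : Set E) :
    hContent n S ≤ μH[(n : ℝ)] S := by
  refine ENNReal.le_of_forall_pos_le_add fun ε hε hfin => ?_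
  have hε2 : ((ε / 2 : ℝ≥0) : ℝ≥0∞) ≠ 0 := by simpa using hε.ne'
  rw [Measure.hausdorffMeasure_apply] at hfin ⊢
  set F := fun r : ℝ≥0∞ => ⨅ (t : ℕ → Set E) (_ : S ⊆ ⋃ n, t n) (_ : ∀ n, Metric.ediam (t n) ≤ r),
    ∑' k, ⨆ _ : (t k).Nonempty, Metric.ediam (t k) ^ (n : ℝ) with hF
  have h1 : F 1 ≤ ⨆ (r : ℝ≥0∞) (_ : 0 < r), F r := le_iSup₂ (f := fun r (_ : 0 < r) => F r) 1 one_pos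
  have h2 : F 1 < (⨆ (r : ℝ≥0∞) (_ : 0 < r), F r) + ((ε / 2 : ℝ≥0) : ℝ≥0∞) :=
    h1.trans_lt (ENNReal.lt_add_right hfin.ne hε2)
  simp only [hF, iInf_lt_iff] at h2
  obtain ⟨t, ht, -, hlt⟩ := h2
  obtain ⟨η, hη, hηsum⟩ := ENNReal.exists_pos_sum_of_countable hε2 ℕ
  choose O hO htO hOd using fun k => exists_isOpen_ediam_pow_le (n := n) (t k)
    (ENNReal.coe_ne_zero.2 (hη k).ne')
  refine (hContent_le O (ht.trans (iUnion_mono htO)) hO).trans ?_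
  calc ∑' k, Metric.ediam (O k) ^ n ≤ ∑' k, (Metric.ediam (t k) ^ n + (η k : ℝ≥0∞)) :=
        ENNReal.tsum_le_tsum hOd
    _ = ∑' k, Metric.ediam (t k) ^ n + ∑' k, (η k : ℝ≥0∞) := ENNReal.tsum_add
    _ ≤ ((⨆ (r : ℝ≥0∞) (_ : 0 < r), F r) + ((ε / 2 : ℝ≥0) : ℝ≥0∞)) + ((ε / 2 : ℝ≥0) : ℝ≥0∞) := by
        refine add_le_add (le_trans (ENNReal.tsum_le_tsum fun k => ?_) hlt.le) hηsum.le
        rcases (t k).eq_empty_or_nonempty with h | h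
        · simp [h, hn.ne']
        · rw [ciSup_pos h, ENNReal.rpow_natCast]
    _ = _ := by rw [add_assoc, ← ENNReal.coe_add, add_halves]

lemma hausdorffMeasure_eq_zero_of_hContent {n : ℕ} (hn : 0 < n) {S : Set E} (h : hContent n S = 0) :
    μH[(n : ℝ)] S = 0 := by
  rw [Measure.hausdorffMeasure_apply]
  refine le_antisymm (iSup₂_le fun r hr => ?_) zero_le
  refine ENNReal.le_of_forall_pos_le_add fun ε hε _ => ?_
  rw [zero_add]
  have hpos : 0 < min (ε : ℝ≥0∞) (r ^ n) := lt_min (by simpa using hε) (by positivity)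
  obtain ⟨t, ht, hto, hlt⟩ := exists_cover_of_hContent_lt (h ▸ hpos)
  refine iInf₂_le_of_le t ht (iInf_le_of_le (fun k => ?_) ?_)
  · have h1 : Metric.ediam (t k) ^ n ≤ r ^ n :=
      (ENNReal.le_tsum k).trans (hlt.le.trans (min_le_right _ _))
    exact (ENNReal.pow_le_pow_left_iff hn.ne').1 h1
  · refine le_trans (ENNReal.tsum_le_tsum fun k => ?_) (hlt.le.trans (min_le_left _ _))
    exact iSup_le fun _ => by rw [ENNReal.rpow_natCast]

lemma isContent_hContent {n : ℕ} (hn : 0 < n) : IsContent n (hContent n : Set E → ℝ≥0∞) where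
  mono h := le_iInf₂ fun t ht => le_iInf fun ho => hContent_le t (h.trans ht) ho
  union_le := hContent_union_le n
  exists_open S q h := by
    obtain ⟨t, ht, hto, hlt⟩ := exists_cover_of_hContent_lt h
    exact ⟨⋃ k, t k, isOpen_iUnion hto, ht, (hContent_le t subset_rfl hto).trans_lt hlt⟩
  bound := ⟨1, fun S => by simpa using hContent_le_hausdorffMeasure hn S⟩
  scale t ht ht1 S := by
    refine le_iInf₂ fun u hu => le_iInf fun ho => ?_
    refine (hContent_le (fun k => t • u k) ?_ fun k => (ho k).smul₀ ht.ne').trans ?_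
    · rw [← smul_set_iUnion]; exact smul_set_mono hu
    · refine ENNReal.tsum_le_tsum fun k => ?_
      refine pow_le_pow_left' ?_ n
      rw [ediam_smul₀]
      have : ‖t‖₊ ≤ 1 := by
        rw [← NNReal.coe_le_coe, coe_nnnorm, Real.norm_of_nonneg ht.le]; exact ht1
      calc ‖t‖₊ • Metric.ediam (u k) = (‖t‖₊ : ℝ≥0∞) * Metric.ediam (u k) := by
            rw [ENNReal.smul_def, smul_eq_mul]
        _ ≤ 1 * _ := by gcongr; exact_mod_cast this
        _ = _ := one_mul _

end HausdorffContent

section ProjContent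
variable {m : ℕ}

/-- The linear map with coordinates `⟨c j, ·⟩`. -/
def coordMap {n m : ℕ} (c : Fin n → EuclideanSpace ℝ (Fin m)) :
    EuclideanSpace ℝ (Fin m) →L[ℝ] (Fin n → ℝ) :=
  ContinuousLinearMap.pi fun j => innerSL ℝ (c j)

@[simp] lemma coordMap_apply {n m : ℕ} (c : Fin n → EuclideanSpace ℝ (Fin m))
    (y : EuclideanSpace ℝ (Fin m)) (j : Fin n) : coordMap c y j = inner ℝ (c j) y := rfl

lemma isContent_volume_image {n : ℕ} (A : EuclideanSpace ℝ (Fin m) →L[ℝ] (Fin n → ℝ)) :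
    IsContent n (fun S : Set (EuclideanSpace ℝ (Fin m)) => volume (A '' S)) where
  mono h := measure_mono (image_mono h)
  union_le S T := by rw [image_union]; exact measure_union_le _ _
  exists_open S q h := by
    obtain ⟨O, hO, ho, hlt⟩ := (A '' S).exists_isOpen_lt_of_lt _ h
    exact ⟨A ⁻¹' O, ho.preimage A.continuous, image_subset_iff.1 hO,
      (measure_mono (image_preimage_subset _ _)).trans_lt hlt⟩
  bound := ⟨‖A‖₊ ^ n, fun S => by
    have := A.lipschitz.hausdorffMeasure_image_le (d := (n : ℝ)) (by positivity) S
    have e : (μH[(n : ℝ)] : Measure (Fin n → ℝ)) = volume := by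
      simpa using hausdorffMeasure_pi_real (ι := Fin n)
    rw [e] at this
    simpa [ENNReal.rpow_natCast] using this⟩
  scale t ht ht1 S := by
    have : A '' (t • S) = t • (A '' S) := by
      rw [← image_smul, ← image_smul, image_image, image_image]; simp
    simp only [this]
    rw [Measure.addHaar_smul]
    calc _ ≤ 1 * volume (A '' S) := by
          gcongr
          rw [abs_of_nonneg (by positivity)]
          exact ENNReal.ofReal_le_one.2 (pow_le_one₀ ht.le ht1)
      _ = _ := one_mul _

end ProjContent

universe u

/-- A finite weighted system of steps of total length one, together with its boundary. -/
structure StepSystem (X : Type u) [MetricSpace X] where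
  ι : Type u
  fι : Fintype ι
  src : ι → X
  tgt : ι → X
  w : ι → ℝ
  w_nonneg : ∀ i, 0 ≤ w i
  length_one : ∑ i, w i * dist (src i) (tgt i) = 1
  β : Type u
  fβ : Fintype β
  s : β → X
  t : β → X
  b : β → ℝ
  b_nonneg : ∀ j, 0 ≤ b j
  boundary : ∀ g : X → ℝ, ∑ i, w i * (g (src i) - g (tgt i)) = ∑ j, b j * (g (s j) - g (t j))

attribute [instance] StepSystem.fι StepSystem.fβ

/-- Lipschitz cutoff functions that are close to one in mean. -/
def Cutoffs {X : Type*} [MetricSpace X] [MeasurableSpace X] (μ : Measure X) (L : ℝ≥0) (α : ℝ) :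
    Set (X → ℝ) :=
  {θ | LipschitzWith L θ ∧ (∀ x, 0 ≤ θ x) ∧ (∀ x, θ x ≤ 1) ∧ ∫ x, (1 - θ x) ∂μ ≤ α}

/-- The steps of the path starting at `x` and visiting the entries of a list. -/
def pathSteps {X : Type*} : X → List X → List (X × X)
  | _, [] => []
  | x, y :: l => (x, y) :: pathSteps y l

/-- The endpoint of a path. -/
def pathEnd {X : Type*} : X → List X → X
  | x, [] => x
  | _, y :: l => pathEnd y l

lemma sum_pathSteps_sub {X : Type*} (g : X → ℝ) (x : X) (l : List X) :
    ((pathSteps x l).map fun q => g q.1 - g q.2).sum = g x - g (pathEnd x l) := by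
  induction l generalizing x with
  | nil => simp [pathSteps, pathEnd]
  | cons y l ih => simp [pathSteps, pathEnd, ih]

lemma isCompact_cutoffs {X : Type*} [MetricSpace X] [CompactSpace X] [MeasurableSpace X]
    [BorelSpace X] (μ : Measure X) [IsFiniteMeasure μ] (L : ℝ≥0) (α : ℝ) :
    IsCompact {θ : BoundedContinuousFunction X ℝ | (θ : X → ℝ) ∈ Cutoffs μ L α} := by
  set A := {θ : BoundedContinuousFunction X ℝ | (θ : X → ℝ) ∈ Cutoffs μ L α} with hA
  have hcl : IsClosed A := by
    have hint : Continuous fun θ : BoundedContinuousFunction X ℝ => ∫ x, θ x ∂μ := by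
      have : LipschitzWith (μ.real univ).toNNReal
          fun θ : BoundedContinuousFunction X ℝ => ∫ x, θ x ∂μ := by
        refine LipschitzWith.of_dist_le_mul fun θ θ' => ?_
        rw [Real.coe_toNNReal _ measureReal_nonneg, Real.dist_eq, ← integral_sub
          (θ.integrable μ) (θ'.integrable μ), mul_comm, ← Real.norm_eq_abs]
        refine norm_integral_le_of_norm_le_const (μ := μ) (ae_of_all _ fun x => ?_)
        rw [← dist_eq_norm]; exact θ.dist_coe_le_dist x
      exact this.continuous
    have : A = (⋂ (x : X) (y : X), {θ | dist (θ x) (θ y) ≤ L * dist x y}) ∩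
        ((⋂ x, {θ | 0 ≤ θ x}) ∩ ((⋂ x, {θ | θ x ≤ 1}) ∩
          {θ | μ.real univ - ∫ x, θ x ∂μ ≤ α})) := by
      ext θ
      have e : ∫ x, (1 - θ x) ∂μ = μ.real univ - ∫ x, θ x ∂μ := by
        rw [integral_sub (integrable_const _) (θ.integrable μ)]; simp
      simp [A, Cutoffs, lipschitzWith_iff_dist_le_mul, e]
    rw [this]
    have hev : ∀ x : X, Continuous fun θ : BoundedContinuousFunction X ℝ => θ x :=
      fun x => (continuous_apply x).comp BoundedContinuousFunction.continuous_coe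
    refine IsClosed.inter (isClosed_iInter fun x => isClosed_iInter fun y => isClosed_le
      ((hev x).dist (hev y)) continuous_const) (IsClosed.inter
      (isClosed_iInter fun x => isClosed_le continuous_const (hev x)) (IsClosed.inter
      (isClosed_iInter fun x => isClosed_le (hev x) continuous_const)
      (isClosed_le (continuous_const.sub hint) continuous_const)))
  rw [← hcl.closure_eq]
  refine BoundedContinuousFunction.arzela_ascoli (Icc (0 : ℝ) 1) isCompact_Icc A
    (fun θ x hθ => ⟨hθ.2.1 x, hθ.2.2.1 x⟩) ?_
  refine (LipschitzWith.uniformEquicontinuous (fun θ : A => (θ.1 : X → ℝ)) L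
    fun θ => θ.2.1).equicontinuous

/-- A finite-dimensional minimax principle. -/
lemma exists_weights_of_finite_cover {F : Type*} [AddCommGroup F] [Module ℝ F]
    [TopologicalSpace F] {A : Set F} (hA : IsCompact A) (hconv : Convex ℝ A)
    {γ : Type*} (a : γ → F → ℝ) (hcont : ∀ i, Continuous (a i))
    (haff : ∀ i, ∀ x ∈ A, ∀ y ∈ A, ∀ s t : ℝ, 0 ≤ s → 0 ≤ t → s + t = 1 →
      a i (s • x + t • y) = s * a i x + t * a i y) (ε : ℝ)
    (hneg : ∀ x ∈ A, ∃ i, a i x < -ε) :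
    ∃ (T : Finset γ) (w : γ → ℝ), (∀ i, 0 ≤ w i) ∧
      ∀ x ∈ A, ∑ i ∈ T, w i * a i x < - ε * ∑ i ∈ T, w i := by
  classical
  obtain ⟨T, hT⟩ := hA.elim_finite_subcover (fun i => {x | a i x < -ε})
    (fun i => isOpen_lt (hcont i) continuous_const) (fun x hx => by
      obtain ⟨i, hi⟩ := hneg x hx; exact mem_iUnion.2 ⟨i, hi⟩)
  let G : F → (T → ℝ) := fun x i => a i x
  have hGc : IsCompact (G '' A) := hA.image (continuous_pi fun i => hcont i)
  have hGconv : Convex ℝ (G '' A) := by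
    rintro _ ⟨x, hx, rfl⟩ _ ⟨y, hy, rfl⟩ s t hs ht hst
    refine ⟨s • x + t • y, hconv hx hy hs ht hst, ?_⟩
    funext i
    simp [G, haff i x hx y hy s t hs ht hst]
  let Q : Set (T → ℝ) := {v | ∀ i, -ε ≤ v i}
  have hQc : IsClosed Q := by
    have : Q = ⋂ i, {v | -ε ≤ v i} := by ext; simp [Q]
    rw [this]; exact isClosed_iInter fun i => isClosed_le continuous_const (continuous_apply i)
  have hQconv : Convex ℝ Q := by
    intro x hx y hy s t hs ht hst i
    have h1 := mul_le_mul_of_nonneg_left (hx i) hs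
    have h2 := mul_le_mul_of_nonneg_left (hy i) ht
    simp only [Pi.add_apply, Pi.smul_apply, smul_eq_mul]
    have : -ε = s * -ε + t * -ε := by rw [← add_mul, hst, one_mul]
    linarith
  have hdisj : Disjoint (G '' A) Q := by
    rw [disjoint_left]
    rintro _ ⟨x, hx, rfl⟩ hq
    obtain ⟨i, hi, hlt⟩ := mem_iUnion₂.1 (hT hx)
    exact absurd (hq ⟨i, hi⟩) (not_le.2 hlt)
  obtain ⟨f, u, v, h1, h2, h3⟩ := geometric_hahn_banach_compact_closed hGconv hGc hQconv hQc hdisj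
  have hf : ∀ z : T → ℝ, f z = ∑ i, z i * f (Pi.single i 1) := by
    intro z
    conv_lhs => rw [← Finset.univ_sum_single z]
    rw [map_sum]
    refine Finset.sum_congr rfl fun i _ => ?_
    have : (Pi.single i (z i) : T → ℝ) = z i • Pi.single i 1 := by
      rw [← Pi.single_smul]; simp
    rw [this, map_smul, smul_eq_mul]
  have hw : ∀ i, 0 ≤ f (Pi.single i 1) := by
    intro i
    by_contra! hlt
    have hconst := h3 (fun _ => -ε) (fun _ => le_rfl)
    set c := f (fun _ => -ε) with hc
    have hs : 0 ≤ (c - v) / -f (Pi.single i 1) := by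
      apply div_nonneg <;> linarith
    have := h3 ((fun _ => -ε) + ((c - v) / -f (Pi.single i 1)) • Pi.single i 1) (fun j => by
      simp only [Pi.add_apply, Pi.smul_apply, smul_eq_mul]
      have : (0 : ℝ) ≤ (Pi.single i (1 : ℝ) : T → ℝ) j := by
        by_cases h : j = i
        · subst h; simp
        · simp [h]
      nlinarith [mul_nonneg hs this])
    rw [map_add, map_smul, ← hc, smul_eq_mul, div_mul_eq_mul_div, mul_div_assoc,
      div_neg, div_self hlt.ne] at this
    linarith
  refine ⟨T, fun i => if h : i ∈ T then f (Pi.single ⟨i, h⟩ 1) else 0, fun i => ?_, fun x hx => ?_⟩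
  · dsimp only; split_ifs
    · exact hw _
    · exact le_rfl
  · have hh : f (G x) < f (fun _ => -ε) :=
      (h1 _ ⟨x, hx, rfl⟩).trans (h2.trans (h3 _ fun _ => le_rfl))
    rw [hf, hf (fun _ => -ε), ← Finset.mul_sum] at hh
    rw [← Finset.sum_coe_sort T, ← Finset.sum_coe_sort T]
    simp only [Finset.coe_mem, dite_true, Subtype.coe_eta]
    convert hh using 2
    simp only [G]; ring

/-- The excess of a path over the drop of `p` along it, when steps shorter than `τ` receive the
discount `θ`. -/
def pathExcess {X : Type*} [MetricSpace X] (p : X → ℝ) (κ τ : ℝ) (θ : X → ℝ) (x : X)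
    (l : List X) : ℝ :=
  ((pathSteps x l).map fun q => κ * dist q.1 q.2 + |p q.1 - p q.2| - (p q.1 - p q.2) -
    θ q.1 * ((if dist q.1 q.2 < τ then 1 else 0) * |p q.1 - p q.2|)).sum

theorem flat_or_steps {X : Type u} [MetricSpace X] [CompactSpace X] [MeasurableSpace X]
    [BorelSpace X] (μ : Measure X) [IsFiniteMeasure μ] {p : X → ℝ} {C : ℝ≥0}
    (hp : LipschitzWith C p) {κ α ε' : ℝ} (hκ : 0 < κ) (hα : 0 ≤ α) (hε : 0 < ε') (τ : ℝ)
    (L : ℝ≥0) :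
    (∃ θ ∈ Cutoffs μ L α, ∃ f : X → ℝ, (∀ x, p x - ε' ≤ f x ∧ f x ≤ p x) ∧
      ∀ x y, f x ≤ f y + κ * dist x y +
        (1 - θ x * (if dist x y < τ then 1 else 0)) * |p x - p y|) ∨
    ∃ S : StepSystem X, ∑ j, S.b j ≤ C / ε' ∧ ∀ θ ∈ Cutoffs μ L α, ∀ ζ : ℝ → ℝ,
      (∀ d, 0 ≤ ζ d) → (∀ d, ζ d ≤ 1) → (∀ d < τ, ζ d = 1) →
      κ ≤ ∑ i, S.w i * (ζ (dist (S.src i) (S.tgt i)) * θ (S.src i) *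
        (p (S.src i) - p (S.tgt i))) := by
  classical
  by_cases hflat : ∃ θ ∈ Cutoffs μ L α, ∀ x l, -ε' ≤ pathExcess p κ τ θ x l
  · left
    obtain ⟨θ, hθ, hle⟩ := hflat
    have hbdd : ∀ x, BddBelow (range fun l => p x + pathExcess p κ τ θ x l) := fun x =>
      ⟨p x - ε', by rintro _ ⟨l, rfl⟩; have := hle x l; dsimp only; linarith⟩
    refine ⟨θ, hθ, fun x => ⨅ l, p x + pathExcess p κ τ θ x l, fun x => ⟨?_, ?_⟩, fun x y => ?_⟩
    · exact le_ciInf fun l => by have := hle x l; linarith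
    · refine (ciInf_le (hbdd x) []).trans ?_
      simp [pathExcess, pathSteps]
    · rw [add_assoc, ← sub_le_iff_le_add]
      refine le_ciInf fun l => ?_
      have := ciInf_le (hbdd x) (y :: l)
      simp only [pathExcess, pathSteps, List.map_cons, List.sum_cons] at this ⊢
      linarith
  · right
    push Not at hflat
    have hcv : Convex ℝ {θ : BoundedContinuousFunction X ℝ | (θ : X → ℝ) ∈ Cutoffs μ L α} := by
      rintro θ ⟨h1, h2, h3, h4⟩ θ' ⟨h1', h2', h3', h4'⟩ s t hs ht hst
      refine ⟨?_, fun x => ?_, fun x => ?_, ?_⟩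
      · refine LipschitzWith.of_dist_le_mul fun x y => ?_
        have e1 := h1.dist_le_mul x y
        have e2 := h1'.dist_le_mul x y
        rw [Real.dist_eq] at *
        have e3 : (s • θ + t • θ') x - (s • θ + t • θ') y
            = s * (θ x - θ y) + t * (θ' x - θ' y) := by simp; ring
        rw [e3]
        calc |s * (θ x - θ y) + t * (θ' x - θ' y)| ≤ s * |θ x - θ y| + t * |θ' x - θ' y| := by
              refine (abs_add_le _ _).trans ?_
              rw [abs_mul, abs_mul, abs_of_nonneg hs, abs_of_nonneg ht]
          _ ≤ s * (L * dist x y) + t * (L * dist x y) := by gcongr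
          _ = L * dist x y := by rw [← add_mul, hst, one_mul]
      · have := mul_nonneg hs (h2 x); have := mul_nonneg ht (h2' x)
        simp; linarith
      · have := mul_le_mul_of_nonneg_left (h3 x) hs
        have := mul_le_mul_of_nonneg_left (h3' x) ht
        simp; linarith
      · have e : ∀ x, 1 - (s • θ + t • θ') x = s * (1 - θ x) + t * (1 - θ' x) := fun x => by
          have : (1 : ℝ) = s + t := hst.symm
          simp; linear_combination (1 : ℝ) * this
        simp_rw [e]
        have i1 : Integrable (fun x => 1 - θ x) μ := (integrable_const _).sub (θ.integrable μ)
        have i2 : Integrable (fun x => 1 - θ' x) μ := (integrable_const _).sub (θ'.integrable μ)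
        rw [integral_add (i1.const_mul s) (i2.const_mul t), integral_const_mul,
          integral_const_mul]
        have := mul_le_mul_of_nonneg_left h4 hs
        have := mul_le_mul_of_nonneg_left h4' ht
        have : α = s * α + t * α := by rw [← add_mul, hst, one_mul]
        linarith
    have hone : (1 : BoundedContinuousFunction X ℝ) ∈
        {θ : BoundedContinuousFunction X ℝ | (θ : X → ℝ) ∈ Cutoffs μ L α} :=
      ⟨LipschitzWith.of_dist_le_mul fun x y => by simp; positivity, by simp, by simp, by simpa⟩
    have hev : ∀ x : X, Continuous fun θ : BoundedContinuousFunction X ℝ => θ x :=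
      fun x => (continuous_apply x).comp BoundedContinuousFunction.continuous_coe
    obtain ⟨T, w, hw, hTw⟩ := exists_weights_of_finite_cover (isCompact_cutoffs μ L α) hcv
      (fun (γ : X × List X) (θ : BoundedContinuousFunction X ℝ) => pathExcess p κ τ θ γ.1 γ.2)
      (fun γ => by
        unfold pathExcess
        refine continuous_list_sum _ fun q _ => ?_
        exact continuous_const.sub ((hev _).mul continuous_const))
      (fun γ θ _ θ' _ s t _ _ hst => by
        unfold pathExcess
        rw [← List.sum_map_mul_left, ← List.sum_map_mul_left, ← List.sum_map_add]
        congr 1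
        refine List.map_congr_left fun q _ => ?_
        have : t = 1 - s := by linarith
        subst this
        simp only [BoundedContinuousFunction.coe_add, BoundedContinuousFunction.coe_smul,
          Pi.add_apply, smul_eq_mul]
        ring) ε' (fun θ hθ => by
        obtain ⟨x, l, h⟩ := hflat θ hθ
        exact ⟨(x, l), h⟩)
    have hp' : ∀ x y, |p x - p y| ≤ C * dist x y := fun x y => hp.dist_le_mul x y
    let ι := Σ γ : T, Fin (pathSteps γ.1.1 γ.1.2).length
    let stp : ι → X × X := fun i => (pathSteps i.1.1.1 i.1.1.2)[i.2]
    have hsum : ∀ h : X × X → ℝ, ∑ i : ι, w i.1 * h (stp i) =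
        ∑ γ ∈ T, w γ * ((pathSteps γ.1 γ.2).map h).sum := by
      intro h
      rw [← Finset.sum_coe_sort T, Fintype.sum_sigma]
      refine Finset.sum_congr rfl fun γ _ => ?_
      rw [← Fin.sum_univ_fun_getElem, Finset.mul_sum]
      rfl
    set ℓ := ∑ i : ι, w i.1 * dist (stp i).1 (stp i).2 with hℓ
    set W := ∑ γ ∈ T, w γ with hW
    have hW0 : 0 ≤ W := Finset.sum_nonneg fun i _ => hw i
    have hℓ0 : 0 ≤ ℓ := Finset.sum_nonneg fun i _ => mul_nonneg (hw _) dist_nonneg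
    have hexc : ∀ θ : X → ℝ, ∑ γ ∈ T, w γ * pathExcess p κ τ θ γ.1 γ.2 = κ * ℓ -
        ∑ i : ι, w i.1 * (p (stp i).1 - p (stp i).2 - |p (stp i).1 - p (stp i).2| +
          θ (stp i).1 * ((if dist (stp i).1 (stp i).2 < τ then 1 else 0) *
            |p (stp i).1 - p (stp i).2|)) := by
      intro θ
      unfold pathExcess
      rw [← hsum, hℓ, Finset.mul_sum, ← Finset.sum_sub_distrib]
      refine Finset.sum_congr rfl fun i _ => ?_
      ring
    have hkey : ∀ θ ∈ Cutoffs μ L α, κ * ℓ + ε' * W <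
        ∑ i : ι, w i.1 * (p (stp i).1 - p (stp i).2 - |p (stp i).1 - p (stp i).2| +
          θ (stp i).1 * ((if dist (stp i).1 (stp i).2 < τ then 1 else 0) *
            |p (stp i).1 - p (stp i).2|)) := by
      intro θ hθ
      have hcont : Continuous θ := hθ.1.continuous
      have := hTw (BoundedContinuousFunction.mkOfCompact ⟨θ, hcont⟩) hθ
      have e := hexc θ
      change ∑ γ ∈ T, w γ * pathExcess p κ τ θ γ.1 γ.2 < _ at this
      linarith
    have hlen : κ * ℓ + ε' * W < C * ℓ := by
      refine (hkey _ hone).trans_le ?_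
      rw [hℓ, Finset.mul_sum]
      refine Finset.sum_le_sum fun i _ => ?_
      have h1 := hp' (stp i).1 (stp i).2
      have h2 := le_abs_self (p (stp i).1 - p (stp i).2)
      have h3 := abs_nonneg (p (stp i).1 - p (stp i).2)
      rw [mul_left_comm (C : ℝ)]
      refine mul_le_mul_of_nonneg_left ?_ (hw _)
      simp only [BoundedContinuousFunction.coe_one, Pi.one_apply, one_mul]
      split_ifs <;> nlinarith
    have hℓpos : 0 < ℓ := by
      rcases hℓ0.eq_or_lt with h | h
      · rw [← h] at hlen; nlinarith
      · exact h
    refine ⟨⟨ι, inferInstance, fun i => (stp i).1, fun i => (stp i).2, fun i => w i.1 / ℓ,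
      fun i => div_nonneg (hw _) hℓ0, ?_, T, inferInstance, fun γ => γ.1.1,
      fun γ => pathEnd γ.1.1 γ.1.2, fun γ => w γ / ℓ, fun γ => div_nonneg (hw _) hℓ0, fun g => ?_⟩,
      ?_, ?_⟩
    · simp_rw [div_mul_eq_mul_div]
      rw [← Finset.sum_div, ← hℓ, div_self hℓpos.ne']
    · simp_rw [div_mul_eq_mul_div]
      rw [← Finset.sum_div, ← Finset.sum_div, hsum fun q => g q.1 - g q.2,
        ← Finset.sum_coe_sort T]
      simp_rw [sum_pathSteps_sub]
    · dsimp only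
      rw [← Finset.sum_div, Finset.sum_coe_sort T, div_le_div_iff₀ hℓpos hε, ← hW]
      nlinarith
    · intro θ hθ ζ hζ0 hζ1 hζ
      dsimp only
      simp_rw [div_mul_eq_mul_div]
      rw [← Finset.sum_div, le_div_iff₀ hℓpos]
      have h1 := hkey θ hθ
      refine le_trans (by nlinarith) (h1.le.trans (Finset.sum_le_sum fun i _ =>
        mul_le_mul_of_nonneg_left ?_ (hw _)))
      set Δ := p (stp i).1 - p (stp i).2
      set d := dist (stp i).1 (stp i).2
      have h2 := hθ.2.1 (stp i).1
      have h3 := hθ.2.2.1 (stp i).1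
      set t := θ (stp i).1
      by_cases hd : d < τ
      · rw [if_pos hd, hζ d hd]
        have : Δ ≤ |Δ| := le_abs_self _
        nlinarith
      · rw [if_neg hd]
        have h4 : 0 ≤ ζ d * t := mul_nonneg (hζ0 d) h2
        have h5 : ζ d * t ≤ 1 := mul_le_one₀ (hζ1 d) h2 h3
        rcases abs_cases Δ with ⟨e, h⟩ | ⟨e, h⟩ <;> rw [e] <;> nlinarith

lemma exists_limit_measure {Y : Type*} [MetricSpace Y] [CompactSpace Y] [MeasurableSpace Y]
    [BorelSpace Y] {M : ℝ≥0} {ι : ℕ → Type*} [∀ k, Fintype (ι k)] (c : ∀ k, ι k → ℝ)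
    (hc : ∀ k i, 0 ≤ c k i) (hM : ∀ k, ∑ i, c k i ≤ M) (y : ∀ k, ι k → Y) :
    ∃ μ : Measure Y, IsFiniteMeasure μ ∧ ∀ F : Y → ℝ, Continuous F →
      Tendsto (fun k => ∑ i, c k i * F (y k i)) (hyperfilter ℕ) (nhds (∫ z, F z ∂μ)) := by
  let m : ℕ → Measure Y := fun k => ∑ i, ENNReal.ofReal (c k i) • Measure.dirac (y k i)
  have hfin : ∀ k, IsFiniteMeasure (m k) := fun k => by
    refine ⟨?_⟩
    simp only [m, Measure.coe_finsetSum, Finset.sum_apply, Measure.smul_apply]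
    refine ENNReal.sum_lt_top.2 fun i _ => ?_
    simp
  let f : ℕ → FiniteMeasure Y := fun k => ⟨m k, hfin k⟩
  have hmass : ∀ k, (f k).mass ≤ M := fun k => by
    have : m k univ ≤ M := by
      simp only [m, Measure.coe_finsetSum, Finset.sum_apply, Measure.smul_apply, measure_univ,
        smul_eq_mul, mul_one]
      rw [← ENNReal.ofReal_sum_of_nonneg fun i _ => hc k i]
      exact ENNReal.ofReal_le_of_le_toReal (by simpa using hM k)
    rw [← ENNReal.coe_le_coe, FiniteMeasure.ennreal_mass]
    exact this
  have hint : ∀ k, ∀ F : BoundedContinuousFunction Y ℝ,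
      ∫ z, F z ∂(f k : Measure Y) = ∑ i, c k i * F (y k i) := fun k F => by
    change ∫ z, F z ∂(m k) = _
    rw [integral_finsetSum_measure fun i _ => (F.integrable _).smul_measure (by simp)]
    refine Finset.sum_congr rfl fun i _ => ?_
    rw [integral_smul_measure, integral_dirac, ENNReal.toReal_ofReal (hc k i), smul_eq_mul]
  obtain ⟨μ, -, hμ⟩ := (isCompact_setOfPred_finiteMeasure_le_of_compactSpace Y M).ultrafilter_le_nhds
    ((hyperfilter ℕ).map f) (by
      simp only [Ultrafilter.coe_map, le_principal_iff, mem_map]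
      exact univ_mem' hmass)
  refine ⟨μ, inferInstance, fun F hF => ?_⟩
  have h := (FiniteMeasure.tendsto_iff_forall_integral_tendsto.1
    (show Tendsto f (hyperfilter ℕ) (nhds μ) from hμ)) (BoundedContinuousFunction.mkOfCompact ⟨F, hF⟩)
  simp only [hint] at h
  exact h

/-- A bound for a functional of a Lipschitz function and a test function, expressing that the
functional is approximately a divergence. -/
def LocalFlow {X E : Type*} [MetricSpace X] [MeasurableSpace X] [NormedAddCommGroup E]
    [NormedSpace ℝ E] (ψ : X → E) (T : (X → ℝ) → (E → ℝ) → ℝ) : Prop :=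
  ∃ ρ : Measure X, IsFiniteMeasure ρ ∧ ∀ ε : ℝ, 0 < ε → ∃ σ ν : Measure X, IsFiniteMeasure σ ∧
    IsFiniteMeasure ν ∧ σ.real univ ≤ ε ∧ ∀ (K : ℝ≥0) (V : X → ℝ), LipschitzWith K V →
      (∀ x, 0 ≤ V x) → (∀ x, V x ≤ 1) → ∀ χ : E → ℝ, ContDiff ℝ 1 χ → ∀ D : E → ℝ, Continuous D →
        (∀ z, 0 ≤ D z) → (∀ y z, |χ y - χ z| ≤ ‖y - z‖ * (D y + D z)) →
          |T V χ| ≤ ∫ x, D (ψ x) ∂σ + K * ∫ x, |χ (ψ x)| ∂ρ + ∫ x, |χ (ψ x)| ∂ν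

/-- A continuous cutoff of the interval `[0, t]`. -/
def cut (t d : ℝ) : ℝ := min 1 (max 0 (2 - d / t))

lemma cut_nonneg (t d : ℝ) : 0 ≤ cut t d := le_min zero_le_one (le_max_left _ _)

lemma cut_le_one (t d : ℝ) : cut t d ≤ 1 := min_le_left _ _

lemma continuous_cut (t : ℝ) : Continuous (cut t) := by unfold cut; fun_prop

lemma cut_eq_one {t d : ℝ} (ht : 0 < t) (h : d ≤ t) : cut t d = 1 := by
  have : d / t ≤ 1 := (div_le_one ht).2 h
  rw [cut, min_eq_left]; exact le_max_of_le_right (by linarith)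

lemma cut_eq_zero {t d : ℝ} (ht : 0 < t) (h : 2 * t ≤ d) : cut t d = 0 := by
  have : 2 ≤ d / t := (le_div_iff₀ ht).2 h
  rw [cut, max_eq_left (by linarith)]; simp

lemma one_sub_cut_le {t d : ℝ} (ht : 0 < t) (h : 0 ≤ d) : 1 - cut t d ≤ d / t := by
  have h0 : 0 ≤ d / t := by positivity
  rcases le_total (d / t) 1 with h1 | h1
  · rw [cut_eq_one ht ((div_le_one ht).1 h1)]; simpa
  · linarith [cut_nonneg t d]

lemma cut_mono {s t d : ℝ} (hs : 0 < s) (hst : s ≤ t) (hd : 0 ≤ d) : cut s d ≤ cut t d := by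
  unfold cut
  have : d / t ≤ d / s := by gcongr
  gcongr

lemma tendsto_integral_cut {Y : Type*} [MetricSpace Y] [CompactSpace Y] [MeasurableSpace Y]
    [BorelSpace Y] (μ : Measure Y) [IsFiniteMeasure μ] {d F : Y → ℝ} (hd : Continuous d)
    (hd0 : ∀ y, 0 ≤ d y) (hF : Continuous F) :
    Tendsto (fun n : ℕ => ∫ y, cut (1 / (n + 1)) (d y) * F y ∂μ) atTop
      (nhds (∫ y in {y | d y = 0}, F y ∂μ)) := by
  have hm : MeasurableSet {y | d y = 0} := (isClosed_eq hd continuous_const).measurableSet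
  rw [← integral_indicator hm]
  obtain ⟨M, hM⟩ := (isCompact_univ (X := Y)).exists_bound_of_continuousOn hF.continuousOn
  refine tendsto_integral_of_dominated_convergence (fun _ => M)
    (fun n => (((continuous_cut _).comp hd).mul hF).aestronglyMeasurable)
    (integrable_const _) (fun n => ae_of_all _ fun y => ?_) (ae_of_all _ fun y => ?_)
  · rw [norm_mul, Real.norm_eq_abs, abs_of_nonneg (cut_nonneg _ _)]
    exact (mul_le_of_le_one_left (norm_nonneg _) (cut_le_one _ _)).trans (hM y trivial)
  · by_cases hy : d y = 0
    · rw [indicator_of_mem (by exact hy)]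
      refine tendsto_const_nhds.congr fun n => ?_
      rw [cut_eq_one (by positivity) (by rw [hy]; positivity), one_mul]
    · rw [indicator_of_notMem (by exact hy)]
      have hpos : 0 < d y := (hd0 y).lt_of_ne' hy
      have h2 : Tendsto (fun n : ℕ => 2 * (1 / ((n : ℝ) + 1))) atTop (nhds (2 * 0)) :=
        tendsto_one_div_add_atTop_nhds_zero_nat.const_mul 2
      rw [mul_zero] at h2
      refine tendsto_const_nhds.congr' ?_
      filter_upwards [h2.eventually (gt_mem_nhds hpos)] with n hn
      rw [cut_eq_zero (by positivity) hn.le, zero_mul]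

lemma exists_uniform_taylor {E : Type*} [NormedAddCommGroup E] [NormedSpace ℝ E]
    [FiniteDimensional ℝ E] {χ : E → ℝ} (hχ : ContDiff ℝ 1 χ) (R : ℝ) {η : ℝ} (hη : 0 < η) :
    ∃ δ > 0, ∀ y ∈ closedBall (0 : E) R, ∀ z ∈ closedBall (0 : E) R, ‖y - z‖ < δ →
      |χ y - χ z - fderiv ℝ χ y (y - z)| ≤ η * ‖y - z‖ := by
  have hc : Continuous (fderiv ℝ χ) := hχ.continuous_fderiv one_ne_zero
  have hu := (isCompact_closedBall (0 : E) R).uniformContinuousOn_of_continuous hc.continuousOn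
  rw [Metric.uniformContinuousOn_iff] at hu
  obtain ⟨δ, hδ, h⟩ := hu η hη
  refine ⟨δ, hδ, fun y hy z hz hyz => ?_⟩
  have := ((convex_closedBall (0 : E) R).inter (convex_ball y δ)).norm_image_sub_le_of_norm_fderiv_le'
    (𝕜 := ℝ) (f := χ) (φ := fderiv ℝ χ y) (C := η)
    (fun x _ => (hχ.differentiable one_ne_zero) x)
    (fun x hx => by rw [← dist_eq_norm]; exact (h x hx.1 y hy hx.2).le)
    ⟨hz, by rw [mem_ball, dist_comm, dist_eq_norm]; exact hyz⟩ ⟨hy, mem_ball_self hδ⟩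
  simpa using this

/-- The direction of the step from `x` to `y`. -/
def stepDir {X E : Type*} [MetricSpace X] [NormedAddCommGroup E] [NormedSpace ℝ E] (ψ : X → E)
    (x y : X) : E := (dist x y)⁻¹ • (ψ x - ψ y)

lemma dist_smul_stepDir {X E : Type*} [MetricSpace X] [NormedAddCommGroup E] [NormedSpace ℝ E]
    (ψ : X → E) (x y : X) : dist x y • stepDir ψ x y = ψ x - ψ y := by
  rcases eq_or_ne x y with rfl | h
  · simp [stepDir]
  · rw [stepDir, smul_inv_smul₀ (dist_pos.2 h).ne']

lemma norm_stepDir_le {X E : Type*} [MetricSpace X] [NormedAddCommGroup E] [NormedSpace ℝ E]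
    {ψ : X → E} {C : ℝ≥0} (hψ : LipschitzWith C ψ) (x y : X) : ‖stepDir ψ x y‖ ≤ C := by
  rcases eq_or_ne x y with rfl | h
  · simp [stepDir]
  · have hd := dist_pos.2 h
    rw [stepDir, norm_smul, norm_inv, Real.norm_eq_abs, abs_of_pos hd, inv_mul_le_iff₀ hd,
      ← dist_eq_norm, mul_comm]
    exact hψ.dist_le_mul x y

/-- The basic inequality for a finite system of steps. -/
lemma StepSystem.abs_sum_le {X : Type*} [MetricSpace X] (S : StepSystem X) {K : ℝ≥0} {V : X → ℝ}
    (hV : LipschitzWith K V) (hV0 : ∀ x, 0 ≤ V x) (hV1 : ∀ x, V x ≤ 1) (g : X → ℝ) :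
    |∑ i, S.w i * (V (S.src i) * (g (S.src i) - g (S.tgt i)))| ≤
      K * ∑ i, S.w i * dist (S.src i) (S.tgt i) * |g (S.tgt i)| +
        (∑ j, S.b j * |g (S.s j)| + ∑ j, S.b j * |g (S.t j)|) := by
  have hb := S.boundary fun x => V x * g x
  have e : ∑ i, S.w i * (V (S.src i) * (g (S.src i) - g (S.tgt i))) =
      ∑ j, S.b j * (V (S.s j) * g (S.s j) - V (S.t j) * g (S.t j)) -
        ∑ i, S.w i * ((V (S.src i) - V (S.tgt i)) * g (S.tgt i)) := by
    rw [← hb, ← Finset.sum_sub_distrib]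
    exact Finset.sum_congr rfl fun i _ => by ring
  have hg : ∀ x, |V x * g x| ≤ |g x| := fun x => by
    rw [abs_mul, abs_of_nonneg (hV0 x)]
    exact mul_le_of_le_one_left (abs_nonneg _) (hV1 x)
  rw [e, ← Finset.sum_add_distrib, Finset.mul_sum, add_comm]
  refine (abs_sub _ _).trans (add_le_add ?_ ?_)
  · refine (Finset.abs_sum_le_sum_abs _ _).trans (Finset.sum_le_sum fun j _ => ?_)
    rw [abs_mul, abs_of_nonneg (S.b_nonneg j), ← mul_add]
    exact mul_le_mul_of_nonneg_left ((abs_sub _ _).trans (add_le_add (hg _) (hg _)))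
      (S.b_nonneg j)
  · refine (Finset.abs_sum_le_sum_abs _ _).trans (Finset.sum_le_sum fun i _ => ?_)
    rw [abs_mul, abs_mul, abs_of_nonneg (S.w_nonneg i)]
    have := hV.dist_le_mul (S.src i) (S.tgt i)
    rw [Real.dist_eq] at this
    calc S.w i * (|V (S.src i) - V (S.tgt i)| * |g (S.tgt i)|)
        ≤ S.w i * (K * dist (S.src i) (S.tgt i) * |g (S.tgt i)|) := by
          gcongr; exact S.w_nonneg i
      _ = _ := by ring

theorem exists_flow_of_steps {X : Type u} [MetricSpace X] [CompactSpace X] [MeasurableSpace X]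
    [BorelSpace X] {E : Type*} [NormedAddCommGroup E] [InnerProductSpace ℝ E]
    [FiniteDimensional ℝ E] [MeasurableSpace E] [BorelSpace E] (μ : Measure X) {ψ : X → E}
    {C : ℝ≥0} (hψ : LipschitzWith C ψ) (e : E) {κ α : ℝ} (M : ℝ≥0)
    (h : ∀ k : ℕ, ∃ S : StepSystem X, ∑ j, S.b j ≤ M ∧ ∀ θ ∈ Cutoffs μ k α, ∀ ζ : ℝ → ℝ,
      (∀ d, 0 ≤ ζ d) → (∀ d, ζ d ≤ 1) → (∀ d < 1 / ((k : ℝ) + 1), ζ d = 1) →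
      κ ≤ ∑ i, S.w i * (ζ (dist (S.src i) (S.tgt i)) * θ (S.src i) *
        (inner ℝ e (ψ (S.src i)) - inner ℝ e (ψ (S.tgt i))))) :
    ∃ Λ : Measure (X × E), IsFiniteMeasure Λ ∧ Λ.real univ ≤ 1 ∧ (∀ᵐ q ∂Λ, ‖q.2‖ ≤ C) ∧
      (∀ (L : ℝ≥0), ∀ θ ∈ Cutoffs μ L α, κ ≤ ∫ q, θ q.1 * inner ℝ e q.2 ∂Λ) ∧
      LocalFlow ψ fun V χ => ∫ q, V q.1 * fderiv ℝ χ (ψ q.1) q.2 ∂Λ := by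
  choose S hSM hS using h
  have : CompactSpace (closedBall (0 : E) C) :=
    isCompact_iff_compactSpace.1 (isCompact_closedBall _ _)
  let c : ∀ k, (S k).ι → ℝ := fun k i => (S k).w i * dist ((S k).src i) ((S k).tgt i)
  let pt : ∀ k, (S k).ι → X × X × closedBall (0 : E) C := fun k i => ((S k).src i, (S k).tgt i,
    ⟨stepDir ψ ((S k).src i) ((S k).tgt i), by simpa using norm_stepDir_le hψ _ _⟩)
  have hc : ∀ k i, 0 ≤ c k i := fun k i => mul_nonneg ((S k).w_nonneg i) dist_nonneg
  obtain ⟨P, hPf, hP⟩ := exists_limit_measure (M := 1) c hc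
    (fun k => by simpa [c] using (S k).length_one.le) pt
  obtain ⟨νs, hνsf, hνs⟩ := exists_limit_measure (fun k => (S k).b) (fun k => (S k).b_nonneg) hSM
    (fun k => (S k).s)
  obtain ⟨νt, hνtf, hνt⟩ := exists_limit_measure (fun k => (S k).b) (fun k => (S k).b_nonneg) hSM
    (fun k => (S k).t)
  have hψc := hψ.continuous
  let dd : X × X × closedBall (0 : E) C → ℝ := fun y => dist y.1 y.2.1
  have hdd : Continuous dd := by fun_prop
  have hdd0 : ∀ y, 0 ≤ dd y := fun y => dist_nonneg
  let pr : X × X × closedBall (0 : E) C → X × E := fun y => (y.1, y.2.2)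
  have hpr : Continuous pr := by fun_prop
  let Z : Set (X × X × closedBall (0 : E) C) := {y | dd y = 0}
  have hZ : MeasurableSet Z := (isClosed_eq hdd continuous_const).measurableSet
  have hΛint : ∀ F : X × E → ℝ, Continuous F →
      ∫ q, F q ∂((P.restrict Z).map pr) = ∫ y in Z, F (pr y) ∂P := fun F hF =>
    integral_map hpr.aemeasurable hF.aestronglyMeasurable
  have hcut0 : Tendsto (fun n : ℕ => 1 / ((n : ℝ) + 1)) atTop (nhds 0) :=
    tendsto_one_div_add_atTop_nhds_zero_nat
  have hint : ∀ F : X × X × closedBall (0 : E) C → ℝ, Continuous F → Integrable F P := fun F hF =>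
    (BoundedContinuousFunction.mkOfCompact ⟨F, hF⟩).integrable P
  refine ⟨(P.restrict Z).map pr, inferInstance, ?_, ?_, fun L θ hθ => ?_, ?_⟩
  · rw [map_measureReal_apply hpr.measurable MeasurableSet.univ, preimage_univ,
      measureReal_restrict_apply_univ]
    refine (measureReal_mono (subset_univ Z)).trans ?_
    have h1 := hP (fun _ => 1) continuous_const
    simp only [integral_const, smul_eq_mul, mul_one] at h1
    exact le_of_tendsto' h1 fun k => (S k).length_one.le
  · rw [ae_map_iff hpr.aemeasurable
      (isClosed_le (by fun_prop) continuous_const).measurableSet]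
    exact ae_of_all _ fun y => mem_closedBall_zero_iff.1 y.2.2.2
  · have hθc := hθ.1.continuous
    rw [hΛint _ (by fun_prop)]
    refine ge_of_tendsto (tendsto_integral_cut P hdd hdd0
      (F := fun y => θ y.1 * inner ℝ e (y.2.2 : E)) (by fun_prop))
      (Eventually.of_forall fun n => ?_)
    refine ge_of_tendsto (hP _ (((continuous_cut _).comp hdd).mul (by fun_prop))) ?_
    obtain ⟨k0, hk0⟩ := exists_nat_ge (L : ℝ)
    have hev : ∀ᶠ k in (hyperfilter ℕ : Filter ℕ), max k0 n ≤ k :=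
      (Nat.hyperfilter_le_atTop) (eventually_ge_atTop _)
    filter_upwards [hev] with k hk
    refine (hS k θ ⟨hθ.1.weaken ?_, hθ.2⟩ (cut (1 / (n + 1))) (cut_nonneg _) (cut_le_one _)
      fun d hd => cut_eq_one (by positivity) (hd.le.trans ?_)).trans_eq
        (Finset.sum_congr rfl fun i _ => ?_)
    · rw [← NNReal.coe_le_coe]
      exact hk0.trans (by exact_mod_cast (le_max_left _ _).trans hk)
    · have : (n : ℝ) ≤ k := by exact_mod_cast (le_max_right _ _).trans hk
      gcongr
    · rw [← inner_sub_right, ← dist_smul_stepDir, inner_smul_right]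
      simp only [c, pt, dd]
      ring
  · refine ⟨P.map fun y => y.2.1, inferInstance, fun ε hε => ?_⟩
    obtain ⟨n0, hn0⟩ : ∃ n : ℕ, ∫ y, cut (1 / (n + 1)) (dd y) * 1 ∂P <
        P.real Z + ε / (2 * C + 1) := by
      have := tendsto_integral_cut P hdd hdd0 (F := fun _ => 1) continuous_const
      simp only [setIntegral_const, smul_eq_mul, mul_one] at this
      simp only [mul_one]
      exact (this.eventually (gt_mem_nhds (lt_add_of_pos_right _ (by positivity)))).exists
    set t : ℝ := 1 / (n0 + 1) with ht
    have htpos : 0 < t := by positivity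
    let A : Set (X × X × closedBall (0 : E) C) := {y | dd y ≤ t} \ Z
    have hA : MeasurableSet A := (isClosed_le hdd continuous_const).measurableSet.diff hZ
    have hAle : P.real A ≤ ε / (2 * C + 1) := by
      have h1 : P.real {y | dd y ≤ t} ≤ ∫ y, cut t (dd y) * 1 ∂P := by
        rw [← integral_indicator_one (isClosed_le hdd continuous_const).measurableSet]
        refine integral_mono ((integrable_const _).indicator
          (isClosed_le hdd continuous_const).measurableSet)
          (hint _ (((continuous_cut _).comp hdd).mul continuous_const)) fun y => ?_
        by_cases hy : dd y ≤ t
        · rw [indicator_of_mem (by exact hy)]; simp [cut_eq_one htpos hy]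
        · rw [indicator_of_notMem (by exact hy)]; simpa using cut_nonneg _ _
      have h2 : P.real A = P.real {y | dd y ≤ t} - P.real Z :=
        measureReal_sdiff (fun y (hy : dd y = 0) => by
          change dd y ≤ t; rw [hy]; exact htpos.le) hZ
      linarith
    set s := t / 2 with hs
    have hspos : 0 < s := by positivity
    refine ⟨C • ((P.restrict A).map (fun y => y.1) + (P.restrict A).map fun y => y.2.1),
      νs + νt + (s⁻¹).toNNReal • (P.map (fun y => y.1) + P.map fun y => y.2.1),
      inferInstance, inferInstance, ?_, ?_⟩
    · rw [measureReal_nnreal_smul_apply, measureReal_add_apply,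
        map_measureReal_apply (by fun_prop) MeasurableSet.univ,
        map_measureReal_apply (by fun_prop) MeasurableSet.univ, preimage_univ, preimage_univ,
        measureReal_restrict_apply_univ]
      calc (C : ℝ) * (P.real A + P.real A) ≤ C * (ε / (2 * C + 1) + ε / (2 * C + 1)) := by gcongr
        _ = (2 * C) / (2 * C + 1) * ε := by ring
        _ ≤ 1 * ε := by
          gcongr
          rw [div_le_one (by positivity)]; linarith
        _ = ε := one_mul _
    intro K V hV hV0 hV1 χ hχ D hD hD0 hχD
    have hχc := hχ.continuous
    have hVc := hV.continuous
    have hχ' : Continuous (fderiv ℝ χ) := hχ.continuous_fderiv one_ne_zero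
    let a : X × X × closedBall (0 : E) C → ℝ := fun y => |χ (ψ y.1)|
    let b : X × X × closedBall (0 : E) C → ℝ := fun y => |χ (ψ y.2.1)|
    let G : X × X × closedBall (0 : E) C → ℝ := fun y => C * (D (ψ y.1) + D (ψ y.2.1))
    let F : X × X × closedBall (0 : E) C → ℝ := fun y => V y.1 * fderiv ℝ χ (ψ y.1) y.2.2
    have ha : Continuous a := by fun_prop
    have hb : Continuous b := by fun_prop
    have hG : Continuous G := by fun_prop
    have hF : Continuous F := by fun_prop
    have hG0 : ∀ y, 0 ≤ G y := fun y => mul_nonneg C.2 (add_nonneg (hD0 _) (hD0 _))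
    have hD1 : ∀ (ν : Measure X) [IsFiniteMeasure ν] (g : X → ℝ), Continuous g → Integrable g ν :=
      fun ν _ g hg => (BoundedContinuousFunction.mkOfCompact ⟨g, hg⟩).integrable ν
    change |∫ q, V q.1 * fderiv ℝ χ (ψ q.1) q.2 ∂((P.restrict Z).map pr)| ≤ _
    rw [hΛint _ (by fun_prop)]
    change |∫ y in Z, F y ∂P| ≤ _
    have eσ : ∫ x, D (ψ x) ∂(C • ((P.restrict A).map (fun y => y.1) +
        (P.restrict A).map fun y => y.2.1)) = ∫ y in A, G y ∂P := by
      rw [integral_smul_nnreal_measure, integral_add_measure (hD1 _ _ (by fun_prop))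
        (hD1 _ _ (by fun_prop)), integral_map (by fun_prop) (by fun_prop),
        integral_map (by fun_prop) (by fun_prop), ← integral_add
        (hint _ (by fun_prop)).integrableOn (hint _ (by fun_prop)).integrableOn]
      exact (integral_const_mul _ _).symm
    have eρ : ∫ x, |χ (ψ x)| ∂(P.map fun y => y.2.1) = ∫ y, b y ∂P :=
      integral_map (by fun_prop) (by fun_prop)
    have eν : ∫ x, |χ (ψ x)| ∂(νs + νt + (s⁻¹).toNNReal • (P.map (fun y => y.1) +
        P.map fun y => y.2.1)) = ∫ x, |χ (ψ x)| ∂νs + ∫ x, |χ (ψ x)| ∂νt +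
          s⁻¹ * (∫ y, a y ∂P + ∫ y, b y ∂P) := by
      rw [integral_add_measure (hD1 _ _ (by fun_prop)) (hD1 _ _ (by fun_prop)),
        integral_add_measure (hD1 _ _ (by fun_prop)) (hD1 _ _ (by fun_prop)),
        integral_smul_nnreal_measure,
        integral_add_measure (hD1 _ _ (by fun_prop)) (hD1 _ _ (by fun_prop)), eρ,
        integral_map (by fun_prop) (by fun_prop)]
      rw [NNReal.smul_def, Real.coe_toNNReal _ (by positivity), smul_eq_mul]
    rw [eσ, eρ, eν]
    obtain ⟨R, hR⟩ := (isCompact_univ (X := X)).exists_bound_of_continuousOn hψc.continuousOn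
    have hη : ∀ η > 0, |∫ y in Z, F y ∂P| ≤ (∫ y in A, G y ∂P + K * ∫ y, b y ∂P +
        (∫ x, |χ (ψ x)| ∂νs + ∫ x, |χ (ψ x)| ∂νt + s⁻¹ * (∫ y, a y ∂P + ∫ y, b y ∂P))) +
          η * C * P.real univ := by
      intro η hη
      obtain ⟨δ, hδ, hT⟩ := exists_uniform_taylor hχ R hη
      have hGc : Continuous fun y => cut s (dd y) * G y := ((continuous_cut _).comp hdd).mul hG
      have lim1 := (tendsto_integral_cut P hdd hdd0 hF).abs
      have lim2 := (((tendsto_integral_cut P hdd hdd0 hG).const_sub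
        (∫ y, cut s (dd y) * G y ∂P)).add_const (K * ∫ y, b y ∂P +
        (∫ x, |χ (ψ x)| ∂νs + ∫ x, |χ (ψ x)| ∂νt + s⁻¹ * (∫ y, a y ∂P + ∫ y, b y ∂P)))).add_const
          (η * C * P.real univ)
      refine (le_of_tendsto_of_tendsto lim1 lim2 ?_).trans ?_
      swap
      · have : ∫ y, cut s (dd y) * G y ∂P ≤ ∫ y in A, G y ∂P + ∫ y in Z, G y ∂P := by
          rw [← integral_indicator hA, ← integral_indicator hZ, ← integral_add
            ((hint _ hG).indicator hA) ((hint _ hG).indicator hZ)]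
          refine integral_mono (hint _ hGc) (((hint _ hG).indicator hA).add
            ((hint _ hG).indicator hZ)) fun y => ?_
          dsimp only
          by_cases hy : y ∈ Z
          · rw [indicator_of_notMem (fun h => h.2 hy), indicator_of_mem hy, zero_add]
            exact mul_le_of_le_one_left (hG0 y) (cut_le_one _ _)
          · rw [indicator_of_notMem hy, add_zero]
            by_cases hyA : dd y ≤ t
            · rw [indicator_of_mem (show y ∈ A from ⟨hyA, hy⟩)]
              exact mul_le_of_le_one_left (hG0 y) (cut_le_one _ _)
            · rw [cut_eq_zero hspos (by rw [hs]; linarith), zero_mul]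
              exact indicator_nonneg (fun _ _ => hG0 _) _
        linarith
      have hsmall : ∀ᶠ n : ℕ in atTop, 2 * (1 / ((n : ℝ) + 1)) * (C + 1) < min δ s := by
        have h2 : Tendsto (fun n : ℕ => 2 * (1 / ((n : ℝ) + 1)) * (C + 1)) atTop
            (nhds (2 * 0 * (C + 1))) := (hcut0.const_mul 2).mul_const _
        rw [mul_zero, zero_mul] at h2
        exact h2.eventually (gt_mem_nhds (lt_min hδ hspos))
      filter_upwards [hsmall] with n hn
      set t' : ℝ := 1 / (n + 1) with ht'
      have ht'pos : 0 < t' := by positivity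
      have hnδ : 2 * t' * (C + 1) < δ := hn.trans_le (min_le_left _ _)
      have ht's : t' ≤ s := by
        have h3 := hn.trans_le (min_le_right δ s)
        have : (0 : ℝ) ≤ C := C.2
        nlinarith
      have cF : Continuous fun y => cut t' (dd y) * F y := ((continuous_cut _).comp hdd).mul hF
      have cG : Continuous fun y => cut t' (dd y) * G y := ((continuous_cut _).comp hdd).mul hG
      have L1 := (hP _ cF).abs
      have L2 := (((((hP _ hGc).sub (hP _ cG)).add
        (((hP _ hb).const_mul (K : ℝ)).add (((hνs (fun x => |χ (ψ x)|) (by fun_prop)).add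
        (hνt (fun x => |χ (ψ x)|) (by fun_prop))).add
        (((hP _ ha).add (hP _ hb)).const_mul s⁻¹))))).add
        (hP (fun _ => η * C) continuous_const))
      rw [integral_const, smul_eq_mul] at L2
      rw [mul_comm (η * (C : ℝ))]
      refine le_of_tendsto_of_tendsto' L1 L2 fun k => ?_
      have hbd := (S k).abs_sum_le hV hV0 hV1 fun x => χ (ψ x)
      have hdiff : ∑ i, c k i * (cut t' (dd (pt k i)) * F (pt k i)) =
          ∑ i, (S k).w i * (V ((S k).src i) * (χ (ψ ((S k).src i)) - χ (ψ ((S k).tgt i)))) -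
          ∑ i, ((S k).w i * (V ((S k).src i) * (χ (ψ ((S k).src i)) - χ (ψ ((S k).tgt i)))) -
            c k i * (cut t' (dd (pt k i)) * F (pt k i))) := by
        rw [Finset.sum_sub_distrib]; ring
      have hpt : ∀ i, |(S k).w i * (V ((S k).src i) * (χ (ψ ((S k).src i)) -
          χ (ψ ((S k).tgt i)))) - c k i * (cut t' (dd (pt k i)) * F (pt k i))| ≤
          c k i * (cut s (dd (pt k i)) * G (pt k i)) - c k i * (cut t' (dd (pt k i)) * G (pt k i)) +
          s⁻¹ * (c k i * a (pt k i) + c k i * b (pt k i)) + c k i * (η * C) := by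
        intro i
        set x := (S k).src i
        set y := (S k).tgt i
        set Δ := ψ x - ψ y with hΔ
        have hd : dd (pt k i) = dist x y := rfl
        have hd0' : 0 ≤ dist x y := dist_nonneg
        have hw := (S k).w_nonneg i
        have hΔn : ‖Δ‖ ≤ C * dist x y := by
          rw [hΔ, ← dist_eq_norm]; exact hψ.dist_le_mul x y
        have e1 : c k i * (cut t' (dd (pt k i)) * F (pt k i)) =
            (S k).w i * (V x * (cut t' (dist x y) * fderiv ℝ χ (ψ x) Δ)) := by
          rw [hΔ, ← dist_smul_stepDir, map_smul, smul_eq_mul]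
          simp only [c, F, pt, hd]
          ring
        have b1 : cut t' (dist x y) * |χ (ψ x) - χ (ψ y) - fderiv ℝ χ (ψ x) Δ| ≤
            η * (C * dist x y) := by
          by_cases h2 : 2 * t' ≤ dist x y
          · rw [cut_eq_zero ht'pos h2, zero_mul]; positivity
          · push Not at h2
            have hlt : ‖Δ‖ < δ := by
              have : (0 : ℝ) ≤ C := C.2
              nlinarith
            have := hT (ψ x) (by simpa using hR x trivial) (ψ y) (by simpa using hR y trivial) hlt
            calc _ ≤ 1 * (η * ‖Δ‖) := by
                  gcongr
                  exact cut_le_one _ _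
              _ ≤ _ := by rw [one_mul]; gcongr
        have b2 : |χ (ψ x) - χ (ψ y)| ≤ dist x y * (C * (D (ψ x) + D (ψ y))) := by
          refine (hχD _ _).trans ?_
          have := add_nonneg (hD0 (ψ x)) (hD0 (ψ y))
          calc _ ≤ C * dist x y * (D (ψ x) + D (ψ y)) := by gcongr
            _ = _ := by ring
        have b3 := cut_mono ht'pos ht's hd0'
        have b4 := one_sub_cut_le hspos hd0'
        have b5 : |χ (ψ x) - χ (ψ y)| ≤ |χ (ψ x)| + |χ (ψ y)| := abs_sub _ _
        have e2 : (S k).w i * (V x * (χ (ψ x) - χ (ψ y))) -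
            (S k).w i * (V x * (cut t' (dist x y) * fderiv ℝ χ (ψ x) Δ)) = (S k).w i * V x *
            (cut t' (dist x y) * (χ (ψ x) - χ (ψ y) - fderiv ℝ χ (ψ x) Δ) +
              ((cut s (dist x y) - cut t' (dist x y)) * (χ (ψ x) - χ (ψ y)) +
                (1 - cut s (dist x y)) * (χ (ψ x) - χ (ψ y)))) := by ring
        rw [e1, e2, abs_mul, abs_mul, abs_of_nonneg hw, abs_of_nonneg (hV0 x)]
        have b6 : |cut t' (dist x y) * (χ (ψ x) - χ (ψ y) - fderiv ℝ χ (ψ x) Δ) +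
              ((cut s (dist x y) - cut t' (dist x y)) * (χ (ψ x) - χ (ψ y)) +
                (1 - cut s (dist x y)) * (χ (ψ x) - χ (ψ y)))| ≤ η * (C * dist x y) +
            ((cut s (dist x y) - cut t' (dist x y)) * (dist x y * (C * (D (ψ x) + D (ψ y)))) +
              dist x y / s * (|χ (ψ x)| + |χ (ψ y)|)) := by
          refine (abs_add_le _ _).trans (add_le_add ?_ ((abs_add_le _ _).trans (add_le_add ?_ ?_)))
          · rw [abs_mul, abs_of_nonneg (cut_nonneg _ _)]; exact b1
          · rw [abs_mul, abs_of_nonneg (sub_nonneg.2 b3)]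
            exact mul_le_mul_of_nonneg_left b2 (sub_nonneg.2 b3)
          · rw [abs_mul, abs_of_nonneg (sub_nonneg.2 (cut_le_one _ _))]
            exact mul_le_mul b4 b5 (abs_nonneg _) (by positivity)
        calc _ ≤ (S k).w i * 1 * (η * (C * dist x y) +
            ((cut s (dist x y) - cut t' (dist x y)) * (dist x y * (C * (D (ψ x) + D (ψ y)))) +
              dist x y / s * (|χ (ψ x)| + |χ (ψ y)|))) := by
              gcongr
              exact hV1 x
          _ = _ := by
              simp only [c, a, b, G, pt, hd]
              ring
      rw [hdiff]
      refine (abs_sub _ _).trans ((add_le_add hbd ((Finset.abs_sum_le_sum_abs _ _).trans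
        (Finset.sum_le_sum fun i _ => hpt i))).trans_eq ?_)
      simp only [Finset.sum_add_distrib, Finset.sum_sub_distrib, ← Finset.mul_sum]
      simp only [c, a, b, pt]
      ring
    refine le_of_forall_pos_le_add fun η' hη' => ?_
    have hpos : 0 < C * P.real univ + 1 := by positivity
    refine (hη (η' / (C * P.real univ + 1)) (by positivity)).trans ?_
    gcongr
    rw [mul_assoc, div_mul_eq_mul_div, div_le_iff₀ hpos]
    nlinarith

/-- A vector-valued marginal of a measure with bounded fibres has a density with respect to a
finite measure, outside a null set. -/
lemma exists_vector_density {X : Type*} [MetricSpace X] [CompactSpace X] [MeasurableSpace X]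
    [BorelSpace X] {E : Type*} [NormedAddCommGroup E] [InnerProductSpace ℝ E]
    [FiniteDimensional ℝ E] [MeasurableSpace E] [BorelSpace E] (Λ : Measure (X × E))
    [IsFiniteMeasure Λ] {C : ℝ} (hC : 0 ≤ C) (hΛ : ∀ᵐ q ∂Λ, ‖q.2‖ ≤ C) (μ : Measure X)
    [IsFiniteMeasure μ] :
    ∃ (ρ : X → ℝ) (u : X → E) (N : Set X), Measurable ρ ∧ (∀ x, 0 ≤ ρ x) ∧ Integrable ρ μ ∧
      Measurable u ∧ (∀ x, ‖u x‖ ≤ C) ∧ MeasurableSet N ∧ μ N = 0 ∧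
      ∫ x, ρ x ∂μ ≤ Λ.real univ ∧
      ∀ B, MeasurableSet B → Disjoint B N → ∀ l : X → E →L[ℝ] ℝ, Continuous l →
        ∫ q in B ×ˢ univ, l q.1 q.2 ∂Λ = ∫ x in B, l x (ρ x • u x) ∂μ := by
  have := FiniteDimensional.complete ℝ E
  have hfib : ∀ᵐ x ∂Λ.fst, ∀ᵐ v ∂(Λ.condKernel x), ‖v‖ ≤ C := by
    have h := hΛ
    rw [← Λ.disintegrate Λ.condKernel] at h
    exact Measure.ae_ae_of_ae_compProd h
  let u0 : X → E := fun x => ∫ v, v ∂(Λ.condKernel x)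
  have hu0 : Measurable u0 := by
    have : StronglyMeasurable fun v : E => v := measurable_id.stronglyMeasurable
    exact this.integral_kernel.measurable
  have hu0C : ∀ᵐ x ∂Λ.fst, ‖u0 x‖ ≤ C := by
    filter_upwards [hfib] with x hx
    simpa using norm_integral_le_of_norm_le_const hx
  let u : X → E := fun x => if ‖u0 x‖ ≤ C then u0 x else 0
  have hu : Measurable u :=
    Measurable.ite (measurableSet_le hu0.norm measurable_const) hu0 measurable_const
  let N : Set X := (Measure.mutuallySingular_singularPart Λ.fst μ).nullSetᶜ
  have hN : MeasurableSet N :=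
    (Measure.MutuallySingular.measurableSet_nullSet _).compl
  have hNμ : μ N = 0 := Measure.MutuallySingular.measure_compl_nullSet _
  have hNs : Λ.fst.singularPart μ Nᶜ = 0 := by
    rw [compl_compl]; exact Measure.MutuallySingular.measure_nullSet _
  have hrn := Measure.measurable_rnDeriv Λ.fst μ
  have hρint : Integrable (fun x => (Λ.fst.rnDeriv μ x).toReal) μ :=
    Measure.integrable_toReal_rnDeriv
  have hres : ∀ B, MeasurableSet B → Disjoint B N →
      Λ.fst.restrict B = (μ.withDensity (Λ.fst.rnDeriv μ)).restrict B := by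
    intro B hB hBN
    conv_lhs => rw [Measure.haveLebesgueDecomposition_add Λ.fst μ]
    rw [Measure.restrict_add, Measure.restrict_eq_zero.2, zero_add]
    exact measure_mono_null (subset_compl_iff_disjoint_right.2 hBN) hNs
  refine ⟨fun x => (Λ.fst.rnDeriv μ x).toReal, u, N, hrn.ennreal_toReal,
    fun x => ENNReal.toReal_nonneg, hρint, hu, fun x => ?_, hN, hNμ, ?_, fun B hB hBN l hl => ?_⟩
  · simp only [u]; split_ifs with h
    · exact h
    · simpa
  · have := Measure.setIntegral_toReal_rnDeriv_le (μ := Λ.fst) (ν := μ) (s := univ) (measure_ne_top _ _)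
    simpa [Measure.real, Measure.fst_univ] using this
  · obtain ⟨M, hM⟩ := (isCompact_univ (X := X)).exists_bound_of_continuousOn hl.continuousOn
    have hcont : Continuous fun q : X × E => l q.1 q.2 := by fun_prop
    have hint : Integrable (fun q : X × E => l q.1 q.2) Λ := by
      refine (integrable_const (M * C)).mono' hcont.aestronglyMeasurable ?_
      filter_upwards [hΛ] with q hq
      refine ((l q.1).le_opNorm _).trans ?_
      exact mul_le_mul (hM q.1 trivial) hq (norm_nonneg _)
        ((norm_nonneg _).trans (hM q.1 trivial))
    rw [← Measure.setIntegral_condKernel hB MeasurableSet.univ hint.integrableOn]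
    have e1 : ∀ᵐ x ∂Λ.fst, ∫ v in univ, l x v ∂(Λ.condKernel x) = l x (u x) := by
      filter_upwards [hfib, hu0C] with x h1 h2
      have : u x = u0 x := if_pos h2
      rw [Measure.restrict_univ, this]
      exact (l x).integral_comp_comm ((integrable_const C).mono'
        measurable_id.aestronglyMeasurable h1)
    rw [integral_congr_ae (ae_restrict_of_ae e1), hres B hB hBN,
      setIntegral_withDensity_eq_setIntegral_toReal_smul hrn ?_ _ hB]
    · simp
    · exact ae_restrict_of_ae (Measure.rnDeriv_lt_top _ _)

/-- A vector field whose restrictions to compact subsets of `S`, away from a null set, are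
approximately divergence free in the image under `ψ`. -/
def FlowDensityOn {X E : Type*} [MetricSpace X] [MeasurableSpace X] [NormedAddCommGroup E]
    [NormedSpace ℝ E] (ψ : X → E) (μ : Measure X) (S : Set X) (a : X → E) : Prop :=
  ∃ N, MeasurableSet N ∧ μ N = 0 ∧ ∀ B ⊆ S \ N, IsCompact B →
    LocalFlow ψ fun V χ => ∫ x in B, V x * fderiv ℝ χ (ψ x) (a x) ∂μ

lemma abs_fderiv_le_of_two_point {E : Type*} [NormedAddCommGroup E] [NormedSpace ℝ E] {χ D : E → ℝ}
    (hχ : ContDiff ℝ 1 χ) (hD : Continuous D) (h : ∀ y z, |χ y - χ z| ≤ ‖y - z‖ * (D y + D z))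
    (z v : E) : |fderiv ℝ χ z v| ≤ 2 * D z * ‖v‖ := by
  have hd : HasDerivAt (fun t : ℝ => χ (z + t • v)) (fderiv ℝ χ z v) 0 := by
    have h1 : HasDerivAt (fun t : ℝ => z + t • v) v 0 := by
      simpa using ((hasDerivAt_id (0 : ℝ)).smul_const v).const_add z
    have h2 : HasFDerivAt χ (fderiv ℝ χ z) (z + (0 : ℝ) • v) := by
      simpa using (hχ.differentiable one_ne_zero z).hasFDerivAt
    exact h2.comp_hasDerivAt (0 : ℝ) h1
  have h1 := (hasDerivAt_iff_tendsto_slope_zero.1 hd).abs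
  have h2 : Tendsto (fun t : ℝ => (D (z + t • v) + D z) * ‖v‖) (nhdsWithin 0 {0}ᶜ)
      (nhds ((D (z + (0 : ℝ) • v) + D z) * ‖v‖)) :=
    (Continuous.tendsto (by fun_prop) 0).mono_left nhdsWithin_le_nhds
  have h3 := le_of_tendsto_of_tendsto h1 h2 (by
    filter_upwards [self_mem_nhdsWithin] with t ht
    have ht' : 0 < |t| := abs_pos.2 ht
    have := h (z + t • v) z
    rw [add_sub_cancel_left, norm_smul, Real.norm_eq_abs] at this
    simp only [zero_add, zero_smul, add_zero, smul_eq_mul]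
    rw [abs_mul, abs_inv, inv_mul_le_iff₀ ht']
    linarith)
  simpa [two_mul] using h3

lemma lipschitzWith_cut {t : ℝ} (ht : 0 < t) : LipschitzWith (t⁻¹).toNNReal (cut t) := by
  have h : LipschitzWith (t⁻¹).toNNReal fun d : ℝ => 2 - d / t := by
    refine LipschitzWith.of_dist_le_mul fun a b => ?_
    rw [Real.coe_toNNReal _ (by positivity), Real.dist_eq, Real.dist_eq,
      show 2 - a / t - (2 - b / t) = t⁻¹ * (b - a) by ring, abs_mul, abs_of_pos (by positivity),
      abs_sub_comm]
  exact (h.const_max 0).const_min 1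

lemma LipschitzWith.mul_unit {X : Type*} [PseudoMetricSpace X] {K L : ℝ≥0} {f g : X → ℝ}
    (hf : LipschitzWith K f) (hg : LipschitzWith L g) (hf1 : ∀ x, |f x| ≤ 1)
    (hg1 : ∀ x, |g x| ≤ 1) : LipschitzWith (K + L) fun x => f x * g x := by
  refine LipschitzWith.of_dist_le_mul fun x y => ?_
  have h1 := hf.dist_le_mul x y
  have h2 := hg.dist_le_mul x y
  rw [Real.dist_eq] at *
  rw [show f x * g x - f y * g y = (f x - f y) * g x + f y * (g x - g y) by ring]
  refine (abs_add_le _ _).trans ?_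
  rw [abs_mul, abs_mul, NNReal.coe_add, add_mul]
  refine add_le_add ?_ ?_
  · exact (mul_le_of_le_one_right (abs_nonneg _) (hg1 x)).trans h1
  · exact (mul_le_of_le_one_left (abs_nonneg _) (hf1 y)).trans h2

lemma LocalFlow.zero {X E : Type*} [MetricSpace X] [MeasurableSpace X] [NormedAddCommGroup E]
    [NormedSpace ℝ E] (ψ : X → E) : LocalFlow ψ fun _ _ => 0 :=
  ⟨0, inferInstance, fun ε hε => ⟨0, 0, inferInstance, inferInstance, by simpa using hε.le,
    fun K V _ _ _ χ _ D _ _ _ => by simp⟩⟩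

lemma LocalFlow.congr {X E : Type*} [MetricSpace X] [MeasurableSpace X] [NormedAddCommGroup E]
    [NormedSpace ℝ E] {ψ : X → E} {T T' : (X → ℝ) → (E → ℝ) → ℝ} (h : LocalFlow ψ T)
    (hT : ∀ V χ, Continuous V → ContDiff ℝ 1 χ → T V χ = T' V χ) : LocalFlow ψ T' := by
  obtain ⟨ρ, hρ, h⟩ := h
  refine ⟨ρ, hρ, fun ε hε => ?_⟩
  obtain ⟨σ, ν, h1, h2, h3, h4⟩ := h ε hε
  refine ⟨σ, ν, h1, h2, h3, fun K V hV hV0 hV1 χ hχ D hD hD0 hχD => ?_⟩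
  rw [← hT V χ hV.continuous hχ]
  exact h4 K V hV hV0 hV1 χ hχ D hD hD0 hχD

lemma LocalFlow.restrict_compact {X : Type*} [MetricSpace X] [CompactSpace X] [MeasurableSpace X]
    [BorelSpace X] {E : Type*} [NormedAddCommGroup E] [InnerProductSpace ℝ E]
    [FiniteDimensional ℝ E] [MeasurableSpace E] [BorelSpace E] {Λ : Measure (X × E)}
    [IsFiniteMeasure Λ] {C : ℝ} (hC : 0 ≤ C) (hΛ : ∀ᵐ q ∂Λ, ‖q.2‖ ≤ C) {ψ : X → E}
    (hψ : Continuous ψ)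
    (h : LocalFlow ψ fun V χ => ∫ q, V q.1 * fderiv ℝ χ (ψ q.1) q.2 ∂Λ) {B : Set X}
    (hB : IsCompact B) :
    LocalFlow ψ fun V χ => ∫ q in B ×ˢ univ, V q.1 * fderiv ℝ χ (ψ q.1) q.2 ∂Λ := by
  rcases B.eq_empty_or_nonempty with rfl | hne
  · simpa using LocalFlow.zero ψ
  obtain ⟨ρ, hρ, h⟩ := h
  have hBm := hB.isClosed.measurableSet
  have hid : Continuous fun x => infDist x B := continuous_infDist_pt B
  have hzero : {x | infDist x B = 0} = B := by
    ext x; exact (hB.isClosed.mem_iff_infDist_zero hne).symm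
  refine ⟨ρ, hρ, fun ε hε => ?_⟩
  obtain ⟨σ, ν, h1, h2, h3, h4⟩ := h (ε / 2) (half_pos hε)
  obtain ⟨n0, hn0⟩ : ∃ n : ℕ, ∫ x, cut (1 / (n + 1)) (infDist x B) * 1 ∂Λ.fst <
      Λ.fst.real B + ε / (4 * C + 1) := by
    have := tendsto_integral_cut Λ.fst hid (fun _ => infDist_nonneg) (F := fun _ => 1)
      continuous_const
    rw [hzero] at this
    simp only [setIntegral_const, smul_eq_mul, mul_one] at this
    simp only [mul_one]
    exact (this.eventually (gt_mem_nhds (lt_add_of_pos_right _ (by positivity)))).exists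
  set t : ℝ := 1 / (n0 + 1) with ht
  have htpos : 0 < t := by positivity
  let A : Set X := {x | infDist x B ≤ t} \ B
  have hAc : MeasurableSet {x | infDist x B ≤ t} := (isClosed_le hid continuous_const).measurableSet
  have hA : MeasurableSet A := hAc.diff hBm
  have hcint : ∀ (η : Measure X) [IsFiniteMeasure η] (g : X → ℝ), Continuous g → Integrable g η :=
    fun η _ g hg => (BoundedContinuousFunction.mkOfCompact ⟨g, hg⟩).integrable η
  have hAle : Λ.fst.real A ≤ ε / (4 * C + 1) := by
    have h1 : Λ.fst.real {x | infDist x B ≤ t} ≤ ∫ x, cut t (infDist x B) * 1 ∂Λ.fst := by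
      rw [← integral_indicator_one hAc]
      refine integral_mono ((integrable_const _).indicator hAc)
        (hcint _ _ (((continuous_cut _).comp hid).mul continuous_const)) fun y => ?_
      by_cases hy : infDist y B ≤ t
      · rw [indicator_of_mem (by exact hy)]; simp [cut_eq_one htpos hy]
      · rw [indicator_of_notMem (by exact hy)]; simpa using cut_nonneg _ _
    have h2 : Λ.fst.real A = Λ.fst.real {x | infDist x B ≤ t} - Λ.fst.real B :=
      measureReal_sdiff (fun y hy => by
        change infDist y B ≤ t; rw [infDist_zero_of_mem hy]; exact htpos.le) hBm
    linarith
  set s := t / 2 with hs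
  have hspos : 0 < s := by positivity
  refine ⟨σ + (2 * C).toNNReal • (Λ.fst.restrict A), ν + (s⁻¹).toNNReal • ρ, inferInstance,
    inferInstance, ?_, fun K V hV hV0 hV1 χ hχ D hD hD0 hχD => ?_⟩
  · rw [measureReal_add_apply, measureReal_nnreal_smul_apply, measureReal_restrict_apply_univ,
      Real.coe_toNNReal _ (by positivity)]
    calc σ.real univ + 2 * C * Λ.fst.real A ≤ ε / 2 + 2 * C * (ε / (4 * C + 1)) := by gcongr
      _ = ε / 2 + (4 * C) / (4 * C + 1) * (ε / 2) := by ring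
      _ ≤ ε / 2 + 1 * (ε / 2) := by
        gcongr
        rw [div_le_one (by positivity)]; linarith
      _ = ε := by ring
  have hχc := hχ.continuous
  have hVc := hV.continuous
  have hχ' : Continuous (fderiv ℝ χ) := hχ.continuous_fderiv one_ne_zero
  have hΞ : LipschitzWith (s⁻¹).toNNReal fun x => cut s (infDist x B) := by
    have := (lipschitzWith_cut hspos).comp (lipschitz_infDist_pt B)
    rw [mul_one] at this
    exact this
  have hΞc := hΞ.continuous
  have habs1 : ∀ {a : ℝ}, 0 ≤ a → a ≤ 1 → |a| ≤ 1 := fun h0 h1 => abs_le.2 ⟨by linarith, h1⟩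
  have key := h4 (K + (s⁻¹).toNNReal) (fun x => V x * cut s (infDist x B))
    (hV.mul_unit hΞ (fun x => habs1 (hV0 x) (hV1 x))
      fun x => habs1 (cut_nonneg _ _) (cut_le_one _ _))
    (fun x => mul_nonneg (hV0 x) (cut_nonneg _ _))
    (fun x => mul_le_one₀ (hV1 x) (cut_nonneg _ _) (cut_le_one _ _)) χ hχ D hD hD0 hχD
  rw [integral_add_measure (hcint _ _ (by fun_prop)) (hcint _ _ (by fun_prop)),
    integral_add_measure (hcint _ _ (by fun_prop)) (hcint _ _ (by fun_prop)),
    integral_smul_nnreal_measure, integral_smul_nnreal_measure, NNReal.smul_def, NNReal.smul_def,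
    Real.coe_toNNReal _ (by positivity), Real.coe_toNNReal _ (by positivity), smul_eq_mul,
    smul_eq_mul]
  rw [NNReal.coe_add, Real.coe_toNNReal _ (by positivity)] at key
  obtain ⟨M, hM⟩ := (isCompact_univ (X := X)).exists_bound_of_continuousOn
    (f := fun x => fderiv ℝ χ (ψ x)) (by fun_prop)
  have hint : ∀ W : X → ℝ, Continuous W → (∀ x, |W x| ≤ 1) →
      Integrable (fun q : X × E => W q.1 * fderiv ℝ χ (ψ q.1) q.2) Λ := by
    intro W hW hW1
    refine (integrable_const (M * C)).mono' (Continuous.aestronglyMeasurable (by fun_prop)) ?_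
    filter_upwards [hΛ] with q hq
    rw [norm_mul]
    refine (mul_le_of_le_one_left (norm_nonneg _) (hW1 _)).trans
      (((fderiv ℝ χ (ψ q.1)).le_opNorm _).trans ?_)
    exact mul_le_mul (hM q.1 trivial) hq (norm_nonneg _) ((norm_nonneg _).trans (hM q.1 trivial))
  have hBu : MeasurableSet (B ×ˢ (univ : Set E)) := hBm.prod MeasurableSet.univ
  have hi1 := hint V hVc fun x => habs1 (hV0 x) (hV1 x)
  have hi2 := hint (fun x => V x * cut s (infDist x B)) (by fun_prop) fun x =>
    habs1 (mul_nonneg (hV0 x) (cut_nonneg _ _))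
      (mul_le_one₀ (hV1 x) (cut_nonneg _ _) (cut_le_one _ _))
  have hdiff : |∫ q in B ×ˢ univ, V q.1 * fderiv ℝ χ (ψ q.1) q.2 ∂Λ -
      ∫ q, V q.1 * cut s (infDist q.1 B) * fderiv ℝ χ (ψ q.1) q.2 ∂Λ| ≤
      2 * C * ∫ x in A, D (ψ x) ∂Λ.fst := by
    have hm : AEStronglyMeasurable (A.indicator fun x => 2 * C * D (ψ x)) (Λ.map Prod.fst) :=
      ((by fun_prop : Continuous fun x => 2 * C * D (ψ x)).measurable.indicator
        hA).aestronglyMeasurable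
    rw [← integral_indicator hBu, ← integral_sub (hi1.indicator hBu) hi2, ← integral_const_mul,
      ← integral_indicator hA, Measure.fst, integral_map measurable_fst.aemeasurable hm,
      ← Real.norm_eq_abs]
    refine norm_integral_le_of_norm_le (((hcint _ (fun x => 2 * C * D (ψ x))
      (by fun_prop)).indicator hA).comp_measurable measurable_fst) ?_
    filter_upwards [hΛ] with q hq
    have hpos : 0 ≤ A.indicator (fun x => 2 * C * D (ψ x)) q.1 :=
      indicator_nonneg (fun x _ => mul_nonneg (by positivity) (hD0 _)) _
    by_cases hqB : q.1 ∈ B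
    · rw [indicator_of_mem (show q ∈ B ×ˢ univ from ⟨hqB, trivial⟩), infDist_zero_of_mem hqB,
        cut_eq_one hspos hspos.le, mul_one, sub_self, norm_zero]
      exact hpos
    · rw [indicator_of_notMem (fun hh => hqB hh.1), zero_sub, norm_neg]
      by_cases hqA : infDist q.1 B ≤ t
      · rw [indicator_of_mem (show q.1 ∈ A from ⟨hqA, hqB⟩), norm_mul, Real.norm_eq_abs,
          Real.norm_eq_abs]
        have b1 := abs_fderiv_le_of_two_point hχ hD hχD (ψ q.1) q.2
        have b2 : |V q.1 * cut s (infDist q.1 B)| ≤ 1 :=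
          habs1 (mul_nonneg (hV0 _) (cut_nonneg _ _))
            (mul_le_one₀ (hV1 _) (cut_nonneg _ _) (cut_le_one _ _))
        refine (mul_le_of_le_one_left (abs_nonneg _) b2).trans (b1.trans ?_)
        have := mul_le_mul_of_nonneg_left hq (hD0 (ψ q.1))
        linarith
      · rw [cut_eq_zero hspos (by rw [hs]; linarith), mul_zero, zero_mul, norm_zero]
        exact hpos
  have := abs_sub_abs_le_abs_sub (∫ q in B ×ˢ univ, V q.1 * fderiv ℝ χ (ψ q.1) q.2 ∂Λ)
    (∫ q, V q.1 * cut s (infDist q.1 B) * fderiv ℝ χ (ψ q.1) q.2 ∂Λ)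
  rw [add_mul] at key
  linarith


lemma exists_lipschitz_zero_set {X : Type*} [PseudoMetricSpace X] {B : Set X} (hB : IsClosed B) :
    ∃ h : X → ℝ, LipschitzWith 1 h ∧ (∀ x, 0 ≤ h x) ∧ {x | h x = 0} = B := by
  rcases B.eq_empty_or_nonempty with rfl | hne
  · exact ⟨fun _ => 1, LipschitzWith.const' 1, fun _ => zero_le_one, by simp⟩
  · exact ⟨fun x => infDist x B, lipschitz_infDist_pt B, fun _ => infDist_nonneg,
      by ext x; exact (hB.mem_iff_infDist_zero hne).symm⟩

/-- A flow charging every large set in direction `e` has a density with respect to `μ` which is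
transverse to `e` on a set of positive measure. -/
lemma exists_flow_density {X : Type*} [MetricSpace X] [CompactSpace X] [MeasurableSpace X]
    [BorelSpace X] {E : Type*} [NormedAddCommGroup E] [InnerProductSpace ℝ E]
    [FiniteDimensional ℝ E] [MeasurableSpace E] [BorelSpace E] (μ : Measure X) [IsFiniteMeasure μ]
    {ψ : X → E} (hψ : Continuous ψ) (Λ : Measure (X × E)) [IsFiniteMeasure Λ] {C : ℝ} (hC : 0 < C)
    (hΛ1 : Λ.real univ ≤ 1) (hΛ : ∀ᵐ q ∂Λ, ‖q.2‖ ≤ C) {κ α : ℝ} (hκ : 0 < κ) (hα : 0 < α) (e : E)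
    (hch : ∀ L : ℝ≥0, ∀ θ ∈ Cutoffs μ L α, κ ≤ ∫ q, θ q.1 * inner ℝ e q.2 ∂Λ) (he : ‖e‖ = 1)
    (hfl : LocalFlow ψ fun V χ => ∫ q, V q.1 * fderiv ℝ χ (ψ q.1) q.2 ∂Λ) :
    ∃ (S : Set X) (a : X → E), MeasurableSet S ∧ 0 < μ S ∧ Measurable a ∧ (∃ M, ∀ x, ‖a x‖ ≤ M) ∧
      FlowDensityOn ψ μ S a ∧ ∀ x ∈ S, 0 < inner ℝ e (a x) ∧ κ / (4 * C) * ‖a x‖ ≤ inner ℝ e (a x) := by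
  obtain ⟨ρ, u, N, hρm, hρ0, hρi, hum, huC, hN, hNμ, hρ1, hform⟩ :=
    exists_vector_density Λ hC.le hΛ μ
  obtain ⟨N', hN'N, hN'c, hN'lt⟩ := hN.exists_isCompact_sdiff_lt (μ := Λ.fst) (measure_ne_top _ _)
    (ε := ENNReal.ofReal (κ / (4 * C))) (by simp; positivity)
  obtain ⟨h, hh1, hh0, hhz⟩ := exists_lipschitz_zero_set hN'c.isClosed
  have hhc := hh1.continuous
  have hcint : ∀ (η : Measure X) [IsFiniteMeasure η] (g : X → ℝ), Continuous g → Integrable g η :=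
    fun η _ g hg => (BoundedContinuousFunction.mkOfCompact ⟨g, hg⟩).integrable η
  obtain ⟨j, hj1, hj2⟩ : ∃ j : ℕ, ∫ x, cut (1 / (j + 1)) (h x) * 1 ∂μ < α ∧
      ∫ x, cut (1 / (j + 1)) (h x) * 1 ∂Λ.fst < Λ.fst.real N' + κ / (4 * C) := by
    have t1 := tendsto_integral_cut μ hhc hh0 (F := fun _ => 1) continuous_const
    have t2 := tendsto_integral_cut Λ.fst hhc hh0 (F := fun _ => 1) continuous_const
    rw [hhz] at t1 t2
    have : μ.real N' = 0 := by rw [Measure.real, measure_mono_null hN'N hNμ]; rfl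
    simp only [setIntegral_const, smul_eq_mul, mul_one, this] at t1 t2
    simp only [mul_one]
    exact ((t1.eventually (gt_mem_nhds hα)).and
      (t2.eventually (gt_mem_nhds (lt_add_of_pos_right _ (by positivity))))).exists
  set t : ℝ := 1 / (j + 1) with ht
  have htpos : 0 < t := by positivity
  simp only [mul_one] at hj1 hj2
  have hθ : (fun x => 1 - cut t (h x)) ∈ Cutoffs μ (t⁻¹).toNNReal α := by
    refine ⟨?_, fun x => ?_, fun x => ?_, ?_⟩
    · have h1 := (lipschitzWith_cut htpos).comp hh1
      rw [mul_one] at h1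
      exact LipschitzWith.of_dist_le_mul fun x y => by
        have := h1.dist_le_mul x y
        rw [Real.dist_eq] at this ⊢
        rw [sub_sub_sub_cancel_left, abs_sub_comm]
        exact this
    · linarith [cut_le_one t (h x)]
    · linarith [cut_nonneg t (h x)]
    · simpa using hj1.le
  have hle := hch _ _ hθ
  have hsnd : Integrable (fun q : X × E => (inner ℝ e q.2 : ℝ)) Λ := by
    refine (integrable_const C).mono' (Continuous.aestronglyMeasurable (by fun_prop)) ?_
    filter_upwards [hΛ] with q hq
    refine (norm_inner_le_norm _ _).trans (by rwa [he, one_mul])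
  have hNu : MeasurableSet (Nᶜ ×ˢ (univ : Set E)) := hN.compl.prod MeasurableSet.univ
  have hi1 : Integrable (fun q : X × E => (1 - cut t (h q.1)) * (inner ℝ e q.2 : ℝ)) Λ := by
    refine (integrable_const C).mono' (Continuous.aestronglyMeasurable ?_) ?_
    · have := continuous_cut t
      fun_prop
    filter_upwards [hΛ] with q hq
    rw [norm_mul]
    refine (mul_le_of_le_one_left (norm_nonneg _) ?_).trans
      ((norm_inner_le_norm _ _).trans (by rwa [he, one_mul]))
    rw [Real.norm_eq_abs, abs_le]
    constructor <;> linarith [cut_le_one t (h q.1), cut_nonneg t (h q.1)]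
  let G : X → ℝ := fun x => C * ((N \ N').indicator 1 x + (cut t (h x) - N'.indicator 1 x))
  have hN'm := hN'c.isClosed.measurableSet
  have hci := hcint Λ.fst (fun x => cut t (h x)) ((continuous_cut t).comp hhc)
  have hGi : Integrable G Λ.fst := Integrable.const_mul
    (((integrable_const _).indicator (hN.diff hN'm)).add
      (hci.sub ((integrable_const _).indicator hN'm))) _
  have hGv : ∫ x, G x ∂Λ.fst ≤ κ / 2 := by
    have e1 : ∫ x, G x ∂Λ.fst = C * (Λ.fst.real (N \ N') + (∫ x, cut t (h x) ∂Λ.fst -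
        Λ.fst.real N')) := by
      simp only [G]
      rw [integral_const_mul, integral_add, integral_sub hci, integral_indicator_one hN'm,
        integral_indicator_one (hN.diff hN'm)]
      · exact (integrable_const _).indicator hN'm
      · exact (integrable_const _).indicator (hN.diff hN'm)
      · exact hci.sub ((integrable_const _).indicator hN'm)
    have e2 : Λ.fst.real (N \ N') ≤ κ / (4 * C) :=
      ENNReal.toReal_le_of_le_ofReal (by positivity) hN'lt.le
    rw [e1]
    calc _ ≤ C * (κ / (4 * C) + κ / (4 * C)) := by gcongr; linarith
      _ = κ / 2 := by field_simp; norm_num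
  have hdiff : |∫ q in Nᶜ ×ˢ univ, (inner ℝ e q.2 : ℝ) ∂Λ -
      ∫ q, (1 - cut t (h q.1)) * (inner ℝ e q.2 : ℝ) ∂Λ| ≤ κ / 2 := by
    refine le_trans ?_ hGv
    have hm : AEStronglyMeasurable G (Λ.map Prod.fst) := hGi.aestronglyMeasurable
    rw [← integral_indicator hNu, ← integral_sub (hsnd.indicator hNu) hi1, Measure.fst,
      integral_map measurable_fst.aemeasurable hm, ← Real.norm_eq_abs]
    refine norm_integral_le_of_norm_le (hGi.comp_measurable measurable_fst) ?_
    filter_upwards [hΛ] with q hq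
    have hin : |(inner ℝ e q.2 : ℝ)| ≤ C :=
      (norm_inner_le_norm (𝕜 := ℝ) _ _).trans (by rwa [he, one_mul])
    have hc0 := cut_nonneg t (h q.1)
    have hc1 := cut_le_one t (h q.1)
    by_cases hq1 : q.1 ∈ N
    · rw [indicator_of_notMem (fun hh => hh.1 hq1), zero_sub, norm_neg, norm_mul,
        Real.norm_eq_abs, Real.norm_eq_abs, abs_of_nonneg (by linarith)]
      by_cases hq2 : q.1 ∈ N'
      · have : h q.1 = 0 := by rw [← hhz] at hq2; exact hq2
        simp [G, hq2, this, cut_eq_one htpos htpos.le]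
      · simp only [G]
        rw [indicator_of_mem (show q.1 ∈ N \ N' from ⟨hq1, hq2⟩), indicator_of_notMem hq2]
        simp only [Pi.one_apply]
        nlinarith [abs_nonneg (inner ℝ e q.2 : ℝ)]
    · rw [indicator_of_mem (show q ∈ Nᶜ ×ˢ univ from ⟨hq1, trivial⟩)]
      simp only [G]
      rw [indicator_of_notMem (fun hh => hq1 hh.1), indicator_of_notMem (fun hh => hq1 (hN'N hh)),
        show (inner ℝ e q.2 : ℝ) - (1 - cut t (h q.1)) * inner ℝ e q.2 =
          cut t (h q.1) * inner ℝ e q.2 by ring, norm_mul, Real.norm_eq_abs, Real.norm_eq_abs,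
        abs_of_nonneg hc0]
      nlinarith [abs_nonneg (inner ℝ e q.2 : ℝ)]
  have hbig : κ / 2 ≤ ∫ x in Nᶜ, ρ x * inner ℝ e (u x) ∂μ := by
    have e1 := hform Nᶜ hN.compl disjoint_compl_left (fun _ => innerSL ℝ e) continuous_const
    simp only [innerSL_apply_apply, inner_smul_right] at e1
    rw [← e1]
    linarith [(abs_le.1 hdiff).1]
  let S : ℕ → Set X := fun M => {x | 0 < ρ x ∧ κ / 4 ≤ inner ℝ e (u x) ∧ ρ x ≤ M}
  have hue : Measurable fun x => (inner ℝ e (u x) : ℝ) := by fun_prop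
  have hSm : ∀ M, MeasurableSet (S M) := fun M =>
    (measurableSet_lt measurable_const hρm).inter
      ((measurableSet_le measurable_const hue).inter
        (measurableSet_le hρm measurable_const))
  obtain ⟨M, hM⟩ : ∃ M, 0 < μ (S M) := by
    by_contra! hcon
    have hz : μ (⋃ M, S M) = 0 := measure_iUnion_null fun M => le_antisymm (hcon M) zero_le
    have hae : ∀ᵐ x ∂μ, ρ x * inner ℝ e (u x) ≤ ρ x * (κ / 4) := by
      filter_upwards [measure_eq_zero_iff_ae_notMem.1 hz] with x hx
      by_contra! hlt
      have hpos : 0 < ρ x := by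
        rcases (hρ0 x).eq_or_lt with h0 | h0
        · rw [← h0] at hlt; simp at hlt
        · exact h0
      obtain ⟨n, hn⟩ := exists_nat_ge (ρ x)
      exact hx (mem_iUnion.2 ⟨n, hpos, (lt_of_mul_lt_mul_left hlt hpos.le).le, hn⟩)
    have hi : Integrable (fun x => ρ x * inner ℝ e (u x)) μ := by
      refine (hρi.mul_const C).mono' (by fun_prop) (ae_of_all _ fun x => ?_)
      rw [norm_mul, Real.norm_eq_abs, abs_of_nonneg (hρ0 x)]
      gcongr
      · exact hρ0 x
      · exact (norm_inner_le_norm _ _).trans (by rw [he, one_mul]; exact huC x)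
    have := calc κ / 2 ≤ ∫ x in Nᶜ, ρ x * inner ℝ e (u x) ∂μ := hbig
      _ ≤ ∫ x in Nᶜ, ρ x * (κ / 4) ∂μ :=
        integral_mono_ae hi.integrableOn (hρi.mul_const _).integrableOn (ae_restrict_of_ae hae)
      _ ≤ ∫ x, ρ x * (κ / 4) ∂μ := setIntegral_le_integral (hρi.mul_const _)
        (ae_of_all _ fun x => mul_nonneg (hρ0 x) (by positivity))
      _ = (∫ x, ρ x ∂μ) * (κ / 4) := integral_mul_const _ _
      _ ≤ 1 * (κ / 4) := by gcongr; exact hρ1.trans hΛ1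
    linarith
  refine ⟨S M, (S M).indicator fun x => ρ x • u x, hSm M, hM,
    (hρm.smul hum).indicator (hSm M), ⟨M * C, fun x => ?_⟩, ⟨N, hN, hNμ, fun B hB hBc => ?_⟩,
    fun x hx => ?_⟩
  · by_cases hx : x ∈ S M
    · rw [indicator_of_mem hx, norm_smul, Real.norm_eq_abs, abs_of_nonneg (hρ0 x)]
      exact mul_le_mul hx.2.2 (huC x) (norm_nonneg _) (by positivity)
    · rw [indicator_of_notMem hx, norm_zero]; positivity
  · refine (hfl.restrict_compact hC.le hΛ hψ hBc).congr fun V χ hV hχ => ?_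
    have hχ' : Continuous (fderiv ℝ χ) := hχ.continuous_fderiv one_ne_zero
    have := hform B hBc.isClosed.measurableSet
      (disjoint_left.2 fun x hx => (hB hx).2) (fun x => V x • fderiv ℝ χ (ψ x)) (by fun_prop)
    simp only [smul_apply, smul_eq_mul] at this
    rw [this]
    refine setIntegral_congr_fun hBc.isClosed.measurableSet fun x hx => ?_
    simp only [indicator_of_mem (hB hx).1]
  · rw [indicator_of_mem hx, inner_smul_right, norm_smul, Real.norm_eq_abs, abs_of_pos hx.1]
    refine ⟨mul_pos hx.1 (lt_of_lt_of_le (by positivity) hx.2.1), ?_⟩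
    calc κ / (4 * C) * (ρ x * ‖u x‖) ≤ κ / (4 * C) * (ρ x * C) := by
          gcongr; exacts [hx.1.le, huC x]
      _ = ρ x * (κ / 4) := by field_simp
      _ ≤ _ := by gcongr; exacts [hx.1.le, hx.2.1]

lemma exists_small_layer {X : Type*} [MeasurableSpace X] (μ : Measure X) [IsFiniteMeasure μ]
    {m : X → ℤ} (hm : Measurable m) {N : ℕ} (hN : 0 < N) :
    ∃ j : ℤ, μ.real {x | m x % N = j % N} ≤ μ.real univ / N := by
  by_contra! hcon
  have hms : ∀ j ∈ Finset.range N, MeasurableSet {x | m x % N = j} := fun j _ =>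
    hm ((Set.to_countable {a : ℤ | a % N = j}).measurableSet)
  have h1 : μ.real (⋃ j ∈ Finset.range N, {x | m x % N = j}) =
      ∑ j ∈ Finset.range N, μ.real {x | m x % N = j} := by
    refine measureReal_biUnion_finset (fun i _ j _ hij => disjoint_left.2 fun x hx hy => hij ?_) hms
    exact_mod_cast (hx : m x % N = i).symm.trans hy
  have h2 : ∑ j ∈ Finset.range N, μ.real univ / N <
      ∑ j ∈ Finset.range N, μ.real {x | m x % N = j} := by
    refine Finset.sum_lt_sum_of_nonempty ⟨0, by simpa using hN⟩ fun j hj => ?_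
    have := hcon j
    rwa [Int.emod_eq_of_lt (by positivity) (by exact_mod_cast Finset.mem_range.1 hj)] at this
  rw [← h1, Finset.sum_const, Finset.card_range, nsmul_eq_mul,
    mul_div_cancel₀ _ (by positivity)] at h2
  exact absurd (measureReal_mono (subset_univ _)) (not_le.2 h2)

/-- Rounding down to a grid is Lipschitz off a thin layer of transitional levels. -/
lemma abs_grid_sub_le {N : ℕ} (hN : 0 < N) {s : ℝ} (hs : 0 < s) (j : ℤ) {t t' : ℝ}
    (ht : ⌊N * t / s⌋ % N ≠ j % N) (ht' : ⌊N * t' / s⌋ % N ≠ j % N) :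
    |s * ((⌊N * t / s⌋ - j) / N : ℤ) - s * ((⌊N * t' / s⌋ - j) / N : ℤ)| ≤ N * |t - t'| := by
  wlog hle : t' ≤ t generalizing t t'
  · rw [abs_sub_comm, abs_sub_comm t]
    exact this ht' ht (le_of_not_ge hle)
  have hN' : (0 : ℤ) < N := by exact_mod_cast hN
  have hmono : ⌊N * t' / s⌋ ≤ ⌊N * t / s⌋ := by gcongr
  set m := ⌊N * t / s⌋ with hm
  set m' := ⌊N * t' / s⌋ with hm'
  have hk : (m' - j) / N ≤ (m - j) / N := Int.ediv_le_ediv hN' (by linarith)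
  set k := (m - j) / (N : ℤ) with hkd
  set k' := (m' - j) / (N : ℤ) with hkd'
  rw [abs_of_nonneg (by rw [← mul_sub]; exact mul_nonneg hs.le (by
    rw [sub_nonneg]; exact_mod_cast hk)), abs_of_nonneg (by linarith)]
  rcases hk.eq_or_lt with heq | hlt
  · rw [heq]; simp only [sub_self]
    exact mul_nonneg (by positivity) (by linarith)
  have e1 : N * k + 1 ≤ m - j := by
    have h1 := Int.emod_add_mul_ediv (m - j) N
    have h2 := Int.emod_nonneg (m - j) hN'.ne'
    have h3 : (m - j) % N ≠ 0 := fun h =>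
      ht (Int.emod_eq_emod_iff_emod_sub_eq_zero.2 h)
    have h4 : 1 ≤ (m - j) % N := by omega
    linarith
  have e2 : m' - j ≤ N * k' + N - 1 := by
    have h1 := Int.emod_add_mul_ediv (m' - j) N
    have h2 := Int.emod_lt_of_pos (m' - j) hN'
    have h4 : (m' - j) % N ≤ N - 1 := by omega
    linarith
  have f1 : (m : ℝ) ≤ N * t / s := Int.floor_le _
  have f2 : N * t' / s < m' + 1 := Int.lt_floor_add_one _
  have e3 : (N : ℝ) * k + 1 ≤ m - j := by exact_mod_cast e1
  have e4 : (m' : ℝ) - j ≤ N * k' + N - 1 := by exact_mod_cast e2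
  have e5 : (1 : ℝ) ≤ k - k' := by
    have : k' + 1 ≤ k := hlt
    have : (k' : ℝ) + 1 ≤ k := by exact_mod_cast this
    linarith
  have e6 : (1 : ℝ) ≤ N := by exact_mod_cast hN
  have e7 : (k : ℝ) - k' ≤ (N * t - N * t') / s := by
    rw [sub_div]; nlinarith
  rw [le_div_iff₀ hs] at e7
  linarith

lemma abs_grid_le {N : ℕ} (hN : 0 < N) {s : ℝ} (hs : 0 < s) (j : ℤ) (t : ℝ) :
    |s * ((⌊N * t / s⌋ - j) / N : ℤ) + s * j / N - t| ≤ s := by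
  have hN' : (0 : ℤ) < N := by exact_mod_cast hN
  have hNr : (0 : ℝ) < N := by exact_mod_cast hN
  set m := ⌊N * t / s⌋ with hm
  set k := (m - j) / (N : ℤ) with hkd
  have h1 := Int.emod_add_mul_ediv (m - j) N
  have h2 := Int.emod_lt_of_pos (m - j) hN'
  have h3 := Int.emod_nonneg (m - j) hN'.ne'
  have h4 : (m - j) % N ≤ N - 1 := by omega
  have e1 : N * k ≤ m - j := by linarith
  have e2 : m - j ≤ N * k + N - 1 := by linarith
  have e3 : (N : ℝ) * k ≤ m - j := by exact_mod_cast e1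
  have e4 : (m : ℝ) - j ≤ N * k + N - 1 := by exact_mod_cast e2
  have f1 : (m : ℝ) ≤ N * t / s := Int.floor_le _
  have f2 : N * t / s < m + 1 := Int.lt_floor_add_one _
  have g1 : (N : ℝ) * k + j ≤ N * t / s := by linarith
  have g2 : N * t / s < N * k + j + N := by linarith
  rw [le_div_iff₀ hs] at g1
  rw [div_lt_iff₀ hs] at g2
  have e : s * (k : ℝ) + s * j / N - t = ((N * k + j) * s - N * t) / N := by field_simp
  rw [e, abs_div, abs_of_pos hNr, div_le_iff₀ hNr, abs_le]
  constructor <;> nlinarith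

/-- A function which is locally almost constant on a large set can be perturbed to have countably
many values there. -/
lemma exists_countable_values {X : Type*} [MetricSpace X] [MeasurableSpace X] [BorelSpace X]
    (μ : Measure X) [IsFiniteMeasure μ] {f : X → ℝ} (hf : Continuous f) {G : Set X}
    (hG : MeasurableSet G) {κ τ : ℝ} (hκ : 0 < κ) (hτ : 0 < τ)
    (hloc : ∀ x ∈ G, ∀ y ∈ G, dist x y < τ → |f x - f y| ≤ κ * dist x y) {N : ℕ} (hN : 0 < N)
    {ε : ℝ} (hε : 0 < ε) :
    ∃ (u : X → ℝ) (G' : Set X), (∀ x, |u x| ≤ ε) ∧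
      (∀ x y, |u x - u y| ≤ (N + 1) * κ * dist x y) ∧ G' ⊆ G ∧ MeasurableSet G' ∧
      μ.real (G \ G') ≤ μ.real univ / N ∧ ((fun x => f x + u x) '' G').Countable := by
  obtain ⟨s, hs, hsε, hsτ⟩ : ∃ s : ℝ, 0 < s ∧ s ≤ ε ∧ 2 * s ≤ (N + 1) * κ * τ := by
    refine ⟨min ε ((N + 1) * κ * τ / 2), by positivity, min_le_left _ _, ?_⟩
    linarith [min_le_right ε ((N + 1) * κ * τ / 2)]
  have hm : Measurable fun x => ⌊N * f x / s⌋ := Int.measurable_floor.comp (by fun_prop)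
  obtain ⟨j, hj⟩ := exists_small_layer μ hm hN
  let T : Set X := {x | ⌊N * f x / s⌋ % N = j % N}
  have hT : MeasurableSet T := hm ((Set.to_countable {a : ℤ | a % N = j % N}).measurableSet)
  let Q : ℤ → ℝ := fun m => s * ((m - j) / N : ℤ) + s * j / N
  let u0 : X → ℝ := fun x => Q ⌊N * f x / s⌋ - f x
  have hu0 : ∀ x, |u0 x| ≤ s := fun x => abs_grid_le hN hs j (f x)
  let K : ℝ≥0 := ((N + 1) * κ).toNNReal
  have hK : (K : ℝ) = (N + 1) * κ := Real.coe_toNNReal _ (by positivity)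
  have hlip : LipschitzOnWith K u0 (G \ T) := by
    refine LipschitzOnWith.of_dist_le_mul fun x hx y hy => ?_
    rw [hK, Real.dist_eq]
    rcases lt_or_ge (dist x y) τ with hlt | hge
    · have h1 := hloc x hx.1 y hy.1 hlt
      have h2 := abs_grid_sub_le hN hs j hx.2 hy.2
      have e : u0 x - u0 y = (s * ((⌊N * f x / s⌋ - j) / N : ℤ) -
          s * ((⌊N * f y / s⌋ - j) / N : ℤ)) - (f x - f y) := by simp only [u0, Q]; ring
      rw [e]
      refine (abs_sub _ _).trans ?_
      have h3 : (N : ℝ) * |f x - f y| ≤ N * (κ * dist x y) := by gcongr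
      linarith
    · have h1 : (N + 1) * κ * τ ≤ (N + 1) * κ * dist x y := by gcongr
      have := abs_sub (u0 x) (u0 y)
      linarith [hu0 x, hu0 y]
  obtain ⟨v, hv, hveq⟩ := hlip.extend_real
  refine ⟨fun x => max (-s) (min s (v x)), G \ T, fun x => ?_, fun x y => ?_, sdiff_subset,
    hG.diff hT, (measureReal_mono fun x hx => ?_).trans hj, ?_⟩
  · exact abs_le.2 ⟨by linarith [le_max_left (-s) (min s (v x))],
      (max_le (by linarith) (min_le_left _ _)).trans hsε⟩
  · have := ((hv.const_min s).const_max (-s)).dist_le_mul x y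
    rwa [hK, Real.dist_eq] at this
  · by_contra hxT
    exact hx.2 ⟨hx.1, hxT⟩
  · refine (countable_range Q).mono ?_
    rintro _ ⟨x, hx, rfl⟩
    refine ⟨⌊N * f x / s⌋, ?_⟩
    have := abs_le.1 (hu0 x)
    simp only [← hveq hx]
    rw [min_eq_right this.2, max_eq_right this.1]
    simp [u0]

/-- Either a direction can be flattened by a small perturbation on a large set, or there is a
field of flows transverse to it. -/
theorem flat_or_flow {X : Type*} [MetricSpace X] [CompactSpace X] [MeasurableSpace X]
    [BorelSpace X] {E : Type*} [NormedAddCommGroup E] [InnerProductSpace ℝ E]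
    [FiniteDimensional ℝ E] [MeasurableSpace E] [BorelSpace E] {ψ : X → E} {C : ℝ≥0} (hC : 0 < C)
    (hψ : LipschitzWith C ψ) {κ η : ℝ} (hκ : 0 < κ) (hη : 0 < η) :
    ∃ c : ℝ, 0 < c ∧ ∀ (μ : Measure X) [IsFiniteMeasure μ] (e : E), ‖e‖ = 1 →
      (∀ ε : ℝ, 0 < ε → ∃ (f : X → ℝ) (G : Set X), (∀ x, |f x - inner ℝ e (ψ x)| ≤ ε) ∧
        (∀ x y, |f x - f y| ≤ |inner ℝ e (ψ x) - inner ℝ e (ψ y)| + κ * dist x y) ∧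
        MeasurableSet G ∧ μ.real Gᶜ ≤ η * μ.real univ ∧ (f '' G).Countable) ∨
      ∃ (S : Set X) (a : X → E), MeasurableSet S ∧ 0 < μ S ∧ Measurable a ∧
        (∃ M, ∀ x, ‖a x‖ ≤ M) ∧ FlowDensityOn ψ μ S a ∧
        ∀ x ∈ S, 0 < inner ℝ e (a x) ∧ c * ‖a x‖ ≤ inner ℝ e (a x) := by
  obtain ⟨n, hn⟩ := exists_nat_gt (2 / η)
  have hn0 : (0 : ℝ) < n := lt_trans (by positivity) hn
  have hnpos : 0 < n := by exact_mod_cast hn0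
  have hC' : (0 : ℝ) < C := hC
  obtain ⟨k, hk, hkle⟩ : ∃ k : ℝ, 0 < k ∧ k + (n + 1) * (k * (1 + C)) ≤ κ := by
    refine ⟨κ / (1 + (n + 1) * (1 + C)), by positivity, le_of_eq ?_⟩
    field_simp
  refine ⟨k / (4 * C), by positivity, fun μ _ e he => ?_⟩
  have hp : LipschitzWith C fun x => (inner ℝ e (ψ x) : ℝ) := by
    refine LipschitzWith.of_dist_le_mul fun x y => ?_
    rw [Real.dist_eq, ← inner_sub_right]
    refine (abs_real_inner_le_norm _ _).trans ?_
    rw [he, one_mul, ← dist_eq_norm]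
    exact hψ.dist_le_mul x y
  rcases eq_or_ne (μ univ) 0 with h0 | h0
  · left
    refine fun ε hε => ⟨_, ∅, fun x => ?_, fun x y => le_add_of_nonneg_right (by positivity),
      MeasurableSet.empty, ?_, by simp⟩
    · simpa using hε.le
    · simp [Measure.real, h0]
  have hμ : 0 < μ.real univ := ENNReal.toReal_pos h0 (measure_ne_top _ _)
  set α := k * η / 2 * μ.real univ with hα
  have hαpos : 0 < α := by positivity
  by_cases hflat : ∀ ε : ℝ, 0 < ε → ∃ i : ℕ, ∃ θ ∈ Cutoffs μ i α, ∃ f : X → ℝ,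
      (∀ x, inner ℝ e (ψ x) - ε ≤ f x ∧ f x ≤ inner ℝ e (ψ x)) ∧
      ∀ x y, f x ≤ f y + k * dist x y + (1 - θ x * (if dist x y < 1 / ((i : ℝ) + 1) then 1 else 0)) *
        |inner ℝ e (ψ x) - inner ℝ e (ψ y)|
  · left
    intro ε hε
    obtain ⟨i, θ, ⟨hθL, hθ0, hθ1, hθi⟩, f, hf1, hf2⟩ := hflat (ε / 2) (half_pos hε)
    have hfp : ∀ x y, |f x - f y| ≤ |inner ℝ e (ψ x) - inner ℝ e (ψ y)| + k * dist x y := by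
      have key : ∀ x y, f x - f y ≤ |inner ℝ e (ψ x) - inner ℝ e (ψ y)| + k * dist x y := by
        intro x y
        have h1 := hf2 x y
        have h2 : (1 - θ x * (if dist x y < 1 / ((i : ℝ) + 1) then 1 else 0)) *
            |(inner ℝ e (ψ x) - inner ℝ e (ψ y) : ℝ)| ≤ |inner ℝ e (ψ x) - inner ℝ e (ψ y)| := by
          refine mul_le_of_le_one_left (abs_nonneg _) ?_
          split_ifs
          · linarith [hθ0 x]
          · simp
        linarith
      intro x y
      have h2 := key y x
      rw [dist_comm, abs_sub_comm] at h2
      exact abs_le.2 ⟨by linarith, key x y⟩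
    have hfc : Continuous f := by
      have : LipschitzWith (C + k.toNNReal) f := by
        refine LipschitzWith.of_dist_le_mul fun x y => ?_
        have h2 := hp.dist_le_mul x y
        rw [Real.dist_eq] at h2 ⊢
        rw [NNReal.coe_add, Real.coe_toNNReal _ hk.le, add_mul]
        linarith [hfp x y]
      exact this.continuous
    have hθc := hθL.continuous
    let G : Set X := {x | 1 - k ≤ θ x}
    have hG : MeasurableSet G := (isClosed_le continuous_const hθc).measurableSet
    have hGc : μ.real Gᶜ ≤ η / 2 * μ.real univ := by
      have h1 := mul_meas_ge_le_integral_of_nonneg (μ := μ) (f := fun x => 1 - θ x)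
        (ae_of_all _ fun x => by simpa using hθ1 x)
        ((BoundedContinuousFunction.mkOfCompact ⟨fun x => 1 - θ x, by fun_prop⟩).integrable μ) k
      have h2 : μ.real Gᶜ ≤ μ.real {x | k ≤ 1 - θ x} :=
        measureReal_mono fun x hx => by
          have : θ x < 1 - k := not_le.1 hx
          change k ≤ 1 - θ x
          linarith
      have h3 : k * μ.real Gᶜ ≤ k * (η / 2 * μ.real univ) :=
        calc _ ≤ k * μ.real {x | k ≤ 1 - θ x} := by gcongr
          _ ≤ α := h1.trans hθi
          _ = _ := by rw [hα]; ring
      exact le_of_mul_le_mul_left h3 hk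
    have hloc : ∀ x ∈ G, ∀ y ∈ G, dist x y < 1 / ((i : ℝ) + 1) →
        |f x - f y| ≤ k * (1 + C) * dist x y := by
      have key : ∀ x ∈ G, ∀ y, dist x y < 1 / ((i : ℝ) + 1) →
          f x - f y ≤ k * (1 + C) * dist x y := by
        intro x hx y hxy
        have h1 := hf2 x y
        rw [if_pos hxy, mul_one] at h1
        have hx' : 1 - θ x ≤ k := by have : 1 - k ≤ θ x := hx; linarith
        have h2 := hp.dist_le_mul x y
        rw [Real.dist_eq] at h2
        have h3 : (1 - θ x) * |(inner ℝ e (ψ x) - inner ℝ e (ψ y) : ℝ)| ≤ k * (C * dist x y) :=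
          mul_le_mul hx' h2 (abs_nonneg _) hk.le
        linarith
      intro x hx y hy hxy
      have h2 := key y hy x (by rwa [dist_comm])
      rw [dist_comm] at h2
      exact abs_le.2 ⟨by linarith, key x hx y hxy⟩
    obtain ⟨u, G', hu, huL, hG'G, hG', hGG', hcount⟩ := exists_countable_values μ hfc hG
      (by positivity) (by positivity) hloc hnpos (half_pos hε)
    refine ⟨fun x => f x + u x, G', fun x => ?_, fun x y => ?_, hG', ?_, hcount⟩
    · have h1 := hf1 x
      have h2 := abs_le.1 (hu x)
      exact abs_le.2 ⟨by linarith, by linarith⟩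
    · have h1 := hfp x y
      have h2 := huL x y
      have h3 := mul_le_mul_of_nonneg_right hkle (dist_nonneg (x := x) (y := y))
      have h4 := abs_add_le (f x - f y) (u x - u y)
      rw [show f x + u x - (f y + u y) = f x - f y + (u x - u y) by ring]
      linarith
    · have h1 : μ.real G'ᶜ ≤ μ.real Gᶜ + μ.real (G \ G') := by
        refine (measureReal_mono fun x hx => ?_).trans (measureReal_union_le _ _)
        by_cases hxG : x ∈ G
        · exact Or.inr ⟨hxG, hx⟩
        · exact Or.inl hxG
      have h2 : μ.real univ / n ≤ η / 2 * μ.real univ := by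
        rw [div_le_iff₀ hn0]
        rw [div_lt_iff₀ hη] at hn
        nlinarith
      linarith
  · right
    push Not at hflat
    obtain ⟨ε, hε, hno⟩ := hflat
    obtain ⟨Λ, hΛf, hΛ1, hΛC, hΛch, hΛfl⟩ := exists_flow_of_steps μ hψ e (κ := k) (α := α)
      (C / ε).toNNReal (fun i => by
        rcases flat_or_steps μ hp hk hαpos.le hε (1 / ((i : ℝ) + 1)) i with h | ⟨S, hS1, hS2⟩
        · obtain ⟨θ, hθ, f, hf1, hf2⟩ := h
          obtain ⟨x, y, hxy⟩ := hno i θ hθ f hf1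
          exact absurd (hf2 x y) (not_le.2 hxy)
        · exact ⟨S, by rwa [Real.coe_toNNReal _ (by positivity)], hS2⟩)
    exact exists_flow_density μ hψ.continuous Λ hC' hΛ1 hΛC hk hαpos e hΛch he hΛfl

/-- Replacing the coordinates of `z` along an orthonormal family by essentially smaller ones does
not essentially increase the norm. -/
lemma norm_add_sum_le {E : Type*} [NormedAddCommGroup E] [InnerProductSpace ℝ E] {ι : Type*}
    [Fintype ι] {b : ι → E} (hb : Orthonormal ℝ b) (z : E) (t : ι → ℝ) {κ : ℝ} (hκ : 0 ≤ κ)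
    (ht : ∀ i, |t i| ≤ |inner ℝ (b i) z| + κ) :
    ‖z + ∑ i, (t i - inner ℝ (b i) z) • b i‖ ≤ ‖z‖ + Fintype.card ι * κ := by
  let p : ι → ℝ := fun i => inner ℝ (b i) z
  have hr : ∀ i, ∃ r, |r| ≤ |p i| ∧ |t i - r| ≤ κ := fun i => by
    have h := abs_le.1 (ht i)
    have hp := abs_nonneg (p i)
    refine ⟨max (-|p i|) (min |p i| (t i)), abs_le.2 ⟨le_max_left _ _, max_le (by linarith)
      (min_le_left _ _)⟩, ?_⟩
    rcases le_total (t i) (-|p i|) with h1 | h1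
    · rw [max_eq_left ((min_le_right _ _).trans h1)]
      exact abs_le.2 ⟨by linarith, by linarith⟩
    · rcases le_total (t i) |p i| with h2 | h2
      · rw [min_eq_right h2, max_eq_right h1]; simpa
      · rw [min_eq_left h2, max_eq_right (by linarith)]
        exact abs_le.2 ⟨by linarith, by linarith⟩
  choose r hr1 hr2 using hr
  have e1 : z + ∑ i, (t i - p i) • b i =
      (z + ∑ i, (r i - p i) • b i) + ∑ i, (t i - r i) • b i := by
    rw [add_assoc, ← Finset.sum_add_distrib]
    congr 1
    refine Finset.sum_congr rfl fun i _ => ?_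
    rw [← add_smul]; congr 1; ring
  have e2 : ‖z + ∑ i, (r i - p i) • b i‖ ≤ ‖z‖ := by
    refine abs_le_of_sq_le_sq' ?_ (norm_nonneg _) |>.2
    have h1 : inner ℝ z (∑ i, (r i - p i) • b i) = ∑ i, (r i - p i) * p i := by
      simp only [inner_sum, inner_smul_right, p]
      exact Finset.sum_congr rfl fun i _ => by rw [real_inner_comm]
    have h2 : ‖∑ i, (r i - p i) • b i‖ ^ 2 = ∑ i, (r i - p i) * (r i - p i) := by
      rw [← real_inner_self_eq_norm_sq, hb.inner_sum]
      simp
    rw [norm_add_sq_real, h1, h2, Finset.mul_sum, add_assoc, ← Finset.sum_add_distrib]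
    have : ∑ i, (2 * ((r i - p i) * p i) + (r i - p i) * (r i - p i)) ≤ 0 :=
      Finset.sum_nonpos fun i _ => by
        have := sq_le_sq.2 (hr1 i)
        nlinarith
    linarith
  have e3 : ‖∑ i, (t i - r i) • b i‖ ≤ Fintype.card ι * κ := by
    refine (norm_sum_le_of_le (f := fun i => (t i - r i) • b i) _ (n := fun _ => κ)
      fun i _ => ?_).trans_eq (by simp)
    rw [norm_smul, hb.1 i, mul_one]
    exact hr2 i
  change ‖z + ∑ i, (t i - p i) • b i‖ ≤ _
  rw [e1]
  exact (norm_add_le _ _).trans (add_le_add e2 e3)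

/-- Vectors orthogonal to `c` are almost orthogonal to the span of `a`. -/
def NearSpan {E : Type*} [NormedAddCommGroup E] [InnerProductSpace ℝ E] {k : ℕ} (κ : ℝ)
    (c a : Fin k → E) : Prop :=
  ∀ (s : Fin k → ℝ) (e : E), (∀ i, inner ℝ (c i) e = 0) →
    |inner ℝ e (∑ i, s i • a i)| ≤ κ * ‖e‖ * ‖∑ i, s i • a i‖

lemma isClosed_nearSpan {E : Type*} [NormedAddCommGroup E] [InnerProductSpace ℝ E] {k : ℕ} (κ : ℝ)
    (c : Fin k → E) : IsClosed {a : Fin k → E | NearSpan κ c a} := by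
  simp only [NearSpan, ofPred_forall]
  exact isClosed_iInter fun s => isClosed_iInter fun e => isClosed_iInter fun _ =>
    isClosed_le (by fun_prop) (by fun_prop)

lemma exists_nearSpan {E : Type*} [NormedAddCommGroup E] [InnerProductSpace ℝ E]
    [FiniteDimensional ℝ E] {k : ℕ} {a : Fin k → E} (ha : LinearIndependent ℝ a) {κ : ℝ}
    (hκ : 0 < κ) {d : ℕ → Fin k → E} (hd : DenseRange d) : ∃ l, NearSpan κ (d l) a := by
  obtain ⟨K, hK, hanti⟩ := LinearMap.exists_antilipschitzWith (Fintype.linearCombination ℝ a)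
    (LinearMap.ker_eq_bot.2 (linearIndependent_iff_injective_fintypeLinearCombination.1 ha))
  have hK' : (0 : ℝ) < K := hK
  obtain ⟨l, hl⟩ := hd.exists_dist_lt a (show 0 < κ / (K * (k + 1)) by positivity)
  refine ⟨l, fun s e he => ?_⟩
  have h1 : ‖s‖ ≤ K * ‖∑ i, s i • a i‖ := by
    have := hanti.le_mul_dist s 0
    simpa [Fintype.linearCombination_apply] using this
  have h2 : inner ℝ e (∑ i, s i • a i) = inner ℝ e (∑ i, s i • (a i - d l i)) := by
    simp only [inner_sum, inner_smul_right, inner_sub_right]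
    refine Finset.sum_congr rfl fun i _ => ?_
    rw [real_inner_comm (d l i), he i, sub_zero]
  rw [h2]
  refine (abs_real_inner_le_norm _ _).trans ?_
  have h3 : ‖∑ i, s i • (a i - d l i)‖ ≤ k * (‖s‖ * (κ / (K * (k + 1)))) := by
    refine (norm_sum_le_of_le (f := fun i => s i • (a i - d l i)) _
      (n := fun _ => ‖s‖ * (κ / (K * (k + 1)))) (fun i _ => ?_)).trans_eq (by simp)
    rw [norm_smul]
    have := (dist_pi_lt_iff (by positivity)).1 hl i
    rw [dist_eq_norm] at this
    exact mul_le_mul (norm_le_pi_norm s i) this.le (norm_nonneg _) (norm_nonneg _)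
  calc ‖e‖ * ‖∑ i, s i • (a i - d l i)‖ ≤
        ‖e‖ * (k * ((K * ‖∑ i, s i • a i‖) * (κ / (K * (k + 1))))) := by
        gcongr; exact h3.trans (by gcongr)
    _ = (k / (k + 1)) * (κ * ‖e‖ * ‖∑ i, s i • a i‖) := by field_simp
    _ ≤ 1 * (κ * ‖e‖ * ‖∑ i, s i • a i‖) := by
        gcongr
        rw [div_le_one (by positivity)]; linarith
    _ = _ := one_mul _

lemma NearSpan.mono {E : Type*} [NormedAddCommGroup E] [InnerProductSpace ℝ E] {k : ℕ} {κ κ' : ℝ}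
    (h : κ ≤ κ') {c a : Fin k → E} (hca : NearSpan κ c a) : NearSpan κ' c a :=
  fun s e he => (hca s e he).trans (by gcongr)

lemma NearSpan.eq_zero {E : Type*} [NormedAddCommGroup E] [InnerProductSpace ℝ E] {k : ℕ} {κ : ℝ}
    (h : κ < 1) {c a : Fin k → E} (hca : NearSpan κ c a) (s : Fin k → ℝ)
    (hs : ∀ i, inner ℝ (c i) (∑ j, s j • a j) = 0) : ∑ j, s j • a j = 0 := by
  have := hca s _ hs
  rw [real_inner_self_eq_norm_sq, abs_of_nonneg (by positivity)] at this
  by_contra hne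
  have hpos := norm_pos_iff.2 hne
  nlinarith [mul_pos hpos hpos]

lemma exists_disjoint_cutoffs {X : Type*} [PseudoMetricSpace X] {ι : Type*} [Fintype ι]
    {B : ι → Set X} (hB : ∀ i, IsCompact (B i)) (hd : Pairwise fun i j => Disjoint (B i) (B j))
    (hcl : ∀ i, IsClosed (B i)) :
    ∃ (K : ℝ≥0) (ζ : ι → X → ℝ), (∀ i, LipschitzWith K (ζ i)) ∧ (∀ i x, 0 ≤ ζ i x) ∧
      (∀ x, ∑ i, ζ i x ≤ 1) ∧ (∀ i, ∀ x ∈ B i, ζ i x = 1) ∧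
      ∀ i, ∀ x ∈ B i, ∀ j, j ≠ i → ζ j x = 0 := by
  classical
  have hev : ∀ᶠ δ : ℝ in nhdsWithin 0 (Ioi 0), ∀ i j, i ≠ j →
      Disjoint (thickening δ (B i)) (thickening δ (B j)) := by
    refine eventually_all.2 fun i => eventually_all.2 fun j => ?_
    by_cases hij : i = j
    · exact Eventually.of_forall fun _ h => absurd hij h
    obtain ⟨δ, hδ, hdis⟩ := (hd hij).exists_thickenings (hB i) (hcl j)
    filter_upwards [Ioo_mem_nhdsGT hδ] with δ' hδ' _
    exact hdis.mono (thickening_mono hδ'.2.le _) (thickening_mono hδ'.2.le _)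
  obtain ⟨δ, hdis, hδ⟩ := (hev.and self_mem_nhdsWithin).exists
  have hδ' : 0 < δ := hδ
  let ζ : ι → X → ℝ := fun i x => (thickenedIndicator hδ' (B i) x : ℝ≥0)
  have hz : ∀ i x, x ∉ thickening δ (B i) → ζ i x = 0 := fun i x hx => by
    simp only [ζ]; rw [thickenedIndicator_zero hδ' _ hx]; rfl
  refine ⟨δ.toNNReal⁻¹, ζ, fun i => ?_, fun i x => NNReal.coe_nonneg _, fun x => ?_,
    fun i x hx => ?_, fun i x hx j hji => ?_⟩
  · exact LipschitzWith.of_dist_le_mul fun x y =>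
      (lipschitzWith_thickenedIndicator hδ' (B i)).dist_le_mul x y
  · by_cases h : ∃ i, x ∈ thickening δ (B i)
    · obtain ⟨i, hi⟩ := h
      rw [Finset.sum_eq_single i (fun j _ hji => hz j x fun hj =>
        disjoint_left.1 (hdis j i hji) hj hi) (by simp)]
      exact_mod_cast thickenedIndicator_le_one hδ' _ _
    · push Not at h
      rw [Finset.sum_eq_zero fun i _ => hz i x (h i)]
      exact zero_le_one
  · simp only [ζ]; rw [thickenedIndicator_one hδ' _ hx]; rfl
  · exact hz j x fun hj => disjoint_left.1 (hdis j i hji) hj (self_subset_thickening hδ' _ hx)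

lemma exists_compact_partition {X : Type*} [MetricSpace X] [CompactSpace X] [MeasurableSpace X]
    [BorelSpace X] (μ : Measure X) [IsFiniteMeasure μ] {B₀ : Set X} (hB₀ : MeasurableSet B₀)
    {P : ℕ → Set X} (hP : ∀ l, MeasurableSet (P l)) (hcov : B₀ ⊆ ⋃ l, P l) {κ : ℝ} (hκ : 0 < κ) :
    ∃ (M : ℕ) (B : Fin M → Set X), (∀ l, IsCompact (B l)) ∧ (∀ l, B l ⊆ B₀ ∩ P l) ∧
      Pairwise (fun i j => Disjoint (B i) (B j)) ∧ μ.real (B₀ \ ⋃ l, B l) ≤ κ := by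
  let D : ℕ → Set X := fun l => B₀ ∩ disjointed P l
  have hD : ∀ l, MeasurableSet (D l) := fun l => hB₀.inter (MeasurableSet.disjointed hP l)
  have hDU : ⋃ l, D l = B₀ := by
    rw [← inter_iUnion, iUnion_disjointed]
    exact inter_eq_left.2 hcov
  have hanti : Antitone fun M : ℕ => B₀ \ ⋃ l ∈ Finset.range M, D l := fun a b hab =>
    sdiff_subset_sdiff_right (biUnion_subset_biUnion_left fun l hl => by
      simp only [Finset.coe_range, mem_Iio] at *
      exact lt_of_lt_of_le hl hab)
  have ht := tendsto_measure_iInter_atTop (μ := μ) (fun M => (hB₀.diff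
    ((Finset.range M).measurableSet_biUnion fun l _ => hD l)).nullMeasurableSet) hanti
    ⟨0, measure_ne_top _ _⟩
  have hempty : ⋂ M : ℕ, B₀ \ ⋃ l ∈ Finset.range M, D l = ∅ := by
    refine eq_empty_of_forall_notMem fun x hx => ?_
    have h0 : x ∈ B₀ := (mem_iInter.1 hx 0).1
    rw [← hDU] at h0
    obtain ⟨l, hl⟩ := mem_iUnion.1 h0
    exact (mem_iInter.1 hx (l + 1)).2 (mem_biUnion (by simp) hl)
  rw [hempty, measure_empty] at ht
  obtain ⟨M, hM⟩ := (ht.eventually (gt_mem_nhds (ENNReal.ofReal_pos.2 (half_pos hκ)))).exists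
  choose B hBD hBc hBlt using fun l => (hD l).exists_isCompact_sdiff_lt (μ := μ)
    (measure_ne_top _ _) (ε := ENNReal.ofReal (κ / (2 * (M + 1)))) (by simp; positivity)
  refine ⟨M, fun l => B l, fun l => hBc l, fun l x hx => ⟨(hBD l hx).1,
    disjointed_subset P l (hBD l hx).2⟩, fun i j hij => ?_, ?_⟩
  · refine Disjoint.mono ((hBD i).trans inter_subset_right) ((hBD j).trans inter_subset_right) ?_
    exact disjoint_disjointed P fun h => hij (Fin.ext h)
  · have hsub : B₀ \ ⋃ l : Fin M, B l ⊆ (B₀ \ ⋃ l ∈ Finset.range M, D l) ∪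
        ⋃ l ∈ Finset.range M, (D l \ B l) := by
      intro x hx
      by_cases h : x ∈ ⋃ l ∈ Finset.range M, D l
      · right
        simp only [mem_iUnion] at h ⊢
        obtain ⟨l, hl, hxl⟩ := h
        exact ⟨l, hl, hxl, fun hB => hx.2 (mem_iUnion.2 ⟨⟨l, Finset.mem_range.1 hl⟩, hB⟩)⟩
      · exact Or.inl ⟨hx.1, h⟩
    have h1 : μ.real (B₀ \ ⋃ l ∈ Finset.range M, D l) ≤ κ / 2 :=
      ENNReal.toReal_le_of_le_ofReal (by positivity) hM.le
    have h2 : ∀ l, μ.real (D l \ B l) ≤ κ / (2 * (M + 1)) := fun l =>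
      ENNReal.toReal_le_of_le_ofReal (by positivity) (hBlt l).le
    calc _ ≤ μ.real (B₀ \ ⋃ l ∈ Finset.range M, D l) +
          μ.real (⋃ l ∈ Finset.range M, (D l \ B l)) :=
        (measureReal_mono hsub).trans (measureReal_union_le _ _)
      _ ≤ κ / 2 + ∑ l ∈ Finset.range M, κ / (2 * (M + 1)) := by
        gcongr
        exact (measureReal_biUnion_finset_le _ _).trans (Finset.sum_le_sum fun l _ => h2 l)
      _ = κ / 2 + M / (M + 1) * (κ / 2) := by
        rw [Finset.sum_const, Finset.card_range, nsmul_eq_mul]; field_simp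
      _ ≤ κ / 2 + 1 * (κ / 2) := by
        gcongr
        rw [div_le_one (by positivity)]; linarith
      _ = κ := by ring

/-- If no flow is transverse to the span of the frame `a`, then `ψ` can be perturbed so that large
pieces of the domain are mapped to countably many translates of subspaces close to this span. -/
theorem exists_flattening {X : Type*} [MetricSpace X] [CompactSpace X] [MeasurableSpace X]
    [BorelSpace X] {E : Type*} [NormedAddCommGroup E] [InnerProductSpace ℝ E]
    [FiniteDimensional ℝ E] [MeasurableSpace E] [BorelSpace E] (μ : Measure X) [IsFiniteMeasure μ]
    {ψ : X → E} {C : ℝ≥0} (hC : 0 < C) (hψ : LipschitzWith C ψ) {k : ℕ} {d : ℕ → Fin k → E}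
    (hd : DenseRange d) {B₀ : Set X} (hB₀ : MeasurableSet B₀) {a : Fin k → X → E}
    (ha : ∀ i, Measurable (a i)) (hLI : ∀ x ∈ B₀, LinearIndependent ℝ fun i => a i x)
    (hmax : ∀ (S : Set X) (a' : X → E), MeasurableSet S → S ⊆ B₀ → 0 < μ S → Measurable a' →
      (∃ M, ∀ x, ‖a' x‖ ≤ M) → FlowDensityOn ψ μ S a' →
        ∃ x ∈ S, a' x ∈ Submodule.span ℝ (range fun i => a i x))
    {κ : ℝ≥0} (hκ : 0 < κ) :
    ∃ (M : ℕ) (B : Fin M → Set X) (c : Fin M → Fin k → E) (ψ' : X → E) (G : Set X),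
      (∀ l, IsCompact (B l)) ∧ (∀ l, B l ⊆ B₀) ∧ (∀ l, c l ∈ range d) ∧
      (∀ l, ∀ x ∈ B l, NearSpan (1 / 2) (c l) fun i => a i x) ∧ LipschitzWith (C + κ) ψ' ∧
      (∀ x, dist (ψ x) (ψ' x) ≤ κ) ∧ MeasurableSet G ∧ μ.real (B₀ \ G) ≤ κ ∧ G ⊆ ⋃ l, B l ∧
      ∀ l, ∃ T : Set E, T.Countable ∧ ∀ x ∈ G ∩ B l, ∃ t ∈ T,
        ψ' x = (Submodule.span ℝ (range (c l))).starProjection (ψ x) + t := by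
  have := FiniteDimensional.complete ℝ E
  have hκ' : (0 : ℝ) < κ := hκ
  set m := Module.finrank ℝ E with hm
  obtain ⟨c₀, hc₀, hdich⟩ := flat_or_flow hC hψ (κ := κ / (2 * (m + 1)))
    (η := κ / (2 * (m + 1) * (μ.real univ + 1))) (by positivity) (by positivity)
  set κ₂ := min (1 / 2) (c₀ / 2) with hκ₂
  have hκ₂pos : 0 < κ₂ := by positivity
  have hκ₂c : κ₂ < c₀ := (min_le_right _ _).trans_lt (by linarith)
  have hcov : B₀ ⊆ ⋃ l, {x | NearSpan κ₂ (d l) fun i => a i x} := fun x hx =>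
    mem_iUnion.2 (exists_nearSpan (hLI x hx) hκ₂pos hd)
  have hPm : ∀ l, MeasurableSet {x | NearSpan κ₂ (d l) fun i => a i x} := fun l =>
    (measurable_pi_lambda _ ha) (isClosed_nearSpan κ₂ (d l)).measurableSet
  obtain ⟨M, B, hBc, hBP, hBd, hBμ⟩ := exists_compact_partition μ hB₀ hPm hcov (half_pos hκ')
  have hBm : ∀ l, MeasurableSet (B l) := fun l => (hBc l).isClosed.measurableSet
  obtain ⟨K, ζ, hζL, hζ0, hζs, hζ1, hζz⟩ := exists_disjoint_cutoffs hBc hBd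
    fun l => (hBc l).isClosed
  let W : Fin M → Submodule ℝ E := fun l => Submodule.span ℝ (range (d l))
  let b := fun l => stdOrthonormalBasis ℝ (W l)ᗮ
  have hbo : ∀ l, Orthonormal ℝ fun j => (b l j : E) := fun l =>
    (b l).orthonormal.comp_linearIsometry (W l)ᗮ.subtypeₗᵢ
  have hdim : ∀ l, Module.finrank ℝ (W l)ᗮ ≤ m := fun l => Submodule.finrank_le _
  have hdimr : ∀ l, (Module.finrank ℝ (W l)ᗮ : ℝ) ≤ m := fun l => by exact_mod_cast hdim l
  set ε : ℝ := κ / (2 * (m + 1) * (M + 1) * (K + 1)) with hε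
  have hεpos : 0 < ε := by positivity
  have hflat : ∀ l j, ∃ (f : X → ℝ) (G : Set X), (∀ x, |f x - inner ℝ (b l j : E) (ψ x)| ≤ ε) ∧
      (∀ x y, |f x - f y| ≤ |inner ℝ (b l j : E) (ψ x) - inner ℝ (b l j : E) (ψ y)| +
        κ / (2 * (m + 1)) * dist x y) ∧ MeasurableSet G ∧
      μ.real (B l \ G) ≤ κ / (2 * (m + 1) * (μ.real univ + 1)) * μ.real (B l) ∧
      (f '' G).Countable := by
    intro l j
    rcases hdich (μ.restrict (B l)) (b l j : E) ((hbo l).1 j) with h | h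
    · obtain ⟨f, G, h1, h2, h3, h4, h5⟩ := h ε hεpos
      refine ⟨f, G, h1, h2, h3, ?_, h5⟩
      rwa [measureReal_restrict_apply h3.compl, measureReal_restrict_apply_univ, inter_comm,
        ← sdiff_eq] at h4
    · obtain ⟨S, a', hS, hμS, ha', hbd, ⟨N, hN, hNμ, hfl⟩, htr⟩ := h
      rw [Measure.restrict_apply hS] at hμS
      rw [Measure.restrict_apply hN] at hNμ
      have hSB : S ∩ B l ⊆ B₀ := fun y hy => (hBP l hy.2).1
      obtain ⟨x, hx, hxs⟩ := hmax (S ∩ B l) a' (hS.inter (hBm l)) hSB hμS ha' hbd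
        ⟨N ∩ B l, hN.inter (hBm l), hNμ, fun D hD hDc => by
          have hDB : D ⊆ B l := fun y hy => (hD hy).1.2
          have hDS : D ⊆ S \ N := fun y hy => ⟨(hD hy).1.1, fun h => (hD hy).2 ⟨h, hDB hy⟩⟩
          have := hfl D hDS hDc
          rwa [Measure.restrict_restrict hDc.isClosed.measurableSet,
            inter_eq_left.2 hDB] at this⟩
      obtain ⟨s, hs⟩ := (Submodule.mem_span_range_iff_exists_fun ℝ).1 hxs
      have h1 := (hBP l hx.2).2 s (b l j : E) fun i =>
        Submodule.inner_right_of_mem_orthogonal (K := W l)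
          (Submodule.subset_span (mem_range_self i)) (b l j).2
      have h2 := htr x hx.1
      rw [← hs, (hbo l).1 j] at *
      exfalso
      have h3 := le_abs_self (inner ℝ (b l j : E) (∑ i, s i • a i x))
      have h4 : 0 < ‖∑ i, s i • a i x‖ := by
        rw [norm_pos_iff]
        intro h0
        rw [h0, inner_zero_right] at h2
        exact lt_irrefl _ h2.1
      nlinarith [h2.2]
  choose f G hf1 hf2 hG hGμ hfc using hflat
  let v : Fin M → X → E := fun l x => ∑ j, (f l j x - inner ℝ (b l j : E) (ψ x)) • (b l j : E)
  have hv : ∀ l x, ‖v l x‖ ≤ m * ε := fun l x => by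
    refine (norm_sum_le_of_le (f := fun j => (f l j x - inner ℝ (b l j : E) (ψ x)) • (b l j : E)) _
      (n := fun _ => ε) fun j _ => ?_).trans ?_
    · rw [norm_smul, (hbo l).1 j, mul_one]
      exact hf1 l j x
    · simp only [Finset.sum_const, Finset.card_univ, Fintype.card_fin, nsmul_eq_mul]
      gcongr
      exact hdim l
  let Gt : Set X := ⋃ l, B l ∩ ⋂ j, G l j
  have hvd : ∀ l x y, ‖ψ x - ψ y + (v l x - v l y)‖ ≤ ‖ψ x - ψ y‖ + κ / 2 * dist x y := by
    intro l x y
    have h1 := norm_add_sum_le (hbo l) (ψ x - ψ y) (fun j => f l j x - f l j y)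
      (κ := κ / (2 * (m + 1)) * dist x y) (by positivity)
      (fun j => by rw [inner_sub_right]; exact hf2 l j x y)
    have h2 : v l x - v l y = ∑ j, (f l j x - f l j y - inner ℝ (b l j : E) (ψ x - ψ y)) •
        (b l j : E) := by
      simp only [v]
      rw [← Finset.sum_sub_distrib]
      refine Finset.sum_congr rfl fun j _ => ?_
      rw [← sub_smul, inner_sub_right]; congr 1; ring
    rw [h2]
    refine h1.trans ?_
    rw [Fintype.card_fin, ← mul_assoc]
    refine add_le_add le_rfl (mul_le_mul_of_nonneg_right ?_ dist_nonneg)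
    calc (Module.finrank ℝ (W l)ᗮ : ℝ) * (κ / (2 * (m + 1))) ≤ (m + 1) * (κ / (2 * (m + 1))) := by
          gcongr; linarith [hdimr l]
      _ = κ / 2 := by field_simp
  refine ⟨M, B, fun l => d l, fun x => ψ x + ∑ l, ζ l x • v l x, Gt, hBc,
    fun l x hx => (hBP l hx).1, fun l => mem_range_self _,
    fun l x hx => (hBP l hx).2.mono (min_le_left _ _),
    LipschitzWith.of_dist_le_mul fun x y => ?_, fun x => ?_,
    MeasurableSet.iUnion fun l => (hBm l).inter (MeasurableSet.iInter fun j => hG l j), ?_,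
    iUnion_mono fun l => inter_subset_left, fun l => ?_⟩
  · have e1 : ψ x + ∑ l, ζ l x • v l x - (ψ y + ∑ l, ζ l y • v l y) =
        (1 - ∑ l, ζ l x) • (ψ x - ψ y) + ∑ l, ζ l x • (ψ x - ψ y + (v l x - v l y)) +
          ∑ l, (ζ l x - ζ l y) • v l y := by
      simp only [smul_add, smul_sub, sub_smul, Finset.sum_add_distrib, Finset.sum_sub_distrib,
        one_smul, Finset.sum_smul]
      abel
    have n1 : ‖(1 - ∑ l, ζ l x) • (ψ x - ψ y)‖ = (1 - ∑ l, ζ l x) * ‖ψ x - ψ y‖ := by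
      rw [norm_smul, Real.norm_eq_abs, abs_of_nonneg (by linarith [hζs x])]
    have n2 : ‖∑ l, ζ l x • (ψ x - ψ y + (v l x - v l y))‖ ≤
        (∑ l, ζ l x) * (‖ψ x - ψ y‖ + κ / 2 * dist x y) := by
      rw [Finset.sum_mul]
      refine norm_sum_le_of_le _ fun l _ => ?_
      rw [norm_smul, Real.norm_eq_abs, abs_of_nonneg (hζ0 l x)]
      exact mul_le_mul_of_nonneg_left (hvd l x y) (hζ0 l x)
    have n3 : ‖∑ l, (ζ l x - ζ l y) • v l y‖ ≤ κ / 2 * dist x y := by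
      refine (norm_sum_le_of_le (f := fun l => (ζ l x - ζ l y) • v l y) _
        (n := fun _ => K * dist x y * (m * ε)) fun l _ => ?_).trans ?_
      · rw [norm_smul, ← dist_eq_norm]
        exact mul_le_mul ((hζL l).dist_le_mul x y) (hv l y) (norm_nonneg _) (by positivity)
      · simp only [Finset.sum_const, Finset.card_univ, Fintype.card_fin, nsmul_eq_mul]
        calc (M : ℝ) * (K * dist x y * (m * ε)) = M * K * m * ε * dist x y := by ring
          _ ≤ (M + 1) * (K + 1) * (m + 1) * ε * dist x y := by gcongr <;> linarith
          _ = κ / 2 * dist x y := by rw [hε]; field_simp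
    have n4 := hψ.dist_le_mul x y
    rw [dist_eq_norm] at n4 ⊢
    rw [e1]
    refine (norm_add_le _ _).trans ((add_le_add_left (norm_add_le _ _) _).trans ?_)
    rw [n1, NNReal.coe_add, add_mul]
    have n5 : (∑ l, ζ l x) * (κ / 2 * dist x y) ≤ 1 * (κ / 2 * dist x y) := by
      gcongr; exact hζs x
    linarith
  · rw [dist_self_add_right]
    refine (norm_sum_le_of_le (f := fun l => ζ l x • v l x) _
        (n := fun l => ζ l x * (m * ε)) fun l _ => ?_).trans ?_
    · rw [norm_smul, Real.norm_eq_abs, abs_of_nonneg (hζ0 l x)]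
      exact mul_le_mul_of_nonneg_left (hv l x) (hζ0 l x)
    · rw [← Finset.sum_mul]
      calc (∑ l, ζ l x) * (m * ε) ≤ 1 * ((m + 1) * ε) := by
            gcongr
            · exact hζs x
            · linarith
        _ = κ / (2 * (M + 1) * (K + 1)) := by rw [hε]; field_simp
        _ ≤ κ := by
          rw [div_le_iff₀ (by positivity)]
          have h1 : (1 : ℝ) ≤ 2 * (M + 1) * (K + 1) := by
            have : (0 : ℝ) ≤ M := by positivity
            have : (0 : ℝ) ≤ K := K.2
            nlinarith
          nlinarith
  · have hsub : B₀ \ Gt ⊆ (B₀ \ ⋃ l, B l) ∪ ⋃ l ∈ Finset.univ, ⋃ j ∈ Finset.univ,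
        B l \ G l j := by
      intro x hx
      by_cases h : x ∈ ⋃ l, B l
      · right
        obtain ⟨l, hl⟩ := mem_iUnion.1 h
        have : x ∉ ⋂ j, G l j := fun h' => hx.2 (mem_iUnion.2 ⟨l, hl, h'⟩)
        simp only [mem_iInter, not_forall] at this
        obtain ⟨j, hj⟩ := this
        exact mem_biUnion (Finset.mem_univ l) (mem_biUnion (Finset.mem_univ j) ⟨hl, hj⟩)
      · exact Or.inl ⟨hx.1, h⟩
    have hsumB : ∑ l, μ.real (B l) ≤ μ.real univ := by
      rw [← measureReal_iUnion_fintype hBd hBm]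
      exact measureReal_mono (subset_univ _)
    calc μ.real (B₀ \ Gt) ≤ μ.real (B₀ \ ⋃ l, B l) +
          ∑ l, ∑ j, μ.real (B l \ G l j) := by
          refine (measureReal_mono hsub).trans ((measureReal_union_le _ _).trans ?_)
          gcongr
          refine (measureReal_biUnion_finset_le _ _).trans (Finset.sum_le_sum fun l _ => ?_)
          exact measureReal_biUnion_finset_le _ _
      _ ≤ κ / 2 + ∑ l, m * (κ / (2 * (m + 1) * (μ.real univ + 1)) * μ.real (B l)) := by
          gcongr with l
          refine (Finset.sum_le_sum fun j _ => hGμ l j).trans ?_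
          simp only [Finset.sum_const, Finset.card_univ, Fintype.card_fin, nsmul_eq_mul]
          gcongr
          exact hdim l
      _ = κ / 2 + m / (m + 1) * ((∑ l, μ.real (B l)) / (μ.real univ + 1)) * (κ / 2) := by
          rw [← Finset.mul_sum, ← Finset.mul_sum]; field_simp
      _ ≤ κ / 2 + 1 * 1 * (κ / 2) := by
          gcongr
          · rw [div_le_one (by positivity)]; linarith
          · rw [div_le_one (by positivity)]; linarith
      _ = κ := by ring
  · refine ⟨(fun t : Fin (Module.finrank ℝ (W l)ᗮ) → ℝ => ∑ j, t j • (b l j : E)) ''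
      (univ.pi fun j => f l j '' G l j), (countable_univ_pi fun j => hfc l j).image _,
      fun x hx => ⟨∑ j, f l j x • (b l j : E), ⟨fun j => f l j x, ?_, rfl⟩, ?_⟩⟩
    · obtain ⟨l', hl', hx'⟩ := mem_iUnion.1 hx.1
      have : l' = l := by
        by_contra hne
        exact disjoint_left.1 (hBd hne) hl' hx.2
      subst this
      exact fun j _ => mem_image_of_mem _ (mem_iInter.1 hx' j)
    · have h1 : ∑ l', ζ l' x • v l' x = v l x := by
        rw [Finset.sum_eq_single l (fun l' _ hne => by rw [hζz l x hx.2 l' hne, zero_smul])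
          (by simp), hζ1 l x hx.2, one_smul]
      have h2 := (W l).starProjection_add_starProjection_orthogonal (ψ x)
      rw [(b l).starProjection_eq_sum_rankOne] at h2
      simp only [sum_apply, InnerProductSpace.rankOne_apply] at h2
      change ψ x + ∑ l', ζ l' x • v l' x = (W l).starProjection (ψ x) + _
      rw [h1]
      nth_rw 1 [← h2]
      simp only [v, sub_smul, Finset.sum_sub_distrib]
      abel

lemma integral_le_integral_sum_measure {X ι : Type*} [MetricSpace X] [CompactSpace X]
    [MeasurableSpace X] [BorelSpace X] [Fintype ι] (σ : ι → Measure X)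
    [∀ i, IsFiniteMeasure (σ i)] {F : X → ℝ} (hF : Continuous F) (h0 : ∀ x, 0 ≤ F x) (i : ι) :
    ∫ x, F x ∂σ i ≤ ∫ x, F x ∂(∑ i, σ i) := by
  refine integral_mono_measure ?_ (Eventually.of_forall h0)
    ((BoundedContinuousFunction.mkOfCompact ⟨F, hF⟩).integrable _)
  rw [Measure.le_iff]
  intro s _
  rw [Measure.coe_finsetSum, Finset.sum_apply]
  exact Finset.single_le_sum (f := fun i => σ i s) (fun _ _ => zero_le) (Finset.mem_univ i)

/-- Finitely many functionals that are approximately divergences admit common bounds. -/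
lemma LocalFlow.exists_uniform {X E : Type*} [MetricSpace X] [CompactSpace X] [MeasurableSpace X]
    [BorelSpace X] [NormedAddCommGroup E] [NormedSpace ℝ E] {ψ : X → E} (hψ : Continuous ψ)
    {k : ℕ} {T : Fin k → (X → ℝ) → (E → ℝ) → ℝ} (hT : ∀ i, LocalFlow ψ (T i)) :
    ∃ ρ : Measure X, IsFiniteMeasure ρ ∧ ∀ ε : ℝ, 0 < ε → ∃ σ ν : Measure X, IsFiniteMeasure σ ∧
      IsFiniteMeasure ν ∧ σ.real univ ≤ ε ∧ ∀ i, ∀ (K : ℝ≥0) (V : X → ℝ), LipschitzWith K V →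
        (∀ x, 0 ≤ V x) → (∀ x, V x ≤ 1) → ∀ χ : E → ℝ, ContDiff ℝ 1 χ →
          ∀ D : E → ℝ, Continuous D → (∀ z, 0 ≤ D z) →
            (∀ y z, |χ y - χ z| ≤ ‖y - z‖ * (D y + D z)) →
              |T i V χ| ≤ ∫ x, D (ψ x) ∂σ + K * ∫ x, |χ (ψ x)| ∂ρ + ∫ x, |χ (ψ x)| ∂ν := by
  choose ρ hρ h using hT
  refine ⟨∑ i, ρ i, inferInstance, fun ε hε => ?_⟩
  choose σ ν hσ hν hσε hb using fun i => h i (ε / (k + 1)) (by positivity)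
  refine ⟨∑ i, σ i, ∑ i, ν i, inferInstance, inferInstance, ?_,
    fun i K V hV h0 h1 χ hχ D hD hD0 hχD => ?_⟩
  · rw [Measure.real, Measure.coe_finsetSum, Finset.sum_apply,
      ENNReal.toReal_sum fun i _ => measure_ne_top _ _]
    calc ∑ i, (σ i univ).toReal ≤ ∑ _i : Fin k, ε / (k + 1) := Finset.sum_le_sum fun i _ => hσε i
      _ = k / (k + 1) * ε := by simp; ring
      _ ≤ 1 * ε := by
        gcongr
        rw [div_le_one (by positivity)]; linarith
      _ = ε := one_mul ε
  · have hχc : Continuous fun x => |χ (ψ x)| := (hχ.continuous.comp hψ).abs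
    refine (hb i K V hV h0 h1 χ hχ D hD hD0 hχD).trans ?_
    exact add_le_add (add_le_add
      (integral_le_integral_sum_measure σ (hD.comp hψ) (fun x => hD0 _) i)
      (mul_le_mul_of_nonneg_left
        (integral_le_integral_sum_measure ρ hχc (fun x => abs_nonneg _) i) K.2))
      (integral_le_integral_sum_measure ν hχc (fun x => abs_nonneg _) i)

/-- The vector fields `v j` on `B`, as fields along `q`, are approximately divergence free. -/
def FlowAlong {X F : Type*} [MetricSpace X] [MeasurableSpace X] [NormedAddCommGroup F]
    [NormedSpace ℝ F] [MeasurableSpace F] (q : X → F) (μ : Measure X) (B : Set X) {k : ℕ}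
    (v : Fin k → X → F) : Prop :=
  ∃ ρ : Measure F, IsFiniteMeasure ρ ∧ ∀ ε : ℝ, 0 < ε → ∃ σ ν : Measure F, IsFiniteMeasure σ ∧
    IsFiniteMeasure ν ∧ σ.real univ ≤ ε ∧ ∀ j, ∀ (K : ℝ≥0) (V : X → ℝ), LipschitzWith K V →
      (∀ x, 0 ≤ V x) → (∀ x, V x ≤ 1) → ∀ χ : F → ℝ, ContDiff ℝ 1 χ →
        ∀ D : F → ℝ, Continuous D → (∀ z, 0 ≤ D z) →
          (∀ y z, |χ y - χ z| ≤ ‖y - z‖ * (D y + D z)) →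
            |∫ x in B, V x * fderiv ℝ χ (q x) (v j x) ∂μ| ≤
              ∫ z, D z ∂σ + K * ∫ z, |χ z| ∂ρ + ∫ z, |χ z| ∂ν

lemma integrable_mul_fderiv {X E : Type*} [MetricSpace X] [CompactSpace X] [MeasurableSpace X]
    [BorelSpace X] [NormedAddCommGroup E] [NormedSpace ℝ E] [FiniteDimensional ℝ E]
    [MeasurableSpace E] [BorelSpace E] {μ : Measure X} [IsFiniteMeasure μ] {ψ : X → E}
    (hψ : Continuous ψ) {V : X → ℝ} (hV : Continuous V) {χ : E → ℝ} (hχ : ContDiff ℝ 1 χ)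
    {a : X → E} (ha : Measurable a) (hab : ∃ M, ∀ x, ‖a x‖ ≤ M) :
    Integrable (fun x => V x * fderiv ℝ χ (ψ x) (a x)) μ := by
  obtain ⟨M, hM⟩ := hab
  have hc : Continuous fun x => fderiv ℝ χ (ψ x) := (hχ.continuous_fderiv one_ne_zero).comp hψ
  obtain ⟨C₁, hC₁⟩ := (isCompact_univ (X := X)).exists_bound_of_continuousOn hV.continuousOn
  obtain ⟨C₂, hC₂⟩ := (isCompact_univ (X := X)).exists_bound_of_continuousOn hc.continuousOn
  have := FiniteDimensional.complete ℝ E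
  have hm : Measurable fun x => V x * fderiv ℝ χ (ψ x) (a x) := by
    have h2 : Measurable fun p : (E →L[ℝ] ℝ) × E => p.1 p.2 := by
      have : Continuous fun p : (E →L[ℝ] ℝ) × E => p.1 p.2 := by fun_prop
      exact this.measurable
    exact hV.measurable.mul (h2.comp (hc.measurable.prodMk ha))
  refine Integrable.of_bound hm.aestronglyMeasurable (C₁ * (C₂ * M)) (Eventually.of_forall fun x => ?_)
  rw [norm_mul]
  have h1 := hC₁ x trivial
  have h2 := hC₂ x trivial
  gcongr
  · exact (norm_nonneg _).trans h1
  · exact (ContinuousLinearMap.le_opNorm _ _).trans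
      (mul_le_mul h2 (hM x) (norm_nonneg _) ((norm_nonneg _).trans h2))

/-- Flow densities whose images under `A` span the vectors `w j` can be combined, on pieces of the
domain, to fields with images close to `w j`. -/
theorem exists_flowAlong {X : Type*} [MetricSpace X] [CompactSpace X] [MeasurableSpace X]
    [BorelSpace X] {E F : Type*} [NormedAddCommGroup E] [NormedSpace ℝ E] [FiniteDimensional ℝ E]
    [MeasurableSpace E] [BorelSpace E] [NormedAddCommGroup F] [NormedSpace ℝ F]
    [FiniteDimensional ℝ F] [MeasurableSpace F] [BorelSpace F] (μ : Measure X) [IsFiniteMeasure μ]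
    {ψ : X → E} (hψ : Continuous ψ) {S : Set X} (hS : MeasurableSet S) {k k' : ℕ}
    {a : Fin k → X → E} (ha : ∀ i, Measurable (a i)) (hab : ∀ i, ∃ M, ∀ x, ‖a i x‖ ≤ M)
    (hfl : ∀ i, FlowDensityOn ψ μ S (a i)) (A : E →L[ℝ] F) (w : Fin k' → F)
    (hw : ∀ x ∈ S, ∀ j, w j ∈ Submodule.span ℝ (range fun i => A (a i x))) {ε : ℝ} (hε : 0 < ε) :
    ∃ (B : ℕ → Set X) (v : ℕ → Fin k' → X → F), (∀ p, IsCompact (B p)) ∧ (∀ p, B p ⊆ S) ∧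
      μ (S \ ⋃ p, B p) = 0 ∧ (∀ p j, Measurable (v p j)) ∧ (∀ p j, ∃ M, ∀ x, ‖v p j x‖ ≤ M) ∧
      (∀ p, ∀ x ∈ B p, ∀ j, ‖v p j x - w j‖ ≤ ε) ∧
      ∀ p, FlowAlong (fun x => A (ψ x)) μ (B p) (v p) := by
  choose N hN hNμ hfl using hfl
  let b : (Fin k' → Fin k → ℝ) → Fin k' → X → E := fun s j x => ∑ i, s j i • a i x
  have hbm : ∀ s j, Measurable (b s j) := fun s j =>
    Finset.measurable_sum _ fun i _ => (ha i).const_smul (s j i)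
  have hbb : ∀ s j, ∃ M, ∀ x, ‖b s j x‖ ≤ M := by
    choose M hM using hab
    refine fun s j => ⟨∑ i, ‖s j i‖ * M i, fun x => norm_sum_le_of_le _ fun i _ => ?_⟩
    rw [norm_smul]
    gcongr
    exact hM i x
  obtain ⟨d, hd⟩ := TopologicalSpace.exists_dense_seq (Fin k' → Fin k → ℝ)
  let P : ℕ → Set X := fun l => (S \ ⋃ i, N i) ∩ {x | ∀ j, ‖A (b (d l) j x) - w j‖ < ε}
  have hP : ∀ l, MeasurableSet (P l) := fun l => by
    refine (hS.diff (MeasurableSet.iUnion hN)).inter ?_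
    rw [ofPred_forall]
    exact MeasurableSet.iInter fun j => measurableSet_lt
      ((A.continuous.measurable.comp (hbm _ j)).sub_const _).norm measurable_const
  have hcov : S \ ⋃ i, N i ⊆ ⋃ l, P l := by
    intro x hx
    have h1 : ∀ j, ∃ c : Fin k → ℝ, ∑ i, c i • A (a i x) = w j := fun j =>
      (Submodule.mem_span_range_iff_exists_fun ℝ).1 (hw x hx.1 j)
    choose c hc using h1
    have hcont : ∀ j, Continuous fun s => ‖A (b s j x) - w j‖ := fun j => by
      simp only [b]; fun_prop
    have ho : IsOpen {s | ∀ j, ‖A (b s j x) - w j‖ < ε} := by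
      rw [ofPred_forall]
      exact isOpen_iInter_of_finite fun j => isOpen_lt (hcont j) continuous_const
    obtain ⟨l, hl⟩ := hd.exists_mem_open ho ⟨c, fun j => by
      have : A (b c j x) = w j := by simp only [b, map_sum, map_smul]; exact hc j
      rw [this, sub_self, norm_zero]; exact hε⟩
    exact mem_iUnion.2 ⟨l, hx, hl⟩
  have hex : ∀ l (r : ℕ), ∃ K ⊆ P l, IsCompact K ∧ μ (P l \ K) < ((r : ℝ≥0∞) + 1)⁻¹ := fun l r =>
    (hP l).exists_isCompact_sdiff_lt (measure_ne_top _ _) (by simp)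
  choose B hBP hBc hBμ using hex
  refine ⟨fun p => B p.unpair.1 p.unpair.2, fun p j x => A (b (d p.unpair.1) j x),
    fun p => hBc _ _, fun p x hx => (hBP _ _ hx).1.1, ?_,
    fun p j => A.continuous.measurable.comp (hbm _ j), fun p j => ?_,
    fun p x hx j => ((hBP _ _ hx).2 j).le, fun p => ?_⟩
  · have h1 : S \ ⋃ p : ℕ, B p.unpair.1 p.unpair.2 ⊆ (⋃ i, N i) ∪ ⋃ l, ⋂ r, P l \ B l r := by
      intro x hx
      by_cases hxN : x ∈ ⋃ i, N i
      · exact Or.inl hxN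
      · obtain ⟨l, hl⟩ := mem_iUnion.1 (hcov ⟨hx.1, hxN⟩)
        refine Or.inr (mem_iUnion.2 ⟨l, mem_iInter.2 fun r => ⟨hl, fun h => hx.2 ?_⟩⟩)
        refine mem_iUnion.2 ⟨Nat.pair l r, ?_⟩
        rw [Nat.unpair_pair]; exact h
    refine measure_mono_null h1 (measure_union_null (measure_iUnion_null hNμ)
      (measure_iUnion_null fun l => ?_))
    refine le_antisymm (le_of_tendsto_of_tendsto' tendsto_const_nhds
      (ENNReal.tendsto_inv_nat_nhds_zero.comp (tendsto_add_atTop_nat 1)) fun r => ?_) zero_le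
    refine (measure_mono (iInter_subset _ r)).trans ((hBμ l r).le.trans ?_)
    simp
  · obtain ⟨M, hM⟩ := hbb (d p.unpair.1) j
    exact ⟨‖A‖ * M, fun x => (A.le_opNorm _).trans (by gcongr; exact hM x)⟩
  · set l := p.unpair.1
    set K₀ := B l p.unpair.2
    have hq : Continuous fun x => A (ψ x) := A.continuous.comp hψ
    have hKN : ∀ i, K₀ ⊆ S \ N i := fun i x hx =>
      ⟨(hBP _ _ hx).1.1, fun h => (hBP _ _ hx).1.2 (mem_iUnion.2 ⟨i, h⟩)⟩
    obtain ⟨ρ, hρ, h⟩ := LocalFlow.exists_uniform hψ fun i => hfl i K₀ (hKN i) (hBc _ _)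
    let c : ℝ≥0 := ∑ j, ∑ i, ‖d l j i‖₊
    have hc : ∀ j, ∑ i, |d l j i| ≤ c := fun j => by
      simp only [c, NNReal.coe_sum, coe_nnnorm, ← Real.norm_eq_abs]
      exact Finset.single_le_sum (f := fun j => ∑ i, ‖d l j i‖)
        (fun j _ => Finset.sum_nonneg fun i _ => norm_nonneg _) (Finset.mem_univ j)
    refine ⟨c • ρ.map fun x => A (ψ x), inferInstance, fun δ hδ => ?_⟩
    obtain ⟨σ, ν, hσ, hν, hσδ, hb⟩ := h (δ / (c * ‖A‖ + 1)) (by positivity)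
    refine ⟨(c * ‖A‖₊) • σ.map fun x => A (ψ x), c • ν.map fun x => A (ψ x), inferInstance,
      inferInstance, ?_, fun j K V hV h0 h1 χ hχ D hD hD0 hχD => ?_⟩
    · rw [Measure.real, Measure.smul_apply, Measure.map_apply hq.measurable MeasurableSet.univ,
        preimage_univ, ENNReal.toReal_smul, NNReal.smul_def, smul_eq_mul]
      rw [le_div_iff₀ (by positivity)] at hσδ
      have : (0 : ℝ) ≤ σ.real univ := measureReal_nonneg
      push_cast
      rw [Measure.real] at *
      nlinarith
    · have hi : ∀ f : F → ℝ, Continuous f → ∀ τ : Measure X, ∫ z, f z ∂(τ.map fun x => A (ψ x)) =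
          ∫ x, f (A (ψ x)) ∂τ := fun f hf τ =>
        integral_map hq.aemeasurable hf.aestronglyMeasurable
      have hχA : ContDiff ℝ 1 fun y => χ (A y) := hχ.comp A.contDiff
      have hfd : ∀ y u, fderiv ℝ (fun y => χ (A y)) y u = fderiv ℝ χ (A y) (A u) := by
        intro y u
        have h1 : HasFDerivAt (fun y => χ (A y)) ((fderiv ℝ χ (A y)).comp A) y :=
          ((hχ.differentiable one_ne_zero (A y)).hasFDerivAt).comp y A.hasFDerivAt
        rw [h1.fderiv]; rfl
      have hT : ∫ x in K₀, V x * fderiv ℝ χ (A (ψ x)) (A (b (d l) j x)) ∂μ =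
          ∑ i, d l j i * ∫ x in K₀, V x * fderiv ℝ (fun y => χ (A y)) (ψ x) (a i x) ∂μ := by
        simp_rw [← integral_const_mul]
        rw [← integral_finsetSum]
        · refine integral_congr_ae (Eventually.of_forall fun x => ?_)
          simp only [b, ← hfd, map_sum, map_smul, smul_eq_mul, Finset.mul_sum]
          exact Finset.sum_congr rfl fun i _ => by ring
        · intro i _
          exact ((integrable_mul_fderiv hψ hV.continuous hχA (ha i) (hab i)).integrableOn).const_mul _
      rw [hT, integral_smul_nnreal_measure, integral_smul_nnreal_measure,
        integral_smul_nnreal_measure, hi D hD, hi _ hχ.continuous.abs, hi _ hχ.continuous.abs]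
      have hbi := fun i => hb i K V hV h0 h1 (fun y => χ (A y)) hχA (fun y => ‖A‖ * D (A y))
        (by fun_prop) (fun y => mul_nonneg (norm_nonneg _) (hD0 _)) fun y z => by
          refine (hχD (A y) (A z)).trans ?_
          rw [← map_sub, ← mul_add, ← mul_assoc, mul_comm ‖y - z‖]
          exact mul_le_mul_of_nonneg_right (A.le_opNorm _) (add_nonneg (hD0 _) (hD0 _))
      set R := ∫ x, ‖A‖ * D (A (ψ x)) ∂σ + K * ∫ x, |χ (A (ψ x))| ∂ρ + ∫ x, |χ (A (ψ x))| ∂ν with hR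
      have hR0 : 0 ≤ R := by
        have e1 : 0 ≤ ∫ x, ‖A‖ * D (A (ψ x)) ∂σ :=
          integral_nonneg fun x => mul_nonneg (norm_nonneg _) (hD0 _)
        have e2 : 0 ≤ ∫ x, |χ (A (ψ x))| ∂ρ := integral_nonneg fun x => abs_nonneg _
        have e3 : 0 ≤ ∫ x, |χ (A (ψ x))| ∂ν := integral_nonneg fun x => abs_nonneg _
        positivity
      calc |∑ i, d l j i * ∫ x in K₀, V x * fderiv ℝ (fun y => χ (A y)) (ψ x) (a i x) ∂μ|
          ≤ ∑ i, |d l j i| * R := by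
            refine (Finset.abs_sum_le_sum_abs _ _).trans (Finset.sum_le_sum fun i _ => ?_)
            rw [abs_mul]
            exact mul_le_mul_of_nonneg_left (hbi i) (abs_nonneg _)
        _ ≤ c * R := by
            rw [← Finset.sum_mul]
            exact mul_le_mul_of_nonneg_right (hc j) hR0
        _ = _ := by
            rw [hR, integral_const_mul]
            simp only [NNReal.smul_def, smul_eq_mul, NNReal.coe_mul, coe_nnnorm]
            ring

/-- Comparison of measures of small balls gives a comparison of the integrals of radially
decreasing functions. -/
lemma integral_antitone_dist_le {F : Type*} [MetricSpace F] [MeasurableSpace F] [BorelSpace F]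
    (σ π : Measure F) [IsFiniteMeasure σ] [IsFiniteMeasure π] (z₀ : F) {r₀ : ℝ} (hr₀ : 0 < r₀)
    {c : ℝ} (hc : 0 ≤ c)
    (h : ∀ r, 0 < r → r ≤ r₀ → σ (closedBall z₀ r) ≤ ENNReal.ofReal c * π (closedBall z₀ r))
    {f : ℝ → ℝ} (hf : Continuous f) (hfa : AntitoneOn f (Ici 0)) (hf0 : ∀ r, 0 ≤ f r) :
    ∫ z, f (dist z z₀) ∂σ ≤ c * ∫ z, f (dist z z₀) ∂π + f r₀ * σ.real univ := by
  have hball : ∀ r, 0 < r → r ≤ r₀ → σ (ball z₀ r) ≤ ENNReal.ofReal c * π (ball z₀ r) := by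
    intro r hr hr'
    have e1 : ball z₀ r = ⋃ k : ℕ, closedBall z₀ (r - r / (k + 2)) := by
      ext z
      simp only [mem_ball, mem_iUnion, mem_closedBall]
      constructor
      · intro hz
        obtain ⟨k, hk⟩ := exists_nat_gt (r / (r - dist z z₀))
        refine ⟨k, ?_⟩
        have h1 : 0 < r - dist z z₀ := by linarith
        rw [div_lt_iff₀ h1] at hk
        have h2 : r / (k + 2) ≤ r - dist z z₀ := by
          rw [div_le_iff₀ (by positivity)]; nlinarith
        linarith
      · rintro ⟨k, hk⟩
        have : 0 < r / ((k : ℝ) + 2) := by positivity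
        linarith
    have hmono : Monotone fun k : ℕ => closedBall z₀ (r - r / (k + 2)) := by
      intro i j hij
      apply closedBall_subset_closedBall
      have : (i : ℝ) ≤ j := by exact_mod_cast hij
      gcongr
    rw [e1, hmono.measure_iUnion]
    refine iSup_le fun k => (h _ ?_ ?_).trans (mul_le_mul_right
      (measure_mono (subset_iUnion (fun k : ℕ => closedBall z₀ (r - r / (k + 2))) k)) _)
    · have : r / ((k : ℝ) + 2) < r := by
        rw [div_lt_iff₀ (by positivity)]
        have : (0 : ℝ) ≤ k := by positivity
        nlinarith
      linarith
    · have : 0 < r / ((k : ℝ) + 2) := by positivity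
      linarith
  let F₀ : F → ℝ := fun z => max (f (dist z z₀) - f r₀) 0
  have hF₀c : Continuous F₀ := by
    simp only [F₀]
    exact ((hf.comp (continuous_id.dist continuous_const)).sub continuous_const).max
      continuous_const
  have hF₀0 : ∀ z, 0 ≤ F₀ z := fun z => le_max_right _ _
  have hfb : ∀ z, f (dist z z₀) ≤ f 0 := fun z => hfa (mem_Ici.2 le_rfl) dist_nonneg dist_nonneg
  have hF₀b : ∀ z, F₀ z ≤ f 0 := fun z => max_le (by linarith [hfb z, hf0 r₀]) (hf0 0)
  have hlev : ∀ t, 0 < t → σ {z | t < F₀ z} ≤ ENNReal.ofReal c * π {z | t < F₀ z} := by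
    intro t ht
    set A : Set ℝ := {r | 0 ≤ r ∧ f r ≤ t + f r₀} with hA
    have hAc : IsClosed A := (isClosed_le continuous_const continuous_id).inter
      (isClosed_le hf continuous_const)
    have hr₀A : r₀ ∈ A := ⟨hr₀.le, by linarith⟩
    have hAb : BddBelow A := ⟨0, fun r hr => hr.1⟩
    have hR := hAc.csInf_mem ⟨r₀, hr₀A⟩ hAb
    set R := sInf A
    have hset : {z | t < F₀ z} = ball z₀ R := by
      ext z
      simp only [mem_ball, F₀]
      change t < max _ _ ↔ _
      rw [lt_max_iff, or_iff_left (not_lt.2 ht.le)]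
      constructor
      · intro hz
        by_contra hcon
        have := hfa hR.1 dist_nonneg (not_lt.1 hcon)
        linarith [hR.2]
      · intro hz
        by_contra hcon
        exact absurd (csInf_le hAb (show dist z z₀ ∈ A from ⟨dist_nonneg, by linarith⟩))
          (not_le.2 hz)
    rw [hset]
    rcases hR.1.eq_or_lt with h0 | h0
    · rw [← h0]; simp
    · exact hball R h0 (csInf_le hAb hr₀A)
  have hlint : ∫⁻ z, ENNReal.ofReal (F₀ z) ∂σ ≤
      ENNReal.ofReal c * ∫⁻ z, ENNReal.ofReal (F₀ z) ∂π := by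
    rw [lintegral_eq_lintegral_meas_lt σ (Eventually.of_forall hF₀0) hF₀c.aemeasurable,
      lintegral_eq_lintegral_meas_lt π (Eventually.of_forall hF₀0) hF₀c.aemeasurable,
      ← lintegral_const_mul' _ _ ENNReal.ofReal_ne_top]
    exact setLIntegral_mono' measurableSet_Ioi fun t ht => hlev t ht
  have hF₀i : ∀ τ : Measure F, IsFiniteMeasure τ → Integrable F₀ τ := fun τ _ =>
    Integrable.of_bound hF₀c.aestronglyMeasurable (f 0) (Eventually.of_forall fun z => by
      rw [Real.norm_eq_abs, abs_of_nonneg (hF₀0 z)]; exact hF₀b z)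
  have hfi : ∀ τ : Measure F, IsFiniteMeasure τ → Integrable (fun z => f (dist z z₀)) τ :=
    fun τ _ => Integrable.of_bound
      (hf.comp (continuous_id.dist continuous_const)).aestronglyMeasurable (f 0)
      (Eventually.of_forall fun z => by
        rw [Real.norm_eq_abs, abs_of_nonneg (hf0 _)]; exact hfb z)
  have hint : ∫ z, F₀ z ∂σ ≤ c * ∫ z, F₀ z ∂π := by
    rw [← ofReal_integral_eq_lintegral_ofReal (hF₀i σ inferInstance) (Eventually.of_forall hF₀0),
      ← ofReal_integral_eq_lintegral_ofReal (hF₀i π inferInstance) (Eventually.of_forall hF₀0),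
      ← ENNReal.ofReal_mul hc] at hlint
    exact (ENNReal.ofReal_le_ofReal_iff
      (mul_nonneg hc (integral_nonneg hF₀0))).1 hlint
  have h1 : ∫ z, f (dist z z₀) ∂σ ≤ ∫ z, (F₀ z + f r₀) ∂σ :=
    integral_mono (hfi σ inferInstance) ((hF₀i σ inferInstance).add (integrable_const _))
      fun z => by simp only [F₀]; linarith [le_max_left (f (dist z z₀) - f r₀) 0]
  rw [integral_add (hF₀i σ inferInstance) (integrable_const _), integral_const, smul_eq_mul] at h1
  have h2 : ∫ z, F₀ z ∂π ≤ ∫ z, f (dist z z₀) ∂π :=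
    integral_mono (hF₀i π inferInstance) (hfi π inferInstance)
      fun z => max_le (by linarith [hf0 r₀]) (hf0 _)
  nlinarith

/-- A measure with high upper densities vanishes on sets of finite lower-dimensional measure. -/
lemma measure_eq_zero_of_density {F : Type*} [MetricSpace F] [MeasurableSpace F] [BorelSpace F]
    (π : Measure F) [IsFiniteMeasure π] {α β : ℝ} (hα : 0 ≤ α) (hαβ : α < β) {D : Set F}
    (hD : Measure.hausdorffMeasure α D ≠ ∞) {Y : Set F} (hYD : Y ⊆ D)
    (hY : ∀ z ∈ Y, ∃ C : ℝ, ∀ s, 0 < s → s < 1 → π.real (closedBall z s) ≤ C * s ^ β) :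
    π Y = 0 := by
  have hβ : 0 < β := hα.trans_lt hαβ
  have hD0 : Measure.hausdorffMeasure β D = 0 :=
    (Measure.hausdorffMeasure_zero_or_top hαβ D).resolve_right hD
  let T : ℕ → Set F := fun j => {z | ∀ s, 0 < s → s < 1 → π.real (closedBall z s) ≤ j * s ^ β}
  have hTc : ∀ j, IsClosed (T j) := by
    intro j
    refine isClosed_of_closure_subset fun z hz s hs hs1 => ?_
    have hlim : Tendsto (fun δ : ℝ => j * (s + δ) ^ β) (nhdsWithin 0 (Ioi 0)) (nhds (j * s ^ β)) := by
      have : ContinuousAt (fun δ : ℝ => j * (s + δ) ^ β) 0 :=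
        continuousAt_const.mul ((continuousAt_const.add continuousAt_id).rpow_const
          (Or.inr hβ.le))
      have h := this.tendsto
      simp only [add_zero] at h
      exact h.mono_left nhdsWithin_le_nhds
    refine ge_of_tendsto hlim ?_
    filter_upwards [Ioo_mem_nhdsGT (show (0 : ℝ) < 1 - s by linarith)] with δ hδ
    obtain ⟨y, hy, hyz⟩ := Metric.mem_closure_iff.1 hz δ hδ.1
    refine (measureReal_mono (closedBall_subset_closedBall' ?_)).trans
      (hy (s + δ) (by linarith [hδ.1]) (by linarith [hδ.2]))
    linarith
  have hcov : Y ⊆ ⋃ j, T j ∩ D := by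
    intro z hz
    obtain ⟨C, hC⟩ := hY z hz
    obtain ⟨j, hj⟩ := exists_nat_ge C
    refine mem_iUnion.2 ⟨j, fun s hs hs1 => (hC s hs hs1).trans ?_, hYD hz⟩
    have := Real.rpow_nonneg hs.le β
    gcongr
  refine measure_mono_null hcov (measure_iUnion_null fun j => ?_)
  have hle : (((j : ℝ≥0) + 1)⁻¹ • π.restrict (T j)) ≤ Measure.hausdorffMeasure β := by
    refine Measure.le_hausdorffMeasure β _ (1 / 2) (by norm_num) fun t ht => ?_
    rw [Measure.smul_apply]
    by_cases hne : (t ∩ T j).Nonempty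
    · obtain ⟨z, hzt, hzT⟩ := hne
      have htop : ediam t ≠ ∞ := (ht.trans_lt (by simp)).ne
      set r := (ediam t).toReal with hr
      have hr1 : r < 1 := by
        have := ENNReal.toReal_mono (by simp) ht
        simp at this
        have h2 : (2 : ℝ)⁻¹ < 1 := by norm_num
        linarith
      have hsub : t ⊆ closedBall z r := fun y hy => by
        rw [mem_closedBall, dist_edist]
        exact ENNReal.toReal_mono htop (edist_le_ediam_of_mem hy hzt)
      have hball : π.real (closedBall z r) ≤ (j + 1) * r ^ β := by
        rcases (show 0 ≤ r from ENNReal.toReal_nonneg).eq_or_lt with h0 | h0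
        · rw [← h0, Real.zero_rpow hβ.ne', mul_zero]
          have hlim : Tendsto (fun δ : ℝ => j * δ ^ β) (nhdsWithin 0 (Ioi 0)) (nhds 0) := by
            have : ContinuousAt (fun δ : ℝ => j * δ ^ β) 0 :=
              continuousAt_const.mul (continuousAt_id.rpow_const (Or.inr hβ.le))
            have h := this.tendsto
            simp only [Real.zero_rpow hβ.ne', mul_zero] at h
            exact h.mono_left nhdsWithin_le_nhds
          refine ge_of_tendsto hlim ?_
          filter_upwards [Ioo_mem_nhdsGT (zero_lt_one' ℝ)] with δ hδ
          exact (measureReal_mono (closedBall_subset_closedBall hδ.1.le)).trans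
            (hzT δ hδ.1 hδ.2)
        · refine (hzT r h0 hr1).trans ?_
          have := Real.rpow_nonneg h0.le β
          gcongr
          linarith
      have h1 : π.restrict (T j) t ≤ ENNReal.ofReal ((j + 1) * r ^ β) :=
        ((Measure.restrict_apply_le _ _).trans (measure_mono hsub)).trans
          ((ENNReal.le_ofReal_iff_toReal_le (measure_ne_top _ _)
            (by have := Real.rpow_nonneg (show 0 ≤ r from ENNReal.toReal_nonneg) β; positivity)).2
            hball)
      have h2 : ediam t ^ β = ENNReal.ofReal (r ^ β) := by
        rw [← ENNReal.ofReal_rpow_of_nonneg ENNReal.toReal_nonneg hβ.le,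
          ENNReal.ofReal_toReal htop]
      rw [h2, ENNReal.smul_def, smul_eq_mul]
      calc _ ≤ (((j : ℝ≥0) + 1)⁻¹ : ℝ≥0) * ENNReal.ofReal ((j + 1) * r ^ β) := by gcongr
        _ = ENNReal.ofReal (r ^ β) := by
          rw [← ENNReal.ofReal_coe_nnreal, ← ENNReal.ofReal_mul (by positivity)]
          congr 1
          push_cast
          field_simp
    · have h0 : π.restrict (T j) t = 0 := by
        refine measure_mono_null (t := (T j)ᶜ) (fun y hy hyT => hne ⟨y, hy, hyT⟩) ?_
        rw [Measure.restrict_apply (hTc j).measurableSet.compl]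
        simp
      rw [h0]; simp
  have h1 : (((j : ℝ≥0) + 1)⁻¹ • π.restrict (T j)) D = 0 :=
    le_antisymm ((hle D).trans hD0.le) zero_le
  rw [Measure.smul_apply, ENNReal.smul_def, smul_eq_mul, mul_eq_zero] at h1
  have h2 := h1.resolve_left (by simp)
  rw [inter_comm]
  rwa [Measure.restrict_apply' (hTc j).measurableSet] at h2

/-- A regularisation of the function `r ^ (-β)`. -/
def regPow (β s r : ℝ) : ℝ := (r ^ 2 + s ^ 2) ^ (-β / 2)

lemma regPow_pos {β s : ℝ} (hs : 0 < s) (r : ℝ) : 0 < regPow β s r :=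
  Real.rpow_pos_of_pos (by positivity) _

lemma continuous_regPow {β s : ℝ} (hs : 0 < s) : Continuous (regPow β s) :=
  Continuous.rpow_const (by fun_prop) fun r => Or.inl (by positivity)

lemma antitoneOn_regPow {β s : ℝ} (hβ : 0 ≤ β) (hs : 0 < s) : AntitoneOn (regPow β s) (Ici 0) :=
  fun a ha b _ hab => Real.rpow_le_rpow_of_nonpos (by positivity)
    (by have : 0 ≤ a := ha; gcongr) (by linarith)

lemma regPow_le {β s r : ℝ} (hβ : 0 ≤ β) (hr : 0 < r) : regPow β s r ≤ (r ^ 2) ^ (-β / 2) :=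
  Real.rpow_le_rpow_of_nonpos (by positivity) (by nlinarith [sq_nonneg s]) (by linarith)

lemma mul_regPow_le {β s r η : ℝ} (hβ : 1 ≤ β) (hη : 0 < η) (hr : η ≤ r) :
    r * regPow β s r ≤ (η ^ 2) ^ ((1 - β) / 2) := by
  have hr0 : 0 < r := hη.trans_le hr
  have hg : 0 < r ^ 2 + s ^ 2 := by positivity
  calc r * regPow β s r ≤ (r ^ 2 + s ^ 2) ^ (1 / 2 : ℝ) * regPow β s r := by
        gcongr
        · exact (Real.rpow_pos_of_pos hg _).le
        · rw [← Real.sqrt_eq_rpow]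
          exact Real.le_sqrt_of_sq_le (by nlinarith [sq_nonneg s])
    _ = (r ^ 2 + s ^ 2) ^ ((1 - β) / 2) := by
        rw [regPow, ← Real.rpow_add hg]; congr 1; ring
    _ ≤ _ := Real.rpow_le_rpow_of_nonpos (by positivity) (by nlinarith [sq_nonneg s])
        (by linarith)

lemma regPow_self {β s : ℝ} (hs : 0 < s) : s ^ β * regPow β s s = 2 ^ (-β / 2) := by
  rw [regPow, ← two_mul, Real.mul_rpow (by norm_num) (by positivity), ← Real.rpow_natCast,
    ← Real.rpow_mul hs.le, mul_left_comm, ← Real.rpow_add hs]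
  have : β + (2 : ℕ) * (-β / 2) = 0 := by push_cast; ring
  rw [this, Real.rpow_zero, mul_one]

lemma mul_regPow_sub_le {β s a b : ℝ} (hβ : 1 ≤ β) (hs : 0 < s) (ha : 0 ≤ a) (hab : a ≤ b) :
    b * (regPow β s a - regPow β s b) ≤ β * regPow β s a * (b - a) := by
  rcases (ha.trans hab).eq_or_lt with hb | hb
  · rw [← hb] at hab ⊢
    have : a = 0 := le_antisymm hab ha
    rw [this]; simp
  have hga : 0 < a ^ 2 + s ^ 2 := by positivity
  have hgb : 0 < b ^ 2 + s ^ 2 := by positivity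
  have h1 : regPow β s b = regPow β s a * ((a ^ 2 + s ^ 2) / (b ^ 2 + s ^ 2)) ^ (β / 2) := by
    rw [regPow, regPow, Real.div_rpow hga.le hgb.le, neg_div, Real.rpow_neg hga.le,
      Real.rpow_neg hgb.le]
    have := Real.rpow_pos_of_pos hga (β / 2)
    have := Real.rpow_pos_of_pos hgb (β / 2)
    field_simp
  have h2 : 1 + β * (a / b - 1) ≤ ((a ^ 2 + s ^ 2) / (b ^ 2 + s ^ 2)) ^ (β / 2) := by
    calc 1 + β * (a / b - 1) ≤ (1 + (a / b - 1)) ^ β :=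
          one_add_mul_self_le_rpow_one_add (by have : 0 ≤ a / b := by positivity
                                               linarith) hβ
      _ = ((a / b) ^ 2) ^ (β / 2) := by
          rw [← Real.rpow_natCast, ← Real.rpow_mul (by positivity)]
          congr 1
          · ring
          · push_cast; ring
      _ ≤ _ := by
          refine Real.rpow_le_rpow (by positivity) ?_ (by linarith)
          rw [div_pow, div_le_div_iff₀ (by positivity) hgb]
          have : a ^ 2 ≤ b ^ 2 := by gcongr
          nlinarith [sq_nonneg s]
  have hp := regPow_pos (β := β) hs a
  rw [h1]
  have h3 : b * (regPow β s a - regPow β s a * ((a ^ 2 + s ^ 2) / (b ^ 2 + s ^ 2)) ^ (β / 2)) ≤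
      b * (regPow β s a - regPow β s a * (1 + β * (a / b - 1))) := by gcongr
  refine h3.trans (le_of_eq ?_)
  field_simp
  ring

section

variable {K : ℕ} {β s : ℝ} (z₀ : EuclideanSpace ℝ (Fin K))

/-- The components of a radial vector field centred at `z₀`. -/
def radialField (β s : ℝ) (z₀ : EuclideanSpace ℝ (Fin K)) (j : Fin K)
    (z : EuclideanSpace ℝ (Fin K)) : ℝ := (z - z₀) j * regPow β s ‖z - z₀‖

lemma contDiff_radialField (hs : 0 < s) (j : Fin K) : ContDiff ℝ 1 (radialField β s z₀ j) := by
  have h1 : ContDiff ℝ 1 fun z : EuclideanSpace ℝ (Fin K) => (z - z₀) j :=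
    (EuclideanSpace.proj (𝕜 := ℝ) j).contDiff.comp (contDiff_id.sub contDiff_const)
  refine h1.mul (ContDiff.rpow_const_of_ne ?_ fun z => by positivity)
  exact (contDiff_id.sub contDiff_const).norm_sq ℝ |>.add contDiff_const

lemma fderiv_radialField (hs : 0 < s) (j : Fin K) (z v : EuclideanSpace ℝ (Fin K)) :
    fderiv ℝ (radialField β s z₀ j) z v = v j * regPow β s ‖z - z₀‖ - β * ((z - z₀) j *
      (regPow β s ‖z - z₀‖ / (‖z - z₀‖ ^ 2 + s ^ 2) * inner ℝ (z - z₀) v)) := by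
  have hg : 0 < ‖z - z₀‖ ^ 2 + s ^ 2 := by positivity
  have h0 : HasFDerivAt (fun z : EuclideanSpace ℝ (Fin K) => z - z₀)
      (ContinuousLinearMap.id ℝ _) z := (hasFDerivAt_id z).sub_const z₀
  have h1 : HasFDerivAt (fun z : EuclideanSpace ℝ (Fin K) => (z - z₀) j)
      ((EuclideanSpace.proj (𝕜 := ℝ) j).comp (ContinuousLinearMap.id ℝ _)) z :=
    ((EuclideanSpace.proj (𝕜 := ℝ) j).hasFDerivAt).comp z h0
  have h2 := (h0.norm_sq.add_const (s ^ 2)).rpow_const (p := -β / 2) (Or.inl hg.ne')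
  have h3 := h1.mul h2
  have h4 : fderiv ℝ (radialField β s z₀ j) z = _ := h3.fderiv
  rw [h4]
  have e : (‖z - z₀‖ ^ 2 + s ^ 2) ^ (-β / 2 - 1) =
      regPow β s ‖z - z₀‖ / (‖z - z₀‖ ^ 2 + s ^ 2) := by
    rw [Real.rpow_sub_one hg.ne']; rfl
  rw [e]
  simp [regPow, inner_sub_left]
  ring

lemma abs_fderiv_radialField_le (hβ : 0 ≤ β) (hs : 0 < s) (j : Fin K)
    (z v : EuclideanSpace ℝ (Fin K)) :
    |fderiv ℝ (radialField β s z₀ j) z v| ≤ (1 + β) * regPow β s ‖z - z₀‖ * ‖v‖ := by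
  rw [fderiv_radialField z₀ hs]
  have hp := regPow_pos (β := β) hs ‖z - z₀‖
  have hg : 0 < ‖z - z₀‖ ^ 2 + s ^ 2 := by positivity
  have h1 : |v j| ≤ ‖v‖ := PiLp.norm_apply_le v j
  have h2 : |(z - z₀) j| ≤ ‖z - z₀‖ := PiLp.norm_apply_le (z - z₀) j
  have h3 := abs_real_inner_le_norm (z - z₀) v
  refine (abs_sub _ _).trans ?_
  rw [abs_mul, abs_mul, abs_mul, abs_mul, abs_of_pos hp, abs_of_nonneg hβ,
    abs_of_pos (div_pos hp hg)]
  have h4 : |(z - z₀) j| * (regPow β s ‖z - z₀‖ / (‖z - z₀‖ ^ 2 + s ^ 2) * |inner ℝ (z - z₀) v|) ≤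
      regPow β s ‖z - z₀‖ * ‖v‖ := by
    calc _ ≤ ‖z - z₀‖ * (regPow β s ‖z - z₀‖ / (‖z - z₀‖ ^ 2 + s ^ 2) * (‖z - z₀‖ * ‖v‖)) := by
          gcongr
      _ = regPow β s ‖z - z₀‖ * ‖v‖ * (‖z - z₀‖ ^ 2 / (‖z - z₀‖ ^ 2 + s ^ 2)) := by
          field_simp
      _ ≤ regPow β s ‖z - z₀‖ * ‖v‖ * 1 := by
          gcongr
          rw [div_le_one hg]
          nlinarith [sq_nonneg s]
      _ = _ := mul_one _
  nlinarith [mul_le_mul_of_nonneg_left h4 hβ, mul_le_mul_of_nonneg_right h1 hp.le]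

lemma div_radialField (hβ : 0 ≤ β) (hs : 0 < s) (z : EuclideanSpace ℝ (Fin K)) :
    (K - β) * regPow β s ‖z - z₀‖ ≤
      ∑ j, fderiv ℝ (radialField β s z₀ j) z (EuclideanSpace.single j 1) := by
  have hp := regPow_pos (β := β) hs ‖z - z₀‖
  have hg : 0 < ‖z - z₀‖ ^ 2 + s ^ 2 := by positivity
  have h1 : ∑ j, fderiv ℝ (radialField β s z₀ j) z (EuclideanSpace.single j 1) =
      K * regPow β s ‖z - z₀‖ - β * (regPow β s ‖z - z₀‖ / (‖z - z₀‖ ^ 2 + s ^ 2) *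
        ‖z - z₀‖ ^ 2) := by
    simp_rw [fderiv_radialField z₀ hs]
    rw [Finset.sum_sub_distrib, ← Finset.mul_sum, EuclideanSpace.norm_sq_eq]
    congr 1
    · simp
    · congr 1
      rw [Finset.mul_sum]
      refine Finset.sum_congr rfl fun j _ => ?_
      rw [EuclideanSpace.inner_single_right]
      simp
      ring
  rw [h1, sub_mul]
  have h2 : regPow β s ‖z - z₀‖ / (‖z - z₀‖ ^ 2 + s ^ 2) * ‖z - z₀‖ ^ 2 ≤
      regPow β s ‖z - z₀‖ := by
    rw [div_mul_eq_mul_div, div_le_iff₀ hg]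
    nlinarith [sq_nonneg s]
  nlinarith [mul_le_mul_of_nonneg_left h2 hβ]

lemma radialField_two_point (hβ : 1 ≤ β) (hs : 0 < s) (j : Fin K)
    (y z : EuclideanSpace ℝ (Fin K)) :
    |radialField β s z₀ j y - radialField β s z₀ j z| ≤
      ‖y - z‖ * ((1 + β) * regPow β s ‖y - z₀‖ + (1 + β) * regPow β s ‖z - z₀‖) := by
  wlog h : ‖y - z₀‖ ≤ ‖z - z₀‖ generalizing y z
  · rw [abs_sub_comm, norm_sub_rev, add_comm]
    exact this z y (le_of_not_ge h)
  have hp := regPow_pos (β := β) hs ‖z - z₀‖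
  have hp' := regPow_pos (β := β) hs ‖y - z₀‖
  have h1 := mul_regPow_sub_le hβ hs (norm_nonneg _) h
  have h2 : |(y - z₀) j - (z - z₀) j| ≤ ‖y - z‖ := by
    have := PiLp.norm_apply_le (y - z) j
    simpa using this
  have h3 : |(z - z₀) j| ≤ ‖z - z₀‖ := PiLp.norm_apply_le (z - z₀) j
  have h4 : ‖z - z₀‖ - ‖y - z₀‖ ≤ ‖y - z‖ := by
    have := norm_sub_norm_le (z - z₀) (y - z₀)
    rwa [sub_sub_sub_cancel_right, norm_sub_rev z y] at this
  have h5 := antitoneOn_regPow (zero_le_one.trans hβ) hs (norm_nonneg (y - z₀))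
    (norm_nonneg (z - z₀)) h
  have e : radialField β s z₀ j y - radialField β s z₀ j z =
      ((y - z₀) j - (z - z₀) j) * regPow β s ‖y - z₀‖ +
        (z - z₀) j * (regPow β s ‖y - z₀‖ - regPow β s ‖z - z₀‖) := by
    simp only [radialField]; ring
  rw [e]
  refine (abs_add_le _ _).trans ?_
  rw [abs_mul, abs_mul, abs_of_pos hp', abs_of_nonneg (sub_nonneg.2 h5)]
  have h6 : |(z - z₀) j| * (regPow β s ‖y - z₀‖ - regPow β s ‖z - z₀‖) ≤
      β * regPow β s ‖y - z₀‖ * ‖y - z‖ := by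
    calc _ ≤ ‖z - z₀‖ * (regPow β s ‖y - z₀‖ - regPow β s ‖z - z₀‖) := by
          have := sub_nonneg.2 h5
          gcongr
      _ ≤ _ := h1.trans (by gcongr)
  have h7 : 0 ≤ ‖y - z‖ * ((1 + β) * regPow β s ‖z - z₀‖) := by positivity
  nlinarith [mul_le_mul_of_nonneg_right h2 hp'.le]

end

section

variable {F : Type*} [MetricSpace F] [MeasurableSpace F] [BorelSpace F]

lemma ae_exists_radius_le_mul [SecondCountableTopology F] [HasBesicovitchCovering F]
    (σ π : Measure F) [IsFiniteMeasure σ] [IsLocallyFiniteMeasure π] :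
    ∀ᵐ z ∂π, ∀ c : ℝ≥0∞, σ.rnDeriv π z < c →
      ∃ r₀ : ℝ, 0 < r₀ ∧ ∀ r, 0 < r → r ≤ r₀ → σ (closedBall z r) ≤ c * π (closedBall z r) := by
  filter_upwards [Besicovitch.ae_tendsto_rnDeriv σ π] with z hz c hc
  obtain ⟨r₀, hr₀, h⟩ := mem_nhdsGT_iff_exists_Ioc_subset.1 (hz.eventually (gt_mem_nhds hc))
  refine ⟨r₀, hr₀, fun r hr hr' => ?_⟩
  have h1 : σ (closedBall z r) / π (closedBall z r) < c := h ⟨hr, hr'⟩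
  by_cases h0 : π (closedBall z r) = 0
  · have h2 : σ (closedBall z r) = 0 := by
      by_contra h3
      rw [h0, ENNReal.div_zero h3] at h1
      exact not_top_lt h1
    rw [h2]; exact zero_le
  · exact (ENNReal.div_le_iff_le_mul (Or.inl h0) (Or.inr (pos_of_gt h1).ne')).1 h1.le

lemma measure_le_rnDeriv_le (σ π : Measure F) (c : ℝ≥0∞) :
    c * π {z | c ≤ σ.rnDeriv π z} ≤ σ univ :=
  (mul_meas_ge_le_lintegral (Measure.measurable_rnDeriv σ π) c).trans Measure.lintegral_rnDeriv_le

end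

/-- If a flow frame has more independent fields than the dimension, the integrals of the
divergences of the radial fields are controlled. -/
lemma FlowAlong.integral_regPow_le {X : Type*} [MetricSpace X] [CompactSpace X]
    [MeasurableSpace X] [BorelSpace X] (μ : Measure X) [IsFiniteMeasure μ] {K : ℕ}
    {q : X → EuclideanSpace ℝ (Fin K)} (hq : Continuous q) {B : Set X} (hB : IsCompact B) {β : ℝ}
    (hβ : 1 ≤ β) (hβK : β + 1 / 2 ≤ K) {v : Fin K → X → EuclideanSpace ℝ (Fin K)}
    (hvm : ∀ j, Measurable (v j)) (hvb : ∀ j, ∃ M, ∀ x, ‖v j x‖ ≤ M)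
    (hv : ∀ x ∈ B, ∀ j, ‖v j x - EuclideanSpace.single j 1‖ ≤ 1 / (4 * K * (1 + β)))
    (hfl : FlowAlong q μ B v) {ε : ℝ} (hε : 0 < ε) :
    ∃ σ ν : Measure (EuclideanSpace ℝ (Fin K)), IsFiniteMeasure σ ∧ IsFiniteMeasure ν ∧
      σ.real univ ≤ ε ∧ ∀ z₀ : EuclideanSpace ℝ (Fin K), ∀ s, 0 < s →
        ∫ z, regPow β s (dist z z₀) ∂((μ.restrict B).map q) ≤
          4 * K * (1 + β) * ∫ z, regPow β s (dist z z₀) ∂σ +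
            4 * K * ∫ z, dist z z₀ * regPow β s (dist z z₀) ∂ν := by
  obtain ⟨ρ, hρ, h⟩ := hfl
  obtain ⟨σ, ν, hσ, hν, hσε, hb⟩ := h ε hε
  refine ⟨σ, ν, hσ, hν, hσε, fun z₀ s hs => ?_⟩
  have hK : (0 : ℝ) < K := by linarith
  have hgc : Continuous fun z => regPow β s (dist z z₀) :=
    (continuous_regPow hs).comp (continuous_id.dist continuous_const)
  have hb1 : ∀ j, |∫ x in B, fderiv ℝ (radialField β s z₀ j) (q x) (v j x) ∂μ| ≤
      (1 + β) * ∫ z, regPow β s (dist z z₀) ∂σ + ∫ z, dist z z₀ * regPow β s (dist z z₀) ∂ν := by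
    intro j
    have h1 := hb j 0 (fun _ => 1) (LipschitzWith.const' 1) (fun _ => zero_le_one) (fun _ => le_rfl)
      (radialField β s z₀ j) (contDiff_radialField z₀ hs j)
      (fun z => (1 + β) * regPow β s (dist z z₀)) (by fun_prop)
      (fun z => mul_nonneg (by linarith) (regPow_pos hs _).le) (fun y z => by
        simp only [dist_eq_norm]
        exact radialField_two_point z₀ hβ hs j y z)
    simp only [one_mul, NNReal.coe_zero, zero_mul, add_zero, integral_const_mul] at h1
    refine h1.trans (add_le_add le_rfl ?_)
    by_cases hint : Integrable (fun z => dist z z₀ * regPow β s (dist z z₀)) ν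
    · refine integral_mono_of_nonneg (Eventually.of_forall fun z => abs_nonneg _) hint
        (Eventually.of_forall fun z => ?_)
      simp only [radialField, abs_mul, abs_of_pos (regPow_pos (β := β) hs ‖z - z₀‖), dist_eq_norm]
      exact mul_le_mul_of_nonneg_right (PiLp.norm_apply_le (z - z₀) j) (regPow_pos hs _).le
    · exfalso
      refine hint (Integrable.of_bound (continuous_id.dist continuous_const |>.mul
        hgc).aestronglyMeasurable (1 * (s ^ 2) ^ (-β / 2) + ((1 : ℝ) ^ 2) ^ ((1 - β) / 2))
        (Eventually.of_forall fun z => ?_))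
      have hp := regPow_pos (β := β) hs (dist z z₀)
      rw [Real.norm_eq_abs, abs_of_nonneg (mul_nonneg dist_nonneg hp.le)]
      have e1 : 0 ≤ 1 * (s ^ 2) ^ (-β / 2) := by positivity
      have e2 : (0 : ℝ) ≤ ((1 : ℝ) ^ 2) ^ ((1 - β) / 2) := by positivity
      rcases le_total (dist z z₀) 1 with h | h
      · refine (mul_le_mul h (c := regPow β s (dist z z₀)) (d := (s ^ 2) ^ (-β / 2)) ?_ hp.le
          zero_le_one).trans (le_add_of_nonneg_right e2)
        exact Real.rpow_le_rpow_of_nonpos (by positivity) (by nlinarith [sq_nonneg (dist z z₀)])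
          (by linarith)
      · exact (mul_regPow_le hβ one_pos h).trans (le_add_of_nonneg_left e1)
  have hint : ∀ j, IntegrableOn (fun x => fderiv ℝ (radialField β s z₀ j) (q x) (v j x)) B μ := by
    intro j
    have := (integrable_mul_fderiv (μ := μ) hq (continuous_const (y := (1 : ℝ)))
      (contDiff_radialField (β := β) z₀ hs j) (hvm j) (hvb j)).integrableOn (s := B)
    simpa only [one_mul] using this
  have hlow : 1 / 4 * ∫ z, regPow β s (dist z z₀) ∂((μ.restrict B).map q) ≤
      ∑ j, ∫ x in B, fderiv ℝ (radialField β s z₀ j) (q x) (v j x) ∂μ := by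
    rw [integral_map hq.aemeasurable hgc.aestronglyMeasurable, ← integral_const_mul,
      ← integral_finsetSum _ fun j _ => hint j]
    refine setIntegral_mono_on ?_ (integrable_finsetSum _ fun j _ => hint j)
      hB.isClosed.measurableSet fun x hx => ?_
    · have hc : Continuous fun x => 1 / 4 * regPow β s (dist (q x) z₀) :=
        continuous_const.mul (hgc.comp hq)
      exact ((BoundedContinuousFunction.mkOfCompact ⟨_, hc⟩).integrable μ).integrableOn
    · have hp := regPow_pos (β := β) hs ‖q x - z₀‖
      have h1 := div_radialField z₀ (β := β) (by linarith) hs (q x)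
      have h2 : ∀ j, fderiv ℝ (radialField β s z₀ j) (q x) (EuclideanSpace.single j 1) -
          regPow β s ‖q x - z₀‖ / (4 * K) ≤ fderiv ℝ (radialField β s z₀ j) (q x) (v j x) := by
        intro j
        have h3 := abs_fderiv_radialField_le z₀ (β := β) (by linarith) hs j (q x)
          (v j x - EuclideanSpace.single j 1)
        rw [map_sub] at h3
        have h4 := (abs_le.1 h3).1
        have h5 : (1 + β) * regPow β s ‖q x - z₀‖ * ‖v j x - EuclideanSpace.single j 1‖ ≤
            (1 + β) * regPow β s ‖q x - z₀‖ * (1 / (4 * K * (1 + β))) := by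
          have : 0 ≤ 1 + β := by linarith
          gcongr
          exact hv x hx j
        have h6 : (1 + β) * regPow β s ‖q x - z₀‖ * (1 / (4 * K * (1 + β))) =
            regPow β s ‖q x - z₀‖ / (4 * K) := by
          have : 1 + β ≠ 0 := by linarith
          field_simp
        linarith
      have h7 := Finset.sum_le_sum fun j (_ : j ∈ Finset.univ) => h2 j
      rw [Finset.sum_sub_distrib] at h7
      simp only [Finset.sum_const, Finset.card_univ, Fintype.card_fin, nsmul_eq_mul] at h7
      have h8 : (K : ℝ) * (regPow β s ‖q x - z₀‖ / (4 * K)) = regPow β s ‖q x - z₀‖ / 4 := by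
        field_simp
      rw [dist_eq_norm]
      nlinarith
  have hup : ∑ j, ∫ x in B, fderiv ℝ (radialField β s z₀ j) (q x) (v j x) ∂μ ≤
      ∑ _j : Fin K, ((1 + β) * ∫ z, regPow β s (dist z z₀) ∂σ +
        ∫ z, dist z z₀ * regPow β s (dist z z₀) ∂ν) :=
    Finset.sum_le_sum fun j _ => (le_abs_self _).trans (hb1 j)
  simp only [Finset.sum_const, Finset.card_univ, Fintype.card_fin, nsmul_eq_mul] at hup
  linarith

/-- In the image of a space of finite `n`-dimensional measure there are at most `n` independent
flows. -/
theorem not_flowAlong_of_lt {X : Type*} [MetricSpace X] [CompactSpace X]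
    [MeasurableSpace X] [BorelSpace X] {n : ℕ} (hn : 0 < n)
    (hX : Measure.hausdorffMeasure n (univ : Set X) ≠ ∞) (μ : Measure X) [IsFiniteMeasure μ]
    {q : X → EuclideanSpace ℝ (Fin (n + 1))} {L : ℝ≥0} (hq : LipschitzWith L q) {B : Set X}
    (hB : IsCompact B) (hμB : μ B ≠ 0) {v : Fin (n + 1) → X → EuclideanSpace ℝ (Fin (n + 1))}
    (hvm : ∀ j, Measurable (v j)) (hvb : ∀ j, ∃ M, ∀ x, ‖v j x‖ ≤ M)
    (hv : ∀ x ∈ B, ∀ j, ‖v j x - EuclideanSpace.single j 1‖ ≤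
      1 / (4 * (n + 1) * (1 + (n + 1 / 2)))) :
    ¬ FlowAlong q μ B v := by
  intro hfl
  have hn1 : (1 : ℝ) ≤ n := by exact_mod_cast hn
  set β : ℝ := n + 1 / 2 with hβdef
  have hβ : 1 ≤ β := by linarith
  set π : Measure (EuclideanSpace ℝ (Fin (n + 1))) := (μ.restrict B).map q with hπ
  set D : Set (EuclideanSpace ℝ (Fin (n + 1))) := q '' B with hD
  have hDc : IsCompact D := hB.image hq.continuous
  have hDH : Measure.hausdorffMeasure n D ≠ ∞ := by
    refine ((hq.hausdorffMeasure_image_le (Nat.cast_nonneg n) B).trans_lt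
      (ENNReal.mul_lt_top ?_ ((measure_mono (subset_univ B)).trans_lt hX.lt_top))).ne
    exact ENNReal.rpow_lt_top_of_nonneg (Nat.cast_nonneg n) ENNReal.coe_ne_top
  have hπu : π univ = μ B := by
    rw [hπ, Measure.map_apply hq.continuous.measurable MeasurableSet.univ, preimage_univ,
      Measure.restrict_apply_univ]
  have hπD : π Dᶜ = 0 := by
    rw [hπ, Measure.map_apply hq.continuous.measurable hDc.isClosed.measurableSet.compl,
      Measure.restrict_apply (hq.continuous.measurable hDc.isClosed.measurableSet.compl)]
    convert measure_empty (μ := μ) using 2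
    ext x
    simp only [mem_inter_iff, mem_preimage, mem_compl_iff, mem_empty_iff_false, iff_false, not_and]
    exact fun h hx => h (mem_image_of_mem _ hx)
  set c : ℝ := 1 / (16 * (n + 1) * (1 + β)) with hc
  have hc0 : 0 < c := by positivity
  have hμB0 : 0 < π.real univ := by
    rw [Measure.real, hπu]; exact ENNReal.toReal_pos hμB (measure_ne_top _ _)
  obtain ⟨σ, ν, hσ, hν, hσε, hineq⟩ := FlowAlong.integral_regPow_le μ hq.continuous hB hβ
    (by push_cast; linarith) hvm hvb (fun x hx j => by push_cast; exact hv x hx j) hfl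
    (ε := c * π.real univ / 2) (by positivity)
  push_cast at hineq
  set Y := {z | σ.rnDeriv π z < ENNReal.ofReal c} with hY
  have hdens : ∀ᵐ z ∂π, z ∈ Y → ∃ C : ℝ, ∀ s, 0 < s → s < 1 →
      π.real (closedBall z s) ≤ C * s ^ β := by
    filter_upwards [ae_exists_radius_le_mul σ π, ae_exists_radius_le_mul ν π,
      Measure.rnDeriv_lt_top ν π] with z h1 h2 h3 hz
    obtain ⟨r₁, hr₁, h1⟩ := h1 _ hz
    obtain ⟨M, hM⟩ := ENNReal.lt_iff_exists_nnreal_btwn.1 h3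
    obtain ⟨r₂, hr₂, h2⟩ := h2 M hM.1
    set η : ℝ := 1 / (16 * (n + 1) * (M + 1)) with hη
    have hη0 : 0 < η := by positivity
    set R : ℝ := 4 * (n + 1) * (1 + β) * ((r₁ ^ 2) ^ (-β / 2) * σ.real univ) + 4 * (n + 1) *
      (η * ((r₂ ^ 2) ^ (-β / 2) * ν.real univ) + (η ^ 2) ^ ((1 - β) / 2) * ν.real univ) with hR
    refine ⟨2 * R * 2 ^ (β / 2), fun s hs hs1 => ?_⟩
    have hgc := continuous_regPow (β := β) hs
    have hga := antitoneOn_regPow (β := β) (by linarith) hs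
    have hgp := fun r => (regPow_pos (β := β) hs r).le
    have i1 := integral_antitone_dist_le σ π z hr₁ hc0.le h1 hgc hga hgp
    have i2 := integral_antitone_dist_le ν π z hr₂ M.2
      (fun r hr hr' => by
        have := h2 r hr hr'
        rwa [NNReal.val_eq_coe, ENNReal.ofReal_coe_nnreal]) hgc hga hgp
    have hgi : ∀ τ : Measure (EuclideanSpace ℝ (Fin (n + 1))), IsFiniteMeasure τ →
        Integrable (fun y => regPow β s (dist y z)) τ := fun τ _ =>
      Integrable.of_bound (hgc.comp (continuous_id.dist continuous_const)).aestronglyMeasurable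
        (regPow β s 0) (Eventually.of_forall fun y => by
          rw [Real.norm_eq_abs, abs_of_nonneg (hgp _)]
          exact hga (mem_Ici.2 le_rfl) dist_nonneg dist_nonneg)
    have i3 : ∫ y, dist y z * regPow β s (dist y z) ∂ν ≤
        η * ∫ y, regPow β s (dist y z) ∂ν + (η ^ 2) ^ ((1 - β) / 2) * ν.real univ := by
      have e : ∫ y, (η * regPow β s (dist y z) + (η ^ 2) ^ ((1 - β) / 2)) ∂ν =
          η * ∫ y, regPow β s (dist y z) ∂ν + (η ^ 2) ^ ((1 - β) / 2) * ν.real univ := by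
        rw [integral_add ((hgi ν hν).const_mul _) (integrable_const _), integral_const_mul,
          integral_const, smul_eq_mul, mul_comm (ν.real univ)]
      rw [← e]
      refine integral_mono_of_nonneg (Eventually.of_forall fun y =>
        mul_nonneg dist_nonneg (hgp _)) (((hgi ν hν).const_mul _).add (integrable_const _))
        (Eventually.of_forall fun y => ?_)
      have e1 : 0 ≤ η * regPow β s (dist y z) := mul_nonneg hη0.le (hgp _)
      have e2 : (0 : ℝ) ≤ (η ^ 2) ^ ((1 - β) / 2) := by positivity
      rcases le_total (dist y z) η with h | h
      · exact (mul_le_mul_of_nonneg_right h (hgp _)).trans (le_add_of_nonneg_right e2)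
      · exact (mul_regPow_le hβ hη0 h).trans (le_add_of_nonneg_left e1)
    have i0 := hineq z s hs
    set I := ∫ y, regPow β s (dist y z) ∂π
    have j1 := regPow_le (β := β) (s := s) (by linarith) hr₁
    have j2 := regPow_le (β := β) (s := s) (by linarith) hr₂
    have hσ0 : 0 ≤ σ.real univ := measureReal_nonneg
    have hν0 : 0 ≤ ν.real univ := measureReal_nonneg
    have hI0 : 0 ≤ I := integral_nonneg fun y => hgp _
    have k1 : 4 * (n + 1) * (1 + β) * ∫ y, regPow β s (dist y z) ∂σ ≤
        1 / 4 * I + 4 * (n + 1) * (1 + β) * ((r₁ ^ 2) ^ (-β / 2) * σ.real univ) := by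
      calc _ ≤ 4 * (n + 1) * (1 + β) * (c * I + (r₁ ^ 2) ^ (-β / 2) * σ.real univ) := by
            refine mul_le_mul_of_nonneg_left (i1.trans ?_) (by positivity)
            gcongr
        _ = _ := by rw [hc]; field_simp; ring
    have k2 : 4 * (n + 1) * ∫ y, dist y z * regPow β s (dist y z) ∂ν ≤ 1 / 4 * I +
        4 * (n + 1) * (η * ((r₂ ^ 2) ^ (-β / 2) * ν.real univ) +
          (η ^ 2) ^ ((1 - β) / 2) * ν.real univ) := by
      have l1 : η * (4 * (n + 1)) * M ≤ 1 / 4 := by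
        have : η * (4 * (n + 1)) * M = 1 / 4 * (M / (M + 1)) := by rw [hη]; field_simp; ring
        rw [this]
        have : (M : ℝ) / (M + 1) ≤ 1 := by rw [div_le_one (by positivity)]; linarith
        linarith
      calc _ ≤ 4 * (n + 1) * (η * (M * I + (r₂ ^ 2) ^ (-β / 2) * ν.real univ) +
            (η ^ 2) ^ ((1 - β) / 2) * ν.real univ) := by
            refine mul_le_mul_of_nonneg_left (i3.trans ?_) (by positivity)
            gcongr
            refine i2.trans ?_
            gcongr
            exact le_rfl
        _ = η * (4 * (n + 1)) * M * I + 4 * (n + 1) * (η * ((r₂ ^ 2) ^ (-β / 2) * ν.real univ) +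
              (η ^ 2) ^ ((1 - β) / 2) * ν.real univ) := by ring
        _ ≤ _ := by gcongr
    have hI : I ≤ 2 * R := by rw [hR]; linarith
    have hball : π.real (closedBall z s) * regPow β s s ≤ I := by
      have e : π.real (closedBall z s) * regPow β s s =
          ∫ y, (closedBall z s).indicator (fun _ => regPow β s s) y ∂π := by
        rw [integral_indicator_const _ isClosed_closedBall.measurableSet, smul_eq_mul]
      rw [e]
      refine integral_mono_of_nonneg (Eventually.of_forall fun y =>
        indicator_nonneg (fun _ _ => hgp _) y) (hgi π inferInstance)
        (Eventually.of_forall fun y => ?_)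
      by_cases hy : y ∈ closedBall z s
      · simp only [indicator_of_mem hy]
        exact hga dist_nonneg (mem_Ici.2 hs.le) hy
      · simp only [indicator_of_notMem hy]
        exact hgp _
    have hs2 := regPow_self (β := β) hs
    have hsβ : 0 < s ^ β := Real.rpow_pos_of_pos hs _
    have h22 : (2 : ℝ) ^ (-β / 2) * 2 ^ (β / 2) = 1 := by
      rw [← Real.rpow_add (by norm_num)]
      have : -β / 2 + β / 2 = 0 := by ring
      rw [this, Real.rpow_zero]
    calc π.real (closedBall z s) =
          (π.real (closedBall z s) * regPow β s s) * s ^ β * 2 ^ (β / 2) := by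
          rw [mul_assoc (π.real _), mul_comm (regPow β s s), hs2, mul_assoc, h22, mul_one]
      _ ≤ (2 * R) * s ^ β * 2 ^ (β / 2) := by
          exact mul_le_mul_of_nonneg_right (mul_le_mul_of_nonneg_right (hball.trans hI) hsβ.le)
            (by positivity)
      _ = _ := by ring
  have hYD : π (Y ∩ D) = 0 := by
    have hae := ae_iff.1 hdens
    set G := {z | ∃ C : ℝ, ∀ s, 0 < s → s < 1 → π.real (closedBall z s) ≤ C * s ^ β}
    have h1 : π (Y ∩ D ∩ G) = 0 :=
      measure_eq_zero_of_density π (Nat.cast_nonneg n) (show (n : ℝ) < β by linarith) hDH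
        (fun z hz => hz.1.2) fun z hz => hz.2
    refine measure_mono_null (fun z hz => ?_) (measure_union_null h1 hae)
    by_cases hG : z ∈ G
    · exact Or.inl ⟨hz, hG⟩
    · exact Or.inr fun h => hG (h hz.1)
  have hYc : ENNReal.ofReal c * π Yᶜ ≤ σ univ := by
    have : Yᶜ = {z | ENNReal.ofReal c ≤ σ.rnDeriv π z} := by ext z; simp [hY]
    rw [this]
    exact measure_le_rnDeriv_le σ π _
  have huniv : π univ ≤ π Yᶜ := by
    calc π univ ≤ π ((Y ∩ D ∪ Dᶜ) ∪ Yᶜ) := measure_mono fun z _ => by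
          by_cases h1 : z ∈ Y <;> by_cases h2 : z ∈ D <;> simp [h1, h2]
      _ ≤ π (Y ∩ D ∪ Dᶜ) + π Yᶜ := measure_union_le _ _
      _ = π Yᶜ := by rw [measure_union_null hYD hπD, zero_add]
  have h1 : c * π.real univ ≤ σ.real univ := by
    have h2 : ENNReal.ofReal c * π univ ≤ σ univ := (mul_le_mul_right huniv _).trans hYc
    have h3 := ENNReal.toReal_mono (measure_ne_top σ univ) h2
    rwa [ENNReal.toReal_mul, ENNReal.toReal_ofReal hc0.le] at h3
  nlinarith

lemma NearSpan.mem_span_coordMap {m k : ℕ} {κ : ℝ} {c a : Fin k → EuclideanSpace ℝ (Fin m)}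
    (h : κ < 1) (hca : NearSpan κ c a) (ha : LinearIndependent ℝ a) (w : Fin k → ℝ) :
    w ∈ Submodule.span ℝ (range fun i => coordMap c (a i)) := by
  let T : (Fin k → ℝ) →ₗ[ℝ] (Fin k → ℝ) :=
    (coordMap c : EuclideanSpace ℝ (Fin m) →ₗ[ℝ] (Fin k → ℝ)).comp (Fintype.linearCombination ℝ a)
  have hT : ∀ s, T s = coordMap c (∑ i, s i • a i) := fun s => rfl
  have hinj : Function.Injective T := by
    rw [← LinearMap.ker_eq_bot, LinearMap.ker_eq_bot']
    intro s hs
    have h0 : ∑ i, s i • a i = 0 := hca.eq_zero h s fun i => by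
      rw [hT] at hs
      rw [← coordMap_apply, hs]; rfl
    exact funext (Fintype.linearIndependent_iff.1 ha s h0)
  obtain ⟨s, hs⟩ := (LinearMap.injective_iff_surjective.1 hinj) w
  rw [Submodule.mem_span_range_iff_exists_fun]
  exact ⟨s, by rw [← hs, hT, map_sum]; simp only [map_smul]⟩

/-- In a space of finite `n`-dimensional measure there are at most `n` independent flows. -/
theorem not_exists_frame {X : Type*} [MetricSpace X] [CompactSpace X]
    [MeasurableSpace X] [BorelSpace X] {n m : ℕ} (hn : 0 < n)
    (hX : Measure.hausdorffMeasure n (univ : Set X) ≠ ∞) (μ : Measure X) [IsFiniteMeasure μ]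
    {ψ : X → EuclideanSpace ℝ (Fin m)} {L : ℝ≥0} (hψ : LipschitzWith L ψ) {S : Set X}
    (hS : MeasurableSet S) (hμS : μ S ≠ 0) {a : Fin (n + 1) → X → EuclideanSpace ℝ (Fin m)}
    (ha : ∀ i, Measurable (a i)) (hab : ∀ i, ∃ M, ∀ x, ‖a i x‖ ≤ M)
    (hfl : ∀ i, FlowDensityOn ψ μ S (a i)) :
    ∃ x ∈ S, ¬ LinearIndependent ℝ fun i => a i x := by
  by_contra! hLI
  obtain ⟨d, hd⟩ := TopologicalSpace.exists_dense_seq (Fin (n + 1) → EuclideanSpace ℝ (Fin m))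
  let P : ℕ → Set X := fun l => S ∩ {x | NearSpan (1 / 2) (d l) fun i => a i x}
  have hPm : ∀ l, MeasurableSet (P l) := fun l =>
    hS.inter ((measurable_pi_lambda _ ha) (isClosed_nearSpan (1 / 2) (d l)).measurableSet)
  obtain ⟨l, hl⟩ : ∃ l, μ (P l) ≠ 0 := by
    by_contra! h
    refine hμS (measure_mono_null (fun x hx => ?_) (measure_iUnion_null h))
    obtain ⟨l, hl⟩ := exists_nearSpan (hLI x hx) (by norm_num : (0 : ℝ) < 1 / 2) hd
    exact mem_iUnion.2 ⟨l, hx, hl⟩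
  let J : (Fin (n + 1) → ℝ) ≃L[ℝ] EuclideanSpace ℝ (Fin (n + 1)) :=
    (EuclideanSpace.equiv (Fin (n + 1)) ℝ).symm
  let A : EuclideanSpace ℝ (Fin m) →L[ℝ] EuclideanSpace ℝ (Fin (n + 1)) :=
    (J : (Fin (n + 1) → ℝ) →L[ℝ] EuclideanSpace ℝ (Fin (n + 1))).comp (coordMap (d l))
  obtain ⟨B, v, hBc, hBP, hBμ, hvm, hvb, hv, hfa⟩ := exists_flowAlong μ hψ.continuous (hPm l) ha hab
    (fun i => by
      obtain ⟨N, hN, hN0, h⟩ := hfl i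
      exact ⟨N, hN, hN0, fun B hB => h B fun x hx => ⟨(hB hx).1.1, (hB hx).2⟩⟩) A
    (fun j : Fin (n + 1) => EuclideanSpace.single j (1 : ℝ)) (fun x hx j => by
      have h1 := hx.2.mem_span_coordMap (by norm_num) (hLI x hx.1)
        (J.symm (EuclideanSpace.single j 1))
      rw [Submodule.mem_span_range_iff_exists_fun] at h1 ⊢
      obtain ⟨s, hs⟩ := h1
      refine ⟨s, ?_⟩
      rw [← J.apply_symm_apply (EuclideanSpace.single j 1), ← hs, map_sum]
      simp only [map_smul]
      rfl) (ε := 1 / (4 * (n + 1) * (1 + (n + 1 / 2)))) (by positivity)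
  obtain ⟨p, hp⟩ : ∃ p, μ (B p) ≠ 0 := by
    by_contra! h
    refine hl (measure_mono_null (fun x hx => ?_) (measure_union_null hBμ
      (measure_iUnion_null h)))
    by_cases hxB : x ∈ ⋃ p, B p
    · exact Or.inr hxB
    · exact Or.inl ⟨hx, hxB⟩
  exact not_flowAlong_of_lt hn hX μ (A.lipschitz.comp hψ) (hBc p) hp (hvm p) (hvb p) (hv p) (hfa p)

section

variable {X F : Type*} [MetricSpace X] [CompactSpace X] [MetricSpace F] [MeasurableSpace F]
  [BorelSpace F] {m : Measure F} [m.InnerRegularCompactLTTop] [IsFiniteMeasureOnCompacts m]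

lemma exists_compact_almost_injOn {q : X → F} (hq : Continuous q) {K : Set X} (hK : IsCompact K)
    {r : ℝ} (hr : 0 < r) {η : ℝ≥0∞} (hη : η ≠ 0) :
    ∃ K' ⊆ K, IsCompact K' ∧ (∀ x ∈ K', ∀ y ∈ K', q x = q y → dist x y ≤ r) ∧
      m (q '' K \ q '' K') ≤ η := by
  have key : ∀ t : Set X, t.Finite → ∀ η : ℝ≥0∞, η ≠ 0 →
      ∃ K' ⊆ K, IsCompact K' ∧ (∀ x ∈ K', ∀ y ∈ K', q x = q y → dist x y ≤ r) ∧
        m (q '' (K ∩ ⋃ i ∈ t, closedBall i (r / 2)) \ q '' K') ≤ η := by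
    intro t ht
    induction t, ht using Set.Finite.induction_on with
    | empty => exact fun η _ => ⟨∅, by simp, isCompact_empty, by simp, by simp⟩
    | @insert i t hit ht IH =>
      intro η hη
      obtain ⟨K₁, hK₁, hK₁c, hK₁r, hK₁m⟩ := IH (η / 2) (ENNReal.half_pos hη).ne'
      have hD : IsCompact (K ∩ closedBall i (r / 2)) := hK.inter_right isClosed_closedBall
      have hfin : m (q '' (K ∩ closedBall i (r / 2)) \ q '' K₁) ≠ ∞ :=
        ne_top_of_le_ne_top (hD.image hq).measure_ne_top (measure_mono sdiff_subset)
      obtain ⟨Z, hZ, hZc, hZm⟩ := ((hD.image hq).measurableSet.diff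
        (hK₁c.image hq).measurableSet).exists_isCompact_sdiff_lt hfin (ENNReal.half_pos hη).ne'
      refine ⟨K₁ ∪ (K ∩ closedBall i (r / 2) ∩ q ⁻¹' Z), union_subset hK₁ fun x hx => hx.1.1,
        hK₁c.union (hD.inter_right (hZc.isClosed.preimage hq)), ?_, ?_⟩
      · rintro x (hx | hx) y (hy | hy) hxy
        · exact hK₁r x hx y hy hxy
        · exact absurd (hxy ▸ mem_image_of_mem q hx) (hZ hy.2).2
        · exact absurd (hxy ▸ mem_image_of_mem q hy) (hZ hx.2).2
        · have h1 := mem_closedBall.1 hx.1.2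
          have h2 := mem_closedBall'.1 hy.1.2
          linarith [dist_triangle x i y]
      · refine (measure_mono (t := (q '' (K ∩ ⋃ i ∈ t, closedBall i (r / 2)) \ q '' K₁) ∪
          ((q '' (K ∩ closedBall i (r / 2)) \ q '' K₁) \ Z)) ?_).trans
          ((measure_union_le _ _).trans ((add_le_add hK₁m hZm.le).trans (ENNReal.add_halves η).le))
        rintro _ ⟨⟨x, ⟨hxK, hx⟩, rfl⟩, hx2⟩
        have hn1 : q x ∉ q '' K₁ := fun h => hx2 (image_mono subset_union_left h)
        simp only [mem_iUnion, exists_prop, mem_insert_iff] at hx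
        obtain ⟨j, rfl | hj, hxj⟩ := hx
        · exact Or.inr ⟨⟨mem_image_of_mem q ⟨hxK, hxj⟩, hn1⟩, fun hZx =>
            hx2 (mem_image_of_mem q (Or.inr ⟨⟨hxK, hxj⟩, hZx⟩))⟩
        · exact Or.inl ⟨mem_image_of_mem q ⟨hxK, mem_iUnion₂.2 ⟨j, hj, hxj⟩⟩, hn1⟩
  obtain ⟨t, -, ht, hcov⟩ := finite_cover_balls_of_compact (isCompact_univ (X := X)) (half_pos hr)
  obtain ⟨K', h1, h2, h3, h4⟩ := key t ht η hη
  refine ⟨K', h1, h2, h3, ?_⟩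
  rwa [inter_eq_left.2 ((subset_univ K).trans (hcov.trans
    (iUnion₂_mono fun i _ => ball_subset_closedBall)))] at h4

/-- A continuous map on a compact set is injective on a compact subset whose image is still
large. -/
lemma exists_compact_injOn {q : X → F} (hq : Continuous q) {B : Set X} (hB : IsCompact B)
    (h0 : m (q '' B) ≠ 0) : ∃ B' ⊆ B, IsCompact B' ∧ InjOn q B' ∧ m (q '' B') ≠ 0 := by
  obtain ⟨η, hη, hηs⟩ := ENNReal.exists_pos_sum_of_countable' h0 ℕ
  choose! S hSK hSc hSr hSm using fun (j : ℕ) (K : Set X) (hK : IsCompact K) =>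
    exists_compact_almost_injOn (m := m) hq hK (r := 1 / ((j : ℝ) + 1)) (by positivity) (hη j).ne'
  let K : ℕ → Set X := fun j => Nat.rec B (fun j K => S j K) j
  have hKs : ∀ j, K (j + 1) = S j (K j) := fun j => rfl
  have hKc : ∀ j, IsCompact (K j) := fun j => by
    induction j with
    | zero => exact hB
    | succ j ih => exact hSc j _ ih
  have hKa : ∀ j, K (j + 1) ⊆ K j := fun j => hSK j _ (hKc j)
  have hKanti : Antitone K := antitone_nat_of_succ_le hKa
  refine ⟨⋂ j, K j, iInter_subset K 0, (hKc 0).of_isClosed_subset (isClosed_iInter fun j => (hKc j).isClosed)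
    (iInter_subset K 0), fun x hx y hy hxy => ?_, fun h => ?_⟩
  · refine dist_le_zero.1 (le_of_forall_pos_le_add fun ε hε => ?_)
    obtain ⟨j, hj⟩ := exists_nat_one_div_lt hε
    have := hSr j _ (hKc j) x (mem_iInter.1 hx (j + 1)) y (mem_iInter.1 hy (j + 1)) hxy
    linarith
  · have hsub : q '' B ⊆ q '' (⋂ j, K j) ∪ ⋃ j, (q '' K j \ q '' K (j + 1)) := by
      intro z hz
      by_cases hall : ∀ j, z ∈ q '' K j
      · left
        obtain ⟨x, hx⟩ := IsCompact.nonempty_iInter_of_sequence_nonempty_isCompact_isClosed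
          (fun j => K j ∩ q ⁻¹' {z}) (fun j => inter_subset_inter_left _ (hKa j))
          (fun j => by obtain ⟨x, hx, rfl⟩ := hall j; exact ⟨x, hx, rfl⟩)
          ((hKc 0).inter_right (isClosed_singleton.preimage hq))
          (fun j => ((hKc j).inter_right (isClosed_singleton.preimage hq)).isClosed)
        exact ⟨x, mem_iInter.2 fun j => (mem_iInter.1 hx j).1, (mem_iInter.1 hx 0).2⟩
      · right
        by_contra hno
        exact hall fun j => by
          induction j with
          | zero => exact hz
          | succ j ih => exact by_contra fun h => hno (mem_iUnion.2 ⟨j, ih, h⟩)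
    have h1 := (measure_mono hsub).trans ((measure_union_le _ _).trans
      (add_le_add h.le (measure_iUnion_le _)))
    rw [zero_add] at h1
    refine absurd (h1.trans (ENNReal.tsum_le_tsum fun j => ?_)) (not_le.2 hηs)
    exact hSm j _ (hKc j)

/-- A continuous map on a compact set restricts to an injective one with positive image on which
the measure upstairs is dominated by the measure downstairs. -/
lemma exists_compact_injOn_le [MeasurableSpace X] [BorelSpace X] (μ : Measure X)
    [IsFiniteMeasure μ] {q : X → F} (hq : Continuous q) {B : Set X} (hB : IsCompact B)
    (h0 : m (q '' B) ≠ 0) : ∃ B' ⊆ B, IsCompact B' ∧ InjOn q B' ∧ m (q '' B') ≠ 0 ∧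
      ∃ r : ℝ≥0, ∀ T, MeasurableSet T → μ (B' ∩ q ⁻¹' T) ≤ r * m T := by
  obtain ⟨B₁, hB₁B, hB₁, hinj, h1⟩ := exists_compact_injOn hq hB h0
  have hne : B₁.Nonempty := by
    by_contra h; rw [not_nonempty_iff_eq_empty.1 h] at h1; simp at h1
  obtain ⟨x₀, hx₀⟩ := hne
  have : Nonempty X := ⟨x₀⟩
  set g := Function.invFunOn q B₁ with hg
  have hqg : ∀ z ∈ q '' B₁, q (g z) = z := fun z hz => Function.invFunOn_eq hz
  have hgB : ∀ z ∈ q '' B₁, g z ∈ B₁ := fun z hz => Function.invFunOn_mem hz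
  have hgq : ∀ x ∈ B₁, g (q x) = x := fun x hx =>
    hinj (hgB _ (mem_image_of_mem q hx)) hx (hqg _ (mem_image_of_mem q hx))
  have hZ : MeasurableSet (q '' B₁) := (hB₁.image hq).measurableSet
  have hgc : ContinuousOn g (q '' B₁) := by
    rw [continuousOn_iff_isClosed]
    intro t ht
    refine ⟨q '' (B₁ ∩ t), ((hB₁.inter_right ht).image hq).isClosed, ?_⟩
    ext z
    constructor
    · rintro ⟨hzt, hz⟩
      exact ⟨⟨g z, ⟨hgB z hz, hzt⟩, hqg z hz⟩, hz⟩
    · rintro ⟨⟨x, ⟨hx, hxt⟩, rfl⟩, hz⟩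
      exact ⟨by rwa [mem_preimage, hgq x hx], hz⟩
  have hgm : AEMeasurable g (m.restrict (q '' B₁)) := hgc.aemeasurable hZ
  have hfin : IsFiniteMeasure (m.restrict (q '' B₁)) :=
    ⟨by rw [Measure.restrict_apply_univ]; exact (hB₁.image hq).measure_lt_top⟩
  set lam := (m.restrict (q '' B₁)).map g with hlam
  have hlamT : ∀ T, MeasurableSet T → lam T = m (q '' (B₁ ∩ T)) := fun T hT => by
    rw [hlam, Measure.map_apply_of_aemeasurable hgm hT, Measure.restrict_apply' hZ]
    congr 1
    ext z
    constructor
    · rintro ⟨hzt, hz⟩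
      exact ⟨g z, ⟨hgB z hz, hzt⟩, hqg z hz⟩
    · rintro ⟨x, ⟨hx, hxt⟩, rfl⟩
      exact ⟨by rwa [mem_preimage, hgq x hx], mem_image_of_mem q hx⟩
  obtain ⟨r, hr0, hr⟩ := ENNReal.exists_nat_pos_mul_gt h1 (measure_ne_top μ univ)
  have hlu : lam univ = m (q '' B₁) := by rw [hlamT _ MeasurableSet.univ, inter_univ]
  have hlf : IsFiniteMeasure lam := ⟨by rw [hlu]; exact (hB₁.image hq).measure_lt_top⟩
  obtain ⟨s, hs, hs1, hs2⟩ := hahn_decomposition μ ((r : ℝ≥0) • lam)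
  have hls : lam (sᶜ ∩ B₁) ≠ 0 := fun h => by
    have h2 : lam univ ≤ lam s := by
      calc lam univ ≤ lam (s ∪ ((sᶜ ∩ B₁) ∪ B₁ᶜ)) := measure_mono fun x _ => by
            by_cases hx : x ∈ s <;> by_cases hx' : x ∈ B₁ <;> simp [hx, hx']
        _ ≤ lam s + (lam (sᶜ ∩ B₁) + lam B₁ᶜ) := (measure_union_le _ _).trans
            (add_le_add le_rfl (measure_union_le _ _))
        _ = lam s := by
            rw [h, hlamT _ hB₁.measurableSet.compl, inter_compl_self]; simp
    have h3 : (r : ℝ≥0∞) * lam s ≤ μ univ := by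
      have := (hs1 s hs le_rfl).trans (measure_mono (subset_univ s))
      simpa [ENNReal.smul_def] using this
    rw [← hlu] at hr
    exact absurd ((mul_le_mul_right h2 _).trans h3) (not_le.2 hr)
  obtain ⟨B', hB', hB'c, hB'm⟩ := (hs.compl.inter hB₁.measurableSet).exists_isCompact_sdiff_lt
    (measure_ne_top lam _) hls
  have hB'0 : lam B' ≠ 0 := fun h => by
    refine absurd ((measure_mono (μ := lam) (show sᶜ ∩ B₁ ⊆ B' ∪ ((sᶜ ∩ B₁) \ B') by
      rw [union_sdiff_self]; exact subset_union_right)).trans (measure_union_le _ _)) (not_le.2 ?_)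
    rwa [h, zero_add]
  refine ⟨B', fun x hx => hB₁B (hB' hx).2, hB'c, hinj.mono fun x hx => (hB' hx).2, ?_, r,
    fun T hT => ?_⟩
  · rwa [hlamT _ hB'c.measurableSet, inter_eq_right.2 fun x hx => (hB' hx).2] at hB'0
  · have hT' : MeasurableSet (B' ∩ q ⁻¹' T) := hB'c.measurableSet.inter (hq.measurable hT)
    refine (hs2 _ hT' fun x hx => (hB' hx.1).1).trans ?_
    rw [Measure.smul_apply, hlamT _ hT', ENNReal.smul_def, smul_eq_mul]
    refine mul_le_mul_right (measure_mono ?_) _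
    rintro _ ⟨x, hx, rfl⟩
    exact hx.2.2

end

/-- The image of `B` under `q` can be shrunk inside the ball around `z` of radius `w` by a small
Lipschitz perturbation of `q`, gaining at least the fraction `c` of the ball. -/
def Gains {X : Type*} [MetricSpace X] {n : ℕ} (q : X → Fin n → ℝ) (B : Set X) (c : ℝ≥0∞) (κ : ℝ≥0)
    (z : Fin n → ℝ) (w : ℝ) : Prop :=
  ∃ h : X → Fin n → ℝ, LipschitzWith κ h ∧ (∀ x, ‖h x‖ ≤ κ * w) ∧
    (∀ x, q x ∉ closedBall z w → h x = 0) ∧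
    volume ((fun x => q x + h x) '' (B ∩ q ⁻¹' closedBall z w)) + c * volume (closedBall z w) ≤
      volume (q '' B ∩ closedBall z w)

lemma exists_measure_gains_le {X : Type*} [MetricSpace X] {n : ℕ} {q : X → Fin n → ℝ}
    (hq : Continuous q) {B : Set X} (hB : IsCompact B) (h0 : volume (q '' B) ≠ 0)
    (hlsc : ∀ r < volume (q '' B), ∃ δ : ℝ≥0, 0 < δ ∧ ∀ h : X → Fin n → ℝ, LipschitzWith δ h →
      (∀ x, ‖h x‖ ≤ δ) → r < volume ((fun x => q x + h x) '' B)) {c : ℝ≥0∞} (hc : c ≠ 0) :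
    ∃ κ : ℝ≥0, 0 < κ ∧
      volume {z | ∀ r > 0, ∃ w, 0 < w ∧ w < r ∧ Gains q B c κ z w} ≤ volume (q '' B) / 2 := by
  have hv : volume (q '' B) ≠ ∞ := (hB.image hq).measure_ne_top
  set v := volume (q '' B) with hvdef
  obtain ⟨δ, hδ, hlsc⟩ := hlsc (v - c * (v / 2)) (ENNReal.sub_lt_self hv h0
    (mul_ne_zero hc (ENNReal.half_pos h0).ne'))
  refine ⟨δ / 2, half_pos hδ, ?_⟩
  by_contra! hlt
  set R := {z | ∀ r > 0, ∃ w, 0 < w ∧ w < r ∧ Gains q B c (δ / 2) z w} with hR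
  obtain ⟨t, r, htc, htR, htr, htm, htd⟩ := Besicovitch.exists_disjoint_closedBall_covering_ae
    volume (fun z => {w | Gains q B c (δ / 2) z w}) R
    (fun z hz ε hε => by
      obtain ⟨w, h1, h2, h3⟩ := hz ε hε
      exact ⟨w, h3, h1, h2⟩) (fun _ => 1) (fun _ _ => one_pos)
  have h1 : v / 2 < ∑' z : t, volume (closedBall (z : Fin n → ℝ) (r z)) := by
    refine hlt.trans_le ?_
    calc volume R ≤ volume ((R \ ⋃ x ∈ t, closedBall x (r x)) ∪ ⋃ x ∈ t, closedBall x (r x)) :=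
          measure_mono (by rw [sdiff_union_self]; exact subset_union_left)
      _ ≤ 0 + ∑' z : t, volume (closedBall (z : Fin n → ℝ) (r z)) :=
          (measure_union_le _ _).trans (add_le_add htm.le (measure_biUnion_le _ htc _))
      _ = _ := zero_add _
  rw [ENNReal.tsum_eq_iSup_sum] at h1
  obtain ⟨u, hu⟩ := lt_iSup_iff.1 h1
  have hune : u.Nonempty := by
    rw [Finset.nonempty_iff_ne_empty]
    rintro rfl
    simp at hu
  have hg : ∀ z : t, Gains q B c (δ / 2) z (r z) := fun z => (htr z z.2).1
  choose h hhL hhb hh0 hhv using hg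
  have hdisj : ∀ i j : t, i ≠ j → Disjoint (closedBall (i : Fin n → ℝ) (r i))
      (closedBall (j : Fin n → ℝ) (r j)) := fun i j hij =>
    htd i.2 j.2 fun h => hij (Subtype.ext h)
  have hsel : ∀ x, ∃ i ∈ u, (∀ j ∈ u, j ≠ i → h j x = 0) ∧ ∑ j ∈ u, h j x = h i x := fun x => by
    by_cases hx : ∃ i ∈ u, q x ∈ closedBall (i : Fin n → ℝ) (r i)
    · obtain ⟨i, hi, hix⟩ := hx
      have h2 : ∀ j ∈ u, j ≠ i → h j x = 0 := fun j _ hji => hh0 j x fun hjx =>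
        disjoint_left.1 (hdisj j i hji) hjx hix
      exact ⟨i, hi, h2, Finset.sum_eq_single_of_mem i hi h2⟩
    · push Not at hx
      obtain ⟨i, hi⟩ := hune
      exact ⟨i, hi, fun j hj _ => hh0 j x (hx j hj), by
        rw [hh0 i x (hx i hi)]
        exact Finset.sum_eq_zero fun j hj => hh0 j x (hx j hj)⟩
  have hd2 : ((δ / 2 : ℝ≥0) : ℝ) = δ / 2 := by push_cast; rfl
  have hL : LipschitzWith δ fun x => ∑ j ∈ u, h j x := by
    refine LipschitzWith.of_dist_le_mul fun x y => ?_
    obtain ⟨i, hi, hi0, hix⟩ := hsel x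
    obtain ⟨j, hj, hj0, hjy⟩ := hsel y
    have hli := (hhL i).dist_le_mul x y
    have hlj := (hhL j).dist_le_mul x y
    rw [hd2] at hli hlj
    have hdn : 0 ≤ (δ : ℝ) * dist x y := by positivity
    simp only [hix, hjy]
    by_cases hij : i = j
    · subst hij; linarith
    · rw [hj0 i hi hij] at hli
      rw [hi0 j hj (Ne.symm hij)] at hlj
      linarith [dist_triangle (h i x) 0 (h j y)]
  have hN : ∀ x, ‖∑ j ∈ u, h j x‖ ≤ δ := fun x => by
    obtain ⟨i, hi, hi0, hix⟩ := hsel x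
    rw [hix]
    have h3 := hhb i x
    have h4 := (htr i i.2).2
    rw [hd2] at h3
    nlinarith [h4.1, h4.2, NNReal.coe_pos.2 hδ]
  have hlt2 := hlsc _ hL hN
  have hball : MeasurableSet (⋃ i ∈ u, closedBall (i : Fin n → ℝ) (r i)) :=
    u.measurableSet_biUnion fun i _ => isClosed_closedBall.measurableSet
  have hsum : (∑ i ∈ u, volume ((fun x => q x + h i x) '' (B ∩ q ⁻¹' closedBall (i : Fin n → ℝ) (r i))))
      + c * ∑ i ∈ u, volume (closedBall (i : Fin n → ℝ) (r i)) ≤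
      volume (q '' B ∩ ⋃ i ∈ u, closedBall (i : Fin n → ℝ) (r i)) := by
    rw [Finset.mul_sum, ← Finset.sum_add_distrib, inter_iUnion₂, measure_biUnion_finset]
    · exact Finset.sum_le_sum fun i _ => hhv i
    · exact fun i _ j _ hij => (hdisj i j hij).mono inter_subset_right inter_subset_right
    · exact fun i _ => (hB.image hq).measurableSet.inter isClosed_closedBall.measurableSet
  have himg : volume ((fun x => q x + ∑ j ∈ u, h j x) '' B) ≤
      volume (q '' B \ ⋃ i ∈ u, closedBall (i : Fin n → ℝ) (r i)) +
      ∑ i ∈ u, volume ((fun x => q x + h i x) '' (B ∩ q ⁻¹' closedBall (i : Fin n → ℝ) (r i))) := by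
    refine (measure_mono (t := (q '' B \ ⋃ i ∈ u, closedBall (i : Fin n → ℝ) (r i)) ∪
      ⋃ i ∈ u, ((fun x => q x + h i x) '' (B ∩ q ⁻¹' closedBall (i : Fin n → ℝ) (r i)))) ?_).trans
      ((measure_union_le _ _).trans (add_le_add le_rfl (measure_biUnion_finset_le _ _)))
    rintro _ ⟨x, hx, rfl⟩
    by_cases hxu : ∃ i ∈ u, q x ∈ closedBall (i : Fin n → ℝ) (r i)
    · obtain ⟨i, hi, hix⟩ := hxu
      refine Or.inr (mem_iUnion₂.2 ⟨i, hi, x, ⟨hx, hix⟩, ?_⟩)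
      have h2 : ∑ j ∈ u, h j x = h i x := Finset.sum_eq_single_of_mem i hi fun j _ hji =>
        hh0 j x fun hjx => disjoint_left.1 (hdisj j i hji) hjx hix
      simp only [h2]
    · push Not at hxu
      left
      have h2 : ∑ j ∈ u, h j x = 0 := Finset.sum_eq_zero fun j hj => hh0 j x (hxu j hj)
      simp only [h2, add_zero]
      refine ⟨mem_image_of_mem q hx, fun hmem => ?_⟩
      obtain ⟨i, hi, hix⟩ := mem_iUnion₂.1 hmem
      exact hxu i hi hix
  refine absurd hlt2 (not_lt.2 ?_)
  refine le_trans ?_ (tsub_le_tsub_left (mul_le_mul_right hu.le c) v)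
  refine ENNReal.le_sub_of_add_le_right ?_ ?_
  · exact ne_top_of_le_ne_top hv ((le_add_self.trans hsum).trans (measure_mono inter_subset_left))
  · calc _ ≤ volume (q '' B \ ⋃ i ∈ u, closedBall (i : Fin n → ℝ) (r i)) +
        ∑ i ∈ u, volume ((fun x => q x + h i x) '' (B ∩ q ⁻¹' closedBall (i : Fin n → ℝ) (r i))) +
        c * ∑ i ∈ u, volume (closedBall (i : Fin n → ℝ) (r i)) := add_le_add himg le_rfl
      _ ≤ volume (q '' B \ ⋃ i ∈ u, closedBall (i : Fin n → ℝ) (r i)) +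
        volume (q '' B ∩ ⋃ i ∈ u, closedBall (i : Fin n → ℝ) (r i)) := by
          rw [add_assoc]; exact add_le_add le_rfl hsum
      _ = v := by rw [add_comm, measure_inter_add_sdiff _ hball]

/-- If the mollification of a function with respect to a measure comparable with Lebesgue measure is
nearly constant on a ball, then a small translate of its large level set meets any other large
set. -/
lemma exists_overlap {n : ℕ} {π : Measure (Fin n → ℝ)} [IsFiniteMeasure π] {K r : ℝ≥0∞}
    {Z : Set (Fin n → ℝ)} (hZK : ∀ T, MeasurableSet T → volume (Z ∩ T) ≤ K * π T)
    (hπr : ∀ T, MeasurableSet T → π T ≤ r * volume T) (hr : r ≠ ∞) (hK : K ≠ ∞)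
    {G f : (Fin n → ℝ) → ℝ≥0∞} (hG : Measurable G) (hf : Measurable f)
    (hf1 : ∀ u, ‖u‖ ≤ 1 / 2 → 1 ≤ f u) (hf0 : ∀ u, 1 < ‖u‖ → f u = 0) (hfle : ∀ u, f u ≤ 1)
    {s w : ℝ} (hs : 0 < s) (hsw : s ≤ w) {z : Fin n → ℝ} {c : ℝ≥0∞}
    (hΦ : ∀ y ∈ closedBall z (2 * w), ∀ y' ∈ closedBall z (2 * w),
      ∫⁻ u, G u * f (s⁻¹ • (u - y)) ∂π ≤
        ∫⁻ u, G u * f (s⁻¹ • (u - y')) ∂π + c * ENNReal.ofReal s ^ n)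
    {A₀ A₁ : Set (Fin n → ℝ)} (hA₀ : MeasurableSet A₀) (hA₁ : MeasurableSet A₁)
    (hA₀z : A₀ ⊆ closedBall z w) (hA₁z : A₁ ⊆ closedBall z w) (hA₁Z : A₁ ⊆ Z)
    (hA₁G : ∀ u ∈ A₁, 1 ≤ G u) {a M : ℝ≥0∞} (ha₀ : a ≤ volume A₀) (ha₁ : a ≤ volume A₁)
    (hc : K * volume (closedBall z (2 * w)) * c ≤ a / 2)
    (hM : K * volume (closedBall z (2 * w)) * (r * (2 ^ n * M)) < a / 2 * a) :
    ∃ t : Fin n → ℝ, ‖t‖ ≤ s ∧ M < ∫⁻ y in A₀, G (y + t) := by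
  by_contra! hno
  have hw : 0 < w := hs.trans_le hsw
  set S := ENNReal.ofReal s ^ n with hS
  set W := volume (closedBall z (2 * w)) with hW
  have hS0 : S ≠ 0 := pow_ne_zero _ (ENNReal.ofReal_pos.2 hs).ne'
  have hSt : S ≠ ∞ := ENNReal.pow_ne_top ENNReal.ofReal_ne_top
  have hball : ∀ u : Fin n → ℝ, volume (closedBall u (s / 2)) = S := fun u => by
    rw [Real.volume_pi_closedBall _ (by positivity), Fintype.card_fin, hS, mul_div_cancel₀ _ two_ne_zero,
      ENNReal.ofReal_pow hs.le]
  have hball2 : volume (closedBall (0 : Fin n → ℝ) s) = 2 ^ n * S := by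
    rw [Real.volume_pi_closedBall _ hs.le, Fintype.card_fin, mul_pow, ENNReal.ofReal_mul
      (by positivity), hS, ENNReal.ofReal_pow hs.le, ENNReal.ofReal_pow (by norm_num)]
    norm_num
  have hWt : W ≠ ∞ := (isCompact_closedBall z _).measure_ne_top
  have hat : a ≠ ∞ := ne_top_of_le_ne_top (isCompact_closedBall z w).measure_ne_top
    (ha₀.trans (measure_mono hA₀z))
  have hmeas : Measurable (Function.uncurry fun (y u : Fin n → ℝ) => G u * f (s⁻¹ • (u - y))) := by
    refine (hG.comp measurable_snd).mul (hf.comp ?_)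
    fun_prop
  have hlow : S * π A₁ ≤ ∫⁻ y in closedBall z (2 * w), ∫⁻ u, G u * f (s⁻¹ • (u - y)) ∂π := by
    rw [lintegral_lintegral_swap hmeas.aemeasurable]
    calc S * π A₁ = ∫⁻ _ in A₁, S ∂π := (setLIntegral_const _ _).symm
      _ ≤ ∫⁻ u in A₁, ∫⁻ y in closedBall z (2 * w), G u * f (s⁻¹ • (u - y)) ∂volume ∂π := by
          refine setLIntegral_mono_ae' hA₁ (ae_of_all _ fun u hu => ?_)
          calc S = ∫⁻ y in closedBall u (s / 2), 1 := by rw [setLIntegral_one, hball]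
            _ ≤ ∫⁻ y in closedBall u (s / 2), G u * f (s⁻¹ • (u - y)) := by
                refine setLIntegral_mono' isClosed_closedBall.measurableSet fun y hy => ?_
                refine one_le_mul (hA₁G u hu) (hf1 _ ?_)
                rw [norm_smul, norm_inv, Real.norm_of_nonneg hs.le, ← dist_eq_norm, dist_comm,
                  inv_mul_le_iff₀ hs]
                linarith [mem_closedBall.1 hy]
            _ ≤ _ := lintegral_mono_set (closedBall_subset_closedBall' (by
                linarith [mem_closedBall.1 (hA₁z hu)]))
      _ ≤ _ := setLIntegral_le_lintegral _ _
  have hpt : ∀ y ∈ A₀, S * (a / 2) ≤ K * W * ∫⁻ u, G u * f (s⁻¹ • (u - y)) ∂π := fun y hy => by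
    have hy2 : y ∈ closedBall z (2 * w) := closedBall_subset_closedBall (by linarith) (hA₀z hy)
    have h1 : ∫⁻ y in closedBall z (2 * w), ∫⁻ u, G u * f (s⁻¹ • (u - y)) ∂π ≤
        (∫⁻ u, G u * f (s⁻¹ • (u - y)) ∂π + c * S) * W := by
      rw [← setLIntegral_const]
      exact setLIntegral_mono' isClosed_closedBall.measurableSet fun y' hy' => hΦ y' hy' y hy2
    have h2 : S * a ≤ K * W * (∫⁻ u, G u * f (s⁻¹ • (u - y)) ∂π) + S * (a / 2) := by
      calc S * a ≤ S * (K * π A₁) := by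
            refine mul_le_mul_right (ha₁.trans ?_) _
            have := hZK A₁ hA₁
            rwa [inter_eq_right.2 hA₁Z] at this
        _ = K * (S * π A₁) := by ring
        _ ≤ K * ((∫⁻ u, G u * f (s⁻¹ • (u - y)) ∂π + c * S) * W) :=
            mul_le_mul_right (hlow.trans h1) _
        _ = K * W * (∫⁻ u, G u * f (s⁻¹ • (u - y)) ∂π) + S * (K * W * c) := by ring
        _ ≤ _ := add_le_add le_rfl (mul_le_mul_right hc _)
    have hfin : S * (a / 2) ≠ ∞ := ENNReal.mul_ne_top hSt (ENNReal.div_ne_top hat (by norm_num))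
    refine (ENNReal.add_le_add_iff_right hfin).1 (le_trans (le_of_eq ?_) h2)
    rw [← mul_add, ENNReal.add_halves]
  have hup : ∫⁻ y in A₀, ∫⁻ u, G u * f (s⁻¹ • (u - y)) ∂π ≤ r * (M * (2 ^ n * S)) := by
    have h1 : ∀ y, ∫⁻ u, G u * f (s⁻¹ • (u - y)) ∂π ≤ r * ∫⁻ t, G (y + t) * f (s⁻¹ • t) := fun y => by
      have h2 : π ≤ r • volume := Measure.le_iff.2 fun T hT => hπr T hT
      refine (lintegral_mono' h2 le_rfl).trans (le_of_eq ?_)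
      rw [lintegral_smul_measure, smul_eq_mul, ← lintegral_add_left_eq_self _ y]
      simp only [add_sub_cancel_left]
    have hm2 : Measurable (Function.uncurry fun (y t : Fin n → ℝ) => G (y + t) * f (s⁻¹ • t)) :=
      (hG.comp (measurable_fst.add measurable_snd)).mul (hf.comp (by fun_prop))
    calc _ ≤ ∫⁻ y in A₀, r * ∫⁻ t, G (y + t) * f (s⁻¹ • t) := lintegral_mono h1
      _ = r * ∫⁻ y in A₀, ∫⁻ t, G (y + t) * f (s⁻¹ • t) := lintegral_const_mul' _ _ hr
      _ = r * ∫⁻ t, ∫⁻ y in A₀, G (y + t) * f (s⁻¹ • t) := by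
          rw [lintegral_lintegral_swap hm2.aemeasurable]
      _ ≤ r * ∫⁻ t, (closedBall (0 : Fin n → ℝ) s).indicator (fun _ => M) t := by
          refine mul_le_mul_right (lintegral_mono fun t => ?_) _
          by_cases ht : t ∈ closedBall (0 : Fin n → ℝ) s
          · rw [indicator_of_mem ht]
            refine le_trans ?_ (hno t (by simpa using ht))
            exact lintegral_mono fun y => mul_le_of_le_one_right' (hfle _)
          · rw [indicator_of_notMem ht]
            have : f (s⁻¹ • t) = 0 := hf0 _ (by
              rw [norm_smul, norm_inv, Real.norm_of_nonneg hs.le, lt_inv_mul_iff₀ hs]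
              simpa using ht)
            simp [this]
      _ = _ := by
          rw [lintegral_indicator isClosed_closedBall.measurableSet, setLIntegral_const, hball2]
  have hfinal : S * (a / 2 * a) ≤ S * (K * W * (r * (2 ^ n * M))) := by
    calc S * (a / 2 * a) ≤ S * (a / 2) * volume A₀ := by
          rw [← mul_assoc]; exact mul_le_mul_right ha₀ _
      _ = ∫⁻ y in A₀, S * (a / 2) := (setLIntegral_const _ _).symm
      _ ≤ ∫⁻ y in A₀, K * W * ∫⁻ u, G u * f (s⁻¹ • (u - y)) ∂π :=
          setLIntegral_mono' hA₀ hpt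
      _ = K * W * ∫⁻ y in A₀, ∫⁻ u, G u * f (s⁻¹ • (u - y)) ∂π :=
          lintegral_const_mul' _ _ (ENNReal.mul_ne_top hK hWt)
      _ ≤ K * W * (r * (M * (2 ^ n * S))) := mul_le_mul_right hup _
      _ = _ := by ring
  exact absurd ((ENNReal.mul_le_mul_iff_right hS0 hSt).1 hfinal) (not_le.2 hM)

lemma integral_le_mul_measureReal {F : Type*} [MeasurableSpace F] {σ : Measure F}
    [IsFiniteMeasure σ] {D : F → ℝ} {T : Set F} (hT : MeasurableSet T) {c : ℝ} (h0 : ∀ u, 0 ≤ D u)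
    (hc : ∀ u ∈ T, D u ≤ c) (hD : ∀ u ∉ T, D u = 0) : ∫ u, D u ∂σ ≤ c * σ.real T := by
  calc ∫ u, D u ∂σ ≤ ∫ u, T.indicator (fun _ => c) u ∂σ := by
        refine integral_mono_of_nonneg (ae_of_all _ h0) ((integrable_const c).indicator hT)
          (ae_of_all _ fun u => ?_)
        by_cases hu : u ∈ T
        · simpa [hu] using hc u hu
        · simpa [hu] using (hD u hu).le
    _ = c * σ.real T := by rw [integral_indicator hT, setIntegral_const, smul_eq_mul, mul_comm]

/-- The inequality defining a flow frame controls the mollifications of Lipschitz functions. -/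
lemma mollify_sub_le {X : Type*} [MetricSpace X] [CompactSpace X] [MeasurableSpace X] [BorelSpace X]
    (μ : Measure X) [IsFiniteMeasure μ] {n : ℕ} {q : X → Fin n → ℝ} (hq : Continuous q) {B : Set X}
    (hB : IsCompact B) {v : Fin n → X → Fin n → ℝ} (hvm : ∀ j, Measurable (v j))
    (hvb : ∀ j, ∃ M, ∀ x, ‖v j x‖ ≤ M) {ε : ℝ} (hε : 0 ≤ ε)
    (hv : ∀ x ∈ B, ∀ j, ‖v j x - Pi.single j 1‖ ≤ ε)
    {σ ν ρ : Measure (Fin n → ℝ)} [IsFiniteMeasure σ] [IsFiniteMeasure ν] [IsFiniteMeasure ρ]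
    {K : ℝ≥0} {V : X → ℝ} (hV : LipschitzWith K V) (hV0 : ∀ x, 0 ≤ V x) (hV1 : ∀ x, V x ≤ 1)
    (hflow : ∀ j, ∀ χ : (Fin n → ℝ) → ℝ, ContDiff ℝ 1 χ →
        ∀ D : (Fin n → ℝ) → ℝ, Continuous D → (∀ z, 0 ≤ D z) →
          (∀ y z, |χ y - χ z| ≤ ‖y - z‖ * (D y + D z)) →
            |∫ x in B, V x * fderiv ℝ χ (q x) (v j x) ∂μ| ≤
              ∫ z, D z ∂σ + K * ∫ z, |χ z| ∂ρ + ∫ z, |χ z| ∂ν)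
    {f : (Fin n → ℝ) → ℝ} (hf : ContDiff ℝ 1 f) {l : ℝ≥0} (hfl : LipschitzWith l f)
    (hf0 : ∀ u, 0 ≤ f u) (hf1 : ∀ u, f u ≤ 1) (hfs : ∀ u, 1 < ‖u‖ → f u = 0)
    {s w : ℝ} (hs : 0 < s) (hsw : 2 * s ≤ w) {z : Fin n → ℝ} {bσ bν bρ bμ : ℝ}
    (hbσ : σ.real (closedBall z (3 * w)) ≤ bσ) (hbν : ν.real (closedBall z (3 * w)) ≤ bν)
    (hbρ : ρ.real (closedBall z (3 * w)) ≤ bρ)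
    (hbμ : μ.real (B ∩ q ⁻¹' closedBall z (3 * w)) ≤ bμ) {y y' : Fin n → ℝ}
    (hy : y ∈ closedBall z (2 * w)) (hy' : y' ∈ closedBall z (2 * w)) :
    |∫ x in B, V x * f (s⁻¹ • (q x - y)) ∂μ - ∫ x in B, V x * f (s⁻¹ • (q x - y')) ∂μ| ≤
      4 * w * (n * (2 * l / s * bσ + K * bρ + bν + l / s * ε * bμ)) := by
  have hw : 0 < w := by linarith
  have hls : 0 ≤ l / s := by positivity
  set M := 2 * l / s * bσ + K * bρ + bν + l / s * ε * bμ with hM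
  set χ : (Fin n → ℝ) → (Fin n → ℝ) → ℝ := fun y u => f (s⁻¹ • (u - y)) with hχ
  have hχc : ∀ y, ContDiff ℝ 1 (χ y) := fun y =>
    hf.comp (by fun_prop)
  have hχd : ∀ y u, HasFDerivAt (χ y) (s⁻¹ • fderiv ℝ f (s⁻¹ • (u - y))) u := fun y u => by
    have h1 := (hf.differentiable one_ne_zero (s⁻¹ • (u - y))).hasFDerivAt.comp u
      (((hasFDerivAt_id u).sub_const y).const_smul s⁻¹)
    refine h1.congr_fderiv ?_
    ext e; simp
  have hχd' : ∀ y u, HasFDerivAt (fun y => χ y u) (-(s⁻¹ • fderiv ℝ f (s⁻¹ • (u - y)))) y :=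
    fun y u => by
    have h1 := (hf.differentiable one_ne_zero (s⁻¹ • (u - y))).hasFDerivAt.comp y
      (((hasFDerivAt_id y).const_sub u).const_smul s⁻¹)
    refine h1.congr_fderiv ?_
    ext e; simp
  have hfd : ∀ u, ‖fderiv ℝ f u‖ ≤ l := fun u => norm_fderiv_le_of_lipschitz ℝ hfl
  have hfd0 : ∀ u, 1 < ‖u‖ → fderiv ℝ f u = 0 := fun u hu => by
    have : f =ᶠ[nhds u] fun _ => 0 := by
      filter_upwards [(continuous_norm.isOpen_preimage _ isOpen_Ioi).mem_nhds hu] with a ha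
      exact hfs a ha
    rw [this.fderiv_eq]; simp
  have hnorm : ∀ y u : Fin n → ℝ, ‖s⁻¹ • (u - y)‖ = ‖u - y‖ / s := fun y u => by
    rw [norm_smul, norm_inv, Real.norm_of_nonneg hs.le, inv_mul_eq_div]
  have hint : ∀ y, ∀ b : X → Fin n → ℝ, Measurable b → (∃ M, ∀ x, ‖b x‖ ≤ M) →
      IntegrableOn (fun x => V x * fderiv ℝ (χ y) (q x) (b x)) B μ := fun y b hb hbb =>
    (integrable_mul_fderiv hq hV.continuous (hχc y) hb hbb).integrableOn
  have hint2 : ∀ y j,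
      IntegrableOn (fun x => V x * fderiv ℝ (χ y) (q x) (v j x - Pi.single j 1)) B μ := fun y j =>
    hint y _ ((hvm j).sub_const _) (by
      obtain ⟨M, hM⟩ := hvb j
      exact ⟨M + ‖(Pi.single j 1 : Fin n → ℝ)‖, fun x =>
        (norm_sub_le _ _).trans (add_le_add (hM x) le_rfl)⟩)
  have hdir : ∀ y ∈ closedBall z (2 * w), ∀ j,
      |∫ x in B, V x * fderiv ℝ (χ y) (q x) (Pi.single j 1) ∂μ| ≤ M := by
    intro y hy j
    have hsub : closedBall y (2 * s) ⊆ closedBall z (3 * w) := closedBall_subset_closedBall' (by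
      linarith [mem_closedBall.1 hy])
    have h1 := hflow j (χ y) (hχc y) (fun u => l / s * max 0 (2 - ‖u - y‖ / s)) (by fun_prop)
      (fun u => by positivity) ?_
    · have e1 : ∫ u, l / s * max 0 (2 - ‖u - y‖ / s) ∂σ ≤ 2 * l / s * bσ := by
        refine (integral_le_mul_measureReal (c := 2 * l / s) (T := closedBall z (3 * w))
          isClosed_closedBall.measurableSet (fun u => by positivity) (fun u _ => ?_)
          (fun u hu => ?_)).trans (mul_le_mul_of_nonneg_left hbσ (by positivity))
        · have : max 0 (2 - ‖u - y‖ / s) ≤ 2 := max_le (by norm_num) (by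
            linarith [div_nonneg (norm_nonneg (u - y)) hs.le])
          calc l / s * max 0 (2 - ‖u - y‖ / s) ≤ l / s * 2 := mul_le_mul_of_nonneg_left this hls
            _ = 2 * l / s := by ring
        · have h2 : 2 * s < ‖u - y‖ := by
            rw [← dist_eq_norm]
            exact not_le.1 fun h => hu (hsub h)
          rw [max_eq_left, mul_zero]
          rw [sub_nonpos, le_div_iff₀ hs]; exact h2.le
      have e2 : ∀ (τ : Measure (Fin n → ℝ)) [IsFiniteMeasure τ],
          ∫ u, |χ y u| ∂τ ≤ τ.real (closedBall z (3 * w)) := fun τ _ => by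
        have := integral_le_mul_measureReal (σ := τ) (D := fun u => |χ y u|) (c := 1)
          (T := closedBall z (3 * w)) isClosed_closedBall.measurableSet (fun u => abs_nonneg _)
          (fun u _ => by rw [abs_of_nonneg (hf0 _)]; exact hf1 _) (fun u hu => by
            have h2 : 2 * s < ‖u - y‖ := by
              rw [← dist_eq_norm]
              exact not_le.1 fun h => hu (hsub h)
            have h3 : χ y u = 0 := hfs _ (by rw [hnorm, lt_div_iff₀ hs]; linarith)
            rw [h3, abs_zero])
        rwa [one_mul] at this
      have e3 : |∫ x in B, V x * fderiv ℝ (χ y) (q x) (v j x - Pi.single j 1) ∂μ| ≤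
          l / s * ε * bμ := by
        have hpt : ∀ x ∈ B, |V x * fderiv ℝ (χ y) (q x) (v j x - Pi.single j 1)| ≤
            (q ⁻¹' closedBall z (3 * w)).indicator (fun _ => l / s * ε) x := fun x hx => by
          by_cases hxz : x ∈ q ⁻¹' closedBall z (3 * w)
          · rw [indicator_of_mem hxz, abs_mul, abs_of_nonneg (hV0 x)]
            refine (mul_le_of_le_one_left (abs_nonneg _) (hV1 x)).trans ?_
            rw [← Real.norm_eq_abs]
            refine (ContinuousLinearMap.le_opNorm _ _).trans ?_
            refine mul_le_mul ?_ (hv x hx j) (norm_nonneg _) hls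
            rw [(hχd y (q x)).fderiv, norm_smul, norm_inv, Real.norm_of_nonneg hs.le,
              inv_mul_eq_div]
            exact div_le_div_of_nonneg_right (hfd _) hs.le
          · rw [indicator_of_notMem hxz]
            have h2 : 2 * s < ‖q x - y‖ := by
              rw [← dist_eq_norm]
              exact not_le.1 fun h => hxz (hsub h)
            rw [(hχd y (q x)).fderiv, hfd0 _ (by rw [hnorm, lt_div_iff₀ hs]; linarith)]
            simp
        have hmq : MeasurableSet (q ⁻¹' closedBall z (3 * w)) :=
          hq.measurable isClosed_closedBall.measurableSet
        refine (abs_integral_le_integral_abs).trans ?_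
        calc ∫ x in B, |V x * fderiv ℝ (χ y) (q x) (v j x - Pi.single j 1)| ∂μ ≤
            ∫ x in B, (q ⁻¹' closedBall z (3 * w)).indicator (fun _ => l / s * ε) x ∂μ :=
              setIntegral_mono_on (hint2 y j).abs
                ((integrable_const _).indicator hmq) hB.measurableSet hpt
          _ = l / s * ε * μ.real (B ∩ q ⁻¹' closedBall z (3 * w)) := by
              rw [integral_indicator hmq, setIntegral_const, smul_eq_mul, mul_comm,
                measureReal_restrict_apply hmq, inter_comm]
          _ ≤ _ := mul_le_mul_of_nonneg_left hbμ (by positivity)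
      have e4 : ∫ x in B, V x * fderiv ℝ (χ y) (q x) (Pi.single j 1) ∂μ =
          ∫ x in B, V x * fderiv ℝ (χ y) (q x) (v j x) ∂μ -
            ∫ x in B, V x * fderiv ℝ (χ y) (q x) (v j x - Pi.single j 1) ∂μ := by
        rw [← integral_sub (hint y _ (hvm j) (hvb j)) (hint2 y j)]
        refine integral_congr_ae (ae_of_all _ fun x => ?_)
        simp only [map_sub]; ring
      rw [e4]
      refine (abs_sub _ _).trans ?_
      have e5 := mul_le_mul_of_nonneg_left ((e2 ρ).trans hbρ) K.coe_nonneg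
      linarith [(e2 ν).trans hbν]
    · intro a b
      have key : ∀ a b : Fin n → ℝ, ‖a - y‖ ≤ s → |χ y a - χ y b| ≤ ‖a - b‖ * (l / s) *
          max 0 (2 - ‖a - y‖ / s) := fun a b ha => by
        have h2 : |χ y a - χ y b| ≤ ‖a - b‖ * (l / s) := by
          have h3 := hfl.dist_le_mul (s⁻¹ • (a - y)) (s⁻¹ • (b - y))
          rw [Real.dist_eq, dist_eq_norm, ← smul_sub, sub_sub_sub_cancel_right, norm_smul, norm_inv,
            Real.norm_of_nonneg hs.le] at h3
          refine h3.trans (le_of_eq ?_)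
          field_simp
        refine h2.trans (le_mul_of_one_le_right (by positivity) (le_max_of_le_right ?_))
        have : ‖a - y‖ / s ≤ 1 := (div_le_one hs).2 ha
        linarith
      have hm : ∀ a : Fin n → ℝ, 0 ≤ max 0 (2 - ‖a - y‖ / s) := fun a => le_max_left _ _
      have hp : ∀ a : Fin n → ℝ, 0 ≤ ‖a‖ * (l / s) := fun a => by positivity
      by_cases ha : ‖a - y‖ ≤ s
      · refine (key a b ha).trans ?_
        nlinarith [mul_nonneg (hp (a - b)) (hm b)]
      · by_cases hb : ‖b - y‖ ≤ s
        · rw [abs_sub_comm, norm_sub_rev]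
          refine (key b a hb).trans ?_
          nlinarith [mul_nonneg (hp (b - a)) (hm a)]
        · have h2 : ∀ a : Fin n → ℝ, ¬ ‖a - y‖ ≤ s → χ y a = 0 := fun a ha => hfs _ (by
            rw [hnorm, lt_div_iff₀ hs, one_mul]; exact not_le.1 ha)
          rw [h2 a ha, h2 b hb, sub_zero, abs_zero]
          have := mul_nonneg hls (hm a)
          have := mul_nonneg hls (hm b)
          positivity
  have hΦ : ∀ y, HasFDerivAt (fun y => ∫ x in B, V x * χ y (q x) ∂μ)
      (∫ x in B, V x • -(s⁻¹ • fderiv ℝ f (s⁻¹ • (q x - y))) ∂μ) y := fun y => by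
    have hcf : Continuous fun x => V x • -(s⁻¹ • fderiv ℝ f (s⁻¹ • (q x - y))) := by
      have := hf.continuous_fderiv one_ne_zero
      have := hV.continuous
      fun_prop
    refine hasFDerivAt_integral_of_dominated_of_fderiv_le (s := univ) (bound := fun _ => s⁻¹ * l)
      (F' := fun y x => V x • -(s⁻¹ • fderiv ℝ f (s⁻¹ • (q x - y)))) univ_mem
      (Eventually.of_forall fun y => ?_) ?_ ?_ (ae_of_all _ fun x y _ => ?_) (integrable_const _)
      (ae_of_all _ fun x y _ => ?_)
    · have := hf.continuous
      have := hV.continuous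
      exact (by fun_prop : Continuous fun x => V x * χ y (q x)).aestronglyMeasurable
    · have := hf.continuous
      have := hV.continuous
      have hcc : Continuous fun x => V x * χ y (q x) := by fun_prop
      exact (BoundedContinuousFunction.mkOfCompact ⟨_, hcc⟩).integrable _
    · exact hcf.aestronglyMeasurable
    · rw [norm_smul, norm_neg, norm_smul, norm_inv, Real.norm_of_nonneg hs.le,
        Real.norm_of_nonneg (hV0 x)]
      refine (mul_le_of_le_one_left (by positivity) (hV1 x)).trans ?_
      exact mul_le_mul_of_nonneg_left (hfd _) (by positivity)
    · exact (hχd' y (q x)).const_smul (V x)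
  have hΦb : ∀ y ∈ closedBall z (2 * w),
      ‖∫ x in B, V x • -(s⁻¹ • fderiv ℝ f (s⁻¹ • (q x - y))) ∂μ‖ ≤ n * M := fun y hy => by
    have hM0 : 0 ≤ n * M := by
      rcases Nat.eq_zero_or_pos n with rfl | hn
      · simp
      · exact mul_nonneg (Nat.cast_nonneg _) ((abs_nonneg _).trans (hdir y hy ⟨0, hn⟩))
    refine ContinuousLinearMap.opNorm_le_bound _ hM0 fun e => ?_
    have hcf : Continuous fun x => V x • -(s⁻¹ • fderiv ℝ f (s⁻¹ • (q x - y))) := by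
      have := hf.continuous_fderiv one_ne_zero
      have := hV.continuous
      fun_prop
    have hci : Integrable (fun x => V x • -(s⁻¹ • fderiv ℝ f (s⁻¹ • (q x - y)))) (μ.restrict B) :=
      (BoundedContinuousFunction.mkOfCompact ⟨_, hcf⟩).integrable _
    rw [ContinuousLinearMap.integral_apply hci]
    have h1 : ∀ x, (V x • -(s⁻¹ • fderiv ℝ f (s⁻¹ • (q x - y)))) e =
        -∑ j, e j * (V x * fderiv ℝ (χ y) (q x) (Pi.single j 1)) := fun x => by
      rw [(hχd y (q x)).fderiv]
      conv_lhs => rw [← Finset.univ_sum_single e]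
      simp only [smul_apply, neg_apply, map_sum, smul_eq_mul]
      rw [← Finset.sum_neg_distrib]
      refine Finset.sum_congr rfl fun j _ => ?_
      rw [show (Pi.single j (e j) : Fin n → ℝ) = e j • Pi.single j 1 by
        rw [← Pi.single_smul, smul_eq_mul, mul_one], map_smul, smul_eq_mul]
      ring
    simp only [h1]
    rw [integral_neg, norm_neg, integral_finsetSum _ fun j _ =>
      (hint y _ measurable_const ⟨_, fun _ => le_rfl⟩).const_mul (e j)]
    calc _ ≤ ∑ j : Fin n, ‖e‖ * M := norm_sum_le_of_le _ fun j _ => by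
          rw [integral_const_mul, norm_mul]
          exact mul_le_mul (norm_le_pi_norm e j) (hdir y hy j) (norm_nonneg _) (norm_nonneg _)
      _ = n * M * ‖e‖ := by simp; ring
  have h1 := (convex_closedBall z (2 * w)).norm_image_sub_le_of_norm_hasFDerivWithin_le
    (fun y _ => (hΦ y).hasFDerivWithinAt) hΦb hy' hy
  have hM0 : 0 ≤ n * M := (norm_nonneg _).trans (hΦb y hy)
  have h2 : ‖y - y'‖ ≤ 4 * w := by
    rw [← dist_eq_norm]
    linarith [dist_triangle_right y y' z, mem_closedBall.1 hy, mem_closedBall.1 hy']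
  refine h1.trans ?_
  rw [mul_comm]
  exact mul_le_mul_of_nonneg_right h2 hM0

/-- Translating a part of the image onto another part gains volume if the overlap beats the part
of the image which has to be deformed. -/
lemma gains_of_translate {X : Type*} [MetricSpace X] [MeasurableSpace X] (μ : Measure X) {n : ℕ}
    {q : X → Fin n → ℝ} {L : ℝ≥0} (hq : LipschitzWith L q) {K r : ℝ≥0}
    (hK : ∀ q' : X → Fin n → ℝ, LipschitzWith (L + 1) q' → ∀ S, volume (q' '' S) ≤ K * μ S)
    {B S : Set X} (hB : IsCompact B) (hS : IsCompact S) (hSB : S ⊆ B) (hinj : InjOn q B)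
    (hr : ∀ T, MeasurableSet T → μ (B ∩ q ⁻¹' T) ≤ r * volume T) {KV : ℝ≥0} {V : X → ℝ}
    (hV : LipschitzWith KV V) (hV0 : ∀ x, 0 ≤ V x) (hV1 : ∀ x, V x ≤ 1) {κ : ℝ≥0} (hκ : κ ≤ 1)
    {z t : Fin n → ℝ} {w τ : ℝ} (hw : 0 < w) (hτ : 0 < τ) (ht : ‖t‖ ≤ τ * w) (htκ : ‖t‖ ≤ κ * w)
    (htL : ‖t‖ * (KV + L / (τ * w)) ≤ κ) {c : ℝ≥0∞}
    (hc : c * volume (closedBall z ((1 + 2 * τ) * w)) + K * r * volume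
        ((q '' B ∩ closedBall z ((1 + 2 * τ) * w)) \
          ((q '' (S ∩ V ⁻¹' {0}) ∪ q '' (S ∩ V ⁻¹' {1})) ∩ closedBall z ((1 + τ) * w))) ≤
      volume (q '' (S ∩ V ⁻¹' {0}) ∩ closedBall z w ∩
        (fun y => y + t) ⁻¹' (q '' (S ∩ V ⁻¹' {1})))) :
    Gains q B c κ z ((1 + 2 * τ) * w) := by
  set W := (1 + 2 * τ) * w with hW
  set Q₀ := q '' (S ∩ V ⁻¹' {0}) with hQ₀
  set Q₁ := q '' (S ∩ V ⁻¹' {1}) with hQ₁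
  set T := (q '' B ∩ closedBall z W) \ ((Q₀ ∪ Q₁) ∩ closedBall z ((1 + τ) * w)) with hT
  set O := Q₀ ∩ closedBall z w ∩ (fun y => y + t) ⁻¹' Q₁ with hO
  have hτw : 0 < τ * w := mul_pos hτ hw
  have hQ₀c : IsCompact Q₀ :=
    (hS.inter_right (isClosed_singleton.preimage hV.continuous)).image hq.continuous
  have hQ₁c : IsCompact Q₁ :=
    (hS.inter_right (isClosed_singleton.preimage hV.continuous)).image hq.continuous
  have hcont : Continuous fun y : Fin n → ℝ => y + t := by fun_prop
  have hOm : MeasurableSet O := ((hQ₀c.isClosed.inter isClosed_closedBall).inter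
    (hQ₁c.isClosed.preimage hcont)).measurableSet
  have hTm : MeasurableSet T := ((hB.image hq.continuous).isClosed.inter
    isClosed_closedBall).measurableSet.diff ((hQ₀c.isClosed.union hQ₁c.isClosed).inter
      isClosed_closedBall).measurableSet
  set cut : X → ℝ := fun x => max 0 (min 1 (2 + τ⁻¹ - dist (q x) z / (τ * w))) with hcut
  have hcut0 : ∀ x, 0 ≤ cut x := fun x => le_max_left _ _
  have hcut1 : ∀ x, cut x ≤ 1 := fun x => max_le zero_le_one (min_le_left _ _)
  have hcutin : ∀ x, q x ∈ closedBall z ((1 + τ) * w) → cut x = 1 := fun x hx => by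
    have h1 : dist (q x) z / (τ * w) ≤ 1 + τ⁻¹ := by
      rw [div_le_iff₀ hτw]
      refine (mem_closedBall.1 hx).trans (le_of_eq ?_)
      field_simp; ring
    simp only [hcut]
    rw [min_eq_left (by linarith), max_eq_right zero_le_one]
  have hcutout : ∀ x, q x ∉ closedBall z W → cut x = 0 := fun x hx => by
    have h1 : 2 + τ⁻¹ ≤ dist (q x) z / (τ * w) := by
      rw [le_div_iff₀ hτw]
      refine le_trans (le_of_eq ?_) (not_le.1 fun h => hx (mem_closedBall.2 h)).le
      rw [hW]; field_simp; ring
    exact max_eq_left ((min_le_right _ _).trans (by linarith))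
  have hcutL : LipschitzWith (L / (τ * w).toNNReal) cut := by
    have h1 : LipschitzWith (L / (τ * w).toNNReal)
        fun x => 2 + τ⁻¹ - dist (q x) z / (τ * w) := by
      refine LipschitzWith.of_dist_le_mul fun x y => ?_
      rw [Real.dist_eq, NNReal.coe_div, Real.coe_toNNReal _ hτw.le, sub_sub_sub_cancel_left,
        ← sub_div, abs_div, abs_of_pos hτw, div_mul_eq_mul_div]
      refine div_le_div_of_nonneg_right ?_ hτw.le
      refine (abs_dist_sub_le _ _ _).trans ?_
      rw [dist_comm]; exact hq.dist_le_mul x y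
    exact (h1.const_min 1).const_max 0
  have hprod : LipschitzWith (KV + L / (τ * w).toNNReal) fun x => V x * cut x := by
    refine LipschitzWith.of_dist_le_mul fun x y => ?_
    have h1 := hV.dist_le_mul x y
    have h2 := hcutL.dist_le_mul x y
    rw [Real.dist_eq] at h1 h2 ⊢
    rw [NNReal.coe_add, add_mul]
    have h3 : V x * cut x - V y * cut y = (V x - V y) * cut x + V y * (cut x - cut y) := by ring
    rw [h3]
    refine (abs_add_le _ _).trans (add_le_add ?_ ?_)
    · rw [abs_mul, abs_of_nonneg (hcut0 x)]
      exact (mul_le_of_le_one_right (abs_nonneg _) (hcut1 x)).trans h1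
    · rw [abs_mul, abs_of_nonneg (hV0 y)]
      exact (mul_le_of_le_one_left (abs_nonneg _) (hV1 y)).trans h2
  have hhL : LipschitzWith κ fun x => -((V x * cut x) • t) := by
    refine LipschitzWith.of_dist_le_mul fun x y => ?_
    have h1 := hprod.dist_le_mul x y
    rw [NNReal.coe_add, NNReal.coe_div, Real.coe_toNNReal _ hτw.le] at h1
    rw [dist_neg_neg, dist_eq_norm, ← sub_smul, norm_smul, ← dist_eq_norm]
    calc _ ≤ ((KV + L / (τ * w)) * dist x y) * ‖t‖ := mul_le_mul_of_nonneg_right h1 (norm_nonneg _)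
      _ = ‖t‖ * (KV + L / (τ * w)) * dist x y := by ring
      _ ≤ _ := mul_le_mul_of_nonneg_right htL dist_nonneg
  refine ⟨fun x => -((V x * cut x) • t), hhL, fun x => ?_, fun x hx => ?_, ?_⟩
  · rw [norm_neg, norm_smul, Real.norm_of_nonneg (mul_nonneg (hV0 x) (hcut0 x))]
    refine (mul_le_of_le_one_left (norm_nonneg _)
      (mul_le_one₀ (hV1 x) (hcut0 x) (hcut1 x))).trans (htκ.trans ?_)
    refine mul_le_mul_of_nonneg_left ?_ κ.coe_nonneg
    rw [hW]; nlinarith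
  · simp only [hcutout x hx, mul_zero, zero_smul, neg_zero]
  · set P₀ := Q₀ ∩ closedBall z ((1 + τ) * w) with hP₀
    set P₁ := Q₁ ∩ closedBall z ((1 + τ) * w) with hP₁
    have hP₁m : MeasurableSet P₁ := (hQ₁c.isClosed.inter isClosed_closedBall).measurableSet
    have hOP₀ : O ⊆ P₀ := fun y hy => ⟨hy.1.1, closedBall_subset_closedBall (by nlinarith) hy.1.2⟩
    have hOP₁ : O ⊆ (fun y => y + t) ⁻¹' P₁ := fun y hy => by
      refine ⟨hy.2, mem_closedBall.2 ?_⟩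
      have h1 : dist (y + t) y ≤ τ * w := by rw [dist_eq_norm, add_sub_cancel_left]; exact ht
      have h2 := mem_closedBall.1 hy.1.2
      linarith [dist_triangle (y + t) y z]
    have hsub : (fun x => q x + -((V x * cut x) • t)) '' (B ∩ q ⁻¹' closedBall z W) ⊆
        P₀ ∪ ((fun y => y + t) ⁻¹' P₁ \ O) ∪
          (fun x => q x + -((V x * cut x) • t)) '' (B ∩ q ⁻¹' T) := by
      rintro _ ⟨x, ⟨hxB, hxW⟩, rfl⟩
      by_cases hxT : q x ∈ T
      · exact Or.inr ⟨x, ⟨hxB, hxT⟩, rfl⟩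
      · left
        have h1 : q x ∈ (Q₀ ∪ Q₁) ∩ closedBall z ((1 + τ) * w) := by
          by_contra h
          exact hxT ⟨⟨mem_image_of_mem q hxB, hxW⟩, h⟩
        rcases h1.1 with ⟨x', ⟨hx'S, hx'V⟩, hx'q⟩ | ⟨x', ⟨hx'S, hx'V⟩, hx'q⟩
        · obtain rfl := hinj (hSB hx'S) hxB hx'q
          left
          have hV' : V x' = 0 := hx'V
          simp only [hV', zero_mul, zero_smul, neg_zero, add_zero]
          exact ⟨⟨x', ⟨hx'S, hx'V⟩, rfl⟩, h1.2⟩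
        · obtain rfl := hinj (hSB hx'S) hxB hx'q
          have hV' : V x' = 1 := hx'V
          have hy : q x' + -((V x' * cut x') • t) + t = q x' := by
            rw [hV', hcutin x' h1.2, one_mul, one_smul]; abel
          by_cases hyO : q x' + -((V x' * cut x') • t) ∈ O
          · exact Or.inl (hOP₀ hyO)
          · refine Or.inr ⟨?_, hyO⟩
            change q x' + -((V x' * cut x') • t) + t ∈ P₁
            rw [hy]
            exact ⟨⟨x', ⟨hx'S, hx'V⟩, rfl⟩, h1.2⟩
    have hdisj : Disjoint P₀ P₁ := by
      refine disjoint_left.2 ?_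
      rintro _ ⟨⟨x, ⟨hxS, hxV⟩, rfl⟩, -⟩ ⟨⟨x', ⟨hx'S, hx'V⟩, hx'q⟩, -⟩
      obtain rfl := hinj (hSB hx'S) (hSB hxS) hx'q
      have h0 : V x' = 0 := hxV
      have h1 : V x' = 1 := hx'V
      linarith
    have hPsub : P₀ ∪ P₁ ⊆ q '' B ∩ closedBall z W := by
      have hle : closedBall z ((1 + τ) * w) ⊆ closedBall z W :=
        closedBall_subset_closedBall (by rw [hW]; nlinarith)
      refine union_subset ?_ ?_
      · exact inter_subset_inter (image_mono (inter_subset_left.trans hSB)) hle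
      · exact inter_subset_inter (image_mono (inter_subset_left.trans hSB)) hle
    have hfin : ∀ {A : Set (Fin n → ℝ)} {ρ : ℝ}, A ⊆ closedBall z ρ → volume A ≠ ∞ := fun hA =>
      ne_top_of_le_ne_top (isCompact_closedBall z _).measure_ne_top (measure_mono hA)
    have hqh : LipschitzWith (L + 1) fun x => q x + -((V x * cut x) • t) :=
      (hq.add hhL).weaken (add_le_add le_rfl hκ)
    have hTimg : volume ((fun x => q x + -((V x * cut x) • t)) '' (B ∩ q ⁻¹' T)) ≤
        K * r * volume T := by
      rw [mul_assoc]
      exact (hK _ hqh _).trans (mul_le_mul_right (hr T hTm) _)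
    have hpre : volume ((fun y => y + t) ⁻¹' P₁ \ O) + volume O = volume P₁ := by
      rw [measure_sdiff hOP₁ hOm.nullMeasurableSet (hfin (hOP₀.trans inter_subset_right)),
        measure_preimage_add_right, tsub_add_cancel_of_le]
      rw [← measure_preimage_add_right volume t P₁]
      exact measure_mono hOP₁
    have hOt : volume O ≠ ∞ := hfin (hOP₀.trans inter_subset_right)
    have hTt : K * r * volume T ≠ ∞ :=
      ENNReal.mul_ne_top (by finiteness) (hfin (sdiff_subset.trans inter_subset_right))
    refine (ENNReal.add_le_add_iff_right hTt).1 ?_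
    calc _ ≤ (volume P₀ + volume ((fun y => y + t) ⁻¹' P₁ \ O) + K * r * volume T) +
          volume O := by
          rw [add_assoc]
          refine add_le_add ((measure_mono hsub).trans ?_) hc
          exact (measure_union_le _ _).trans (add_le_add (measure_union_le _ _) hTimg)
      _ = volume P₀ + (volume ((fun y => y + t) ⁻¹' P₁ \ O) + volume O) + K * r * volume T := by
          ring
      _ = volume (P₀ ∪ P₁) + K * r * volume T := by
          rw [hpre, measure_union hdisj hP₁m]
      _ ≤ _ := add_le_add (measure_mono hPsub) le_rfl

/-- A continuous function on a compact set on which `q` is injective descends to a measurable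
function on the target, extended by zero. -/
lemma exists_measurable_pushforward {X Y : Type*} [TopologicalSpace X] [TopologicalSpace Y]
    [T2Space Y] [MeasurableSpace Y] [BorelSpace Y] {q : X → Y} (hq : Continuous q) {S : Set X}
    (hS : IsCompact S) (hinj : InjOn q S) {V : X → ℝ≥0∞} (hV : Continuous V) :
    ∃ G : Y → ℝ≥0∞, Measurable G ∧ (∀ x ∈ S, G (q x) = V x) ∧ ∀ y ∉ q '' S, G y = 0 := by
  have h1 : ∀ x ∈ S, ⨆ x' ∈ S ∩ q ⁻¹' {q x}, V x' = V x := fun x hx => by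
    have : S ∩ q ⁻¹' {q x} = {x} := by
      ext x'
      constructor
      · rintro ⟨h, h'⟩
        exact hinj h hx h'
      · rintro rfl
        exact ⟨hx, rfl⟩
    rw [this, iSup_singleton]
  have h2 : ∀ y ∉ q '' S, ⨆ x' ∈ S ∩ q ⁻¹' {y}, V x' = 0 := fun y hy => by
    have : S ∩ q ⁻¹' {y} = ∅ := eq_empty_of_forall_notMem fun x hx => hy ⟨x, hx.1, hx.2⟩
    simp [this]
  refine ⟨fun y => ⨆ x ∈ S ∩ q ⁻¹' {y}, V x, measurable_of_Ici fun t => ?_, h1, h2⟩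
  rcases eq_or_ne t 0 with rfl | ht
  · simp
  · have : (fun y => ⨆ x ∈ S ∩ q ⁻¹' {y}, V x) ⁻¹' Ici t = q '' (S ∩ V ⁻¹' Ici t) := by
      ext y
      constructor
      · intro hy
        by_cases hyS : y ∈ q '' S
        · obtain ⟨x, hx, rfl⟩ := hyS
          refine ⟨x, ⟨hx, ?_⟩, rfl⟩
          have h3 : t ≤ ⨆ x' ∈ S ∩ q ⁻¹' {q x}, V x' := hy
          rwa [h1 x hx] at h3
        · have h3 : t ≤ ⨆ x' ∈ S ∩ q ⁻¹' {y}, V x' := hy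
          rw [h2 y hyS] at h3
          exact absurd (le_antisymm h3 zero_le) ht
      · rintro ⟨x, ⟨hx, hxt⟩, rfl⟩
        change t ≤ ⨆ x' ∈ S ∩ q ⁻¹' {q x}, V x'
        rw [h1 x hx]
        exact hxt
    rw [this]
    exact ((hS.inter_right (isClosed_Ici.preimage hV)).image hq).isClosed.measurableSet

/-- If the mollifications of `V` are nearly constant on a ball, both `{V = 0}` and `{V = 1}` have a
substantial share of the ball and the rest is negligible, then volume can be gained. -/
lemma gains_of_levels {X : Type*} [MetricSpace X] [CompactSpace X] [MeasurableSpace X]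
    [BorelSpace X] (μ : Measure X) [IsFiniteMeasure μ] {n : ℕ}
    {q : X → Fin n → ℝ} {L : ℝ≥0} (hq : LipschitzWith L q) {K r : ℝ≥0}
    (hK : ∀ q' : X → Fin n → ℝ, LipschitzWith (L + 1) q' → ∀ S, volume (q' '' S) ≤ K * μ S)
    {B S : Set X} (hB : IsCompact B) (hS : IsCompact S) (hSB : S ⊆ B) (hinj : InjOn q B)
    (hr : ∀ T, MeasurableSet T → μ (B ∩ q ⁻¹' T) ≤ r * volume T) {KV : ℝ≥0} {V : X → ℝ}
    (hV : LipschitzWith KV V) (hV0 : ∀ x, 0 ≤ V x) (hV1 : ∀ x, V x ≤ 1) {κ : ℝ≥0} (hκ : κ ≤ 1)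
    {f : (Fin n → ℝ) → ℝ} (hfc : Continuous f) (hf0 : ∀ u, 0 ≤ f u) (hf1 : ∀ u, f u ≤ 1)
    (hfin : ∀ u, ‖u‖ ≤ 1 / 2 → f u = 1) (hfs : ∀ u, 1 < ‖u‖ → f u = 0)
    {z : Fin n → ℝ} {w s τ : ℝ} (hs : 0 < s) (hτ : 0 < τ) (hτ2 : τ ≤ 1 / 2) (hsτ : s ≤ τ * w)
    (hsκ : s ≤ κ * w) (hsL : s * (KV + L / (τ * w)) ≤ κ) {α θ m c c₀ : ℝ≥0}
    (hΦ : ∀ y ∈ closedBall z (2 * w), ∀ y' ∈ closedBall z (2 * w),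
      |∫ x in S, V x * f (s⁻¹ • (q x - y)) ∂μ - ∫ x in S, V x * f (s⁻¹ • (q x - y')) ∂μ| ≤
        c₀ * s ^ n)
    (hE₀ : α * volume (closedBall z w) ≤ volume (q '' (S ∩ V ⁻¹' {0}) ∩ closedBall z w))
    (hE₁ : α * volume (closedBall z w) ≤ volume (q '' (S ∩ V ⁻¹' {1}) ∩ closedBall z w))
    (hmid : volume (q '' (S ∩ V ⁻¹' Ioo 0 1) ∩ closedBall z (2 * w)) ≤
      θ * volume (closedBall z w))
    (hden : volume ((q '' B \ q '' S) ∩ closedBall z (2 * w)) ≤ θ * volume (closedBall z w))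
    (hshell : (1 + 2 * τ) ^ n ≤ (1 + τ) ^ n + θ) (hc₀ : K * 2 ^ n * c₀ ≤ α / 2)
    (hm : K * r * 4 ^ n * m < α / 2 * α) (hcm : c * 2 ^ n + K * r * (3 * θ) + θ ≤ m) :
    Gains q B c κ z ((1 + 2 * τ) * w) := by
  have hw : 0 < w := by
    by_contra h
    nlinarith
  set b := volume (closedBall z w) with hb
  have hscale : ∀ a : ℝ, 0 ≤ a → volume (closedBall z (a * w)) = ENNReal.ofReal (a ^ n) * b := by
    intro a ha
    rw [hb, Real.volume_pi_closedBall _ (by positivity), Real.volume_pi_closedBall _ hw.le,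
      Fintype.card_fin, ← ENNReal.ofReal_mul (by positivity), ← mul_pow]
    congr 2
    ring
  have hb2 : volume (closedBall z (2 * w)) = 2 ^ n * b := by
    rw [hscale 2 zero_le_two, ENNReal.ofReal_pow zero_le_two]
    norm_num
  have hb0 : b ≠ 0 := (measure_closedBall_pos volume z hw).ne'
  have hbt : b ≠ ∞ := (isCompact_closedBall z w).measure_ne_top
  have hVc := hV.continuous
  have hqc := hq.continuous
  obtain ⟨G, hGm, hGq, hG0⟩ := exists_measurable_pushforward hqc hS (hinj.mono hSB)
    (V := fun x => ENNReal.ofReal (V x)) (ENNReal.continuous_ofReal.comp hVc)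
  have hQ₀ : IsCompact (q '' (S ∩ V ⁻¹' {0})) :=
    (hS.inter_right (isClosed_singleton.preimage hVc)).image hqc
  have hQ₁ : IsCompact (q '' (S ∩ V ⁻¹' {1})) :=
    (hS.inter_right (isClosed_singleton.preimage hVc)).image hqc
  set π := (μ.restrict S).map q with hπ
  have hπT : ∀ T, MeasurableSet T → π T = μ (S ∩ q ⁻¹' T) := fun T hT => by
    rw [hπ, Measure.map_apply hqc.measurable hT, Measure.restrict_apply (hqc.measurable hT),
      inter_comm]
  have hint : ∀ y, ∫⁻ u, G u * ENNReal.ofReal (f (s⁻¹ • (u - y))) ∂π =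
      ENNReal.ofReal (∫ x in S, V x * f (s⁻¹ • (q x - y)) ∂μ) := fun y => by
    have hci : Integrable (fun x => V x * f (s⁻¹ • (q x - y))) (μ.restrict S) :=
      (BoundedContinuousFunction.mkOfCompact
        ⟨fun x => V x * f (s⁻¹ • (q x - y)), by fun_prop⟩).integrable _
    rw [ofReal_integral_eq_lintegral_ofReal hci
      (ae_of_all _ fun x => mul_nonneg (hV0 x) (hf0 _)), hπ, lintegral_map ?_ hqc.measurable]
    · refine setLIntegral_congr_fun hS.measurableSet fun x hx => ?_
      rw [hGq x hx, ENNReal.ofReal_mul (hV0 x)]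
    · refine hGm.mul (ENNReal.measurable_ofReal.comp ?_)
      have : Continuous fun u => f (s⁻¹ • (u - y)) := by fun_prop
      exact this.measurable
  obtain ⟨t, hts, hMt⟩ := exists_overlap (π := π) (K := K) (r := r) (Z := q '' S) (G := G)
    (f := fun u => ENNReal.ofReal (f u)) (s := s) (w := w) (z := z) (c := c₀)
    (A₀ := q '' (S ∩ V ⁻¹' {0}) ∩ closedBall z w) (A₁ := q '' (S ∩ V ⁻¹' {1}) ∩ closedBall z w)
    (a := α * b) (M := m * b)
    (fun T hT => by
      rw [hπT T hT, ← image_inter_preimage]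
      exact hK q (hq.weaken le_self_add) _)
    (fun T hT => by
      rw [hπT T hT]
      exact (measure_mono (inter_subset_inter_left _ hSB)).trans (hr T hT))
    ENNReal.coe_ne_top ENNReal.coe_ne_top hGm
    (ENNReal.measurable_ofReal.comp hfc.measurable)
    (fun u hu => by simp [hfin u hu]) (fun u hu => by simp [hfs u hu])
    (fun u => by simpa using hf1 u) hs (by nlinarith)
    (fun y hy y' hy' => by
      rw [hint, hint]
      have h := (abs_le.1 (hΦ y hy y' hy')).2
      have hI : 0 ≤ ∫ x in S, V x * f (s⁻¹ • (q x - y')) ∂μ :=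
        integral_nonneg fun x => mul_nonneg (hV0 x) (hf0 _)
      have he : (c₀ : ℝ≥0∞) * ENNReal.ofReal s ^ n = ENNReal.ofReal (c₀ * s ^ n) := by
        rw [ENNReal.ofReal_mul c₀.coe_nonneg, ENNReal.ofReal_coe_nnreal, ENNReal.ofReal_pow hs.le]
      rw [he, ← ENNReal.ofReal_add hI (by positivity)]
      exact ENNReal.ofReal_le_ofReal (by linarith))
    (hQ₀.isClosed.inter isClosed_closedBall).measurableSet
    (hQ₁.isClosed.inter isClosed_closedBall).measurableSet inter_subset_right inter_subset_right
    (inter_subset_left.trans (image_mono inter_subset_left))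
    (by
      rintro _ ⟨⟨x, ⟨hxS, hxV⟩, rfl⟩, -⟩
      have h1 : V x = 1 := hxV
      rw [hGq x hxS, h1, ENNReal.ofReal_one])
    hE₀ hE₁
    (by
      rw [hb2]
      have h1 : (K : ℝ≥0∞) * 2 ^ n * c₀ ≤ (α : ℝ≥0∞) / 2 := by
        rw [← ENNReal.coe_ofNat, ← ENNReal.coe_div two_ne_zero]
        exact_mod_cast hc₀
      calc (K : ℝ≥0∞) * (2 ^ n * b) * c₀ = K * 2 ^ n * c₀ * b := by ring
        _ ≤ α / 2 * b := mul_le_mul_left h1 _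
        _ = _ := by rw [div_eq_mul_inv, div_eq_mul_inv]; ring)
    (by
      rw [hb2]
      have h1 : (K : ℝ≥0∞) * r * 4 ^ n * m < (α : ℝ≥0∞) / 2 * α := by
        rw [← ENNReal.coe_ofNat (n := 2), ← ENNReal.coe_div two_ne_zero]
        exact_mod_cast hm
      have h4 : (4 : ℝ≥0∞) ^ n = 2 ^ n * 2 ^ n := by rw [← mul_pow]; norm_num
      have hbb : b * b ≠ 0 := mul_ne_zero hb0 hb0
      have hbbt : b * b ≠ ∞ := ENNReal.mul_ne_top hbt hbt
      calc (K : ℝ≥0∞) * (2 ^ n * b) * (r * (2 ^ n * (m * b))) = K * r * 4 ^ n * m * (b * b) := by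
            rw [h4]; ring
        _ < α / 2 * α * (b * b) := (ENNReal.mul_lt_mul_iff_left hbb hbbt).2 h1
        _ = _ := by rw [div_eq_mul_inv, div_eq_mul_inv]; ring)
  set O := q '' (S ∩ V ⁻¹' {0}) ∩ closedBall z w ∩
    (fun y => y + t) ⁻¹' (q '' (S ∩ V ⁻¹' {1})) with hO
  set Mid := q '' (S ∩ V ⁻¹' Ioo 0 1) ∩ closedBall z (2 * w) with hMid
  have hOm : MeasurableSet O := ((hQ₀.isClosed.inter isClosed_closedBall).inter
    (hQ₁.isClosed.preimage (by fun_prop))).measurableSet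
  have hcases : ∀ x ∈ S, V x = 0 ∨ V x = 1 ∨ x ∈ S ∩ V ⁻¹' Ioo 0 1 := fun x hx => by
    rcases (hV0 x).eq_or_lt with h | h
    · exact Or.inl h.symm
    · rcases (hV1 x).eq_or_lt with h' | h'
      · exact Or.inr (Or.inl h')
      · exact Or.inr (Or.inr ⟨hx, h, h'⟩)
  have hOb : ∫⁻ y in q '' (S ∩ V ⁻¹' {0}) ∩ closedBall z w, G (y + t) ≤ volume O + θ * b := by
    calc _ ≤ ∫⁻ y in q '' (S ∩ V ⁻¹' {0}) ∩ closedBall z w,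
          (O.indicator 1 y + ((fun y => y + t) ⁻¹' Mid).indicator 1 y) := by
          refine setLIntegral_mono' (hQ₀.isClosed.inter isClosed_closedBall).measurableSet
            fun y hy => ?_
          by_cases hyS : y + t ∈ q '' S
          · obtain ⟨x, hx, hxy⟩ := hyS
            rw [← hxy, hGq x hx]
            rcases hcases x hx with h | h | h
            · simp [h]
            · have : y ∈ O := ⟨hy, ⟨x, ⟨hx, h⟩, hxy⟩⟩
              simp [this, h]
            · have : y ∈ (fun y => y + t) ⁻¹' Mid := by
                refine ⟨⟨x, h, hxy⟩, mem_closedBall.2 ?_⟩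
                have h1 : dist (y + t) y ≤ s := by
                  rw [dist_eq_norm, add_sub_cancel_left]; exact hts
                have h2 := mem_closedBall.1 hy.2
                nlinarith [dist_triangle (y + t) y z]
              rw [indicator_of_mem this]
              refine le_add_left ?_
              simpa using hV1 x
          · rw [hG0 _ hyS]; exact zero_le
      _ ≤ ∫⁻ y, (O.indicator 1 y + ((fun y => y + t) ⁻¹' Mid).indicator 1 y) :=
          setLIntegral_le_lintegral _ _
      _ ≤ volume O + volume ((fun y => y + t) ⁻¹' Mid) := by
          rw [lintegral_add_left (measurable_one.indicator hOm)]
          exact add_le_add (lintegral_indicator_one_le _) (lintegral_indicator_one_le _)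
      _ ≤ _ := by
          rw [measure_preimage_add_right]
          exact add_le_add le_rfl hmid
  refine gains_of_translate μ hq hK hB hS hSB hinj hr hV hV0 hV1 hκ (t := t) hw hτ
    (hts.trans hsτ) (hts.trans hsκ) ((mul_le_mul_of_nonneg_right hts (by positivity)).trans hsL) ?_
  have hW2 : volume (closedBall z ((1 + 2 * τ) * w)) ≤ 2 ^ n * b := by
    rw [← hb2]
    exact measure_mono (closedBall_subset_closedBall (by nlinarith))
  have hsh : volume (closedBall z ((1 + 2 * τ) * w) \ closedBall z ((1 + τ) * w)) ≤ θ * b := by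
    rw [measure_sdiff (closedBall_subset_closedBall (by nlinarith))
      isClosed_closedBall.measurableSet.nullMeasurableSet
      (isCompact_closedBall z _).measure_ne_top, tsub_le_iff_left, hscale _ (by positivity),
      hscale _ (by positivity), ← add_mul]
    refine mul_le_mul_left ?_ _
    rw [← ENNReal.ofReal_coe_nnreal (p := θ), ← ENNReal.ofReal_add (by positivity) θ.coe_nonneg]
    exact ENNReal.ofReal_le_ofReal hshell
  have hT : volume ((q '' B ∩ closedBall z ((1 + 2 * τ) * w)) \
      ((q '' (S ∩ V ⁻¹' {0}) ∪ q '' (S ∩ V ⁻¹' {1})) ∩ closedBall z ((1 + τ) * w))) ≤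
      3 * θ * b := by
    have hsub : (q '' B ∩ closedBall z ((1 + 2 * τ) * w)) \
        ((q '' (S ∩ V ⁻¹' {0}) ∪ q '' (S ∩ V ⁻¹' {1})) ∩ closedBall z ((1 + τ) * w)) ⊆
        ((q '' B \ q '' S) ∩ closedBall z (2 * w) ∪ Mid) ∪
          (closedBall z ((1 + 2 * τ) * w) \ closedBall z ((1 + τ) * w)) := by
      rintro y ⟨⟨hyB, hyW⟩, hyn⟩
      by_cases hy1 : y ∈ closedBall z ((1 + τ) * w)
      · left
        have hy2 : y ∈ closedBall z (2 * w) := closedBall_subset_closedBall (by nlinarith) hyW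
        by_cases hyS : y ∈ q '' S
        · obtain ⟨x, hx, rfl⟩ := hyS
          rcases hcases x hx with h | h | h
          · exact absurd ⟨Or.inl ⟨x, ⟨hx, h⟩, rfl⟩, hy1⟩ hyn
          · exact absurd ⟨Or.inr ⟨x, ⟨hx, h⟩, rfl⟩, hy1⟩ hyn
          · exact Or.inr ⟨⟨x, h, rfl⟩, hy2⟩
        · exact Or.inl ⟨⟨hyB, hyS⟩, hy2⟩
      · exact Or.inr ⟨hyW, hy1⟩
    calc _ ≤ _ := measure_mono hsub
      _ ≤ θ * b + θ * b + θ * b := (measure_union_le _ _).trans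
          (add_le_add ((measure_union_le _ _).trans (add_le_add hden hmid)) hsh)
      _ = _ := by ring
  have hθb : θ * b ≠ ∞ := ENNReal.mul_ne_top ENNReal.coe_ne_top hbt
  refine (ENNReal.add_le_add_iff_right hθb).1 ?_
  have hcm' : (c : ℝ≥0∞) * 2 ^ n + K * r * (3 * θ) + θ ≤ m := by exact_mod_cast hcm
  calc _ ≤ c * (2 ^ n * b) + K * r * (3 * θ * b) + θ * b :=
        add_le_add (add_le_add (mul_le_mul_right hW2 _) (mul_le_mul_right hT _)) le_rfl
    _ = (c * 2 ^ n + K * r * (3 * θ) + θ) * b := by ring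
    _ ≤ m * b := mul_le_mul_left hcm' _
    _ ≤ _ := hMt.le.trans hOb

/-- A standard bump function, with a Lipschitz constant. -/
lemma exists_lipschitz_bump (n : ℕ) : ∃ (f : (Fin n → ℝ) → ℝ) (l : ℝ≥0), ContDiff ℝ 1 f ∧
    LipschitzWith l f ∧ (∀ u, 0 ≤ f u) ∧ (∀ u, f u ≤ 1) ∧ (∀ u, ‖u‖ ≤ 1 / 2 → f u = 1) ∧
      ∀ u, 1 < ‖u‖ → f u = 0 := by
  let f : ContDiffBump (0 : Fin n → ℝ) := ⟨1 / 2, 1, by norm_num, by norm_num⟩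
  have hf : ContDiff ℝ 1 f := f.contDiff
  obtain ⟨l, hl⟩ := hf.lipschitzWith_of_hasCompactSupport f.hasCompactSupport one_ne_zero
  refine ⟨f, l, hf, hl, fun _ => f.nonneg, fun _ => f.le_one, fun u hu => ?_, fun u hu => ?_⟩
  · exact f.one_of_mem_closedBall (by simpa [f] using hu)
  · exact f.zero_of_le_dist (by simpa [f] using hu.le)

/-- Among disjoint level strips, one occupies at most an average share of a set. -/
lemma exists_level_strip {X Y : Type*} [TopologicalSpace X] [TopologicalSpace Y] [T2Space Y]
    [MeasurableSpace Y] [BorelSpace Y] (m : Measure Y) {q : X → Y} (hq : Continuous q) {S : Set X}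
    (hS : IsCompact S) (hinj : InjOn q S) {h : X → ℝ} (hh : Continuous h) (a : ℝ) {η : ℝ}
    (hη : 0 < η) {N : ℕ} (hN : 0 < N) {A : Set Y} (hA : MeasurableSet A) :
    ∃ i < N, N * m (q '' (S ∩ h ⁻¹' Ioo (a + i * η) (a + i * η + η)) ∩ A) ≤ m A := by
  set M : ℕ → Set Y := fun i => q '' (S ∩ h ⁻¹' Ioo (a + i * η) (a + i * η + η)) ∩ A with hM
  have hMm : ∀ i, MeasurableSet (M i) := fun i => by
    have h1 : q '' (S ∩ h ⁻¹' Ioo (a + i * η) (a + i * η + η)) =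
        q '' S \ q '' (S \ h ⁻¹' Ioo (a + i * η) (a + i * η + η)) := by
      rw [← hinj.image_sdiff_subset sdiff_subset, sdiff_sdiff_right_self]
    simp only [hM]
    rw [h1]
    exact ((hS.image hq).isClosed.measurableSet.diff
      ((hS.diff (isOpen_Ioo.preimage hh)).image hq).isClosed.measurableSet).inter hA
  have hdisj : ∀ i j, i < j → Disjoint (M i) (M j) := fun i j hij => by
    refine disjoint_left.2 ?_
    rintro _ ⟨⟨x, ⟨hx, -, hx2⟩, rfl⟩, -⟩ ⟨⟨x', ⟨hx', hx1', -⟩, he⟩, -⟩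
    obtain rfl := hinj hx' hx he
    have : ((i : ℝ) + 1) * η ≤ j * η := mul_le_mul_of_nonneg_right (by exact_mod_cast hij) hη.le
    linarith
  by_contra! hno
  have hsum : ∑ i ∈ Finset.range N, m (M i) ≤ m A := by
    rw [← measure_biUnion_finset (fun i _ j _ hij => ?_) fun i _ => hMm i]
    · exact measure_mono (iUnion₂_subset fun i _ => inter_subset_right)
    · rcases lt_or_gt_of_ne hij with h | h
      · exact hdisj i j h
      · exact (hdisj j i h).symm
  have hlt : ∑ i ∈ Finset.range N, m A < ∑ i ∈ Finset.range N, N * m (M i) := by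
    refine ENNReal.sum_lt_sum_of_nonempty (Finset.nonempty_range_iff.2 hN.ne') fun i hi =>
      hno i (Finset.mem_range.1 hi)
  rw [← Finset.mul_sum, Finset.sum_const, Finset.card_range, nsmul_eq_mul] at hlt
  exact absurd (mul_le_mul_right hsum _) (not_le.2 hlt)

lemma exists_shell_le (n : ℕ) {θ : ℝ≥0} (hθ0 : 0 < θ) :
    ∃ τ : ℝ, 0 < τ ∧ τ ≤ 1 / 2 ∧ (1 + 2 * τ) ^ n ≤ (1 + τ) ^ n + θ := by
  have hc : Tendsto (fun τ : ℝ => (1 + τ) ^ n + θ - (1 + 2 * τ) ^ n) (nhdsWithin 0 (Ioi 0))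
      (nhds ((1 + 0) ^ n + θ - (1 + 2 * 0) ^ n)) := by
    refine Tendsto.mono_left ?_ nhdsWithin_le_nhds
    exact Continuous.tendsto (by fun_prop) _
  have hpos : (0 : ℝ) < (1 + 0) ^ n + θ - (1 + 2 * 0) ^ n := by
    simpa using hθ0
  obtain ⟨τ, hτ1, hτ2⟩ := ((hc.eventually_const_lt hpos).and
    (Ioc_mem_nhdsGT (by norm_num : (0 : ℝ) < 1 / 2))).exists
  exact ⟨τ, hτ2.1, hτ2.2, by linarith⟩

set_option maxHeartbeats 1000000 in
/-- Near a point where the measures controlling a flow frame have small densities, a Lipschitz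
function with substantial shares of small and of large values makes it possible to gain volume. -/
lemma gains_of_flow {X : Type*} [MetricSpace X] [CompactSpace X] [MeasurableSpace X]
    [BorelSpace X] (μ : Measure X) [IsFiniteMeasure μ] {n : ℕ}
    {q : X → Fin n → ℝ} {L : ℝ≥0} (hq : LipschitzWith L q) {K r : ℝ≥0}
    (hK : ∀ q' : X → Fin n → ℝ, LipschitzWith (L + 1) q' → ∀ S, volume (q' '' S) ≤ K * μ S)
    {B : Set X} (hB : IsCompact B) (hinj : InjOn q B)
    (hr : ∀ T, MeasurableSet T → μ (B ∩ q ⁻¹' T) ≤ r * volume T) {κ α m c : ℝ≥0} (hκ0 : 0 < κ)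
    (hκ : κ ≤ 1) (hm : K * r * 4 ^ n * m < α / 2 * α) (hcm : c * 2 ^ n < m) :
    ∃ (ε : ℝ) (θ : ℝ≥0), 0 < ε ∧ 0 < θ ∧ ∀ S ⊆ B, IsCompact S → ∀ v : Fin n → X → Fin n → ℝ,
      (∀ j, Measurable (v j)) → (∀ j, ∃ M, ∀ x, ‖v j x‖ ≤ M) →
      (∀ x ∈ S, ∀ j, ‖v j x - Pi.single j 1‖ ≤ ε) →
      ∀ (σ ν ρ : Measure (Fin n → ℝ)) [IsFiniteMeasure σ] [IsFiniteMeasure ν] [IsFiniteMeasure ρ],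
      (∀ j (K : ℝ≥0) (V : X → ℝ), LipschitzWith K V → (∀ x, 0 ≤ V x) → (∀ x, V x ≤ 1) →
        ∀ χ : (Fin n → ℝ) → ℝ, ContDiff ℝ 1 χ →
          ∀ D : (Fin n → ℝ) → ℝ, Continuous D → (∀ z, 0 ≤ D z) →
            (∀ y z, |χ y - χ z| ≤ ‖y - z‖ * (D y + D z)) →
              |∫ x in S, V x * fderiv ℝ χ (q x) (v j x) ∂μ| ≤
                ∫ z, D z ∂σ + K * ∫ z, |χ z| ∂ρ + ∫ z, |χ z| ∂ν) →
      ∀ (z : Fin n → ℝ) (D r₁ : ℝ), 0 ≤ D → 0 < r₁ → (∀ w, 0 < w → w ≤ r₁ →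
        σ.real (closedBall z w) ≤ ε * w ^ n ∧ ρ.real (closedBall z w) ≤ D * w ^ n ∧
        ν.real (closedBall z w) ≤ D * w ^ n ∧
        volume ((q '' B \ q '' S) ∩ closedBall z w) ≤ θ * volume (closedBall z w)) →
      ∃ C r₀ : ℝ, 0 < C ∧ 0 < r₀ ∧ ∀ w, 0 < w → w ≤ r₀ → ∀ h : X → ℝ, LipschitzWith 1 h → ∀ a,
        α * volume (closedBall z w) ≤ volume (q '' (S ∩ h ⁻¹' Iic a) ∩ closedBall z w) →
        α * volume (closedBall z w) ≤ volume (q '' (S ∩ h ⁻¹' Ici (a + C * w)) ∩ closedBall z w) →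
        ∃ w', w ≤ w' ∧ w' ≤ 2 * w ∧ Gains q B c κ z w' := by
  obtain ⟨f, l, hfC, hfl, hf0, hf1, hfin, hfs⟩ := exists_lipschitz_bump n
  have hα : 0 < α := by
    rcases eq_or_ne α 0 with rfl | h
    · simp at hm
    · exact pos_iff_ne_zero.2 h
  set θ : ℝ≥0 := (m - c * 2 ^ n) / (3 * (K * r) + 1) with hθ
  have hθ0 : 0 < θ := div_pos (tsub_pos_of_lt hcm) (by positivity)
  have hcθ : c * 2 ^ n + K * r * (3 * θ) + θ ≤ m := by
    have h1 : K * r * (3 * θ) + θ = m - c * 2 ^ n := by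
      rw [hθ]; field_simp
    rw [add_assoc, h1, add_tsub_cancel_of_le hcm.le]
  obtain ⟨τ, hτ0, hτ2, hτ⟩ := exists_shell_le n hθ0
  set k : ℝ := τ * κ / (1 + L) with hk
  have hκ0' : (0 : ℝ) < κ := hκ0
  have hκ' : (κ : ℝ) ≤ 1 := hκ
  have hL0 : (0 : ℝ) ≤ L := L.coe_nonneg
  have hk0 : 0 < k := by positivity
  have hkτκ : k ≤ τ * κ := div_le_self (by positivity) (by linarith)
  have hkτ : k ≤ τ := hkτκ.trans (mul_le_of_le_one_right hτ0.le hκ')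
  have hkκ : k ≤ κ := hkτκ.trans (mul_le_of_le_one_left hκ0'.le (by linarith))
  have hkL : k * (1 + L / τ) ≤ κ := by
    have h1 : k * (1 + L / τ) = κ * ((τ + L) / (1 + L)) := by
      rw [hk]; field_simp
    rw [h1]
    refine mul_le_of_le_one_right hκ0'.le ((div_le_one (by positivity)).2 (by linarith))
  set c₀ : ℝ≥0 := α / (2 * 2 ^ n * (K + 1)) with hc₀
  have hc₀0 : 0 < c₀ := by positivity
  have hKc₀ : K * 2 ^ n * c₀ ≤ α / 2 := by
    have h1 : K * 2 ^ n * c₀ = α / 2 * (K / (K + 1)) := by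
      rw [hc₀]; field_simp
    rw [h1]
    exact mul_le_of_le_one_right' (div_le_one_of_le₀ le_self_add zero_le)
  set Γ : ℝ := c₀ * k ^ n with hΓ
  have hΓ0 : 0 < Γ := by positivity
  set P : ℝ := 4 * n * l * (2 * 3 ^ n + r * 6 ^ n) with hP
  have hP0 : 0 ≤ P := by positivity
  obtain ⟨N, hN⟩ := exists_nat_ge (2 ^ n / θ + 1)
  have hN0 : 0 < N := by
    have : (0 : ℝ≥0) < N := lt_of_lt_of_le (by positivity) hN
    exact_mod_cast this
  have hNθ : 2 ^ n ≤ θ * N := by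
    have : 2 ^ n / θ ≤ N := le_self_add.trans hN
    rwa [div_le_iff₀ hθ0, mul_comm] at this
  refine ⟨Γ * k / (3 * P + 1), θ / 2 ^ n, by positivity, by positivity, ?_⟩
  intro S hSB hS v hvm hvb hv σ ν ρ _ _ _ hflow z D r₁ hD hr₁ hz
  set ε := Γ * k / (3 * P + 1) with hε
  have hε0 : 0 < ε := by positivity
  have hPε : P * ε / k ≤ Γ / 3 := by
    rw [hε, div_le_div_iff₀ hk0 (by norm_num)]
    have h1 : P * (Γ * k / (3 * P + 1)) * 3 = Γ * k * (3 * P / (3 * P + 1)) := by ring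
    rw [h1]
    exact mul_le_of_le_one_right (by positivity) (div_le_one_of_le₀ (by linarith) (by positivity))
  set Q : ℝ := 4 * n * 3 ^ n * D with hQ
  have hQ0 : 0 ≤ Q := by positivity
  have hN0' : (0 : ℝ) < N := by exact_mod_cast hN0
  set C : ℝ := N + 3 * N * Q / Γ with hC
  have hC0 : 0 < C := by positivity
  have hNC : N / C ≤ 1 := div_le_one_of_le₀ (by rw [hC]; exact le_add_of_nonneg_right (by positivity))
    hC0.le
  have hQC : Q * (N / C) ≤ Γ / 3 := by
    rw [← mul_div_assoc, div_le_div_iff₀ hC0 (by norm_num), hC]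
    have : Γ * (N + 3 * N * Q / Γ) = Γ * N + 3 * N * Q := by field_simp
    rw [this]
    nlinarith [mul_pos hΓ0 hN0']
  refine ⟨C, min (r₁ / 3) (Γ / (3 * Q + 1)), hC0, by positivity, ?_⟩
  clear_value k c₀ Γ P ε Q C
  intro w hw hwr h hh a hlo hhi
  have hw1 : 3 * w ≤ r₁ := by linarith [hwr.trans (min_le_left _ _)]
  have hQw : Q * w ≤ Γ / 3 := by
    have h1 : w ≤ Γ / (3 * Q + 1) := hwr.trans (min_le_right _ _)
    rw [le_div_iff₀ (by positivity)] at h1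
    linarith
  set η : ℝ := C * w / N with hη
  have hη0 : 0 < η := by positivity
  obtain ⟨i, hiN, hi⟩ := exists_level_strip volume hq.continuous hS (hinj.mono hSB)
    hh.continuous a hη0 hN0 (isClosed_closedBall (x := z) (ε := 2 * w)).measurableSet
  set b := a + i * η with hb
  have hiη : 0 ≤ i * η := by positivity
  clear_value η b
  have hbC : b + η ≤ a + C * w := by
    have h1 : ((i : ℝ) + 1) * η ≤ N * η := mul_le_mul_of_nonneg_right (by exact_mod_cast hiN) hη0.le
    have h2 : N * η = C * w := by rw [hη]; field_simp
    linarith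
  set V : X → ℝ := fun x => max 0 (min 1 ((h x - b) / η)) with hVdef
  have hV : LipschitzWith (1 / η).toNNReal V := by
    refine LipschitzWith.const_max (LipschitzWith.const_min ?_ 1) 0
    refine LipschitzWith.of_dist_le_mul fun x y => ?_
    rw [Real.coe_toNNReal _ (by positivity), Real.dist_eq, ← sub_div, sub_sub_sub_cancel_right,
      abs_div, abs_of_pos hη0, div_eq_inv_mul, one_div]
    refine mul_le_mul_of_nonneg_left ?_ (by positivity)
    simpa [Real.dist_eq] using hh.dist_le_mul x y
  have hV0 : ∀ x, 0 ≤ V x := fun x => le_max_left _ _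
  have hV1 : ∀ x, V x ≤ 1 := fun x => max_le zero_le_one (min_le_left _ _)
  have hKV : ((1 / η).toNNReal : ℝ) = N / C / w := by
    rw [Real.coe_toNNReal _ (by positivity), hη]; field_simp
  have hmono : ∀ {A A' : Set X} {ρ : ℝ}, A ⊆ A' →
      volume (q '' (S ∩ A) ∩ closedBall z ρ) ≤ volume (q '' (S ∩ A') ∩ closedBall z ρ) :=
    fun hAA' => measure_mono (inter_subset_inter_left _ (image_mono (inter_subset_inter_right _ hAA')))
  have hτw : τ * w ≤ 1 / 2 * w := mul_le_mul_of_nonneg_right hτ2 hw.le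
  have hτw0 : 0 ≤ τ * w := by positivity
  refine ⟨(1 + 2 * τ) * w, by linarith, by linarith, ?_⟩
  refine gains_of_levels μ hq hK hB hS hSB hinj hr hV hV0 hV1 hκ hfC.continuous hf0 hf1 hfin hfs
    (s := k * w) (τ := τ) (α := α) (θ := θ) (m := m) (c₀ := c₀) (by positivity) hτ0 hτ2
    (mul_le_mul_of_nonneg_right hkτ hw.le) (mul_le_mul_of_nonneg_right hkκ hw.le) ?_ ?_
    (hlo.trans (hmono ?_)) (hhi.trans (hmono ?_)) ?_ ?_ hτ hKc₀ hm hcθ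
  · rw [hKV]
    have h1 : k * w * (N / C / w + L / (τ * w)) = k * (N / C + L / τ) := by field_simp
    rw [h1]
    exact (mul_le_mul_of_nonneg_left (by linarith) hk0.le).trans hkL
  · intro y hy y' hy'
    have hσν := hz (3 * w) (by positivity) hw1
    have hμb : μ.real (S ∩ q ⁻¹' closedBall z (3 * w)) ≤ r * (6 * w) ^ n := by
      have h1 := (measure_mono (inter_subset_inter_left _ hSB)).trans
        (hr (closedBall z (3 * w)) isClosed_closedBall.measurableSet)
      rw [Real.volume_pi_closedBall _ (by positivity), Fintype.card_fin,
        ← ENNReal.ofReal_coe_nnreal, ← ENNReal.ofReal_mul r.coe_nonneg] at h1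
      refine (ENNReal.toReal_mono ENNReal.ofReal_ne_top h1).trans (le_of_eq ?_)
      rw [ENNReal.toReal_ofReal (by positivity)]
      ring
    refine (mollify_sub_le μ hq.continuous hS hvm hvb hε0.le hv hV hV0 hV1
      (fun j => hflow j _ V hV hV0 hV1) hfC hfl hf0 hf1 hfs (s := k * w) (by positivity)
      (by linarith [mul_le_mul_of_nonneg_right (hkτ.trans hτ2) hw.le]) hσν.1 hσν.2.2.1 hσν.2.1 hμb hy hy').trans ?_
    rw [hKV]
    have h1 : 4 * w * (n * (2 * l / (k * w) * (ε * (3 * w) ^ n) + N / C / w * (D * (3 * w) ^ n) +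
        D * (3 * w) ^ n + l / (k * w) * ε * (r * (6 * w) ^ n))) =
        (P * ε / k + Q * (N / C) + Q * w) * w ^ n := by
      rw [hP, hQ, mul_pow, mul_pow]
      field_simp
      ring
    have h2 : (c₀ : ℝ) * (k * w) ^ n = Γ * w ^ n := by rw [hΓ, mul_pow]; ring
    rw [h1, h2]
    exact mul_le_mul_of_nonneg_right (by linarith) (by positivity)
  · intro x hx
    have h1 : h x ≤ a := hx
    have h2 : (h x - b) / η ≤ 0 := div_nonpos_of_nonpos_of_nonneg (by linarith) hη0.le
    exact max_eq_left ((min_le_right _ _).trans h2)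
  · intro x hx
    have h1 : a + C * w ≤ h x := hx
    have h2 : 1 ≤ (h x - b) / η := (one_le_div hη0).2 (by linarith)
    change max 0 (min 1 ((h x - b) / η)) = 1
    rw [min_eq_left h2, max_eq_right zero_le_one]
  · have hsub : V ⁻¹' Ioo 0 1 ⊆ h ⁻¹' Ioo b (b + η) := by
      rintro x ⟨hx0, hx1⟩
      constructor
      · by_contra hle
        have h2 : (h x - b) / η ≤ 0 := div_nonpos_of_nonpos_of_nonneg (by linarith) hη0.le
        exact hx0.ne' (max_eq_left ((min_le_right _ _).trans h2))
      · by_contra hle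
        have h2 : 1 ≤ (h x - b) / η := (one_le_div hη0).2 (by linarith)
        refine hx1.ne ?_
        change max 0 (min 1 ((h x - b) / η)) = 1
        rw [min_eq_left h2, max_eq_right zero_le_one]
    refine (hmono hsub).trans ?_
    have hvol : volume (closedBall z (2 * w)) = 2 ^ n * volume (closedBall z w) := by
      rw [Real.volume_pi_closedBall _ (by positivity), Real.volume_pi_closedBall _ hw.le,
        Fintype.card_fin, mul_left_comm, mul_pow, ENNReal.ofReal_mul (by positivity),
        ENNReal.ofReal_pow zero_le_two]
      norm_num
    rw [hvol] at hi
    have hNθ' : (2 : ℝ≥0∞) ^ n ≤ θ * N := by exact_mod_cast hNθ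
    have hNn : (N : ℝ≥0∞) ≠ 0 := by exact_mod_cast hN0.ne'
    refine (ENNReal.mul_le_mul_iff_right hNn (ENNReal.natCast_ne_top N)).1 (hi.trans ?_)
    calc _ ≤ θ * N * volume (closedBall z w) := mul_le_mul_left hNθ' _
      _ = _ := by ring
  · have hvol : volume (closedBall z (2 * w)) = 2 ^ n * volume (closedBall z w) := by
      rw [Real.volume_pi_closedBall _ (by positivity), Real.volume_pi_closedBall _ hw.le,
        Fintype.card_fin, mul_left_comm, mul_pow, ENNReal.ofReal_mul (by positivity),
        ENNReal.ofReal_pow zero_le_two]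
      norm_num
    refine (hz (2 * w) (by positivity) (by linarith)).2.2.2.trans (le_of_eq ?_)
    rw [hvol, ← mul_assoc]
    congr 1
    have : (θ / 2 ^ n * 2 ^ n : ℝ≥0) = θ := by field_simp
    exact_mod_cast this

lemma volume_closedBall_half {n : ℕ} (z z' : Fin n → ℝ) {w : ℝ} (hw : 0 ≤ w) :
    volume (closedBall z w) = 2 ^ n * volume (closedBall z' (w / 2)) := by
  rw [Real.volume_pi_closedBall _ hw, Real.volume_pi_closedBall _ (by positivity),
    Fintype.card_fin, mul_div_cancel₀ _ two_ne_zero, mul_pow, ENNReal.ofReal_mul (by positivity),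
    ENNReal.ofReal_pow zero_le_two]
  norm_num

/-- If Lipschitz functions cannot have substantial shares of small and of large values near `q x₀`,
then most points near `q x₀` have preimages at a proportionally small distance from `x₀`. -/
lemma volume_far_lt {X : Type*} [MetricSpace X] {n : ℕ} {q : X → Fin n → ℝ} (hq : Continuous q)
    {S : Set X} (hS : IsCompact S) (hinj : InjOn q S) {x₀ : X} (hx₀ : x₀ ∈ S) {α : ℝ≥0}
    (hα : α * (2 + 2 ^ n) ≤ 1) {C r : ℝ} (hC : 0 < C)
    (hdens : ∀ w, 0 < w → w ≤ r →
      volume (closedBall (q x₀) w \ q '' S) ≤ α * volume (closedBall (q x₀) w))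
    (hdich : ∀ w, 0 < w → w ≤ r → ∀ h : X → ℝ, LipschitzWith 1 h → ∀ a,
      volume (q '' (S ∩ h ⁻¹' Iic a) ∩ closedBall (q x₀) w) < α * volume (closedBall (q x₀) w) ∨
      volume (q '' (S ∩ h ⁻¹' Ici (a + C * w)) ∩ closedBall (q x₀) w) <
        α * volume (closedBall (q x₀) w)) {w : ℝ} (hw : 0 < w) (hwr : w ≤ r) :
    volume (q '' (S ∩ dist x₀ ⁻¹' Ici (3 * C * w)) ∩ closedBall (q x₀) w) <
      α * volume (closedBall (q x₀) w) := by
  set z := q x₀ with hz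
  by_contra hno
  have hL : LipschitzWith 1 (dist x₀) := LipschitzWith.dist_right x₀
  set s : ℕ → ℝ := fun k => w / 2 ^ k with hs
  have hs0 : ∀ k, 0 < s k := fun k => by positivity
  have hsr : ∀ k, s k ≤ r := fun k => (div_le_self hw.le (one_le_pow₀ one_le_two)).trans hwr
  have hs1 : ∀ k, s (k + 1) = s k / 2 := fun k => by simp only [hs, pow_succ]; ring
  set b : ℕ → ℝ≥0∞ := fun k => volume (closedBall z (s k)) with hb
  have hbt : ∀ k, b k ≠ ∞ := fun k => (isCompact_closedBall _ _).measure_ne_top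
  have hb0 : ∀ k, b k ≠ 0 := fun k => (measure_closedBall_pos volume z (hs0 k)).ne'
  have hcov : ∀ k a, b k ≤ volume (closedBall z (s k) \ q '' S) +
      volume (q '' (S ∩ dist x₀ ⁻¹' Iic a) ∩ closedBall z (s k)) +
      volume (q '' (S ∩ dist x₀ ⁻¹' Ici a) ∩ closedBall z (s k)) := fun k a => by
    refine (measure_mono fun y hy => ?_).trans ((measure_union_le _ _).trans
      (add_le_add (measure_union_le _ _) le_rfl))
    by_cases hyS : y ∈ q '' S
    · obtain ⟨x, hx, rfl⟩ := hyS
      rcases le_total (dist x₀ x) a with h | h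
      · exact Or.inl (Or.inr ⟨⟨x, ⟨hx, h⟩, rfl⟩, hy⟩)
      · exact Or.inr ⟨⟨x, ⟨hx, h⟩, rfl⟩, hy⟩
    · exact Or.inl (Or.inl ⟨hy, hyS⟩)
  have hα' : (α : ℝ≥0∞) * (2 + 2 ^ n) ≤ 1 := by exact_mod_cast hα
  have hbad : ∀ k, volume (q '' (S ∩ dist x₀ ⁻¹' Iic (C * w + C * s k)) ∩ closedBall z (s k)) <
      α * b k := by
    intro k
    induction k with
    | zero =>
      have h0 : s 0 = w := by simp [hs]
      have h1 := (hdich w hw hwr _ hL (2 * C * w)).resolve_right (by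
        rwa [show 2 * C * w + C * w = 3 * C * w by ring])
      simp only [hb, h0]
      rwa [show C * w + C * w = 2 * C * w by ring]
    | succ k ih =>
      have h1 := hdich (s (k + 1)) (hs0 _) (hsr _) _ hL (C * w + C * s (k + 1))
      refine h1.resolve_right fun h2 => ?_
      have h3 : C * w + C * s (k + 1) + C * s (k + 1) = C * w + C * s k := by rw [hs1]; ring
      rw [h3] at h2
      have h4 : b k = 2 ^ n * b (k + 1) := by
        simp only [hb]
        rw [hs1]
        exact volume_closedBall_half z z (hs0 k).le
      have h5 : volume (q '' (S ∩ dist x₀ ⁻¹' Iic (C * w + C * s k)) ∩ closedBall z (s (k + 1))) ≤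
          α * b k := (measure_mono (inter_subset_inter_right _ (closedBall_subset_closedBall (by
            rw [hs1]; linarith [hs0 k])))).trans ih.le
      refine (hcov (k + 1) (C * w + C * s k)).not_gt ?_
      calc _ < α * b (k + 1) + α * b k + α * b (k + 1) := by
            have h6 := add_le_add (hdens _ (hs0 (k + 1)) (hsr _)) h5
            exact ENNReal.add_lt_add_of_le_of_lt (ne_top_of_le_ne_top (ENNReal.add_ne_top.2
              ⟨ENNReal.mul_ne_top ENNReal.coe_ne_top (hbt _),
                ENNReal.mul_ne_top ENNReal.coe_ne_top (hbt _)⟩) h6) h6 h2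
        _ = α * (2 + 2 ^ n) * b (k + 1) := by rw [h4]; ring
        _ ≤ 1 * b (k + 1) := mul_le_mul_left hα' _
        _ = b (k + 1) := one_mul _
  have hfar : z ∉ q '' (S ∩ dist x₀ ⁻¹' Ici (C * w)) := by
    rintro ⟨x, ⟨hx, hxw⟩, hxz⟩
    obtain rfl := hinj hx hx₀ hxz
    have : C * w ≤ dist x x := hxw
    rw [dist_self] at this
    exact this.not_gt (by positivity)
  have hcl : IsClosed (q '' (S ∩ dist x₀ ⁻¹' Ici (C * w))) :=
    ((hS.inter_right (isClosed_Ici.preimage hL.continuous)).image hq).isClosed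
  obtain ⟨ρ, hρ, hρsub⟩ := Metric.isOpen_iff.1 hcl.isOpen_compl z hfar
  obtain ⟨k, hk⟩ : ∃ k, s k < ρ := by
    have : Tendsto s atTop (nhds 0) := by
      have h := tendsto_const_nhds.div_atTop (tendsto_pow_atTop_atTop_of_one_lt
        (one_lt_two (α := ℝ))) (a := w)
      exact h
    exact (this.eventually_lt_const hρ).exists
  have hem : q '' (S ∩ dist x₀ ⁻¹' Ici (C * w)) ∩ closedBall z (s k) = ∅ := by
    refine eq_empty_of_forall_notMem fun y hy => ?_
    exact hρsub (closedBall_subset_ball hk hy.2) hy.1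
  have h1 := hcov k (C * w)
  rw [hem, measure_empty, add_zero] at h1
  refine h1.not_gt ?_
  calc _ < α * b k + α * b k := by
        have h6 := hdens _ (hs0 k) (hsr _)
        refine ENNReal.add_lt_add_of_le_of_lt (ne_top_of_le_ne_top
          (ENNReal.mul_ne_top ENNReal.coe_ne_top (hbt k)) h6) h6
          ((measure_mono (inter_subset_inter_left _ (image_mono (inter_subset_inter_right _
            (preimage_mono (Iic_subset_Iic.2 ?_)))))).trans_lt (hbad k))
        exact le_add_of_nonneg_right (mul_pos hC (hs0 k)).le
    _ = α * 2 * b k := by ring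
    _ ≤ α * (2 + 2 ^ n) * b k := mul_le_mul_left (mul_le_mul_right le_self_add _) _
    _ ≤ 1 * b k := mul_le_mul_left hα' _
    _ = b k := one_mul _

/-- An injective map whose inverse is close to Lipschitz in measure near many points is
bi-Lipschitz from below on a compact set with large image. -/
lemma exists_antilipschitz_piece {X : Type*} [MetricSpace X] {n : ℕ} {q : X → Fin n → ℝ}
    (hq : Continuous q) {S : Set X} (hS : IsCompact S) (hinj : InjOn q S) {A : Set (Fin n → ℝ)}
    (hAS : A ⊆ q '' S) (hA0 : volume A ≠ 0) {α : ℝ≥0} (hα : α = 1 / (4 * 2 ^ n))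
    (hdens : ∀ z ∈ A, ∃ r, 0 < r ∧ ∀ w, 0 < w → w ≤ r →
      volume (closedBall z w \ q '' S) ≤ α * volume (closedBall z w))
    (hdich : ∀ z ∈ A, ∃ C r, 0 < C ∧ 0 < r ∧ ∀ w, 0 < w → w ≤ r →
      ∀ h : X → ℝ, LipschitzWith 1 h → ∀ a,
        volume (q '' (S ∩ h ⁻¹' Iic a) ∩ closedBall z w) < α * volume (closedBall z w) ∨
        volume (q '' (S ∩ h ⁻¹' Ici (a + C * w)) ∩ closedBall z w) < α * volume (closedBall z w)) :
    ∃ F ⊆ S, IsCompact F ∧ volume (q '' F) ≠ 0 ∧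
      ∃ M : ℝ≥0, ∀ x ∈ F, ∀ y ∈ F, dist x y ≤ M * dist (q x) (q y) := by
  have hα1 : α * (2 + 2 ^ n) ≤ 1 := by
    rw [hα, one_div, inv_mul_le_one₀ (by positivity)]
    nlinarith [one_le_pow₀ (one_le_two (α := ℝ≥0)) (n := n)]
  have hα3 : 3 * α * 2 ^ n < 1 := by
    have : 3 * α * 2 ^ n = 3 / 4 := by rw [hα]; field_simp
    rw [this]
    exact (div_lt_one (by norm_num)).2 (by norm_num)
  set E : ℕ → Set (Fin n → ℝ) := fun j => {z | ∃ x₀ ∈ S, q x₀ = z ∧ ∀ w : ℝ, 0 < w → w * (j + 1) ≤ 1 →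
    volume (closedBall z w \ q '' S) ≤ α * volume (closedBall z w) ∧
    volume (q '' (S ∩ dist x₀ ⁻¹' Ici (j * w)) ∩ closedBall z w) ≤ α * volume (closedBall z w)}
    with hE
  have hAE : A ⊆ ⋃ j, E j := by
    intro z hz
    obtain ⟨x₀, hx₀, rfl⟩ := hAS hz
    obtain ⟨r₁, hr₁, h1⟩ := hdens _ hz
    obtain ⟨C, r₂, hC, hr₂, h2⟩ := hdich _ hz
    obtain ⟨j, hj⟩ := exists_nat_ge (max (3 * C) (max r₁⁻¹ r₂⁻¹))
    have hj1 : 3 * C ≤ j := (le_max_left _ _).trans hj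
    have hj2 : r₁⁻¹ ≤ j := (le_max_left _ _).trans ((le_max_right _ _).trans hj)
    have hj3 : r₂⁻¹ ≤ j := (le_max_right _ _).trans ((le_max_right _ _).trans hj)
    have hle : ∀ r : ℝ, 0 < r → r⁻¹ ≤ j → ∀ w : ℝ, w * (j + 1) ≤ 1 → 0 < w → w ≤ r := by
      intro r hr hrj w hw hw0
      have : w * r⁻¹ ≤ 1 := (mul_le_mul_of_nonneg_left (by linarith) hw0.le).trans hw
      rwa [← div_eq_mul_inv, div_le_one hr] at this
    refine mem_iUnion.2 ⟨j, x₀, hx₀, rfl, fun w hw hwj => ⟨h1 w hw (hle _ hr₁ hj2 w hwj hw), ?_⟩⟩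
    have h3 := volume_far_lt hq hS hinj hx₀ hα1 hC
      (fun w hw hwr => h1 w hw (hwr.trans (min_le_left _ _)))
      (fun w hw hwr => h2 w hw (hwr.trans (min_le_right _ _))) hw
      (le_min (hle _ hr₁ hj2 w hwj hw) (hle _ hr₂ hj3 w hwj hw))
    refine (measure_mono (inter_subset_inter_left _ (image_mono (inter_subset_inter_right _
      (preimage_mono (Ici_subset_Ici.2 ?_)))))).trans h3.le
    exact mul_le_mul_of_nonneg_right hj1 hw.le
  obtain ⟨j, hj⟩ : ∃ j, volume (E j) ≠ 0 := by
    by_contra! h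
    exact hA0 (measure_mono_null hAE (measure_iUnion_null h))
  set ρ : ℝ := 1 / (2 * (j + 1)) with hρ
  have hρ0 : 0 < ρ := by positivity
  obtain ⟨i, hi⟩ : ∃ i, volume (E j ∩ closedBall (TopologicalSpace.denseSeq (Fin n → ℝ) i) ρ) ≠ 0 := by
    by_contra! h
    refine hj (measure_mono_null (fun z hz => ?_) (measure_iUnion_null h))
    obtain ⟨i, hi⟩ := (TopologicalSpace.denseRange_denseSeq (Fin n → ℝ)).exists_dist_lt z hρ0
    exact mem_iUnion.2 ⟨i, hz, hi.le⟩
  set E' := E j ∩ closedBall (TopologicalSpace.denseSeq (Fin n → ℝ) i) ρ with hE'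
  have hkey : ∀ x ∈ S ∩ q ⁻¹' E', ∀ y ∈ S ∩ q ⁻¹' E', dist x y ≤ 2 * j * dist (q x) (q y) := by
    rintro x ⟨hx, ⟨x', hx', hxx', hxE⟩, hxb⟩ y ⟨hy, ⟨y', hy', hyy', hyE⟩, hyb⟩
    obtain rfl := hinj hx' hx hxx'
    obtain rfl := hinj hy' hy hyy'
    rcases eq_or_ne x' y' with rfl | hne
    · simp
    set w := dist (q x') (q y') with hw
    have hw0 : 0 < w := dist_pos.2 fun h => hne (hinj hx hy h)
    have hwj : w * (j + 1) ≤ 1 := by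
      have h1 : w ≤ 2 * ρ := by
        have h2 := mem_closedBall.1 hxb
        have h3 := mem_closedBall.1 hyb
        rw [dist_comm] at h3
        linarith [dist_triangle (q x') (TopologicalSpace.denseSeq (Fin n → ℝ) i) (q y')]
      calc w * (j + 1) ≤ 2 * ρ * (j + 1) := by gcongr
        _ = 1 := by rw [hρ]; field_simp
    set p := midpoint ℝ (q x') (q y') with hp
    have hsub1 : closedBall p (w / 2) ⊆ closedBall (q x') w := closedBall_subset_closedBall' (by
      rw [hp, dist_midpoint_left, Real.norm_of_nonneg zero_le_two]; linarith)
    have hsub2 : closedBall p (w / 2) ⊆ closedBall (q y') w := closedBall_subset_closedBall' (by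
      rw [hp, dist_midpoint_right, Real.norm_of_nonneg zero_le_two]; linarith)
    have hbt : volume (closedBall p (w / 2)) ≠ ∞ := (isCompact_closedBall _ _).measure_ne_top
    have hb0 : volume (closedBall p (w / 2)) ≠ 0 :=
      (measure_closedBall_pos volume p (by positivity)).ne'
    have hvx := volume_closedBall_half (q x') p hw0.le
    have hvy := volume_closedBall_half (q y') p hw0.le
    by_contra hfar
    rw [not_le] at hfar
    have hcov : closedBall p (w / 2) ⊆ (closedBall (q x') w \ q '' S) ∪
        (q '' (S ∩ dist x' ⁻¹' Ici (j * w)) ∩ closedBall (q x') w) ∪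
        (q '' (S ∩ dist y' ⁻¹' Ici (j * w)) ∩ closedBall (q y') w) := by
      intro u hu
      by_cases huS : u ∈ q '' S
      · obtain ⟨v, hv, rfl⟩ := huS
        by_cases h1 : j * w ≤ dist x' v
        · exact Or.inl (Or.inr ⟨⟨v, ⟨hv, h1⟩, rfl⟩, hsub1 hu⟩)
        · refine Or.inr ⟨⟨v, ⟨hv, ?_⟩, rfl⟩, hsub2 hu⟩
          change j * w ≤ dist y' v
          rw [not_le] at h1
          have h2 := dist_triangle_right x' y' v
          linarith
      · exact Or.inl (Or.inl ⟨hsub1 hu, huS⟩)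
    have h1 := (measure_mono (μ := volume) hcov).trans ((measure_union_le _ _).trans
      (add_le_add (measure_union_le _ _) le_rfl))
    have h2 := h1.trans (add_le_add (add_le_add (hxE w hw0 hwj).1 (hxE w hw0 hwj).2)
      (hyE w hw0 hwj).2)
    rw [hvx, hvy] at h2
    refine h2.not_gt ?_
    have hα3' : 3 * (α : ℝ≥0∞) * 2 ^ n < 1 := by exact_mod_cast hα3
    calc _ = 3 * (α : ℝ≥0∞) * 2 ^ n * volume (closedBall p (w / 2)) := by ring
      _ < 1 * volume (closedBall p (w / 2)) := (ENNReal.mul_lt_mul_iff_left hb0 hbt).2 hα3'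
      _ = _ := one_mul _
  have hFS : closure (S ∩ q ⁻¹' E') ⊆ S := hS.isClosed.closure_subset_iff.2 inter_subset_left
  refine ⟨closure (S ∩ q ⁻¹' E'), hFS, hS.of_isClosed_subset isClosed_closure hFS, fun h0 => ?_,
    2 * j, ?_⟩
  · refine hi (measure_mono_null (fun z hz => ?_) h0)
    obtain ⟨x₀, hx₀, hxz, -⟩ := hz.1
    exact ⟨x₀, subset_closure ⟨hx₀, by rw [mem_preimage, hxz]; exact hz⟩, hxz⟩
  · intro x hx y hy
    have hcl : IsClosed {p : X × X | dist p.1 p.2 ≤ 2 * j * dist (q p.1) (q p.2)} :=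
      isClosed_le (by fun_prop) (by fun_prop)
    have hmem : (x, y) ∈ closure ((S ∩ q ⁻¹' E') ×ˢ (S ∩ q ⁻¹' E')) := by
      rw [closure_prod_eq]
      exact ⟨hx, hy⟩
    have := hcl.closure_subset_iff.2 (fun p hp => hkey p.1 hp.1 p.2 hp.2) hmem
    simpa using this

lemma measureReal_closedBall_le {n : ℕ} {σ : Measure (Fin n → ℝ)} {z : Fin n → ℝ}
    {c : ℝ} (hc0 : 0 ≤ c) {w : ℝ} (hw : 0 < w)
    (h : σ (closedBall z w) ≤ ENNReal.ofReal c * volume (closedBall z w)) :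
    σ.real (closedBall z w) ≤ c * 2 ^ n * w ^ n := by
  rw [Real.volume_pi_closedBall _ hw.le, Fintype.card_fin, ← ENNReal.ofReal_mul hc0, mul_pow,
    ← mul_assoc] at h
  exact ENNReal.toReal_le_of_le_ofReal (by positivity) h

lemma ae_exists_measureReal_le {n : ℕ} (σ : Measure (Fin n → ℝ)) [IsFiniteMeasure σ] :
    ∀ᵐ z : Fin n → ℝ, ∃ D r : ℝ, 0 ≤ D ∧ 0 < r ∧ ∀ w, 0 < w → w ≤ r →
      σ.real (closedBall z w) ≤ D * w ^ n := by
  filter_upwards [ae_exists_radius_le_mul σ volume, σ.rnDeriv_lt_top volume] with z hz ht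
  obtain ⟨c, hc, hc'⟩ := ENNReal.lt_iff_exists_nnreal_btwn.1 ht
  obtain ⟨r, hr, h⟩ := hz c hc
  refine ⟨c * 2 ^ n, r, by positivity, hr, fun w hw hwr => ?_⟩
  exact measureReal_closedBall_le c.2 hw (by simpa using h w hw hwr)

lemma ae_exists_index_measureReal_le {n : ℕ} (σ : ℕ → Measure (Fin n → ℝ))
    [∀ k, IsFiniteMeasure (σ k)] (hσ : ∀ k, (σ k).real univ ≤ 1 / ((k : ℝ) + 1)) {ε : ℝ}
    (hε : 0 < ε) :
    ∀ᵐ z : Fin n → ℝ, ∃ k, ∃ r : ℝ, 0 < r ∧ ∀ w, 0 < w → w ≤ r →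
      (σ k).real (closedBall z w) ≤ ε * w ^ n := by
  set c : ℝ := ε / 2 ^ n with hc
  have hc0 : 0 < c := by positivity
  have h1 : ∀ᵐ z : Fin n → ℝ, ∃ k, (σ k).rnDeriv volume z < ENNReal.ofReal c := by
    rw [ae_iff]
    have h2 : ∀ k : ℕ, ENNReal.ofReal c *
        volume {z : Fin n → ℝ | ¬ ∃ k, (σ k).rnDeriv volume z < ENNReal.ofReal c} ≤
          ENNReal.ofReal (1 / ((k : ℝ) + 1)) := fun k => by
      refine (mul_le_mul_right (measure_mono fun z hz => ?_) _).trans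
        ((measure_le_rnDeriv_le (σ k) volume (ENNReal.ofReal c)).trans ?_)
      · simp only [mem_ofPred_eq, not_exists, not_lt] at hz ⊢
        exact hz k
      · rw [← ofReal_measureReal]
        exact ENNReal.ofReal_le_ofReal (hσ k)
    have h3 : Tendsto (fun k : ℕ => ENNReal.ofReal (1 / ((k : ℝ) + 1))) atTop (nhds 0) := by
      have := ENNReal.tendsto_ofReal (tendsto_one_div_add_atTop_nhds_zero_nat (𝕜 := ℝ))
      simpa using this
    have h4 := nonpos_iff_eq_zero.1 (ge_of_tendsto' h3 h2)
    rcases mul_eq_zero.1 h4 with h5 | h5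
    · exact absurd h5 (by simpa using hc0)
    · exact h5
  have h2 : ∀ᵐ z : Fin n → ℝ, ∀ k, ∀ c : ℝ≥0∞, (σ k).rnDeriv volume z < c →
      ∃ r₀ : ℝ, 0 < r₀ ∧ ∀ r, 0 < r → r ≤ r₀ →
        σ k (closedBall z r) ≤ c * volume (closedBall z r) :=
    ae_all_iff.2 fun k => ae_exists_radius_le_mul (σ k) volume
  filter_upwards [h1, h2] with z ⟨k, hk⟩ hz
  obtain ⟨r, hr, h⟩ := hz k _ hk
  refine ⟨k, r, hr, fun w hw hwr => ?_⟩
  have := measureReal_closedBall_le hc0.le hw (h w hw hwr)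
  rwa [hc, div_mul_cancel₀ _ (by positivity)] at this

lemma ae_exists_volume_sdiff_le {n : ℕ} {T : Set (Fin n → ℝ)} (hT : MeasurableSet T) :
    ∀ᵐ z : Fin n → ℝ, z ∈ T → ∀ θ : ℝ≥0, 0 < θ → ∃ r : ℝ, 0 < r ∧ ∀ w, 0 < w → w ≤ r →
      volume (closedBall z w \ T) ≤ θ * volume (closedBall z w) := by
  filter_upwards [Besicovitch.ae_tendsto_measure_inter_div_of_measurableSet volume hT.compl]
    with z hz hzT θ hθ
  rw [indicator_of_notMem (by simpa using hzT)] at hz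
  obtain ⟨r, hr, h⟩ := mem_nhdsGT_iff_exists_Ioc_subset.1
    (hz.eventually (gt_mem_nhds (ENNReal.coe_pos.2 hθ)))
  refine ⟨r, hr, fun w hw hwr => ?_⟩
  have h1 : volume (Tᶜ ∩ closedBall z w) / volume (closedBall z w) < θ := h ⟨hw, hwr⟩
  rw [sdiff_eq, inter_comm]
  exact (ENNReal.div_le_iff_le_mul (Or.inl (measure_closedBall_pos _ _ hw).ne')
    (Or.inl measure_closedBall_lt_top.ne)).1 h1.le

lemma Gains.mono {X : Type*} [MetricSpace X] {n : ℕ} {q : X → Fin n → ℝ} {B : Set X} {c : ℝ≥0∞}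
    {κ κ' : ℝ≥0} (hκ : κ ≤ κ') {z : Fin n → ℝ} {w : ℝ} (hw : 0 ≤ w) (h : Gains q B c κ z w) :
    Gains q B c κ' z w := by
  obtain ⟨f, h1, h2, h3, h4⟩ := h
  exact ⟨f, h1.weaken hκ, fun x => (h2 x).trans (by gcongr), h3, h4⟩

/-- An injective image of a set on which a Lipschitz map is expanding is rectifiable. -/
lemma Unrect.volume_image_eq_zero {X : Type*} [MetricSpace X] [MeasurableSpace X] [BorelSpace X]
    {n : ℕ} {U : Set X} (hU : Unrect n U) {q : X → Fin n → ℝ} {L : ℝ≥0}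
    (hq : LipschitzWith L q) {F : Set X} (hF : IsCompact F) (hFU : F ⊆ U) {M : ℝ≥0}
    (hM : ∀ x ∈ F, ∀ y ∈ F, dist x y ≤ M * dist (q x) (q y)) : volume (q '' F) = 0 := by
  rcases F.eq_empty_or_nonempty with rfl | ⟨x₀, hx₀⟩
  · simp
  have : Nonempty X := ⟨x₀⟩
  have hinj : InjOn q F := fun x hx y hy hxy => dist_le_zero.1 ((hM x hx y hy).trans (by simp [hxy]))
  set e := EuclideanSpace.equiv (Fin n) ℝ with he
  set g : EuclideanSpace ℝ (Fin n) → X := fun y => Function.invFunOn q F (e y) with hg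
  have hgq : ∀ x ∈ F, g (e.symm (q x)) = x := fun x hx => by
    simp only [hg, ContinuousLinearEquiv.apply_symm_apply]
    exact hinj.leftInvOn_invFunOn hx
  set Z := (fun x => e.symm (q x)) '' F with hZ
  have hgZ : g '' Z = F := by
    rw [hZ, image_image]
    exact (image_congr hgq).trans (image_id' F)
  have hZc : IsCompact Z := hF.image (e.symm.continuous.comp hq.continuous)
  have hgl : LipschitzOnWith (M * ‖(e : EuclideanSpace ℝ (Fin n) →L[ℝ] (Fin n → ℝ))‖₊) g Z := by
    refine LipschitzOnWith.of_dist_le_mul ?_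
    rintro _ ⟨x, hx, rfl⟩ _ ⟨y, hy, rfl⟩
    rw [hgq x hx, hgq y hy]
    refine (hM x hx y hy).trans ?_
    have h1 := (e : EuclideanSpace ℝ (Fin n) →L[ℝ] (Fin n → ℝ)).lipschitz.dist_le_mul
      (e.symm (q x)) (e.symm (q y))
    simp only [ContinuousLinearEquiv.coe_coe, ContinuousLinearEquiv.apply_symm_apply] at h1
    rw [NNReal.coe_mul, mul_assoc]
    exact mul_le_mul_of_nonneg_left h1 M.2
  have h0 := hU Z g _ hZc hgl (hgZ.subset.trans hFU)
  rw [hgZ] at h0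
  have h1 := hq.hausdorffMeasure_image_le (d := n) (Nat.cast_nonneg n) F
  rw [h0, mul_zero] at h1
  rw [← hausdorffMeasure_pi_real, Fintype.card_fin]
  exact nonpos_iff_eq_zero.1 h1

theorem Unrect.volume_image_eq_zero_of_flow {X : Type*} [MetricSpace X] [CompactSpace X]
    [MeasurableSpace X] [BorelSpace X] {n : ℕ} (hX : μH[(n : ℝ)] (univ : Set X) ≠ ∞) {U : Set X}
    (hU : Unrect n U) {q : X → Fin n → ℝ} {L : ℝ≥0} (hq : LipschitzWith L q) {B : Set X}
    (hB : IsCompact B) (hBU : B ⊆ U)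
    (hlsc : ∀ B' ⊆ B, IsCompact B' → ∀ r < volume (q '' B'), ∃ δ : ℝ≥0, 0 < δ ∧
      ∀ h : X → Fin n → ℝ, LipschitzWith δ h → (∀ x, ‖h x‖ ≤ δ) →
        r < volume ((fun x => q x + h x) '' B'))
    (hflow : ∀ B' ⊆ B, IsCompact B' → ∀ ε : ℝ, 0 < ε →
      ∃ (S : ℕ → Set X) (v : ℕ → Fin n → X → Fin n → ℝ), (∀ p, IsCompact (S p)) ∧
        (∀ p, S p ⊆ B') ∧ μH[(n : ℝ)] (B' \ ⋃ p, S p) = 0 ∧ (∀ p j, Measurable (v p j)) ∧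
        (∀ p j, ∃ M, ∀ x, ‖v p j x‖ ≤ M) ∧
        (∀ p, ∀ x ∈ S p, ∀ j, ‖v p j x - Pi.single j 1‖ ≤ ε) ∧
        ∀ p, FlowAlong q μH[(n : ℝ)] (S p) (v p)) : volume (q '' B) = 0 := by
  by_contra hvol
  have : IsFiniteMeasure (μH[(n : ℝ)] : Measure X) := ⟨hX.lt_top⟩
  set μ : Measure X := μH[(n : ℝ)] with hμ
  obtain ⟨B', hB'B, hB', hinj, hB'0, r, hr⟩ :=
    exists_compact_injOn_le (m := volume) μ hq.continuous hB hvol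
  set K : ℝ≥0 := (L + 1) ^ n with hKdef
  have hK : ∀ q' : X → Fin n → ℝ, LipschitzWith (L + 1) q' → ∀ S, volume (q' '' S) ≤ K * μ S := by
    intro q' hq' S
    have h1 := hq'.hausdorffMeasure_image_le (d := n) (Nat.cast_nonneg n) S
    rw [← hausdorffMeasure_pi_real, Fintype.card_fin]
    simpa [hKdef] using h1
  set α : ℝ≥0 := 1 / (4 * 2 ^ n) with hα
  have hα0 : 0 < α := by positivity
  set m : ℝ≥0 := α / 2 * α / (K * r * 4 ^ n + 1) with hm
  have hm0 : 0 < m := by positivity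
  set c : ℝ≥0 := m / 2 ^ (n + 1) with hc
  have hc0 : 0 < c := by positivity
  have hm1 : K * r * 4 ^ n * m < α / 2 * α := by
    have h1 : (K * r * 4 ^ n + 1) * m = α / 2 * α := by
      rw [hm, mul_div_cancel₀]; positivity
    rw [← h1, add_mul, one_mul]
    exact lt_add_of_pos_right _ hm0
  have hcm : c * 2 ^ n < m := by
    have : c * 2 ^ n = m / 2 := by
      rw [hc, pow_succ]; field_simp
    rw [this]; exact half_lt_self hm0
  obtain ⟨κ₀, hκ₀, hred⟩ := exists_measure_gains_le hq.continuous hB' hB'0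
    (hlsc B' hB'B hB') (ENNReal.coe_ne_zero.2 hc0.ne')
  set Red := {z | ∀ r > 0, ∃ w, 0 < w ∧ w < r ∧ Gains q B' c κ₀ z w} with hRed
  set κ := min κ₀ 1
  obtain ⟨ε, θ, hε, hθ, hgain⟩ := gains_of_flow μ hq hK hB' hinj hr (κ := κ) (lt_min hκ₀ one_pos)
    (min_le_right _ _) hm1 hcm
  obtain ⟨S, v, hSc, hSB, hScov, hvm, hvb, hvε, hfl⟩ := hflow B' hB'B hB' ε hε
  have hfin : volume (q '' B') ≠ ∞ := (hB'.image hq.continuous).measure_ne_top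
  obtain ⟨p, hp⟩ : ∃ p, volume (q '' S p \ Red) ≠ 0 := by
    by_contra! hcon
    have h1 : volume (⋃ p, q '' S p \ Red) = 0 := measure_iUnion_null hcon
    have h2 : volume (q '' (B' \ ⋃ p, S p)) = 0 :=
      nonpos_iff_eq_zero.1 ((hK q (hq.weaken (by simp)) _).trans (by rw [hScov, mul_zero]))
    have h3 : q '' B' ⊆ Red ∪ ((⋃ p, q '' S p \ Red) ∪ q '' (B' \ ⋃ p, S p)) := by
      rintro _ ⟨x, hx, rfl⟩
      by_cases hxr : q x ∈ Red
      · exact Or.inl hxr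
      · by_cases hxp : x ∈ ⋃ p, S p
        · obtain ⟨p, hxp⟩ := mem_iUnion.1 hxp
          exact Or.inr (Or.inl (mem_iUnion.2 ⟨p, mem_image_of_mem _ hxp, hxr⟩))
        · exact Or.inr (Or.inr (mem_image_of_mem _ ⟨hx, hxp⟩))
    have h4 : volume (q '' B') ≤ volume (q '' B') / 2 := by
      refine (measure_mono h3).trans ((measure_union_le _ _).trans ?_)
      rw [measure_union_null h1 h2, add_zero]
      exact hred
    exact (ENNReal.half_lt_self hB'0 hfin).not_ge h4
  obtain ⟨ρ, hρ, hσν⟩ := hfl p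
  choose σ ν hσ hν hσε hineq using fun k : ℕ => hσν (1 / ((k : ℝ) + 1)) (by positivity)
  have hgood := (ae_exists_measureReal_le ρ).and
    ((ae_all_iff.2 fun k => ae_exists_measureReal_le (ν k)).and
      ((ae_exists_index_measureReal_le σ hσε hε).and
        (ae_exists_volume_sdiff_le ((hSc p).image hq.continuous).measurableSet)))
  set A := {z | z ∈ q '' S p \ Red ∧ _} with hA
  have hA0 : volume A ≠ 0 := fun h => hp (by
    have := (measure_eq_zero_iff_ae_notMem.1 h)
    refine measure_eq_zero_iff_ae_notMem.2 ?_
    filter_upwards [this, hgood] with z h1 h2 h3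
    exact h1 ⟨h3, h2⟩)
  obtain ⟨F, hFS, hFc, hF0, M, hM⟩ := exists_antilipschitz_piece hq.continuous (hSc p)
    (hinj.mono (hSB p)) (A := A) (fun z hz => hz.1.1) hA0 hα
    (fun z hz => hz.2.2.2.2 hz.1.1 α hα0) (by
      rintro z ⟨⟨hzS, hzR⟩, ⟨D₁, r₁, hD₁, hr₁, h1⟩, h2, ⟨k, r₃, hr₃, h3⟩, h4⟩
      obtain ⟨D₂, r₂, hD₂, hr₂, h2⟩ := h2 k
      obtain ⟨r₄, hr₄, h4⟩ := h4 hzS θ hθ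
      have hrad : ∀ w, 0 < w → w ≤ min (min r₁ r₂) (min r₃ r₄) →
          (σ k).real (closedBall z w) ≤ ε * w ^ n ∧ ρ.real (closedBall z w) ≤ max D₁ D₂ * w ^ n ∧
          (ν k).real (closedBall z w) ≤ max D₁ D₂ * w ^ n ∧
          volume ((q '' B' \ q '' S p) ∩ closedBall z w) ≤ θ * volume (closedBall z w) := by
        intro w hw hwr
        simp only [le_min_iff] at hwr
        have hwn : 0 ≤ w ^ n := by positivity
        refine ⟨h3 w hw hwr.2.1, (h1 w hw hwr.1.1).trans
          (mul_le_mul_of_nonneg_right (le_max_left _ _) hwn), (h2 w hw hwr.1.2).trans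
          (mul_le_mul_of_nonneg_right (le_max_right _ _) hwn),
          (measure_mono fun y hy => ?_).trans (h4 w hw hwr.2.2)⟩
        exact ⟨hy.2, hy.1.2⟩
      obtain ⟨C, r₀, hC, hr₀, hG⟩ := hgain (S p) (hSB p) (hSc p) (v p) (hvm p) (hvb p) (hvε p)
        (σ k) (ν k) ρ (hineq k) z (max D₁ D₂) (min (min r₁ r₂) (min r₃ r₄))
        (hD₁.trans (le_max_left _ _)) (lt_min (lt_min hr₁ hr₂) (lt_min hr₃ hr₄))
        hrad
      simp only [hRed, mem_ofPred_eq, not_forall, not_exists, not_and] at hzR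
      obtain ⟨r₅, hr₅, h5⟩ := hzR
      refine ⟨C, min r₀ (r₅ / 3), hC, lt_min hr₀ (by positivity), fun w hw hwr h hh a => ?_⟩
      by_contra! hcon
      obtain ⟨w', hw1, hw2, hgw⟩ := hG w hw (hwr.trans (min_le_left _ _)) h hh a hcon.1 hcon.2
      have hw5 : w ≤ r₅ / 3 := hwr.trans (min_le_right _ _)
      exact h5 w' (by linarith) (by linarith) (hgw.mono (min_le_left _ _) (by linarith)))
  exact hF0 (hU.volume_image_eq_zero hq hFc ((hFS.trans (hSB p)).trans (hB'B.trans hBU)) hM)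

lemma FlowDensityOn.mono {X E : Type*} [MetricSpace X] [MeasurableSpace X] [NormedAddCommGroup E]
    [NormedSpace ℝ E] {ψ : X → E} {μ : Measure X} {S T : Set X} {a : X → E}
    (h : FlowDensityOn ψ μ S a) (hT : T ⊆ S) : FlowDensityOn ψ μ T a := by
  obtain ⟨N, hN, hN0, h⟩ := h
  exact ⟨N, hN, hN0, fun B hB => h B (hB.trans (sdiff_subset_sdiff_left hT))⟩

lemma NearSpan.exists_rightInverse {m k : ℕ} {κ : ℝ} {c a : Fin k → EuclideanSpace ℝ (Fin m)}
    (h : κ < 1) (hca : NearSpan κ c a) (ha : LinearIndependent ℝ a) :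
    ∃ R : (Fin k → ℝ) →L[ℝ] EuclideanSpace ℝ (Fin m), ∀ y, coordMap c (R y) = y := by
  have hs : LinearMap.range (coordMap c : EuclideanSpace ℝ (Fin m) →ₗ[ℝ] (Fin k → ℝ)) = ⊤ := by
    rw [eq_top_iff]
    intro w _
    refine Submodule.span_le.2 ?_ (hca.mem_span_coordMap h ha w)
    rintro _ ⟨i, rfl⟩
    exact ⟨a i, rfl⟩
  obtain ⟨R, hR⟩ := LinearMap.exists_rightInverse_of_surjective _ hs
  exact ⟨LinearMap.toContinuousLinearMap R, fun y => LinearMap.congr_fun hR y⟩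

/-- A map which is, up to countably many translations, the projection of `ψ` to a subspace has
a null image as soon as the coordinates of `ψ` do. -/
lemma hausdorffMeasure_image_eq_zero_of_flat {X : Type*} {n m k : ℕ}
    {c : Fin k → EuclideanSpace ℝ (Fin m)} {R : (Fin k → ℝ) →L[ℝ] EuclideanSpace ℝ (Fin m)}
    (hR : ∀ y, coordMap c (R y) = y) {ψ ψ' : X → EuclideanSpace ℝ (Fin m)} {B : Set X}
    (h0 : μH[(n : ℝ)] (coordMap c '' (ψ '' B)) = 0) {T : Set (EuclideanSpace ℝ (Fin m))}
    (hT : T.Countable) (hψ' : ∀ x ∈ B, ∃ t ∈ T,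
      ψ' x = (Submodule.span ℝ (range c)).starProjection (ψ x) + t) :
    μH[(n : ℝ)] (ψ' '' B) = 0 := by
  set P := (Submodule.span ℝ (range c)).starProjection with hP
  have hker : ∀ y, P y = P (R (coordMap c y)) := fun y => by
    rw [← sub_eq_zero, ← map_sub, hP, Submodule.starProjection_apply_eq_zero_iff,
      Submodule.mem_orthogonal]
    intro u hu
    induction hu using Submodule.span_induction with
    | mem u hu =>
      obtain ⟨j, rfl⟩ := hu
      have h1 : coordMap c (y - R (coordMap c y)) = 0 := by rw [map_sub, hR, sub_self]
      exact congrFun h1 j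
    | zero => simp
    | add u v _ _ hu hv => rw [inner_add_left, hu, hv, add_zero]
    | smul s u _ hu => rw [inner_smul_left, hu, mul_zero]
  have h1 : ψ' '' B ⊆ ⋃ t ∈ T, (fun w => (P.comp R) w + t) '' (coordMap c '' (ψ '' B)) := by
    rintro _ ⟨x, hx, rfl⟩
    obtain ⟨t, ht, hxt⟩ := hψ' x hx
    refine mem_iUnion₂.2 ⟨t, ht, _, mem_image_of_mem _ (mem_image_of_mem _ hx), ?_⟩
    rw [hxt, hker (ψ x)]; rfl
  refine measure_mono_null h1 ((measure_biUnion_null_iff hT).2 fun t _ => ?_)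
  have hl : LipschitzWith (‖P.comp R‖₊ + 0) fun w => (P.comp R) w + t :=
    (P.comp R).lipschitz.add (LipschitzWith.const t)
  have h2 := hl.hausdorffMeasure_image_le (d := n) (Nat.cast_nonneg n) (coordMap c '' (ψ '' B))
  rw [h0, mul_zero] at h2
  exact nonpos_iff_eq_zero.1 h2

lemma Unrect.volume_coordMap_image_eq_zero {X : Type*} [MetricSpace X] [CompactSpace X]
    [MeasurableSpace X] [BorelSpace X] {n m : ℕ} (hX : μH[(n : ℝ)] (univ : Set X) ≠ ∞) {U : Set X}
    (hU : Unrect n U) {ψ : X → EuclideanSpace ℝ (Fin m)} {C : ℝ≥0} (hψ : LipschitzWith C ψ)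
    {c : Fin n → EuclideanSpace ℝ (Fin m)}
    (hlsc : ∀ B, IsCompact B → ∀ r < volume (coordMap c '' (ψ '' B)), ∃ δ : ℝ≥0, 0 < δ ∧
      ∀ ψ' : X → EuclideanSpace ℝ (Fin m), LipschitzWith (C + δ) ψ' →
        (∀ x, dist (ψ x) (ψ' x) ≤ δ) → r < volume (coordMap c '' (ψ' '' B)))
    {B : Set X} (hB : IsCompact B) (hBU : B ⊆ U) {a : Fin n → X → EuclideanSpace ℝ (Fin m)}
    (ha : ∀ i, Measurable (a i)) (hab : ∀ i, ∃ M, ∀ x, ‖a i x‖ ≤ M)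
    (hfl : ∀ i, FlowDensityOn ψ μH[(n : ℝ)] B (a i))
    (hLI : ∀ x ∈ B, LinearIndependent ℝ fun i => a i x)
    (hca : ∀ x ∈ B, NearSpan (1 / 2) c fun i => a i x) : volume (coordMap c '' (ψ '' B)) = 0 := by
  rcases B.eq_empty_or_nonempty with rfl | ⟨x₀, hx₀⟩
  · simp
  have : IsFiniteMeasure (μH[(n : ℝ)] : Measure X) := ⟨hX.lt_top⟩
  obtain ⟨R, hR⟩ := (hca x₀ hx₀).exists_rightInverse (by norm_num) (hLI x₀ hx₀)
  have hq : LipschitzWith (‖coordMap c‖₊ * C) fun x => coordMap c (ψ x) :=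
    (coordMap c).lipschitz.comp hψ
  have him : ∀ (f : X → EuclideanSpace ℝ (Fin m)) B,
      coordMap c '' (f '' B) = (fun x => coordMap c (f x)) '' B := fun f B => image_image _ _ _
  rw [him]
  refine hU.volume_image_eq_zero_of_flow hX hq hB hBU (fun B' _ hB' r hr => ?_)
    (fun B' hB'B hB' ε hε => ?_)
  · rw [← him] at hr
    obtain ⟨δ, hδ, h⟩ := hlsc B' hB' r hr
    set δ' : ℝ≥0 := min δ (δ / (‖R‖₊ + 1)) with hδ'
    have hδR : ‖R‖₊ * δ' ≤ δ := by
      calc ‖R‖₊ * δ' ≤ (‖R‖₊ + 1) * (δ / (‖R‖₊ + 1)) :=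
            mul_le_mul' (le_add_of_nonneg_right zero_le_one) (min_le_right _ _)
        _ = δ := mul_div_cancel₀ _ (by positivity)
    refine ⟨δ', lt_min hδ (by positivity), fun f hf hfb => ?_⟩
    have h1 := h (fun x => ψ x + R (f x))
      ((hψ.add (R.lipschitz.comp hf)).weaken (by gcongr)) (fun x => by
        rw [dist_self_add_right]
        refine (R.le_opNorm _).trans ((mul_le_mul_of_nonneg_left (hfb x) (norm_nonneg _)).trans ?_)
        exact_mod_cast hδR)
    rw [him] at h1
    simpa only [map_add, hR] using h1
  · exact exists_flowAlong μH[(n : ℝ)] hψ.continuous hB'.measurableSet ha hab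
      (fun i => (hfl i).mono hB'B) (coordMap c) (fun j => Pi.single j (1 : ℝ))
      (fun x hx j => (hca x (hB'B hx)).mem_span_coordMap (by norm_num) (hLI x (hB'B hx)) _) hε

lemma hContent_image_eq_zero_of_frame {X : Type*} [MetricSpace X] [CompactSpace X]
    [MeasurableSpace X] [BorelSpace X] {n m k : ℕ} (hn : 0 < n)
    (hX : μH[(n : ℝ)] (univ : Set X) ≠ ∞) {ψ : X → EuclideanSpace ℝ (Fin m)} {C : ℝ≥0}
    (hC : 0 < C) (hψ : LipschitzWith C ψ) {B : Set X} (hB : IsCompact B)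
    (hlsc : ∀ r < hContent n (ψ '' B), ∃ δ : ℝ≥0, 0 < δ ∧
      ∀ ψ' : X → EuclideanSpace ℝ (Fin m), LipschitzWith (C + δ) ψ' →
        (∀ x, dist (ψ x) (ψ' x) ≤ δ) → r < hContent n (ψ' '' B))
    {d : ℕ → Fin k → EuclideanSpace ℝ (Fin m)} (hd : DenseRange d)
    {a : Fin k → X → EuclideanSpace ℝ (Fin m)} (ha : ∀ i, Measurable (a i))
    (hLI : ∀ x ∈ B, LinearIndependent ℝ fun i => a i x)
    (hmax : ∀ (S : Set X) (a' : X → EuclideanSpace ℝ (Fin m)), MeasurableSet S → S ⊆ B →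
      0 < μH[(n : ℝ)] S → Measurable a' → (∃ M, ∀ x, ‖a' x‖ ≤ M) →
        FlowDensityOn ψ μH[(n : ℝ)] S a' → ∃ x ∈ S, a' x ∈ Submodule.span ℝ (range fun i => a i x))
    (hproj : ∀ c ∈ range d, ∀ B' ⊆ B, IsCompact B' →
      (∀ x ∈ B', NearSpan (1 / 2) c fun i => a i x) →
        μH[(n : ℝ)] (coordMap c '' (ψ '' B')) = 0) : hContent n (ψ '' B) = 0 := by
  by_contra hne
  have : IsFiniteMeasure (μH[(n : ℝ)] : Measure X) := ⟨hX.lt_top⟩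
  obtain ⟨r, hr0, hr⟩ := ENNReal.lt_iff_exists_nnreal_btwn.1 (pos_iff_ne_zero.2 hne)
  have hr0' : 0 < r := by exact_mod_cast hr0
  obtain ⟨δ, hδ, h⟩ := hlsc r hr
  set κ : ℝ≥0 := min δ (min 1 (r / ((C + 1) ^ n + 1))) with hκ
  have hκ0 : 0 < κ := lt_min hδ (lt_min one_pos (by positivity))
  obtain ⟨M, B', c, ψ', G, hBc, hBB, hcd, hns, hψ', hdist, hG, hμG, hGB, hT⟩ :=
    exists_flattening μH[(n : ℝ)] hC hψ hd hB.measurableSet ha hLI hmax hκ0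
  have hκr : (C + κ) ^ n * κ ≤ r := by
    have hk1 : κ ≤ 1 := (min_le_right _ _).trans (min_le_left _ _)
    have hk2 : κ ≤ r / ((C + 1) ^ n + 1) := (min_le_right _ _).trans (min_le_right _ _)
    calc (C + κ) ^ n * κ ≤ ((C + 1) ^ n + 1) * (r / ((C + 1) ^ n + 1)) := by
          refine mul_le_mul' (le_trans (by gcongr) (le_add_of_nonneg_right zero_le_one)) hk2
      _ = r := mul_div_cancel₀ _ (by positivity)
  have h1 := h ψ' (hψ'.weaken (by gcongr; exact min_le_left _ _))
    fun x => (hdist x).trans (by exact_mod_cast min_le_left _ _)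
  refine h1.not_ge ((hContent_le_hausdorffMeasure hn _).trans ?_)
  have h2 : ∀ l, μH[(n : ℝ)] (ψ' '' (G ∩ B' l)) = 0 := fun l => by
    rcases (G ∩ B' l).eq_empty_or_nonempty with he | ⟨x₀, hx₀⟩
    · rw [he, image_empty, measure_empty]
    obtain ⟨R, hR⟩ := (hns l x₀ hx₀.2).exists_rightInverse (by norm_num) (hLI x₀ (hBB l hx₀.2))
    obtain ⟨T, hTc, hT⟩ := hT l
    refine hausdorffMeasure_image_eq_zero_of_flat hR (ψ := ψ) ?_ hTc hT
    exact measure_mono_null (image_mono (image_mono inter_subset_right))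
      (hproj _ (hcd l) _ (hBB l) (hBc l) (hns l))
  have h3 : ψ' '' B ⊆ (⋃ l, ψ' '' (G ∩ B' l)) ∪ ψ' '' (B \ G) := by
    rintro _ ⟨x, hx, rfl⟩
    by_cases hxG : x ∈ G
    · obtain ⟨l, hl⟩ := mem_iUnion.1 (hGB hxG)
      exact Or.inl (mem_iUnion.2 ⟨l, mem_image_of_mem _ ⟨hxG, hl⟩⟩)
    · exact Or.inr (mem_image_of_mem _ ⟨hx, hxG⟩)
  calc μH[(n : ℝ)] (ψ' '' B) ≤ 0 + μH[(n : ℝ)] (ψ' '' (B \ G)) := by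
        refine (measure_mono h3).trans ((measure_union_le _ _).trans ?_)
        rw [measure_iUnion_null h2]
    _ ≤ ((C + κ : ℝ≥0) : ℝ≥0∞) ^ (n : ℝ) * κ := by
        rw [zero_add]
        refine (hψ'.hausdorffMeasure_image_le (Nat.cast_nonneg n) _).trans (mul_le_mul_right ?_ _)
        rw [← ofReal_measureReal]
        exact (ENNReal.ofReal_le_ofReal hμG).trans (by simp)
    _ ≤ r := by
        rw [ENNReal.rpow_natCast]
        exact_mod_cast hκr

lemma hausdorffMeasure_eq_zero_of_lt {n k : ℕ} (hkn : k < n) (S : Set (Fin k → ℝ)) :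
    μH[(n : ℝ)] S = 0 := by
  have h : dimH S < ((n : ℝ≥0) : ℝ≥0∞) := by
    refine (dimH_mono (subset_univ S)).trans_lt ?_
    rw [Real.dimH_univ_pi_fin]
    exact_mod_cast hkn
  simpa using hausdorffMeasure_of_dimH_lt h

/-- The perturbation theorem for maps into a Euclidean space. -/
theorem perturbStatement {n : ℕ} (hn : 0 < n) {X : Type*} [MetricSpace X] [CompactSpace X]
    [MeasurableSpace X] [BorelSpace X] (hX : μH[(n : ℝ)] (univ : Set X) < ∞) (m : ℕ) :
    PerturbStatement n X m := by
  intro U hU hUr C C' hC hCC' φ hφ ε hε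
  have : IsFiniteMeasure (μH[(n : ℝ)] : Measure X) := ⟨hX⟩
  set μ : Measure X := μH[(n : ℝ)] with hμ
  have hC' : 0 < C' := hC.trans hCC'
  obtain ⟨d, hd⟩ := TopologicalSpace.exists_dense_seq (Fin n → EuclideanSpace ℝ (Fin m))
  obtain ⟨ψ, hψ, hdist, hgen⟩ := exists_generic_lipschitz n hX
    (fun i : Option ℕ => i.elim (hContent n)
      fun l (S : Set (EuclideanSpace ℝ (Fin m))) => volume (coordMap (d l) '' S))
    (by
      rintro (_ | l)
      · exact isContent_hContent hn
      · exact isContent_volume_image _) C' φ (hφ.weaken hCC'.le) ε hε hC'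
  refine ⟨ψ, hψ, hdist, ?_⟩
  obtain ⟨f, hf, hfmax⟩ := exists_seq_exhausting μ
    {S | MeasurableSet S ∧ S ⊆ U ∧ μH[(n : ℝ)] (ψ '' S) = 0} (fun S hS => hS.1)
    ⟨∅, MeasurableSet.empty, empty_subset _, by simp⟩
  set N := ⋃ k, f k with hN
  have hNm : MeasurableSet N := MeasurableSet.iUnion fun k => (hf k).1
  have hN0 : μH[(n : ℝ)] (ψ '' N) = 0 := by
    rw [hN, image_iUnion]
    exact measure_iUnion_null fun k => (hf k).2.2
  suffices hUN : μ (U \ N) = 0 by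
    have h1 := hψ.hausdorffMeasure_image_le (d := n) (Nat.cast_nonneg n) (U \ N)
    rw [← hμ, hUN, mul_zero] at h1
    refine measure_mono_null (t := ψ '' N ∪ ψ '' (U \ N)) ?_
      (measure_union_null hN0 (nonpos_iff_eq_zero.1 h1))
    rw [← image_union]
    exact image_mono fun x hx => by by_cases h : x ∈ N <;> simp [h, hx]
  by_contra hUN
  let Fr : ℕ → Prop := fun k => ∃ S ⊆ U \ N, MeasurableSet S ∧ μ S ≠ 0 ∧
    ∃ a : Fin k → X → EuclideanSpace ℝ (Fin m), (∀ i, Measurable (a i)) ∧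
      (∀ i, ∃ M, ∀ x, ‖a i x‖ ≤ M) ∧ (∀ i, FlowDensityOn ψ μ S (a i)) ∧
        ∀ x ∈ S, LinearIndependent ℝ fun i => a i x
  have hFr0 : Fr 0 := ⟨U \ N, subset_rfl, hU.measurableSet.diff hNm, hUN, fun i => i.elim0,
    fun i => i.elim0, fun i => i.elim0, fun i => i.elim0, fun x _ => linearIndependent_empty_type⟩
  have hFrn : ∀ k, Fr k → k ≤ n := by
    rintro k ⟨S, hSU, hS, hS0, a, ha, hab, hfl, hLI⟩
    by_contra! hkn
    obtain ⟨x, hx, hx'⟩ := not_exists_frame hn hX.ne μ hψ hS hS0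
      (a := fun i : Fin (n + 1) => a (Fin.castLE hkn i)) (fun i => ha _) (fun i => hab _)
      (fun i => hfl _)
    exact hx' ((hLI x hx).comp _ (Fin.castLE_injective hkn))
  obtain ⟨k, hk, hk'⟩ : ∃ k, Fr k ∧ ¬ Fr (k + 1) := by
    by_contra! h
    have h1 : ∀ k, Fr k := fun k => Nat.rec hFr0 h k
    exact (Nat.lt_succ_self n).not_ge (hFrn _ (h1 (n + 1)))
  have hkn := hFrn k hk
  obtain ⟨S, hSU, hS, hS0, a, ha, hab, hfl, hLI⟩ := hk
  obtain ⟨B, hBS, hB, hB0⟩ := hS.exists_lt_isCompact (pos_iff_ne_zero.2 hS0)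
  have hmax : ∀ (S' : Set X) (a' : X → EuclideanSpace ℝ (Fin m)), MeasurableSet S' → S' ⊆ B →
      0 < μ S' → Measurable a' → (∃ M, ∀ x, ‖a' x‖ ≤ M) → FlowDensityOn ψ μ S' a' →
        ∃ x ∈ S', a' x ∈ Submodule.span ℝ (range fun i => a i x) := by
    intro S' a' hS' hS'B hS'0 ha' hab' hfl'
    by_contra! hcon
    refine hk' ⟨S', (hS'B.trans hBS).trans hSU, hS', hS'0.ne',
      Fin.snoc (α := fun _ => X → EuclideanSpace ℝ (Fin m)) a a', ?_, ?_, ?_, fun x hx => ?_⟩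
    · exact Fin.lastCases (by simpa using ha') fun i => by simpa using ha i
    · exact Fin.lastCases (by simpa using hab') fun i => by simpa using hab i
    · exact Fin.lastCases (by simpa using hfl') fun i => by
        simpa using (hfl i).mono (hS'B.trans hBS)
    · have heq : (fun i => Fin.snoc (α := fun _ => X → EuclideanSpace ℝ (Fin m)) a a' i x) =
          Fin.snoc (α := fun _ => EuclideanSpace ℝ (Fin m)) (fun i => a i x) (a' x) :=
        funext fun i => Fin.lastCases (by simp) (fun i => by simp) i
      rw [heq]
      exact linearIndependent_finSnoc.2 ⟨hLI x (hBS (hS'B hx)), hcon x hx⟩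
  have hcont : hContent n (ψ '' B) = 0 := by
    rcases hkn.lt_or_eq with hkn | rfl
    · obtain ⟨d', hd'⟩ := TopologicalSpace.exists_dense_seq (Fin k → EuclideanSpace ℝ (Fin m))
      exact hContent_image_eq_zero_of_frame hn hX.ne hC' hψ hB (hgen none B hB) hd' ha
        (fun x hx => hLI x (hBS hx)) hmax
        (fun c _ B' _ _ _ => hausdorffMeasure_eq_zero_of_lt hkn _)
    · refine hContent_image_eq_zero_of_frame hn hX.ne hC' hψ hB (hgen none B hB) hd ha
        (fun x hx => hLI x (hBS hx)) hmax ?_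
      rintro _ ⟨l, rfl⟩ B' hB'B hB' hns
      have h1 := hUr.volume_coordMap_image_eq_zero hX.ne hψ (fun B hB => hgen (some l) B hB) hB'
        (((hB'B.trans hBS).trans hSU).trans sdiff_subset) ha hab
        (fun i => (hfl i).mono (hB'B.trans hBS)) (fun x hx => hLI x (hBS (hB'B hx))) hns
      rwa [← hausdorffMeasure_pi_real, Fintype.card_fin] at h1
  have h1 := hfmax B ⟨hB.measurableSet, (hBS.trans hSU).trans sdiff_subset,
    hausdorffMeasure_eq_zero_of_hContent hn hcont⟩
  have h2 : B \ N = B := sdiff_eq_left.2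
    (disjoint_left.2 fun x hx => (hSU (hBS hx)).2)
  rw [h2] at h1
  exact hB0.ne' h1

/-- (Perturbation of a Lipschitz map into a simplicial complex.)
Given a compact metric space `X` of finite Hausdorff `n`-measure, a finite simplicial
complex `Σ` (side length `s`, `ℓ²`-metric), a `C`-Lipschitz map `φ : X → Σ` and a purely
`n`-unrectifiable set `P ⊆ X`, for every `ε > 0` there is a `3C`-Lipschitz map `ψ : X → Σ`
with `d(φ(x), ψ(x)) ≤ ε` for all `x`, `ψ(φ⁻¹(Δ)) ⊆ Δ` for every simplex `Δ` of `Σ`,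
and `H^n(ψ(P)) ≤ ε`. -/
theorem stmt1 (n : ℕ) (X : Type*) [MetricSpace X] [CompactSpace X]
    [MeasurableSpace X] [BorelSpace X]
    (hX : μH[(n : ℝ)] (Set.univ : Set X) < ⊤)
    (m : ℕ) (K : SimplicialCplx (Fin m)) (s : ℝ) (hs : 0 < s)
    (C : ℝ≥0) (φ : X → EuclideanSpace ℝ (Fin m))
    (hφmem : ∀ x, φ x ∈ realization s K) (hφ : LipschitzWith C φ)
    (P : Set X) (hP : PurelyUnrectifiable n P)
    (ε : ℝ) (hε : 0 < ε) :
    ∃ ψ : X → EuclideanSpace ℝ (Fin m),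
      (∀ x, ψ x ∈ realization s K) ∧
      LipschitzWith (3 * C) ψ ∧
      -- (1) `ψ` is uniformly `ε`-close to `φ`
      (∀ x, dist (φ x) (ψ x) ≤ ε) ∧
      -- (2) `ψ(φ⁻¹(Δ)) ⊆ Δ` for every simplex `Δ` of `Σ`
      (∀ S ∈ K.F, ∀ x : X, φ x ∈ simplexOf s S → ψ x ∈ simplexOf s S) ∧
      -- (3) `H^n(ψ(P)) ≤ ε`
      μH[(n : ℝ)] (ψ '' P) ≤ ENNReal.ofReal ε := by
  exact simplicial_perturbation_of_euclidean n X hX m (fun hn => perturbStatement hn hX m) K s hs C φ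
    hφmem hφ P hP ε hε
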